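/- There exists μ₀ ∈ (0, 1/2] such that for every μ ∈ (0, μ₀) the planar circular restricted three-body problem with mass ratio μ has a solution (q(t), p(t)) defined for all t ∈ ℝ (never hitting the singularities q = (−μ,0), q = (1−μ,0)) which is oscillatory in both time directions and accumulates on collision with the first primary: limsup_{t→+∞} ‖q(t)‖ = +∞, liminf_{t→+∞} ‖q(t) + (μ,0)‖ = 0, limsup_{t→−∞} ‖q(t)‖ = +∞, liminf_{t→−∞} ‖q(t) + (μ,0)‖ = 0; moreover limsup_{t→±∞} ‖p(t)‖ = +∞ and liminf_{t→±∞} ‖p(t)‖ < ∞. -/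

import Mathlib

open Real Filter MeasureTheory
open scoped Topology

/-- Euclidean norm of a planar vector given by its components. -/
noncomputable def nrm2 (x y : ℝ) : ℝ := Real.sqrt (x ^ 2 + y ^ 2)

/-- Distance from `(x,y)` to the first (massive) primary, located at `(-μ,0)`. -/
noncomputable def dS (μ x y : ℝ) : ℝ := Real.sqrt ((x + μ) ^ 2 + y ^ 2)

/-- Distance from `(x,y)` to the second primary, located at `(1-μ,0)`. -/
noncomputable def dJ (μ x y : ℝ) : ℝ := Real.sqrt ((x - (1 - μ)) ^ 2 + y ^ 2)

/-- `(q₁,q₂,p₁,p₂)` is a solution of the planar circular restricted three-body problem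
with mass ratio `μ` on the set `I` of times: it avoids the two singularities and satisfies
Hamilton's equations `q̇ = ∂H/∂p`, `ṗ = -∂H/∂q` for the Hamiltonian
`H(q,p;μ) = ‖p‖²/2 - q₁p₂ + q₂p₁ - (1-μ)/‖q+(μ,0)‖ - μ/‖q-(1-μ,0)‖`,
whose partial derivatives have been computed explicitly. -/
def IsPCRTBPSol (μ : ℝ) (I : Set ℝ) (q1 q2 p1 p2 : ℝ → ℝ) : Prop :=
  ∀ t ∈ I,
    ((q1 t, q2 t) ≠ (-μ, 0) ∧ (q1 t, q2 t) ≠ (1 - μ, 0)) ∧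
    HasDerivAt q1 (p1 t + q2 t) t ∧
    HasDerivAt q2 (p2 t - q1 t) t ∧
    HasDerivAt p1 (p2 t - (1 - μ) * (q1 t + μ) / (dS μ (q1 t) (q2 t)) ^ 3
        - μ * (q1 t - (1 - μ)) / (dJ μ (q1 t) (q2 t)) ^ 3) t ∧
    HasDerivAt p2 (-(p1 t) - (1 - μ) * (q2 t) / (dS μ (q1 t) (q2 t)) ^ 3
        - μ * (q2 t) / (dJ μ (q1 t) (q2 t)) ^ 3) t

namespace PCRTBP

open Set

section Flow

variable {E : Type*} [NormedAddCommGroup E] [NormedSpace ℝ E]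

theorem exists_global_curve [CompleteSpace E] {f : E → E} {K L : NNReal} (hf : LipschitzWith K f)
    (hL : ∀ x, ‖f x‖ ≤ L) (x : E) :
    ∃ γ : ℝ → E, γ 0 = x ∧ ∀ t, HasDerivAt γ (f (γ t)) t := by
  have key : ∀ n : ℕ, ∃ α : ℝ → E, α 0 = x ∧
      ∀ t ∈ Icc (-(n + 1 : ℝ)) (n + 1), HasDerivWithinAt α (f (α t)) (Icc (-(n + 1 : ℝ)) (n + 1)) t := by
    intro n
    have h0 : (0 : ℝ) ∈ Icc (-(n + 1 : ℝ)) (n + 1) := ⟨by linarith [n.cast_nonneg (α := ℝ)], by positivity⟩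
    have : IsPicardLindelof (fun _ => f) (⟨0, h0⟩ : Icc (-(n + 1 : ℝ)) (n + 1)) x
        (L * (n + 1)) 0 L K := by
      refine ⟨fun _ _ => hf.lipschitzOnWith, fun _ _ => continuousOn_const, fun _ _ y _ => hL y, ?_⟩
      simp
    exact this.exists_eq_forall_mem_Icc_hasDerivWithinAt₀
  choose α hα0 hα using key
  have hα' : ∀ n : ℕ, ∀ t ∈ Ioo (-(n + 1 : ℝ)) (n + 1), HasDerivAt (α n) (f (α n t)) t :=
    fun n t ht => (hα n t (Ioo_subset_Icc_self ht)).hasDerivAt (Icc_mem_nhds ht.1 ht.2)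
  have huniq : ∀ n m : ℕ, n ≤ m → ∀ t ∈ Ioo (-(n + 1 : ℝ)) (n + 1), α n t = α m t := by
    intro n m hnm t ht
    have hnm' : (n : ℝ) ≤ m := by exact_mod_cast hnm
    refine ODE_solution_unique_of_mem_Ioo (v := fun _ => f) (s := fun _ => univ) (K := K)
      (a := -(n + 1 : ℝ)) (b := n + 1) (t₀ := 0)
      (fun _ _ => hf.lipschitzOnWith) ⟨by linarith [n.cast_nonneg (α := ℝ)], by positivity⟩
      (fun t ht => ⟨hα' n t ht, trivial⟩)
      (fun t ht => ⟨hα' m t ⟨by linarith [ht.1], by linarith [ht.2]⟩, trivial⟩)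
      (by rw [hα0, hα0]) ht
  have hmem : ∀ t : ℝ, t ∈ Ioo (-((⌈|t|⌉₊ : ℝ) + 1)) ((⌈|t|⌉₊ : ℝ) + 1) := by
    intro t
    have h1 := Nat.le_ceil |t|
    exact ⟨by linarith [neg_abs_le t], by linarith [le_abs_self t]⟩
  refine ⟨fun t => α ⌈|t|⌉₊ t, by simp [hα0], fun t => ?_⟩
  have heq : (fun t => α ⌈|t|⌉₊ t) =ᶠ[𝓝 t] α (⌈|t|⌉₊ + 1) := by
    filter_upwards [Ioo_mem_nhds (hmem t).1 (hmem t).2] with s hs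
    rcases le_total ⌈|s|⌉₊ (⌈|t|⌉₊ + 1) with h | h
    · exact huniq _ _ h s (hmem s)
    · refine (huniq _ _ h s ⟨?_, ?_⟩).symm <;> push_cast <;> linarith [hs.1, hs.2]
  have := (hα' (⌈|t|⌉₊ + 1) t ⟨by push_cast; linarith [(hmem t).1], by push_cast; linarith [(hmem t).2]⟩)
  rw [← heq.eq_of_nhds] at this
  exact this.congr_of_eventuallyEq heq

theorem integralCurve_eq {f : E → E} {K : NNReal} (hf : LipschitzWith K f) {γ η : ℝ → E}
    (hγ : ∀ t, HasDerivAt γ (f (γ t)) t) (hη : ∀ t, HasDerivAt η (f (η t)) t) {t₀ : ℝ}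
    (h : γ t₀ = η t₀) : γ = η :=
  ODE_solution_unique_univ (v := fun _ => f) (s := fun _ => univ) (K := K)
    (fun _ => hf.lipschitzOnWith) (fun t => ⟨hγ t, trivial⟩) (fun t => ⟨hη t, trivial⟩) h

theorem dist_integralCurve_le {f : E → E} {K : NNReal} (hf : LipschitzWith K f) {γ η : ℝ → E}
    (hγ : ∀ t, HasDerivAt γ (f (γ t)) t) (hη : ∀ t, HasDerivAt η (f (η t)) t) (t : ℝ) :
    dist (γ t) (η t) ≤ dist (γ 0) (η 0) * Real.exp (K * |t|) := by
  have fwd : ∀ (g : E → E) (γ η : ℝ → E), LipschitzWith K g → (∀ t, HasDerivAt γ (g (γ t)) t) →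
      (∀ t, HasDerivAt η (g (η t)) t) → ∀ t, 0 ≤ t →
      dist (γ t) (η t) ≤ dist (γ 0) (η 0) * Real.exp (K * t) := by
    intro g γ η hg hγ hη t ht
    have := dist_le_of_trajectories_ODE (v := fun _ => g) (K := K) (a := 0) (b := t) (f := γ) (g := η)
      (δ := dist (γ 0) (η 0)) (fun _ => hg)
      (fun s _ => (hγ s).continuousAt.continuousWithinAt) (fun s _ => (hγ s).hasDerivWithinAt)
      (fun s _ => (hη s).continuousAt.continuousWithinAt) (fun s _ => (hη s).hasDerivWithinAt)
      le_rfl t ⟨ht, le_rfl⟩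
    simpa using this
  rcases le_total 0 t with ht | ht
  · rw [abs_of_nonneg ht]; exact fwd f γ η hf hγ hη t ht
  · have hneg : ∀ ξ : ℝ → E, (∀ t, HasDerivAt ξ (f (ξ t)) t) →
        ∀ t, HasDerivAt (fun s => ξ (-s)) (-f (ξ (-t))) t := by
      intro ξ hξ t
      simpa [Function.comp_def] using (hξ (-t)).scomp t (hasDerivAt_neg t)
    have := fwd (fun x => -f x) (fun s => γ (-s)) (fun s => η (-s)) hf.neg (hneg γ hγ) (hneg η hη)
      (-t) (by linarith)
    simpa [abs_of_nonpos ht] using this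

/-- The global flow of a bounded Lipschitz vector field, together with its basic estimates. -/
theorem exists_global_flow [CompleteSpace E] {f : E → E} {K L : NNReal} (hf : LipschitzWith K f)
    (hL : ∀ x, ‖f x‖ ≤ L) :
    ∃ Φ : ℝ → E → E, (∀ x, Φ 0 x = x) ∧ (∀ x t, HasDerivAt (fun s => Φ s x) (f (Φ t x)) t) ∧
      Continuous (fun p : ℝ × E => Φ p.1 p.2) := by
  choose γ hγ0 hγ using exists_global_curve hf hL
  refine ⟨fun t x => γ x t, hγ0, fun x t => hγ x t, ?_⟩
  rw [continuous_iff_continuousAt]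
  rintro ⟨t, x⟩
  rw [ContinuousAt, tendsto_iff_dist_tendsto_zero]
  have h1 : Tendsto (fun p : ℝ × E => dist p.2 x * Real.exp (K * |p.1|) + dist (γ x p.1) (γ x t))
      (𝓝 (t, x)) (𝓝 (dist x x * Real.exp (K * |t|) + dist (γ x t) (γ x t))) := by
    have hc : Continuous (γ x) := continuous_iff_continuousAt.2 fun t => (hγ x t).continuousAt
    exact Continuous.tendsto (f := fun p : ℝ × E =>
      dist p.2 x * Real.exp (K * |p.1|) + dist (γ x p.1) (γ x t)) (by fun_prop) (t, x)
  simp only [dist_self, zero_mul, add_zero] at h1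
  refine squeeze_zero (fun _ => dist_nonneg) (fun p => ?_) h1
  refine (dist_triangle _ (γ x p.1) _).trans ?_
  gcongr
  have := dist_integralCurve_le hf (hγ p.2) (hγ x) p.1
  rwa [hγ0, hγ0] at this

/-- Local flow in a neighbourhood of a compact piece of an integral curve of a `C¹` field. -/
theorem exists_flow_near_curve [FiniteDimensional ℝ E] {f : E → E} {U : Set E} (hU : IsOpen U)
    (hf : ContDiffOn ℝ 1 f U) {γ : ℝ → E} {a b : ℝ} (ha : a < 0) (hb : 0 < b)
    (hγ : ∀ s ∈ Icc a b, HasDerivAt γ (f (γ s)) s) (hγU : ∀ s ∈ Icc a b, γ s ∈ U) :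
    ∃ ρ > 0, ∃ K > 0, ∃ Φ : ℝ → E → E, Continuous (fun p : ℝ × E => Φ p.1 p.2) ∧
      (∀ y, Φ 0 y = y) ∧ (∀ s ∈ Icc a b, Φ s (γ 0) = γ s) ∧
      (∀ y, dist y (γ 0) < ρ → ∀ s ∈ Icc a b, HasDerivAt (fun s => Φ s y) (f (Φ s y)) s ∧
        Φ s y ∈ U ∧ dist (Φ s y) (γ s) ≤ K * dist y (γ 0)) := by
  have hc : ContinuousOn γ (Icc a b) := fun s hs => (hγ s hs).continuousAt.continuousWithinAt
  have hZ : IsCompact (γ '' Icc a b) := isCompact_Icc.image_of_continuousOn hc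
  have hZU : γ '' Icc a b ⊆ U := by rintro _ ⟨s, hs, rfl⟩; exact hγU s hs
  obtain ⟨r, hr, hrU⟩ := hZ.exists_cthickening_subset_open hU hZU
  have hcl : IsClosed (Metric.cthickening (r / 2) (γ '' Icc a b)) := Metric.isClosed_cthickening
  have hsub : Metric.cthickening (r / 2) (γ '' Icc a b) ⊆
      interior (Metric.cthickening r (γ '' Icc a b)) := by
    refine (Metric.cthickening_subset_thickening' hr (by linarith) _).trans ?_
    exact interior_maximal (Metric.thickening_subset_cthickening _ _) Metric.isOpen_thickening
  obtain ⟨χ, hχ1, hχ0, hχ⟩ := exists_contMDiffMap_one_nhds_of_subset_interior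
    (I := modelWithCornersSelf ℝ E) (n := 1) hcl hsub
  have hχs : ContDiff ℝ 1 χ := χ.contMDiff.contDiff
  set g : E → E := fun x => χ x • f x with hg
  have hcomp : IsCompact (Metric.cthickening r (γ '' Icc a b)) :=
    hZ.cthickening
  have hgc : HasCompactSupport g := by
    refine HasCompactSupport.intro hcomp fun x hx => ?_
    simp [hg, hχ0 x hx]
  have hgd : ContDiff ℝ 1 g := by
    rw [contDiff_iff_contDiffAt]
    intro x
    by_cases hx : x ∈ U
    · exact hχs.contDiffAt.smul (hf.contDiffAt (hU.mem_nhds hx))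
    · have hx' : x ∈ (Metric.cthickening r (γ '' Icc a b))ᶜ := fun h => hx (hrU h)
      have : g =ᶠ[𝓝 x] fun _ => 0 := by
        filter_upwards [Metric.isClosed_cthickening.isOpen_compl.mem_nhds hx'] with y hy
        simp [hg, hχ0 y hy]
      exact contDiffAt_const.congr_of_eventuallyEq this
  obtain ⟨K, hK⟩ := ContDiff.lipschitzWith_of_hasCompactSupport hgc hgd one_ne_zero
  obtain ⟨L, hL⟩ := hgc.exists_bound_of_continuous hgd.continuous
  have hgf : ∀ x ∈ Metric.cthickening (r / 2) (γ '' Icc a b), g x = f x := by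
    intro x hx
    have h1 : χ x = 1 := hχ1.self_of_nhdsSet x hx
    simp [hg, h1]
  obtain ⟨Φ, hΦ0, hΦ, hΦc⟩ := exists_global_flow hK (L := Real.toNNReal L)
    (fun x => (hL x).trans (Real.le_coe_toNNReal L))
  have h0 : (0 : ℝ) ∈ Icc a b := ⟨ha.le, hb.le⟩
  have hself : ∀ s ∈ Icc a b, γ s ∈ Metric.cthickening (r / 2) (γ '' Icc a b) := fun s hs =>
    Metric.self_subset_cthickening _ (mem_image_of_mem _ hs)
  have href : ∀ s ∈ Icc a b, Φ s (γ 0) = γ s := by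
    refine ODE_solution_unique_of_mem_Icc (v := fun _ => g) (s := fun _ => univ) (K := K)
      (t₀ := 0) (fun _ _ => hK.lipschitzOnWith) ⟨ha, hb⟩
      (fun s _ => (hΦ (γ 0) s).continuousAt.continuousWithinAt) (fun s _ => hΦ (γ 0) s)
      (fun _ _ => trivial) hc (fun s hs => ?_) (fun _ _ => trivial) (hΦ0 _)
    have hs' := Ioo_subset_Icc_self hs
    rw [hgf _ (hself s hs')]
    exact hγ s hs'
  set M := Real.exp (K * (|a| + |b|)) with hM
  have hMpos : 0 < M := Real.exp_pos _
  have hdist : ∀ y, ∀ s ∈ Icc a b, dist (Φ s y) (γ s) ≤ M * dist y (γ 0) := by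
    intro y s hs
    have h := dist_integralCurve_le hK (hΦ y) (hΦ (γ 0)) s
    simp only [hΦ0, href s hs] at h
    refine h.trans ?_
    rw [mul_comm, hM]
    gcongr
    rcases le_total 0 s with h | h
    · rw [abs_of_nonneg h]; linarith [hs.2, le_abs_self b, abs_nonneg a]
    · rw [abs_of_nonpos h]; linarith [hs.1, neg_abs_le a, abs_nonneg b]
  refine ⟨r / 2 / M, by positivity, M, hMpos, Φ, hΦc, hΦ0, href, fun y hy s hs => ?_⟩
  have hlt : dist (Φ s y) (γ s) ≤ r / 2 := by
    refine (hdist y s hs).trans ?_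
    rw [lt_div_iff₀ hMpos] at hy
    linarith
  have hmem : Φ s y ∈ Metric.cthickening (r / 2) (γ '' Icc a b) :=
    Metric.mem_cthickening_of_dist_le _ _ _ _ (mem_image_of_mem _ hs) hlt
  refine ⟨?_, hrU (Metric.cthickening_mono (by linarith) _ hmem), hdist y s hs⟩
  rw [← hgf _ hmem]
  exact hΦ y s

/-- Uniform differentiability of a `C¹` function near a compact piece of a curve. -/
theorem uniform_hasFDerivAt_near_curve {F : Type*} [NormedAddCommGroup F] [NormedSpace ℝ F]
    {f : E → F} {U : Set E} (hU : IsOpen U) (hf : ContDiffOn ℝ 1 f U) {γ : ℝ → E} {a b : ℝ}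
    (hγ : ContinuousOn γ (Icc a b)) (hγU : ∀ s ∈ Icc a b, γ s ∈ U) {ε : ℝ} (hε : 0 < ε) :
    ∃ ρ > 0, ∀ s ∈ Icc a b, ∀ y y', dist y (γ s) ≤ ρ → dist y' (γ s) ≤ ρ → y ∈ U ∧
      ‖f y - f y' - fderiv ℝ f (γ s) (y - y')‖ ≤ ε * ‖y - y'‖ := by
  have hcont : ContinuousOn (fderiv ℝ f) U := hf.continuousOn_fderiv_of_isOpen hU le_rfl
  have hloc : ∀ s ∈ Icc a b, ∃ ρ > 0, ∀ᶠ s' in 𝓝[Icc a b] s, ∀ y, dist y (γ s') ≤ ρ →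
      y ∈ U ∧ ‖fderiv ℝ f y - fderiv ℝ f (γ s')‖ ≤ ε := by
    intro s hs
    have hcs : ContinuousAt (fderiv ℝ f) (γ s) := hcont.continuousAt (hU.mem_nhds (hγU s hs))
    have h1 := (Metric.tendsto_nhds.1 hcs (ε / 2) (by linarith)).and (hU.mem_nhds (hγU s hs))
    obtain ⟨δ, hδ, hδ'⟩ := Metric.eventually_nhds_iff.1 h1
    refine ⟨δ / 2, by linarith, ?_⟩
    filter_upwards [(Metric.tendsto_nhds.1 (hγ s hs) (δ / 2) (by linarith))] with s' hs' y hy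
    have hy1 : dist y (γ s) < δ := (dist_triangle _ (γ s') _).trans_lt (by linarith)
    have hs1 : dist (γ s') (γ s) < δ := by linarith
    refine ⟨(hδ' hy1).2, ?_⟩
    rw [← dist_eq_norm]
    exact (dist_triangle_right _ _ (fderiv ℝ f (γ s))).trans
      (by linarith [(hδ' hy1).1, (hδ' hs1).1])
  have hglob : ∃ ρ > 0, ∀ s' ∈ Icc a b, ∀ y, dist y (γ s') ≤ ρ →
      y ∈ U ∧ ‖fderiv ℝ f y - fderiv ℝ f (γ s')‖ ≤ ε := by
    refine isCompact_Icc.induction_on (p := fun A => ∃ ρ > 0, ∀ s' ∈ A, ∀ y, dist y (γ s') ≤ ρ →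
      y ∈ U ∧ ‖fderiv ℝ f y - fderiv ℝ f (γ s')‖ ≤ ε) ⟨1, one_pos, by simp⟩ ?_ ?_ ?_
    · rintro A B hAB ⟨ρ, hρ, h⟩
      exact ⟨ρ, hρ, fun s hs => h s (hAB hs)⟩
    · rintro A B ⟨ρ, hρ, h⟩ ⟨ρ', hρ', h'⟩
      refine ⟨min ρ ρ', lt_min hρ hρ', fun s hs y hy => ?_⟩
      rcases hs with hs | hs
      · exact h s hs y (hy.trans (min_le_left _ _))
      · exact h' s hs y (hy.trans (min_le_right _ _))
    · intro s hs
      obtain ⟨ρ, hρ, h⟩ := hloc s hs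
      exact ⟨_, h, ρ, hρ, fun s hs => hs⟩
  obtain ⟨ρ, hρ, h⟩ := hglob
  refine ⟨ρ, hρ, fun s hs y y' hy hy' => ⟨(h s hs y hy).1, ?_⟩⟩
  refine (convex_closedBall (γ s) ρ).norm_image_sub_le_of_norm_hasFDerivWithin_le'
    (f := f) (f' := fderiv ℝ f) (fun x hx => ?_) (fun x hx => ?_) (x := y') (y := y) hy' hy
  · exact (((hf.contDiffAt (hU.mem_nhds (h s hs x hx).1)).differentiableAt
      one_ne_zero).hasFDerivAt).hasFDerivWithinAt
  · exact (h s hs x hx).2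

theorem uniform_lipschitz_near_curve {F : Type*} [NormedAddCommGroup F] [NormedSpace ℝ F]
    {f : E → F} {U : Set E} (hU : IsOpen U) (hf : ContDiffOn ℝ 1 f U) {γ : ℝ → E} {a b : ℝ}
    (hγ : ContinuousOn γ (Icc a b)) (hγU : ∀ s ∈ Icc a b, γ s ∈ U) :
    ∃ ρ > 0, ∃ C > 0, ∀ s ∈ Icc a b, ∀ y y', dist y (γ s) ≤ ρ → dist y' (γ s) ≤ ρ → y ∈ U ∧
      ‖f y - f y'‖ ≤ C * ‖y - y'‖ := by
  obtain ⟨ρ, hρ, h⟩ := uniform_hasFDerivAt_near_curve hU hf hγ hγU one_pos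
  have hcont : ContinuousOn (fun s => fderiv ℝ f (γ s)) (Icc a b) :=
    (hf.continuousOn_fderiv_of_isOpen hU le_rfl).comp hγ hγU
  obtain ⟨M, hM⟩ := isCompact_Icc.exists_bound_of_continuousOn hcont
  refine ⟨ρ, hρ, |M| + 1, by positivity, fun s hs y y' hy hy' => ⟨(h s hs y y' hy hy').1, ?_⟩⟩
  have h1 := (h s hs y y' hy hy').2
  have h2 : ‖fderiv ℝ f (γ s) (y - y')‖ ≤ |M| * ‖y - y'‖ :=
    (ContinuousLinearMap.le_opNorm _ _).trans
      (by gcongr; exact (hM s hs).trans (le_abs_self M))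
  have h3 := norm_add_le (f y - f y' - fderiv ℝ f (γ s) (y - y')) (fderiv ℝ f (γ s) (y - y'))
  rw [sub_add_cancel] at h3
  linarith

end Flow

/-- If finitely many functions start positive and each is nondecreasing as long as all of them have
stayed positive, then they stay positive and never fall below their initial values. -/
theorem le_of_monotone_while_pos {ι : Type*} [Finite ι] {u u' : ι → ℝ → ℝ}
    (hu : ∀ i t, 0 ≤ t → HasDerivAt (u i) (u' i t) t) (h0 : ∀ i, 0 < u i 0)
    (hmono : ∀ t, 0 ≤ t → (∀ j, ∀ s ∈ Icc 0 t, 0 < u j s) → ∀ i, 0 ≤ u' i t) :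
    ∀ i t, 0 ≤ t → u i 0 ≤ u i t := by
  have hc : ∀ i, ContinuousOn (u i) (Ici 0) := fun i t ht =>
    (hu i t ht).continuousAt.continuousWithinAt
  have step : ∀ t, 0 ≤ t → (∀ j, ∀ s ∈ Ico 0 t, 0 < u j s) → ∀ i, u i 0 ≤ u i t := by
    intro t ht hpos i
    have : MonotoneOn (u i) (Icc 0 t) := by
      refine monotoneOn_of_deriv_nonneg (convex_Icc 0 t) ((hc i).mono Icc_subset_Ici_self)
        (fun s hs => (hu i s (interior_subset hs).1).differentiableAt.differentiableWithinAt)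
        (fun s hs => ?_)
      rw [interior_Icc] at hs
      rw [(hu i s hs.1.le).deriv]
      exact hmono s hs.1.le (fun j r hr => hpos j r ⟨hr.1, hr.2.trans_lt hs.2⟩) i
    exact this ⟨le_rfl, ht⟩ ⟨ht, le_rfl⟩ ht
  by_contra! hcon
  obtain ⟨i₀, t₀, ht₀, hlt⟩ := hcon
  have hall : ∀ t, 0 ≤ t → ∀ j, 0 < u j t := by
    by_contra! hne
    obtain ⟨t₁, ht₁, j₁, hj₁⟩ := hne
    set A : Set ℝ := {t | 0 ≤ t ∧ ∃ j, u j t ≤ 0} with hA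
    have hAc : IsClosed A := by
      have : A = ⋃ j, Ici 0 ∩ u j ⁻¹' Iic 0 := by ext t; simp [hA]
      rw [this]
      exact isClosed_iUnion_of_finite fun j =>
        (hc j).preimage_isClosed_of_isClosed isClosed_Ici isClosed_Iic
    have hbd : BddBelow A := ⟨0, fun t ht => ht.1⟩
    obtain ⟨hm0, j, hj⟩ := hAc.csInf_mem ⟨t₁, ht₁, j₁, hj₁⟩ hbd
    have := step (sInf A) hm0 (fun j s hs => by
      by_contra hns
      exact absurd (csInf_le hbd ⟨hs.1, j, not_lt.1 hns⟩) (not_le.2 hs.2)) j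
    linarith [h0 j]
  exact absurd (step t₀ ht₀ (fun j s hs => hall s hs.1 j) i₀) (not_le.2 hlt)

end PCRTBP

namespace PCRTBP

open Set

/-- Inverse distance from the point with polar coordinates `(r, φ)` to the point `(-c, 0)`. -/
noncomputable def iD (c r φ : ℝ) : ℝ := (√(r ^ 2 + 2 * c * r * cos φ + c ^ 2))⁻¹

/-- Radial force in barycentric polar coordinates. -/
noncomputable def fr (μ r φ : ℝ) : ℝ :=
  -(1 - μ) * (r + μ * cos φ) * iD μ r φ ^ 3 - μ * (r + (μ - 1) * cos φ) * iD (μ - 1) r φ ^ 3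

/-- Torque in barycentric polar coordinates. -/
noncomputable def tq (μ r φ : ℝ) : ℝ :=
  μ * (1 - μ) * r * sin φ * (iD μ r φ ^ 3 - iD (μ - 1) r φ ^ 3)

/-- Gravitational potential in barycentric polar coordinates. -/
noncomputable def pot (μ r φ : ℝ) : ℝ := -(1 - μ) * iD μ r φ - μ * iD (μ - 1) r φ

theorem sq_dist_bounds {c r : ℝ} (φ : ℝ) (hc : |c| ≤ 1) (hr : 1 ≤ r) :
    (r - 1) ^ 2 ≤ r ^ 2 + 2 * c * r * cos φ + c ^ 2 ∧
      r ^ 2 + 2 * c * r * cos φ + c ^ 2 ≤ (r + 1) ^ 2 := by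
  obtain ⟨h1, h2⟩ := abs_le.1 hc
  have h3 : |c * cos φ| ≤ |c| := by
    rw [abs_mul]; exact mul_le_of_le_one_right (abs_nonneg _) (abs_cos_le_one φ)
  obtain ⟨h4, h5⟩ := abs_le.1 h3
  have h6 : |c| ^ 2 = c ^ 2 := sq_abs c
  have h7 := abs_nonneg c
  constructor
  · nlinarith [mul_nonneg (by linarith : 0 ≤ r - 1) (by linarith : 0 ≤ 1 - |c|),
      mul_nonneg (by linarith : 0 ≤ r) (by linarith : 0 ≤ c * cos φ + |c|)]
  · nlinarith [mul_nonneg (by linarith : 0 ≤ r) (by linarith : 0 ≤ |c| - c * cos φ)]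

theorem iD_bounds {c r : ℝ} (φ : ℝ) (hc : |c| ≤ 1) (hr : 2000 ≤ r) :
    0.999 * r⁻¹ ≤ iD c r φ ∧ iD c r φ ≤ 1.001 * r⁻¹ := by
  obtain ⟨h1, h2⟩ := sq_dist_bounds φ hc (by linarith : 1 ≤ r)
  have hpos : 0 < r ^ 2 + 2 * c * r * cos φ + c ^ 2 := by nlinarith
  have h3 : √(r ^ 2 + 2 * c * r * cos φ + c ^ 2) ≤ r + 1 := Real.sqrt_le_iff.2 ⟨by linarith, h2⟩
  have h4 : r - 1 ≤ √(r ^ 2 + 2 * c * r * cos φ + c ^ 2) := Real.le_sqrt_of_sq_le h1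
  have hr0 : 0 < r := by linarith
  unfold iD
  constructor
  · rw [← div_eq_mul_inv, div_le_iff₀ hr0, inv_mul_eq_div, le_div_iff₀ (by linarith)]
    linarith
  · rw [← div_eq_mul_inv, le_div_iff₀ hr0, inv_mul_eq_div, div_le_iff₀ (by linarith)]
    linarith

theorem hasDerivAt_iD {c t r' φ' : ℝ} {r φ : ℝ → ℝ} (hc : |c| ≤ 1) (hr : 2000 ≤ r t)
    (h1 : HasDerivAt r r' t) (h2 : HasDerivAt φ φ' t) :
    HasDerivAt (fun s => iD c (r s) (φ s))
      (-(r t + c * cos (φ t)) * iD c (r t) (φ t) ^ 3 * r' +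
        c * r t * sin (φ t) * iD c (r t) (φ t) ^ 3 * φ') t := by
  have hpos : 0 < r t ^ 2 + 2 * c * r t * cos (φ t) + c ^ 2 := by
    have := (sq_dist_bounds (φ t) hc (by linarith : 1 ≤ r t)).1
    nlinarith
  have hd : HasDerivAt (fun s => r s ^ 2 + 2 * c * r s * cos (φ s) + c ^ 2)
      (2 * r t * r' + (2 * c * r' * cos (φ t) + 2 * c * r t * (-sin (φ t) * φ'))) t := by
    refine (((h1.pow 2).add ((h1.const_mul (2 * c)).mul h2.cos)).add_const (c ^ 2)).congr_deriv ?_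
    push_cast
    ring
  have hs := (hd.sqrt hpos.ne').inv (Real.sqrt_pos.2 hpos).ne'
  have h0 := (Real.sqrt_pos.2 hpos)
  refine HasDerivAt.congr_deriv hs ?_
  unfold iD
  field_simp
  ring

theorem abs_pow_three_sub_le {a b ρ : ℝ} (hρ : 0 ≤ ρ) (ha : 0 ≤ a) (hb : 0 ≤ b)
    (ha' : a ≤ 1.001 * ρ) (hb' : b ≤ 1.001 * ρ) (hab : |a - b| ≤ a * b) :
    |a ^ 3 - b ^ 3| ≤ 3.1 * ρ ^ 4 ∧ |a ^ 5 - b ^ 5| ≤ 5.1 * ρ ^ 6 := by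
  set m := 1.001 * ρ with hm
  have hm0 : 0 ≤ m := by positivity
  have e1 : a * b ≤ m ^ 2 := by nlinarith [mul_le_mul ha' hb' hb hm0]
  have h2 : |a - b| ≤ m ^ 2 := hab.trans e1
  constructor
  · rw [show a ^ 3 - b ^ 3 = (a - b) * (a ^ 2 + a * b + b ^ 2) by ring, abs_mul,
      abs_of_nonneg (by positivity : 0 ≤ a ^ 2 + a * b + b ^ 2)]
    have : a ^ 2 + a * b + b ^ 2 ≤ m ^ 2 + m * m + m ^ 2 := by gcongr
    calc _ ≤ m ^ 2 * (m ^ 2 + m * m + m ^ 2) := by gcongr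
      _ = 3 * 1.001 ^ 4 * ρ ^ 4 := by rw [hm]; ring
      _ ≤ _ := by gcongr; norm_num
  · rw [show a ^ 5 - b ^ 5 = (a - b) * (a ^ 4 + a ^ 3 * b + a ^ 2 * b ^ 2 + a * b ^ 3 + b ^ 4) by ring,
      abs_mul, abs_of_nonneg (by positivity : 0 ≤ a ^ 4 + a ^ 3 * b + a ^ 2 * b ^ 2 + a * b ^ 3 + b ^ 4)]
    have : a ^ 4 + a ^ 3 * b + a ^ 2 * b ^ 2 + a * b ^ 3 + b ^ 4 ≤
        m ^ 4 + m ^ 3 * m + m ^ 2 * m ^ 2 + m * m ^ 3 + m ^ 4 := by gcongr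
    calc _ ≤ m ^ 2 * (m ^ 4 + m ^ 3 * m + m ^ 2 * m ^ 2 + m * m ^ 3 + m ^ 4) := by gcongr
      _ = 5 * 1.001 ^ 6 * ρ ^ 6 := by rw [hm]; ring
      _ ≤ _ := by gcongr; norm_num

theorem abs_iD_sub_le {μ r : ℝ} (φ : ℝ) (h0 : 0 ≤ μ) (h1 : μ ≤ 1) (hr : 2000 ≤ r) :
    |iD μ r φ - iD (μ - 1) r φ| ≤ iD μ r φ * iD (μ - 1) r φ := by
  have hc1 : |μ| ≤ 1 := abs_le.2 ⟨by linarith, h1⟩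
  have hc2 : |μ - 1| ≤ 1 := abs_le.2 ⟨by linarith, by linarith⟩
  have p1 := (sq_dist_bounds φ hc1 (by linarith : 1 ≤ r)).1
  have p2 := (sq_dist_bounds φ hc2 (by linarith : 1 ≤ r)).1
  have e1 : 0 < r ^ 2 + 2 * μ * r * cos φ + μ ^ 2 := by nlinarith
  have e2 : 0 < r ^ 2 + 2 * (μ - 1) * r * cos φ + (μ - 1) ^ 2 := by nlinarith
  unfold iD
  have s1 := Real.sqrt_pos.2 e1
  have s2 := Real.sqrt_pos.2 e2
  have q1 := Real.sq_sqrt e1.le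
  have q2 := Real.sq_sqrt e2.le
  set A := √(r ^ 2 + 2 * μ * r * cos φ + μ ^ 2)
  set B := √(r ^ 2 + 2 * (μ - 1) * r * cos φ + (μ - 1) ^ 2)
  have hAB : |B - A| ≤ 1 := by
    have hA : |r * cos φ + μ| ≤ A := Real.abs_le_sqrt (by nlinarith [sin_sq_add_cos_sq φ, sq_nonneg (r * sin φ), cos_sq_le_one φ])
    have hB : |r * cos φ + (μ - 1)| ≤ B := Real.abs_le_sqrt (by nlinarith [sin_sq_add_cos_sq φ, sq_nonneg (r * sin φ), cos_sq_le_one φ])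
    have hk : (A - B) * (A + B) = (r * cos φ + μ) + (r * cos φ + (μ - 1)) := by nlinarith
    have h3 : |(A - B) * (A + B)| ≤ A + B := by
      rw [hk]; exact (abs_add_le _ _).trans (by linarith)
    rw [abs_mul, abs_of_pos (by linarith : 0 < A + B)] at h3
    rw [abs_sub_comm]
    exact le_of_mul_le_mul_right (by linarith) (by linarith : 0 < A + B)
  have : A⁻¹ - B⁻¹ = (B - A) * (A⁻¹ * B⁻¹) := by field_simp
  rw [this, abs_mul, abs_of_pos (by positivity : 0 < A⁻¹ * B⁻¹)]
  exact mul_le_of_le_one_left (by positivity) hAB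

/-- Common derivative `∂_r` of the torque and `∂_φ` of the radial force. -/
noncomputable def tqr (μ r φ : ℝ) : ℝ :=
  μ * (1 - μ) * sin φ * ((iD μ r φ ^ 3 - iD (μ - 1) r φ ^ 3) -
    3 * r * ((r + μ * cos φ) * iD μ r φ ^ 5 - (r + (μ - 1) * cos φ) * iD (μ - 1) r φ ^ 5))

noncomputable def tqφ (μ r φ : ℝ) : ℝ :=
  μ * (1 - μ) * r * (cos φ * (iD μ r φ ^ 3 - iD (μ - 1) r φ ^ 3) +
    3 * r * sin φ ^ 2 * (μ * iD μ r φ ^ 5 - (μ - 1) * iD (μ - 1) r φ ^ 5))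

noncomputable def frr (μ r φ : ℝ) : ℝ :=
  -(1 - μ) * (iD μ r φ ^ 3 - 3 * (r + μ * cos φ) ^ 2 * iD μ r φ ^ 5) -
    μ * (iD (μ - 1) r φ ^ 3 - 3 * (r + (μ - 1) * cos φ) ^ 2 * iD (μ - 1) r φ ^ 5)

section

variable {μ : ℝ} (h0 : 0 ≤ μ) (h1 : μ ≤ 1)
include h0 h1

theorem abs_mu_le : |μ| ≤ 1 ∧ |μ - 1| ≤ 1 :=
  ⟨abs_le.2 ⟨by linarith, h1⟩, abs_le.2 ⟨by linarith, by linarith⟩⟩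

theorem hasDerivAt_tq {t r' φ' : ℝ} {r φ : ℝ → ℝ} (hr : 2000 ≤ r t)
    (hr' : HasDerivAt r r' t) (hφ' : HasDerivAt φ φ' t) :
    HasDerivAt (fun s => tq μ (r s) (φ s)) (tqr μ (r t) (φ t) * r' + tqφ μ (r t) (φ t) * φ') t := by
  have hS := (hasDerivAt_iD (abs_mu_le h0 h1).1 hr hr' hφ').pow 3
  have hJ := (hasDerivAt_iD (abs_mu_le h0 h1).2 hr hr' hφ').pow 3
  refine HasDerivAt.congr_deriv (((hr'.const_mul (μ * (1 - μ))).mul hφ'.sin).mul (hS.sub hJ)) ?_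
  simp only [tqr, tqφ, Pi.mul_apply]
  push_cast
  ring

theorem hasDerivAt_fr {t r' φ' : ℝ} {r φ : ℝ → ℝ} (hr : 2000 ≤ r t)
    (hr' : HasDerivAt r r' t) (hφ' : HasDerivAt φ φ' t) :
    HasDerivAt (fun s => fr μ (r s) (φ s)) (frr μ (r t) (φ t) * r' + tqr μ (r t) (φ t) * φ') t := by
  have hS := (hasDerivAt_iD (abs_mu_le h0 h1).1 hr hr' hφ').pow 3
  have hJ := (hasDerivAt_iD (abs_mu_le h0 h1).2 hr hr' hφ').pow 3
  have c1 := ((hr'.add (hφ'.cos.const_mul μ)).const_mul (-(1 - μ))).mul hS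
  have c2 := ((hr'.add (hφ'.cos.const_mul (μ - 1))).const_mul μ).mul hJ
  refine HasDerivAt.congr_deriv (c1.sub c2) ?_
  simp only [frr, tqr, Pi.pow_apply]
  push_cast
  simp only [Pi.add_apply]
  ring

theorem hasDerivAt_pot {t r' φ' : ℝ} {r φ : ℝ → ℝ} (hr : 2000 ≤ r t)
    (hr' : HasDerivAt r r' t) (hφ' : HasDerivAt φ φ' t) :
    HasDerivAt (fun s => pot μ (r s) (φ s)) (-fr μ (r t) (φ t) * r' - tq μ (r t) (φ t) * φ') t := by
  have hS := (hasDerivAt_iD (abs_mu_le h0 h1).1 hr hr' hφ')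
  have hJ := (hasDerivAt_iD (abs_mu_le h0 h1).2 hr hr' hφ')
  refine HasDerivAt.congr_deriv ((hS.const_mul (-(1 - μ))).sub (hJ.const_mul μ)) ?_
  simp only [fr, tq]
  ring

theorem abs_pow_iD_sub_le {r : ℝ} (φ : ℝ) (hr : 2000 ≤ r) :
    |iD μ r φ ^ 3 - iD (μ - 1) r φ ^ 3| ≤ 3.1 * r⁻¹ ^ 4 ∧
      |iD μ r φ ^ 5 - iD (μ - 1) r φ ^ 5| ≤ 5.1 * r⁻¹ ^ 6 := by
  have hρ : 0 < r⁻¹ := inv_pos.2 (by linarith)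
  obtain ⟨a1, a2⟩ := iD_bounds φ (abs_mu_le h0 h1).1 hr
  obtain ⟨b1, b2⟩ := iD_bounds φ (abs_mu_le h0 h1).2 hr
  exact abs_pow_three_sub_le hρ.le (by nlinarith) (by nlinarith) a2 b2 (abs_iD_sub_le φ h0 h1 hr)

theorem abs_tq_le {r : ℝ} (φ : ℝ) (hr : 2000 ≤ r) : |tq μ r φ| ≤ 4 * μ * r⁻¹ ^ 3 := by
  have hr0 : 0 < r := by linarith
  have hd := (abs_pow_iD_sub_le h0 h1 φ hr).1
  unfold tq
  rw [abs_mul, abs_mul, abs_of_nonneg (by have := mul_nonneg h0 (by linarith : 0 ≤ 1 - μ); positivity : 0 ≤ μ * (1 - μ) * r)]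
  calc _ ≤ μ * 1 * r * 1 * (3.1 * r⁻¹ ^ 4) := by
        gcongr
        · linarith
        · exact abs_sin_le_one φ
    _ = 3.1 * μ * r⁻¹ ^ 3 := by field_simp
    _ ≤ _ := by gcongr; norm_num

theorem abs_tqr_le {r : ℝ} (φ : ℝ) (hr : 2000 ≤ r) : |tqr μ r φ| ≤ 30 * μ * r⁻¹ ^ 4 := by
  have hr0 : 0 < r := by linarith
  have hρ : 0 < r⁻¹ := inv_pos.2 hr0
  obtain ⟨hd3, hd5⟩ := abs_pow_iD_sub_le h0 h1 φ hr
  obtain ⟨a1, a2⟩ := iD_bounds φ (abs_mu_le h0 h1).1 hr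
  obtain ⟨b1, b2⟩ := iD_bounds φ (abs_mu_le h0 h1).2 hr
  have a0 : 0 ≤ iD μ r φ := by nlinarith
  have b0 : 0 ≤ iD (μ - 1) r φ := by nlinarith
  have a5 : iD μ r φ ^ 5 ≤ (1.001 * r⁻¹) ^ 5 := by gcongr
  have b5 : iD (μ - 1) r φ ^ 5 ≤ (1.001 * r⁻¹) ^ 5 := by gcongr
  have hin : |(r + μ * cos φ) * iD μ r φ ^ 5 - (r + (μ - 1) * cos φ) * iD (μ - 1) r φ ^ 5| ≤
      7.2 * r⁻¹ ^ 5 := by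
    have e : (r + μ * cos φ) * iD μ r φ ^ 5 - (r + (μ - 1) * cos φ) * iD (μ - 1) r φ ^ 5 =
        r * (iD μ r φ ^ 5 - iD (μ - 1) r φ ^ 5) + (μ * cos φ * iD μ r φ ^ 5 -
          (μ - 1) * cos φ * iD (μ - 1) r φ ^ 5) := by ring
    rw [e]
    refine (abs_add_le _ _).trans ?_
    have t1 : |r * (iD μ r φ ^ 5 - iD (μ - 1) r φ ^ 5)| ≤ 5.1 * r⁻¹ ^ 5 := by
      rw [abs_mul, abs_of_pos hr0]
      calc _ ≤ r * (5.1 * r⁻¹ ^ 6) := by gcongr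
        _ = _ := by field_simp
    have t2 : |μ * cos φ * iD μ r φ ^ 5| ≤ 1 * 1 * (1.001 * r⁻¹) ^ 5 := by
      rw [abs_mul, abs_mul, abs_of_nonneg (pow_nonneg a0 5)]
      gcongr
      · exact (abs_mu_le h0 h1).1
      · exact abs_cos_le_one φ
    have t3 : |(μ - 1) * cos φ * iD (μ - 1) r φ ^ 5| ≤ 1 * 1 * (1.001 * r⁻¹) ^ 5 := by
      rw [abs_mul, abs_mul, abs_of_nonneg (pow_nonneg b0 5)]
      gcongr
      · exact (abs_mu_le h0 h1).2
      · exact abs_cos_le_one φ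
    have t4 := (abs_sub (μ * cos φ * iD μ r φ ^ 5) ((μ - 1) * cos φ * iD (μ - 1) r φ ^ 5))
    have t5 : (1.001 * r⁻¹) ^ 5 ≤ 1.01 * r⁻¹ ^ 5 := by
      rw [mul_pow]; gcongr; norm_num
    nlinarith [pow_pos hρ 5]
  unfold tqr
  rw [abs_mul, abs_mul, abs_of_nonneg (mul_nonneg h0 (by linarith : 0 ≤ 1 - μ))]
  have hbig : |(iD μ r φ ^ 3 - iD (μ - 1) r φ ^ 3) -
    3 * r * ((r + μ * cos φ) * iD μ r φ ^ 5 - (r + (μ - 1) * cos φ) * iD (μ - 1) r φ ^ 5)| ≤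
      30 * r⁻¹ ^ 4 := by
    refine (abs_sub _ _).trans ?_
    rw [abs_mul (3 * r), abs_of_pos (by positivity : 0 < 3 * r)]
    calc _ ≤ 3.1 * r⁻¹ ^ 4 + 3 * r * (7.2 * r⁻¹ ^ 5) := by gcongr
      _ = 24.7 * r⁻¹ ^ 4 := by field_simp; norm_num
      _ ≤ _ := by gcongr; norm_num
  calc _ ≤ μ * 1 * 1 * (30 * r⁻¹ ^ 4) := by
        gcongr
        · linarith
        · exact abs_sin_le_one φ
    _ = _ := by ring

theorem abs_tqφ_le {r : ℝ} (φ : ℝ) (hr : 2000 ≤ r) : |tqφ μ r φ| ≤ 12 * μ * r⁻¹ ^ 3 := by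
  have hr0 : 0 < r := by linarith
  have hρ : 0 < r⁻¹ := inv_pos.2 hr0
  obtain ⟨hd3, hd5⟩ := abs_pow_iD_sub_le h0 h1 φ hr
  obtain ⟨a1, a2⟩ := iD_bounds φ (abs_mu_le h0 h1).1 hr
  obtain ⟨b1, b2⟩ := iD_bounds φ (abs_mu_le h0 h1).2 hr
  have a0 : 0 ≤ iD μ r φ := by nlinarith
  have b0 : 0 ≤ iD (μ - 1) r φ := by nlinarith
  have a5 : iD μ r φ ^ 5 ≤ (1.001 * r⁻¹) ^ 5 := by gcongr
  have b5 : iD (μ - 1) r φ ^ 5 ≤ (1.001 * r⁻¹) ^ 5 := by gcongr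
  have t5 : (1.001 * r⁻¹) ^ 5 ≤ 1.01 * r⁻¹ ^ 5 := by
    rw [mul_pow]; gcongr; norm_num
  have hin : |μ * iD μ r φ ^ 5 - (μ - 1) * iD (μ - 1) r φ ^ 5| ≤ 2.02 * r⁻¹ ^ 5 := by
    rw [abs_le]
    have := pow_nonneg a0 5
    have := pow_nonneg b0 5
    constructor <;> nlinarith [pow_pos hρ 5]
  have hbig : |cos φ * (iD μ r φ ^ 3 - iD (μ - 1) r φ ^ 3) +
    3 * r * sin φ ^ 2 * (μ * iD μ r φ ^ 5 - (μ - 1) * iD (μ - 1) r φ ^ 5)| ≤ 12 * r⁻¹ ^ 4 := by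
    refine (abs_add_le _ _).trans ?_
    rw [abs_mul (cos φ), abs_mul (3 * r * sin φ ^ 2), abs_of_nonneg (by positivity : 0 ≤ 3 * r * sin φ ^ 2)]
    calc _ ≤ 1 * (3.1 * r⁻¹ ^ 4) + 3 * r * 1 * (2.02 * r⁻¹ ^ 5) := by
          gcongr
          · exact abs_cos_le_one φ
          · exact sin_sq_le_one φ
      _ = 9.16 * r⁻¹ ^ 4 := by field_simp; norm_num
      _ ≤ _ := by gcongr; norm_num
  unfold tqφ
  rw [abs_mul, abs_of_nonneg (by have := mul_nonneg h0 (by linarith : 0 ≤ 1 - μ); positivity : 0 ≤ μ * (1 - μ) * r)]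
  calc _ ≤ μ * 1 * r * (12 * r⁻¹ ^ 4) := by
        gcongr
        linarith
    _ = _ := by field_simp

theorem fr_bounds {r : ℝ} (φ : ℝ) (hr : 2000 ≤ r) :
    -(1.01 * r⁻¹ ^ 2) ≤ fr μ r φ ∧ fr μ r φ ≤ -(0.99 * r⁻¹ ^ 2) := by
  have key : ∀ c, |c| ≤ 1 → 0.99 * r⁻¹ ^ 2 ≤ (r + c * cos φ) * iD c r φ ^ 3 ∧
      (r + c * cos φ) * iD c r φ ^ 3 ≤ 1.01 * r⁻¹ ^ 2 := by
    intro c hc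
    have hr0 : 0 < r := by linarith
    have hρ : 0 < r⁻¹ := inv_pos.2 hr0
    obtain ⟨a1, a2⟩ := iD_bounds φ hc hr
    have h3 : |c * cos φ| ≤ 1 := by
      rw [abs_mul]; exact mul_le_one₀ hc (abs_nonneg _) (abs_cos_le_one φ)
    obtain ⟨h4, h5⟩ := abs_le.1 h3
    have a0 : 0 ≤ iD c r φ := by nlinarith
    constructor
    · calc 0.99 * r⁻¹ ^ 2 ≤ (0.999 * r) * (0.999 * r⁻¹) ^ 3 := by
            rw [mul_pow, show 0.999 * r * (0.999 ^ 3 * r⁻¹ ^ 3) = 0.999 ^ 4 * r⁻¹ ^ 2 by field_simp]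
            gcongr; norm_num
        _ ≤ _ := by gcongr <;> linarith
    · calc _ ≤ (1.001 * r) * (1.001 * r⁻¹) ^ 3 := by gcongr; linarith
        _ ≤ _ := by
            rw [mul_pow, show 1.001 * r * (1.001 ^ 3 * r⁻¹ ^ 3) = 1.001 ^ 4 * r⁻¹ ^ 2 by field_simp]
            gcongr; norm_num
  obtain ⟨s1, s2⟩ := key μ (abs_mu_le h0 h1).1
  obtain ⟨j1, j2⟩ := key (μ - 1) (abs_mu_le h0 h1).2
  have e : fr μ r φ = -((1 - μ) * ((r + μ * cos φ) * iD μ r φ ^ 3) +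
      μ * ((r + (μ - 1) * cos φ) * iD (μ - 1) r φ ^ 3)) := by unfold fr; ring
  rw [e]
  have h1' : 0 ≤ 1 - μ := by linarith
  constructor <;> nlinarith

theorem frr_bounds {r : ℝ} (φ : ℝ) (hr : 2000 ≤ r) :
    1.5 * r⁻¹ ^ 3 ≤ frr μ r φ ∧ frr μ r φ ≤ 3 * r⁻¹ ^ 3 := by
  have key : ∀ c, |c| ≤ 1 → 1.5 * r⁻¹ ^ 3 ≤ 3 * (r + c * cos φ) ^ 2 * iD c r φ ^ 5 - iD c r φ ^ 3 ∧
      3 * (r + c * cos φ) ^ 2 * iD c r φ ^ 5 - iD c r φ ^ 3 ≤ 3 * r⁻¹ ^ 3 := by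
    intro c hc
    have hr0 : 0 < r := by linarith
    have hρ : 0 < r⁻¹ := inv_pos.2 hr0
    obtain ⟨a1, a2⟩ := iD_bounds φ hc hr
    have h3 : |c * cos φ| ≤ 1 := by
      rw [abs_mul]; exact mul_le_one₀ hc (abs_nonneg _) (abs_cos_le_one φ)
    obtain ⟨h4, h5⟩ := abs_le.1 h3
    have a0 : 0 ≤ iD c r φ := by nlinarith
    have l3 : (0.999 * r⁻¹) ^ 3 ≤ iD c r φ ^ 3 := by gcongr
    have u3 : iD c r φ ^ 3 ≤ (1.001 * r⁻¹) ^ 3 := by gcongr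
    have l5 : (0.999 * r) ^ 2 * (0.999 * r⁻¹) ^ 5 ≤ (r + c * cos φ) ^ 2 * iD c r φ ^ 5 := by
      gcongr; linarith
    have u5 : (r + c * cos φ) ^ 2 * iD c r φ ^ 5 ≤ (1.001 * r) ^ 2 * (1.001 * r⁻¹) ^ 5 := by
      gcongr
      · linarith
      · linarith
    rw [show (0.999 * r) ^ 2 * (0.999 * r⁻¹) ^ 5 = 0.999 ^ 7 * r⁻¹ ^ 3 by field_simp] at l5
    rw [show (1.001 * r) ^ 2 * (1.001 * r⁻¹) ^ 5 = 1.001 ^ 7 * r⁻¹ ^ 3 by field_simp] at u5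
    rw [mul_pow] at l3 u3
    have := pow_pos hρ 3
    constructor <;> nlinarith
  obtain ⟨s1, s2⟩ := key μ (abs_mu_le h0 h1).1
  obtain ⟨j1, j2⟩ := key (μ - 1) (abs_mu_le h0 h1).2
  have e : frr μ r φ = (1 - μ) * (3 * (r + μ * cos φ) ^ 2 * iD μ r φ ^ 5 - iD μ r φ ^ 3) +
      μ * (3 * (r + (μ - 1) * cos φ) ^ 2 * iD (μ - 1) r φ ^ 5 - iD (μ - 1) r φ ^ 3) := by
    unfold frr; ring
  rw [e]
  have h1' : 0 ≤ 1 - μ := by linarith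
  constructor <;> nlinarith

/-! ### Increments -/

theorem abs_tq_sub_angle_le {r : ℝ} (hr : 2000 ≤ r) (φ₁ φ₂ : ℝ) :
    |tq μ r φ₂ - tq μ r φ₁| ≤ 12 * μ * r⁻¹ ^ 3 * |φ₂ - φ₁| := by
  have := convex_univ.norm_image_sub_le_of_norm_hasDerivWithin_le (𝕜 := ℝ) (f := fun φ => tq μ r φ)
    (f' := fun φ => tqr μ r φ * 0 + tqφ μ r φ * 1) (C := 12 * μ * r⁻¹ ^ 3)
    (fun x _ => (hasDerivAt_tq h0 h1 (r := fun _ => r) (φ := fun s => s) hr (hasDerivAt_const x r)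
      (hasDerivAt_id x)).hasDerivWithinAt)
    (fun x _ => by simpa using abs_tqφ_le h0 h1 x hr) (mem_univ φ₁) (mem_univ φ₂)
  simpa using this

theorem abs_fr_sub_angle_le {r : ℝ} (hr : 2000 ≤ r) (φ₁ φ₂ : ℝ) :
    |fr μ r φ₂ - fr μ r φ₁| ≤ 30 * μ * r⁻¹ ^ 4 * |φ₂ - φ₁| := by
  have := convex_univ.norm_image_sub_le_of_norm_hasDerivWithin_le (𝕜 := ℝ) (f := fun φ => fr μ r φ)
    (f' := fun φ => frr μ r φ * 0 + tqr μ r φ * 1) (C := 30 * μ * r⁻¹ ^ 4)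
    (fun x _ => (hasDerivAt_fr h0 h1 (r := fun _ => r) (φ := fun s => s) hr (hasDerivAt_const x r)
      (hasDerivAt_id x)).hasDerivWithinAt)
    (fun x _ => by simpa using abs_tqr_le h0 h1 x hr) (mem_univ φ₁) (mem_univ φ₂)
  simpa using this

theorem abs_pot_sub_angle_le {r : ℝ} (hr : 2000 ≤ r) (φ₁ φ₂ : ℝ) :
    |pot μ r φ₂ - pot μ r φ₁| ≤ 4 * μ * r⁻¹ ^ 3 * |φ₂ - φ₁| := by
  have := convex_univ.norm_image_sub_le_of_norm_hasDerivWithin_le (𝕜 := ℝ) (f := fun φ => pot μ r φ)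
    (f' := fun φ => -fr μ r φ * 0 - tq μ r φ * 1) (C := 4 * μ * r⁻¹ ^ 3)
    (fun x _ => (hasDerivAt_pot h0 h1 (r := fun _ => r) (φ := fun s => s) hr (hasDerivAt_const x r)
      (hasDerivAt_id x)).hasDerivWithinAt)
    (fun x _ => by simpa using abs_tq_le h0 h1 x hr) (mem_univ φ₁) (mem_univ φ₂)
  simpa using this

omit h0 h1 in
theorem le_of_deriv_nonneg_Ici {g g' : ℝ → ℝ} {a r₁ r₂ : ℝ} (hg : ∀ r, a ≤ r → HasDerivAt g (g' r) r)
    (hg' : ∀ r, a ≤ r → 0 ≤ g' r) (h₁ : a ≤ r₁) (h : r₁ ≤ r₂) : g r₁ ≤ g r₂ := by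
  have : MonotoneOn g (Ici a) := by
    refine monotoneOn_of_deriv_nonneg (convex_Ici a)
      (fun r hr => (hg r hr).continuousAt.continuousWithinAt) (fun r hr => ?_) (fun r hr => ?_)
    · exact (hg r (interior_subset hr)).differentiableAt.differentiableWithinAt
    · rw [(hg r (interior_subset hr)).deriv]; exact hg' r (interior_subset hr)
  exact this h₁ (h₁.trans h) h

omit h0 h1 in
theorem hasDerivAt_inv_pow {r : ℝ} (hr : 0 < r) (n : ℕ) :
    HasDerivAt (fun x : ℝ => x⁻¹ ^ n) (-(n * r⁻¹ ^ (n + 1))) r := by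
  refine ((hasDerivAt_inv hr.ne').pow n).congr_deriv ?_
  rcases n with _ | n
  · simp
  · rw [← inv_pow]
    push_cast
    ring_nf

theorem abs_tq_sub_radius_le {r₁ r₂ : ℝ} (hr : 2000 ≤ r₁) (h : r₁ ≤ r₂) (φ : ℝ) :
    |tq μ r₂ φ - tq μ r₁ φ| ≤ 10 * μ * (r₁⁻¹ ^ 3 - r₂⁻¹ ^ 3) := by
  have hd : ∀ r, 2000 ≤ r → HasDerivAt (fun r => tq μ r φ) (tqr μ r φ * 1 + tqφ μ r φ * 0) r :=
    fun r hr => hasDerivAt_tq h0 h1 (r := fun s => s) (φ := fun _ => φ) hr (hasDerivAt_id r)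
      (hasDerivAt_const r φ)
  have hp : ∀ r, 2000 ≤ r → HasDerivAt (fun r : ℝ => 10 * μ * r⁻¹ ^ 3)
      (10 * μ * (-(((3 : ℕ) : ℝ) * r⁻¹ ^ 4))) r :=
    fun r hr => (hasDerivAt_inv_pow (by linarith) 3).const_mul _
  have b := fun r hr => abs_le.1 (abs_tqr_le h0 h1 (r := r) φ hr)
  have u := le_of_deriv_nonneg_Ici (fun r hr => (hp r hr).neg.sub (hd r hr))
    (fun r hr => by push_cast; linarith [(b r hr).2]) hr h
  have l := le_of_deriv_nonneg_Ici (fun r hr => (hp r hr).neg.add (hd r hr))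
    (fun r hr => by push_cast; linarith [(b r hr).1]) hr h
  simp only [Pi.neg_apply, Pi.sub_apply, Pi.add_apply] at u l
  rw [abs_le]
  constructor <;> linarith

theorem fr_sub_radius_ge {r₁ r₂ : ℝ} (hr : 2000 ≤ r₁) (h : r₁ ≤ r₂) (φ : ℝ) :
    0.75 * (r₁⁻¹ ^ 2 - r₂⁻¹ ^ 2) ≤ fr μ r₂ φ - fr μ r₁ φ := by
  have hd : ∀ r, 2000 ≤ r → HasDerivAt (fun r => fr μ r φ) (frr μ r φ * 1 + tqr μ r φ * 0) r :=
    fun r hr => hasDerivAt_fr h0 h1 (r := fun s => s) (φ := fun _ => φ) hr (hasDerivAt_id r)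
      (hasDerivAt_const r φ)
  have hp : ∀ r, 2000 ≤ r → HasDerivAt (fun r : ℝ => 0.75 * r⁻¹ ^ 2)
      (0.75 * (-(((2 : ℕ) : ℝ) * r⁻¹ ^ 3))) r :=
    fun r hr => (hasDerivAt_inv_pow (by linarith) 2).const_mul _
  have u := le_of_deriv_nonneg_Ici (fun r hr => (hp r hr).add (hd r hr))
    (fun r hr => by push_cast; linarith [(frr_bounds h0 h1 φ hr).1]) hr h
  simp only [Pi.add_apply] at u
  linarith

theorem pot_sub_radius_bounds {r₁ r₂ : ℝ} (hr : 2000 ≤ r₁) (h : r₁ ≤ r₂) (φ : ℝ) :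
    0.99 * (r₁⁻¹ - r₂⁻¹) ≤ pot μ r₂ φ - pot μ r₁ φ ∧
      pot μ r₂ φ - pot μ r₁ φ ≤ 1.01 * (r₁⁻¹ - r₂⁻¹) := by
  have hd : ∀ r, 2000 ≤ r → HasDerivAt (fun r => pot μ r φ) (-fr μ r φ * 1 - tq μ r φ * 0) r :=
    fun r hr => hasDerivAt_pot h0 h1 (r := fun s => s) (φ := fun _ => φ) hr (hasDerivAt_id r)
      (hasDerivAt_const r φ)
  have hp : ∀ k r : ℝ, 2000 ≤ r → HasDerivAt (fun r : ℝ => k * r⁻¹ ^ 1)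
      (k * (-(((1 : ℕ) : ℝ) * r⁻¹ ^ 2))) r :=
    fun k r hr => (hasDerivAt_inv_pow (by linarith) 1).const_mul _
  have l := le_of_deriv_nonneg_Ici (fun r hr => (hp 0.99 r hr).add (hd r hr))
    (fun r hr => by push_cast; linarith [(fr_bounds h0 h1 φ hr).2]) hr h
  have u := le_of_deriv_nonneg_Ici (fun r hr => (hp 1.01 r hr).neg.sub (hd r hr))
    (fun r hr => by push_cast; linarith [(fr_bounds h0 h1 φ hr).1]) hr h
  simp only [Pi.neg_apply, Pi.sub_apply, Pi.add_apply, pow_one] at u l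
  constructor <;> linarith

theorem abs_tq_sub_le {r₁ r₂ : ℝ} (hr₁ : 2000 ≤ r₁) (hr₂ : 2000 ≤ r₂) (φ : ℝ) :
    |tq μ r₂ φ - tq μ r₁ φ| ≤ |r₂ - r₁| := by
  have := (convex_Ici (2000 : ℝ)).norm_image_sub_le_of_norm_hasDerivWithin_le (𝕜 := ℝ)
    (f := fun r => tq μ r φ) (f' := fun r => tqr μ r φ * 1 + tqφ μ r φ * 0) (C := 1)
    (fun x hx => (hasDerivAt_tq h0 h1 (r := fun s => s) (φ := fun _ => φ) hx (hasDerivAt_id x)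
      (hasDerivAt_const x φ)).hasDerivWithinAt)
    (fun x hx => by
      have hx' : (2000 : ℝ) ≤ x := hx
      have h2 : x⁻¹ ≤ 1 / 2000 := by rw [one_div]; gcongr
      have h3 : x⁻¹ ^ 4 ≤ (1 / 2000) ^ 4 := by
        have : 0 ≤ x⁻¹ := inv_nonneg.2 (by linarith)
        gcongr
      have := abs_tqr_le h0 h1 φ hx'
      rw [mul_one, mul_zero, add_zero, Real.norm_eq_abs]
      nlinarith) hr₁ hr₂
  simpa using this

theorem abs_fr_sub_le {r₁ r₂ : ℝ} (hr₁ : 2000 ≤ r₁) (hr₂ : 2000 ≤ r₂) (φ : ℝ) :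
    |fr μ r₂ φ - fr μ r₁ φ| ≤ |r₂ - r₁| := by
  have := (convex_Ici (2000 : ℝ)).norm_image_sub_le_of_norm_hasDerivWithin_le (𝕜 := ℝ)
    (f := fun r => fr μ r φ) (f' := fun r => frr μ r φ * 1 + tqr μ r φ * 0) (C := 1)
    (fun x hx => (hasDerivAt_fr h0 h1 (r := fun s => s) (φ := fun _ => φ) hx (hasDerivAt_id x)
      (hasDerivAt_const x φ)).hasDerivWithinAt)
    (fun x hx => by
      have hx' : (2000 : ℝ) ≤ x := hx
      have h2 : x⁻¹ ≤ 1 / 2000 := by rw [one_div]; gcongr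
      have hx0 : 0 ≤ x⁻¹ := inv_nonneg.2 (by linarith)
      have h3 : x⁻¹ ^ 3 ≤ (1 / 2000) ^ 3 := by gcongr
      have h4 : 0 ≤ x⁻¹ ^ 3 := by positivity
      obtain ⟨f1, f2⟩ := frr_bounds h0 h1 φ hx'
      rw [mul_one, mul_zero, add_zero, Real.norm_eq_abs, abs_le]
      constructor <;> nlinarith) hr₁ hr₂
  simpa using this

end

end PCRTBP

namespace PCRTBP

open Set

/-! ### The regularised far field -/

/-- Radius of the far region. -/
notation "ℛ" => (50000000 : ℝ)

/-- Truncation to `[-c, c]`. -/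
noncomputable def cl (c x : ℝ) : ℝ := max (-c) (min c x)

theorem abs_cl_le {c : ℝ} (hc : 0 ≤ c) (x : ℝ) : |cl c x| ≤ c :=
  abs_le.2 ⟨le_max_left _ _, max_le (by linarith) (min_le_left _ _)⟩

theorem cl_eq {c x : ℝ} (h : |x| ≤ c) : cl c x = x := by
  obtain ⟨h1, h2⟩ := abs_le.1 h
  simp [cl, h1, h2]

theorem abs_cl_sub_le (c x y : ℝ) : |cl c x - cl c y| ≤ |x - y| := by
  unfold cl
  refine (abs_max_sub_max_le_max _ _ _ _).trans (max_le (by simp) ?_)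
  exact (abs_min_sub_min_le_max _ _ _ _).trans (max_le (by simp) le_rfl)

theorem cl_neg {c : ℝ} (hc : 0 ≤ c) (x : ℝ) : cl c (-x) = -cl c x := by
  unfold cl
  rcases le_total c x with h | h
  · rw [min_eq_left h, min_eq_right (by linarith), max_eq_left (by linarith),
      max_eq_right (by linarith)]
  rcases le_total (-c) x with h' | h'
  · rw [min_eq_right h, max_eq_right h', min_eq_right (by linarith), max_eq_right (by linarith)]
  · rw [min_eq_right h, max_eq_left h', min_eq_left (by linarith), max_eq_right (by linarith),
      neg_neg]

/-- States `(r, v, φ, G)`: radius, radial velocity, rotating angle, angular momentum. -/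
abbrev FS : Type := ℝ × ℝ × ℝ × ℝ

/-- The vector field of the problem in polar coordinates, truncated outside the far region. -/
noncomputable def farField (μ : ℝ) (x : FS) : FS :=
  (cl 1 x.2.1, cl (1 / 2) x.2.2.2 ^ 2 * (max x.1 ℛ)⁻¹ ^ 3 + fr μ (max x.1 ℛ) x.2.2.1,
    cl (1 / 2) x.2.2.2 * (max x.1 ℛ)⁻¹ ^ 2 - 1, tq μ (max x.1 ℛ) x.2.2.1)

theorem abs_max_sub_le (c x y : ℝ) : |max x c - max y c| ≤ |x - y| :=
  (abs_max_sub_max_le_max _ _ _ _).trans (max_le le_rfl (by simp))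

theorem abs_inv_sub_inv_le {a b : ℝ} (ha : 1 ≤ a) (hb : 1 ≤ b) : |a⁻¹ - b⁻¹| ≤ |a - b| := by
  have : a⁻¹ - b⁻¹ = (b - a) * (a⁻¹ * b⁻¹) := by field_simp
  rw [this, abs_mul, abs_sub_comm b a, abs_of_nonneg (by positivity : 0 ≤ a⁻¹ * b⁻¹)]
  refine mul_le_of_le_one_right (abs_nonneg _) ?_
  exact mul_le_one₀ (inv_le_one_of_one_le₀ ha) (by positivity) (inv_le_one_of_one_le₀ hb)

theorem abs_mul_sub_mul_le {a b c d A C : ℝ} (hb : |b| ≤ A) (hc : |c| ≤ C) :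
    |a * c - b * d| ≤ |a - b| * C + A * |c - d| := by
  have : a * c - b * d = (a - b) * c + b * (c - d) := by ring
  rw [this]
  refine (abs_add_le _ _).trans ?_
  rw [abs_mul, abs_mul]
  gcongr

theorem farField_lipschitz {μ : ℝ} (h0 : 0 ≤ μ) (h1 : μ ≤ 1) : LipschitzWith 40 (farField μ) := by
  refine LipschitzWith.of_dist_le_mul fun x y => ?_
  have hr : |x.1 - y.1| ≤ dist x y := le_max_left _ _
  have hs : dist x.2 y.2 ≤ dist x y := le_max_right _ _
  have hv : |x.2.1 - y.2.1| ≤ dist x y := (le_max_left _ _).trans hs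
  have hs' : dist x.2.2 y.2.2 ≤ dist x y := (le_max_right _ _).trans hs
  have hφ : |x.2.2.1 - y.2.2.1| ≤ dist x y := (le_max_left _ _).trans hs'
  have hG : |x.2.2.2 - y.2.2.2| ≤ dist x y := (le_max_right _ _).trans hs'
  generalize dist x y = d at *
  obtain ⟨r₁, v₁, φ₁, G₁⟩ := x
  obtain ⟨r₂, v₂, φ₂, G₂⟩ := y
  simp only at hr hv hφ hG
  have hd : 0 ≤ d := (abs_nonneg _).trans hr
  have hr' := (abs_max_sub_le ℛ r₁ r₂).trans hr
  have hG' := (abs_cl_sub_le (1 / 2) G₁ G₂).trans hG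
  have b1 : ℛ ≤ max r₁ ℛ := le_max_right _ _
  have b2 : ℛ ≤ max r₂ ℛ := le_max_right _ _
  have g1 := abs_cl_le (by norm_num : (0 : ℝ) ≤ 1 / 2) G₁
  have g2 := abs_cl_le (by norm_num : (0 : ℝ) ≤ 1 / 2) G₂
  have fφ := abs_fr_sub_angle_le h0 h1 (by linarith : 2000 ≤ max r₁ ℛ) φ₂ φ₁
  have frr' := abs_fr_sub_le h0 h1 (by linarith : 2000 ≤ max r₂ ℛ) (by linarith : 2000 ≤ max r₁ ℛ) φ₂
  have tφ := abs_tq_sub_angle_le h0 h1 (by linarith : 2000 ≤ max r₁ ℛ) φ₂ φ₁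
  have tr := abs_tq_sub_le h0 h1 (by linarith : 2000 ≤ max r₂ ℛ) (by linarith : 2000 ≤ max r₁ ℛ) φ₂
  have hi := (abs_inv_sub_inv_le (by linarith : 1 ≤ max r₁ ℛ) (by linarith : 1 ≤ max r₂ ℛ)).trans hr'
  have i1 : |(max r₁ ℛ)⁻¹| ≤ 1 := by
    rw [abs_of_pos (inv_pos.2 (by linarith))]; exact inv_le_one_of_one_le₀ (by linarith)
  have i2 : |(max r₂ ℛ)⁻¹| ≤ 1 := by
    rw [abs_of_pos (inv_pos.2 (by linarith))]; exact inv_le_one_of_one_le₀ (by linarith)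
  have j0 : 0 ≤ (max r₁ ℛ)⁻¹ := inv_nonneg.2 (by linarith)
  have j1 := (abs_le.1 i1).2
  change max (|cl 1 v₁ - cl 1 v₂|)
    (max (|(cl (1 / 2) G₁ ^ 2 * (max r₁ ℛ)⁻¹ ^ 3 + fr μ (max r₁ ℛ) φ₁) -
        (cl (1 / 2) G₂ ^ 2 * (max r₂ ℛ)⁻¹ ^ 3 + fr μ (max r₂ ℛ) φ₂)|)
    (max (|(cl (1 / 2) G₁ * (max r₁ ℛ)⁻¹ ^ 2 - 1) - (cl (1 / 2) G₂ * (max r₂ ℛ)⁻¹ ^ 2 - 1)|)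
      (|tq μ (max r₁ ℛ) φ₁ - tq μ (max r₂ ℛ) φ₂|))) ≤ (40 : ℝ) * d
  generalize max r₁ ℛ = R₁ at *
  generalize max r₂ ℛ = R₂ at *
  generalize cl (1 / 2) G₁ = g₁ at *
  generalize cl (1 / 2) G₂ = g₂ at *
  have k3 : R₁⁻¹ ^ 3 ≤ 1 := pow_le_one₀ j0 j1
  have k4 : R₁⁻¹ ^ 4 ≤ 1 := pow_le_one₀ j0 j1
  have p3 : 0 ≤ R₁⁻¹ ^ 3 := by positivity
  have p4 : 0 ≤ R₁⁻¹ ^ 4 := by positivity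
  have fφ' : |fr μ R₁ φ₁ - fr μ R₁ φ₂| ≤ 30 * d := fφ.trans (by
    calc _ ≤ 30 * 1 * 1 * d := by gcongr
      _ = _ := by ring)
  have tφ' : |tq μ R₁ φ₁ - tq μ R₁ φ₂| ≤ 12 * d := tφ.trans (by
    calc _ ≤ 12 * 1 * 1 * d := by gcongr
      _ = _ := by ring)
  have gsq : |g₁ ^ 2 - g₂ ^ 2| ≤ d := by
    have := abs_mul_sub_mul_le (a := g₁) (c := g₁) (d := g₂) g2 g1
    rw [← sq, ← sq] at this; linarith
  have isq : |R₁⁻¹ ^ 2 - R₂⁻¹ ^ 2| ≤ 2 * d := by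
    have := abs_mul_sub_mul_le (a := R₁⁻¹) (c := R₁⁻¹) (d := R₂⁻¹) i2 i1
    rw [← sq, ← sq] at this; linarith
  have i1s : |R₁⁻¹ ^ 2| ≤ 1 := by rw [abs_pow]; exact pow_le_one₀ (abs_nonneg _) i1
  have i1c : |R₁⁻¹ ^ 3| ≤ 1 := by rw [abs_pow]; exact pow_le_one₀ (abs_nonneg _) i1
  have icb : |R₁⁻¹ ^ 3 - R₂⁻¹ ^ 3| ≤ 3 * d := by
    have := abs_mul_sub_mul_le (a := R₁⁻¹) (c := R₁⁻¹ ^ 2) (d := R₂⁻¹ ^ 2) i2 i1s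
    rw [← pow_succ', ← pow_succ'] at this; linarith
  have g2s : |g₂ ^ 2| ≤ 1 := by rw [abs_pow]; exact pow_le_one₀ (abs_nonneg _) (by linarith)
  have t1 := abs_mul_sub_mul_le (a := g₁ ^ 2) (c := R₁⁻¹ ^ 3) (d := R₂⁻¹ ^ 3) g2s i1c
  have t2 := abs_mul_sub_mul_le (a := g₁) (c := R₁⁻¹ ^ 2) (d := R₂⁻¹ ^ 2) g2 i1s
  replace t1 : |g₁ ^ 2 * R₁⁻¹ ^ 3 - g₂ ^ 2 * R₂⁻¹ ^ 3| ≤ 4 * d := by linarith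
  replace t2 : |g₁ * R₁⁻¹ ^ 2 - g₂ * R₂⁻¹ ^ 2| ≤ 2 * d := by linarith
  replace frr' := frr'.trans hr'
  replace tr := tr.trans hr'
  clear fφ tφ i1 i2 hi gsq isq i1s i1c icb g2s
  refine max_le ?_ (max_le ?_ (max_le ?_ ?_))
  · have := (abs_cl_sub_le 1 v₁ v₂).trans hv
    linarith
  · rw [abs_le] at *
    constructor <;> linarith
  · rw [abs_le] at *
    constructor <;> linarith
  · rw [abs_le] at *
    constructor <;> linarith

theorem inv_max_pos (r : ℝ) : 0 < (max r ℛ)⁻¹ ∧ (max r ℛ)⁻¹ ≤ 1 / ℛ := by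
  have b1 : ℛ ≤ max r ℛ := le_max_right _ _
  refine ⟨inv_pos.2 (by linarith), ?_⟩
  rw [one_div]
  gcongr

theorem farField_v_bounds {μ : ℝ} (h0 : 0 ≤ μ) (h1 : μ ≤ 1) (x : FS) :
    -(1.1 * (max x.1 ℛ)⁻¹ ^ 2) ≤ (farField μ x).2.1 ∧
      (farField μ x).2.1 ≤ -(0.9 * (max x.1 ℛ)⁻¹ ^ 2) := by
  have b1 : ℛ ≤ max x.1 ℛ := le_max_right _ _
  obtain ⟨i0, i1⟩ := inv_max_pos x.1
  obtain ⟨f1, f2⟩ := fr_bounds h0 h1 x.2.2.1 (by linarith : 2000 ≤ max x.1 ℛ)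
  have g1 := abs_cl_le (by norm_num : (0 : ℝ) ≤ 1 / 2) x.2.2.2
  have g2 : cl (1 / 2) x.2.2.2 ^ 2 ≤ 1 := by
    rw [← sq_abs]; exact pow_le_one₀ (abs_nonneg _) (by linarith)
  have g3 := sq_nonneg (cl (1 / 2) x.2.2.2)
  change _ ≤ cl (1 / 2) x.2.2.2 ^ 2 * (max x.1 ℛ)⁻¹ ^ 3 + fr μ (max x.1 ℛ) x.2.2.1 ∧
    cl (1 / 2) x.2.2.2 ^ 2 * (max x.1 ℛ)⁻¹ ^ 3 + fr μ (max x.1 ℛ) x.2.2.1 ≤ _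
  generalize (max x.1 ℛ)⁻¹ = ρ at *
  generalize cl (1 / 2) x.2.2.2 ^ 2 = g at *
  have : ρ ^ 3 ≤ 0.01 * ρ ^ 2 := by
    rw [pow_succ, mul_comm]; gcongr; linarith
  have p3 : 0 < ρ ^ 3 := by positivity
  have p2 : 0 < ρ ^ 2 := by positivity
  constructor
  · nlinarith [mul_nonneg g3 p3.le]
  · nlinarith

theorem farField_bounded {μ : ℝ} (h0 : 0 ≤ μ) (h1 : μ ≤ 1) (x : FS) : ‖farField μ x‖ ≤ (10 : NNReal) := by
  have b1 : ℛ ≤ max x.1 ℛ := le_max_right _ _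
  obtain ⟨i0, i1⟩ := inv_max_pos x.1
  obtain ⟨v1, v2⟩ := farField_v_bounds h0 h1 x
  have ht := abs_tq_le h0 h1 x.2.2.1 (by linarith : 2000 ≤ max x.1 ℛ)
  have g1 := abs_cl_le (by norm_num : (0 : ℝ) ≤ 1 / 2) x.2.2.2
  have k2 : (max x.1 ℛ)⁻¹ ^ 2 ≤ 1 := pow_le_one₀ i0.le (by linarith)
  have k3 : (max x.1 ℛ)⁻¹ ^ 3 ≤ 1 := pow_le_one₀ i0.le (by linarith)
  have p2 : 0 < (max x.1 ℛ)⁻¹ ^ 2 := by positivity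
  have p3 : 0 < (max x.1 ℛ)⁻¹ ^ 3 := by positivity
  refine max_le ?_ (max_le ?_ (max_le ?_ ?_))
  · exact (abs_cl_le (by norm_num) _).trans (by norm_num)
  · rw [Real.norm_eq_abs, abs_le]
    constructor <;> push_cast <;> linarith
  · change |cl (1 / 2) x.2.2.2 * (max x.1 ℛ)⁻¹ ^ 2 - 1| ≤ (10 : ℝ)
    refine (abs_sub _ _).trans ?_
    rw [abs_mul, abs_of_pos p2, abs_one]
    nlinarith [abs_nonneg (cl (1 / 2) x.2.2.2)]
  · change |tq μ (max x.1 ℛ) x.2.2.1| ≤ (10 : ℝ)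
    nlinarith

theorem hasDerivAt_prod_iff {E F : Type*} [NormedAddCommGroup E] [NormedSpace ℝ E]
    [NormedAddCommGroup F] [NormedSpace ℝ F] {γ : ℝ → E × F} {d : E × F} {t : ℝ} :
    HasDerivAt γ d t ↔ HasDerivAt (fun s => (γ s).1) d.1 t ∧ HasDerivAt (fun s => (γ s).2) d.2 t :=
  ⟨fun h => ⟨(hasFDerivAt_fst (𝕜 := ℝ) (p := γ t)).comp_hasDerivAt t h,
    (hasFDerivAt_snd (𝕜 := ℝ) (p := γ t)).comp_hasDerivAt t h⟩, fun h => h.1.prodMk h.2⟩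

theorem hasDerivAt_FS {γ : ℝ → FS} {d : FS} {t : ℝ} : HasDerivAt γ d t ↔
    HasDerivAt (fun s => (γ s).1) d.1 t ∧ HasDerivAt (fun s => (γ s).2.1) d.2.1 t ∧
      HasDerivAt (fun s => (γ s).2.2.1) d.2.2.1 t ∧ HasDerivAt (fun s => (γ s).2.2.2) d.2.2.2 t := by
  simp only [hasDerivAt_prod_iff]

/-- The flow of the truncated far field. -/
noncomputable def Ω (μ : ℝ) : ℝ → FS → FS :=
  if h : 0 ≤ μ ∧ μ ≤ 1 then
    (exists_global_flow (farField_lipschitz h.1 h.2) (farField_bounded h.1 h.2)).choose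
  else fun _ x => x

/-- Velocity reversal combined with the reflection in the axis of the primaries. -/
def rev (x : FS) : FS := (x.1, -x.2.1, -x.2.2.1, x.2.2.2)

theorem iD_neg (c r φ : ℝ) : iD c r (-φ) = iD c r φ := by simp [iD]
theorem fr_neg (μ r φ : ℝ) : fr μ r (-φ) = fr μ r φ := by simp [fr, iD_neg]
theorem tq_neg (μ r φ : ℝ) : tq μ r (-φ) = -tq μ r φ := by simp [tq, iD_neg]
theorem pot_neg (μ r φ : ℝ) : pot μ r (-φ) = pot μ r φ := by simp [pot, iD_neg]

/-- Rotation of the angle by `a`. -/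
def rot (a : ℝ) (x : FS) : FS := (x.1, x.2.1, x.2.2.1 + a, x.2.2.2)

theorem farField_rot (μ : ℝ) (k : ℤ) (x : FS) : farField μ (rot (k * (2 * π)) x) = farField μ x := by
  have hc : cos (x.2.2.1 + k * (2 * π)) = cos x.2.2.1 := cos_add_int_mul_two_pi _ k
  have hs : sin (x.2.2.1 + k * (2 * π)) = sin x.2.2.1 := sin_add_int_mul_two_pi _ k
  simp only [farField, rot, fr, tq, iD, hc, hs]

section

variable {μ : ℝ} (h0 : 0 ≤ μ) (h1 : μ ≤ 1)
include h0 h1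

theorem Ω_spec : (∀ x, Ω μ 0 x = x) ∧
    (∀ x t, HasDerivAt (fun s => Ω μ s x) (farField μ (Ω μ t x)) t) ∧
      Continuous (fun p : ℝ × FS => Ω μ p.1 p.2) := by
  have h : 0 ≤ μ ∧ μ ≤ 1 := ⟨h0, h1⟩
  unfold Ω
  rw [dif_pos h]
  exact (exists_global_flow (farField_lipschitz h.1 h.2) (farField_bounded h.1 h.2)).choose_spec

theorem Ω_eq {γ : ℝ → FS} (hγ : ∀ t, HasDerivAt γ (farField μ (γ t)) t) (t : ℝ) :
    Ω μ t (γ 0) = γ t := by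
  obtain ⟨a, b, -⟩ := Ω_spec h0 h1
  exact congrFun (integralCurve_eq (farField_lipschitz h0 h1) (b (γ 0)) hγ (t₀ := 0) (a _)) t

theorem Ω_add (s t : ℝ) (x : FS) : Ω μ (s + t) x = Ω μ s (Ω μ t x) := by
  obtain ⟨a, b, -⟩ := Ω_spec h0 h1
  have := Ω_eq h0 h1 (γ := fun u => Ω μ (u + t) x) (fun u => (b x (u + t)).comp_add_const u t) s
  simpa using this.symm

theorem Ω_rev (t : ℝ) (x : FS) : Ω μ t (rev x) = rev (Ω μ (-t) x) := by
  obtain ⟨a, b, -⟩ := Ω_spec h0 h1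
  have := Ω_eq h0 h1 (γ := fun u => rev (Ω μ (-u) x)) (fun u => by
    have hd := (b x (-u)).scomp u (hasDerivAt_neg u)
    rw [hasDerivAt_FS] at hd ⊢
    obtain ⟨d1, d2, d3, d4⟩ := hd
    refine ⟨d1.congr_deriv ?_, d2.neg.congr_deriv ?_, d3.neg.congr_deriv ?_, d4.congr_deriv ?_⟩
    · simp [farField, rev, cl_neg]
    · simp [farField, rev, fr_neg]
    · simp [farField, rev]
    · simp [farField, rev, tq_neg]) t
  simpa [a] using this

theorem Ω_rot (t : ℝ) (k : ℤ) (x : FS) : Ω μ t (rot (k * (2 * π)) x) = rot (k * (2 * π)) (Ω μ t x) := by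
  obtain ⟨a, b, -⟩ := Ω_spec h0 h1
  have := Ω_eq h0 h1 (γ := fun u => rot (k * (2 * π)) (Ω μ u x)) (fun u => by
    have hd := b x u
    rw [farField_rot]
    rw [hasDerivAt_FS] at hd ⊢
    obtain ⟨d1, d2, d3, d4⟩ := hd
    exact ⟨d1, d2, d3.add_const _, d4⟩) t
  simpa [a] using this

end

end PCRTBP

namespace PCRTBP

open Set

/-! ### Dynamics in the far region -/

theorem le_of_hasDerivAt_nonneg {f f' : ℝ → ℝ} {a b : ℝ} (hab : a ≤ b)
    (hf : ∀ t ∈ Icc a b, HasDerivAt f (f' t) t) (h : ∀ t ∈ Icc a b, 0 ≤ f' t) : f a ≤ f b := by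
  have : MonotoneOn f (Icc a b) := by
    refine monotoneOn_of_deriv_nonneg (convex_Icc a b)
      (fun r hr => (hf r hr).continuousAt.continuousWithinAt) (fun r hr => ?_) (fun r hr => ?_)
    · exact (hf r (interior_subset hr)).differentiableAt.differentiableWithinAt
    · rw [(hf r (interior_subset hr)).deriv]; exact h r (interior_subset hr)
  exact this (left_mem_Icc.2 hab) (right_mem_Icc.2 hab) hab

theorem lt_of_hasDerivAt_pos {f f' : ℝ → ℝ} {a b : ℝ} (hab : a < b)
    (hf : ∀ t ∈ Icc a b, HasDerivAt f (f' t) t) (h : ∀ t ∈ Ioo a b, 0 < f' t) : f a < f b := by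
  have : StrictMonoOn f (Icc a b) := by
    refine strictMonoOn_of_deriv_pos (convex_Icc a b)
      (fun r hr => (hf r hr).continuousAt.continuousWithinAt) (fun r hr => ?_)
    rw [(hf r (interior_subset hr)).deriv]
    rw [interior_Icc] at hr
    exact h r hr
  exact this (left_mem_Icc.2 hab.le) (right_mem_Icc.2 hab.le) hab

/-- Initial conditions whose forward far orbit never turns around. -/
def Nset (μ : ℝ) : Set FS := {x | ∀ t, 0 ≤ t → 0 ≤ (Ω μ t x).2.1}

/-- Outgoing states on the section `r = ℛ`. -/
def Oset (c : ℝ) : Set FS := {x | x.1 = ℛ ∧ 0 < x.2.1 ∧ x.2.1 ≤ 1 / 1000 ∧ |x.2.2.2| ≤ c}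

/-- States at which no truncation is active. -/
def Good (x : FS) : Prop := ℛ ≤ x.1 ∧ |x.2.1| ≤ 1 ∧ |x.2.2.2| ≤ 1 / 2

theorem farField_good {μ : ℝ} {x : FS} (h : Good x) : farField μ x =
    (x.2.1, x.2.2.2 ^ 2 * x.1⁻¹ ^ 3 + fr μ x.1 x.2.2.1, x.2.2.2 * x.1⁻¹ ^ 2 - 1, tq μ x.1 x.2.2.1) := by
  simp only [farField, cl_eq h.2.1, cl_eq h.2.2, max_eq_left h.1]

/-- The Jacobi energy in polar coordinates. -/
noncomputable def Jb (μ : ℝ) (x : FS) : ℝ :=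
  x.2.1 ^ 2 / 2 + x.2.2.2 ^ 2 * x.1⁻¹ ^ 2 / 2 + pot μ x.1 x.2.2.1 - x.2.2.2

theorem cl_pos_iff {c v : ℝ} (hc : 0 < c) : 0 < cl c v ↔ 0 < v := by
  simp [cl, hc, not_lt.2 (neg_nonpos.2 hc.le)]

theorem cl_mono (c : ℝ) : Monotone (cl c) := fun _ _ h => max_le_max le_rfl (min_le_min le_rfl h)

theorem cl_neg_iff {c v : ℝ} (hc : 0 < c) : cl c v < 0 ↔ v < 0 := by
  simp [cl, hc, hc.not_gt]

section

variable {μ : ℝ} (h0 : 0 ≤ μ) (h1 : μ ≤ 1)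
include h0 h1

theorem Ω_zero (x : FS) : Ω μ 0 x = x := (Ω_spec h0 h1).1 x

theorem Ω_continuous : Continuous (fun p : ℝ × FS => Ω μ p.1 p.2) := (Ω_spec h0 h1).2.2

theorem Ω_continuous_left (x : FS) : Continuous (fun t => Ω μ t x) :=
  (Ω_continuous h0 h1).comp (Continuous.prodMk_left x)

theorem Ω_continuous_right (t : ℝ) : Continuous (fun x => Ω μ t x) :=
  (Ω_continuous h0 h1).comp (Continuous.prodMk_right t)

theorem Ω_deriv (x : FS) (t : ℝ) : HasDerivAt (fun s => (Ω μ s x).1) (cl 1 (Ω μ t x).2.1) t ∧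
    HasDerivAt (fun s => (Ω μ s x).2.1) (farField μ (Ω μ t x)).2.1 t ∧
    HasDerivAt (fun s => (Ω μ s x).2.2.1) (farField μ (Ω μ t x)).2.2.1 t ∧
    HasDerivAt (fun s => (Ω μ s x).2.2.2) (farField μ (Ω μ t x)).2.2.2 t :=
  hasDerivAt_FS.1 ((Ω_spec h0 h1).2.1 x t)

theorem Ω_v_strictAnti (x : FS) : StrictAnti fun t => (Ω μ t x).2.1 := by
  refine strictAnti_of_hasDerivAt_neg (fun t => (Ω_deriv h0 h1 x t).2.1) fun t => ?_
  have := (farField_v_bounds h0 h1 (Ω μ t x)).2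
  have hp := (inv_max_pos (Ω μ t x).1).1
  nlinarith [pow_pos hp 2]

theorem Ω_G_drift (x : FS) {s t : ℝ} (hst : s ≤ t) :
    |(Ω μ t x).2.2.2 - (Ω μ s x).2.2.2| ≤ μ / 10000000 * ((Ω μ s x).2.1 - (Ω μ t x).2.1) := by
  have key : ∀ u, |(farField μ (Ω μ u x)).2.2.2| ≤ -(μ / 10000000 * (farField μ (Ω μ u x)).2.1) := by
    intro u
    have b1 : ℛ ≤ max (Ω μ u x).1 ℛ := le_max_right _ _
    have hv := (farField_v_bounds h0 h1 (Ω μ u x)).2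
    obtain ⟨hp, hp'⟩ := inv_max_pos (Ω μ u x).1
    have ht := abs_tq_le h0 h1 (Ω μ u x).2.2.1 (by linarith : 2000 ≤ max (Ω μ u x).1 ℛ)
    change |tq μ (max (Ω μ u x).1 ℛ) (Ω μ u x).2.2.1| ≤ _
    refine ht.trans ?_
    have h3 : (max (Ω μ u x).1 ℛ)⁻¹ ^ 3 ≤ 1 / ℛ * (max (Ω μ u x).1 ℛ)⁻¹ ^ 2 := by
      rw [pow_succ, mul_comm]; gcongr
    nlinarith [mul_le_mul_of_nonneg_left h3 h0, mul_le_mul_of_nonneg_left hv h0, pow_pos hp 2,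
      mul_nonneg h0 (pow_pos hp 2).le]
  have u := le_of_hasDerivAt_nonneg hst (fun u _ => ((Ω_deriv h0 h1 x u).2.2.2.add
    ((Ω_deriv h0 h1 x u).2.1.const_mul (μ / 10000000))).neg)
    (fun u _ => by linarith [(abs_le.1 (key u)).2])
  have l := le_of_hasDerivAt_nonneg hst (fun u _ => ((Ω_deriv h0 h1 x u).2.2.2.sub
    ((Ω_deriv h0 h1 x u).2.1.const_mul (μ / 10000000))))
    (fun u _ => by linarith [(abs_le.1 (key u)).1])
  simp only [Pi.neg_apply, Pi.sub_apply, Pi.add_apply] at u l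
  rw [abs_le]
  constructor <;> linarith

theorem Nset_isClosed : IsClosed (Nset μ) := by
  simp only [Nset, ofPred_forall]
  refine isClosed_iInter fun t => isClosed_iInter fun _ => isClosed_le continuous_const ?_
  exact (continuous_fst.comp continuous_snd).comp (Ω_continuous_right h0 h1 t)

theorem Nset_v_pos {x : FS} (hx : x ∈ Nset μ) {t : ℝ} (ht : 0 ≤ t) : 0 < (Ω μ t x).2.1 :=
  (hx (t + 1) (by linarith)).trans_lt (Ω_v_strictAnti h0 h1 x (lt_add_one t))

theorem Nset_r_gt {x : FS} (hx : x ∈ Nset μ) {t : ℝ} (ht : 0 < t) : x.1 < (Ω μ t x).1 := by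
  have := lt_of_hasDerivAt_pos ht (fun u _ => (Ω_deriv h0 h1 x u).1)
    (fun u hu => (cl_pos_iff one_pos).2 (Nset_v_pos h0 h1 hx hu.1.le))
  rwa [Ω_zero h0 h1] at this

theorem Nset_forward {x : FS} (hx : x ∈ Nset μ) {t : ℝ} (ht : 0 ≤ t) : Ω μ t x ∈ Nset μ := by
  intro s hs
  rw [← Ω_add h0 h1]
  exact hx _ (by linarith)

theorem exists_return {c : ℝ} {x : FS} (hx : x ∈ Oset c) (hN : x ∉ Nset μ) :
    ∃ T, 0 < T ∧ (Ω μ T x).1 = ℛ ∧ (∀ s ∈ Ioo 0 T, ℛ < (Ω μ s x).1) ∧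
      (∀ s, T < s → (Ω μ s x).1 < ℛ) ∧ (Ω μ T x).2.1 < 0 := by
  have hv := Ω_v_strictAnti h0 h1 x
  have hd := fun u => (Ω_deriv h0 h1 x u).1
  have hc : Continuous fun t => (Ω μ t x).1 := continuous_fst.comp (Ω_continuous_left h0 h1 x)
  have hcv : Continuous fun t => (Ω μ t x).2.1 :=
    (continuous_fst.comp continuous_snd).comp (Ω_continuous_left h0 h1 x)
  obtain ⟨t₁, ht₁, hvt₁⟩ : ∃ t, 0 ≤ t ∧ (Ω μ t x).2.1 < 0 := by
    simpa [Nset, not_forall, not_le] using hN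
  have hv0 : (Ω μ 0 x).2.1 = x.2.1 := by rw [Ω_zero h0 h1]
  have hr0 : (Ω μ 0 x).1 = ℛ := by rw [Ω_zero h0 h1]; exact hx.1
  obtain ⟨z, hz, hvz⟩ : ∃ z ∈ Icc 0 t₁, (Ω μ z x).2.1 = 0 :=
    intermediate_value_Icc' ht₁ hcv.continuousOn ⟨hvt₁.le, by simpa [hv0] using hx.2.1.le⟩
  have hz0 : 0 < z := by
    rcases hz.1.eq_or_lt with h | h
    · rw [← h, hv0] at hvz; exact absurd hvz hx.2.1.ne'
    · exact h
  have up : ∀ a b, 0 ≤ a → a < b → b ≤ z → (Ω μ a x).1 < (Ω μ b x).1 := fun a b ha hab hb =>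
    lt_of_hasDerivAt_pos hab (fun u _ => hd u) fun u hu => (cl_pos_iff one_pos).2 <| by
      have := hv (hu.2.trans_le hb); simp only [hvz] at this; exact this
  have down : ∀ a b, z ≤ a → a < b → (Ω μ b x).1 < (Ω μ a x).1 := fun a b ha hab => by
    have := lt_of_hasDerivAt_pos hab (fun u _ => (hd u).neg) fun u hu => neg_pos.2 <|
      (cl_neg_iff one_pos).2 <| by
        have := hv (ha.trans_lt hu.1); simp only [hvz] at this; exact this
    simpa using this
  have hneg : cl 1 (Ω μ (z + 1) x).2.1 < 0 := (cl_neg_iff one_pos).2 <| by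
    have := hv (lt_add_one z); simp only [hvz] at this; exact this
  set κ := -cl 1 (Ω μ (z + 1) x).2.1 with hκ
  have hκ0 : 0 < κ := by linarith
  obtain ⟨t₂, ht₂, hrt₂⟩ : ∃ t, z + 1 ≤ t ∧ (Ω μ t x).1 ≤ ℛ := by
    set d := |(Ω μ (z + 1) x).1 - ℛ| / κ with hdd
    have hd0 : 0 ≤ d := by positivity
    refine ⟨z + 1 + d, by linarith, ?_⟩
    have := le_of_hasDerivAt_nonneg (f := fun u => -(Ω μ u x).1 - κ * u) (by linarith : z + 1 ≤ z + 1 + d)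
      (fun u _ => (hd u).neg.sub ((hasDerivAt_id u).const_mul κ)) fun u hu => by
        have := cl_mono 1 (hv.antitone hu.1)
        linarith
    have h3 : κ * d = |(Ω μ (z + 1) x).1 - ℛ| := by rw [hdd]; field_simp
    have h4 := le_abs_self ((Ω μ (z + 1) x).1 - ℛ)
    nlinarith
  obtain ⟨T, hT, hrT⟩ : ∃ T ∈ Icc z t₂, (Ω μ T x).1 = ℛ :=
    intermediate_value_Icc' (by linarith) hc.continuousOn
      ⟨hrt₂, by rw [← hr0]; exact (up 0 z le_rfl hz0 le_rfl).le⟩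
  have hzT : z < T := by
    rcases hT.1.eq_or_lt with h | h
    · have := up 0 z le_rfl hz0 le_rfl
      rw [h, hrT, hr0] at this; exact absurd this (lt_irrefl _)
    · exact h
  refine ⟨T, by linarith, hrT, fun s hs => ?_, fun s hs => ?_, ?_⟩
  · rcases le_total s z with h | h
    · rw [← hr0]; exact up 0 s le_rfl hs.1 h
    · rw [← hrT]; exact down s T h hs.2
  · rw [← hrT]; exact down T s hzT.le hs
  · have := hv hzT; simp only [hvz] at this; exact this

end

open Classical in
/-- Return time to the section `r = ℛ`. -/
noncomputable def ret (μ : ℝ) (x : FS) : ℝ :=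
  if h : ∃ T, 0 < T ∧ (Ω μ T x).1 = ℛ ∧ (∀ s ∈ Ioo 0 T, ℛ < (Ω μ s x).1) ∧
      (∀ s, T < s → (Ω μ s x).1 < ℛ) ∧ (Ω μ T x).2.1 < 0 then h.choose else 0

/-- The returning state, with reversed time. -/
noncomputable def hat (μ : ℝ) (x : FS) : FS := rev (Ω μ (ret μ x) x)

theorem rev_rev (x : FS) : rev (rev x) = x := by simp [rev]

theorem continuous_rev : Continuous rev := by unfold rev; fun_prop

theorem Jb_rev (μ : ℝ) (x : FS) : Jb μ (rev x) = Jb μ x := by simp [Jb, rev, pot_neg]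

theorem Jb_rot (μ : ℝ) (k : ℤ) (x : FS) : Jb μ (rot (k * (2 * π)) x) = Jb μ x := by
  have hc : cos (x.2.2.1 + k * (2 * π)) = cos x.2.2.1 := cos_add_int_mul_two_pi _ k
  simp [Jb, rot, pot, iD, hc]

section

variable {μ : ℝ} (h0 : 0 ≤ μ) (h1 : μ ≤ 1)
include h0 h1

theorem ret_spec {c : ℝ} {x : FS} (hx : x ∈ Oset c) (hN : x ∉ Nset μ) :
    0 < ret μ x ∧ (Ω μ (ret μ x) x).1 = ℛ ∧ (∀ s ∈ Ioo 0 (ret μ x), ℛ < (Ω μ s x).1) ∧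
      (∀ s, ret μ x < s → (Ω μ s x).1 < ℛ) ∧ (Ω μ (ret μ x) x).2.1 < 0 := by
  have h := exists_return h0 h1 hx hN
  unfold ret
  rw [dif_pos h]
  exact h.choose_spec

theorem lt_ret {c : ℝ} {x : FS} (hx : x ∈ Oset c) (hN : x ∉ Nset μ) {s : ℝ} (h : ℛ < (Ω μ s x).1) :
    s < ret μ x := by
  obtain ⟨-, a, -, b, -⟩ := ret_spec h0 h1 hx hN
  by_contra hs
  rcases (not_lt.1 hs).eq_or_lt with e | e
  · rw [← e, a] at h; exact lt_irrefl _ h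
  · exact lt_asymm h (b s e)

theorem ret_lt {c : ℝ} {x : FS} (hx : x ∈ Oset c) (hN : x ∉ Nset μ) {s : ℝ} (hs0 : 0 < s)
    (h : (Ω μ s x).1 < ℛ) : ret μ x < s := by
  obtain ⟨-, a, b, -, -⟩ := ret_spec h0 h1 hx hN
  by_contra hs
  rcases (not_lt.1 hs).eq_or_lt with e | e
  · rw [e, a] at h; exact lt_irrefl _ h
  · exact lt_asymm h (b s ⟨hs0, e⟩)

theorem ret_eq {c : ℝ} {x : FS} (hx : x ∈ Oset c) (hN : x ∉ Nset μ) {s : ℝ} (hs0 : 0 < s)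
    (h : (Ω μ s x).1 = ℛ) : ret μ x = s := by
  obtain ⟨-, -, b, d, -⟩ := ret_spec h0 h1 hx hN
  rcases lt_trichotomy s (ret μ x) with e | e | e
  · exact absurd h (b s ⟨hs0, e⟩).ne'
  · exact e.symm
  · exact absurd h (d s e).ne

theorem ret_continuousOn (c : ℝ) : ContinuousOn (ret μ) (Oset c \ Nset μ) := by
  intro x hx
  obtain ⟨t0, a, b, d, -⟩ := ret_spec h0 h1 hx.1 hx.2
  have hcont : ∀ s, Continuous fun y => (Ω μ s y).1 := fun s =>
    continuous_fst.comp (Ω_continuous_right h0 h1 s)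
  refine tendsto_order.2 ⟨fun s hs => ?_, fun s hs => ?_⟩
  · set s' := max s (ret μ x / 2)
    have hs' : ℛ < (Ω μ s' x).1 := b s' ⟨lt_max_of_lt_right (by linarith), max_lt hs (by linarith)⟩
    filter_upwards [nhdsWithin_le_nhds ((hcont s').continuousAt.eventually_const_lt hs'),
      self_mem_nhdsWithin] with y hy hyO
    exact (le_max_left _ _).trans_lt (lt_ret h0 h1 hyO.1 hyO.2 hy)
  · filter_upwards [nhdsWithin_le_nhds ((hcont s).continuousAt.eventually_lt_const (d s hs)),
      self_mem_nhdsWithin] with y hy hyO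
    exact ret_lt h0 h1 hyO.1 hyO.2 (by linarith) hy

theorem ret_tendsto {c : ℝ} {x : FS} (hx : x ∈ Oset c) (hN : x ∈ Nset μ) :
    Tendsto (ret μ) (𝓝[Oset c \ Nset μ] x) atTop := by
  refine tendsto_atTop.2 fun T => ?_
  have hcont : ∀ s, Continuous fun y => (Ω μ s y).1 := fun s =>
    continuous_fst.comp (Ω_continuous_right h0 h1 s)
  have := Nset_r_gt h0 h1 hN (lt_max_of_lt_right one_pos : 0 < max T 1)
  rw [hx.1] at this
  filter_upwards [nhdsWithin_le_nhds ((hcont (max T 1)).continuousAt.eventually_const_lt this),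
      self_mem_nhdsWithin] with y hy hyO
  exact ((le_max_left _ _).trans_lt (lt_ret h0 h1 hyO.1 hyO.2 hy)).le

end

end PCRTBP

namespace PCRTBP

open Set

section

variable {μ : ℝ} (h0 : 0 ≤ μ) (h1 : μ ≤ 1)
include h0 h1

theorem Ω_continuous_v (x : FS) : Continuous fun t => (Ω μ t x).2.1 :=
  (continuous_fst.comp continuous_snd).comp (Ω_continuous_left h0 h1 x)

theorem hasDerivAt_energy (k : ℝ) (x : FS) {t : ℝ} (hr : ℛ ≤ (Ω μ t x).1) (hv : |(Ω μ t x).2.1| ≤ 1) :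
    HasDerivAt (fun s => (Ω μ s x).2.1 ^ 2 / 2 - k * (Ω μ s x).1⁻¹)
      ((Ω μ t x).2.1 * ((farField μ (Ω μ t x)).2.1 + k * (Ω μ t x).1⁻¹ ^ 2)) t := by
  obtain ⟨a, b, -⟩ := Ω_deriv h0 h1 x t
  rw [cl_eq hv] at a
  have hr0 : (Ω μ t x).1 ≠ 0 := by linarith
  refine (((b.pow 2).div_const 2).sub ((a.inv hr0).const_mul k)).congr_deriv ?_
  field_simp
  ring

theorem Ω_v_bounds {x : FS} (hr : ℛ ≤ x.1) :
    -(1.1 * x.1⁻¹ ^ 2) ≤ (farField μ x).2.1 ∧ (farField μ x).2.1 ≤ -(0.9 * x.1⁻¹ ^ 2) := by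
  have := farField_v_bounds h0 h1 x
  rwa [max_eq_left hr] at this

theorem descent_speed {x : FS} {z T : ℝ} (hzT : z ≤ T) (hz : (Ω μ z x).2.1 = 0)
    (hr : ∀ s ∈ Icc z T, ℛ ≤ (Ω μ s x).1) : -(1 / 4000) ≤ (Ω μ T x).2.1 := by
  have hv := (Ω_v_strictAnti h0 h1 x).antitone
  have key : ∀ s ∈ Icc z T, -1 ≤ (Ω μ s x).2.1 → -(1 / 4000) ≤ (Ω μ s x).2.1 := by
    intro s hs h
    have := le_of_hasDerivAt_nonneg hs.1 (fun u hu => (hasDerivAt_energy h0 h1 1.1 x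
        (hr u ⟨hu.1, hu.2.trans hs.2⟩) (abs_le.2 ⟨h.trans (hv hu.2), by
          have := hv hu.1; simp only [hz] at this; linarith⟩)).neg) fun u hu => by
      have b := (Ω_v_bounds h0 h1 (hr u ⟨hu.1, hu.2.trans hs.2⟩)).1
      have := hv hu.1
      simp only [hz] at this
      nlinarith
    simp only [Pi.neg_apply, hz] at this
    have i1 : 0 < (Ω μ z x).1⁻¹ := inv_pos.2 (by linarith [hr z ⟨le_rfl, hzT⟩])
    have i2 : (Ω μ s x).1⁻¹ ≤ 1 / ℛ := by
      rw [one_div]; exact inv_anti₀ (by norm_num) (hr s hs)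
    norm_num at i2 this
    nlinarith
  by_contra hc
  have hT : (Ω μ T x).2.1 < -1 := by
    by_contra h
    exact hc (key T ⟨hzT, le_rfl⟩ (not_lt.1 h))
  obtain ⟨s, hs, hs'⟩ := intermediate_value_Icc' hzT (Ω_continuous_v h0 h1 x).continuousOn
    ⟨hT.le, by rw [hz]; norm_num⟩
  have := key s hs hs'.ge
  simp only [] at hs'
  linarith

theorem Ω_G_close {x : FS} {t : ℝ} (ht : 0 ≤ t) (hv0 : x.2.1 ≤ 1 / 1000)
    (hv : -(1 / 4000) ≤ (Ω μ t x).2.1) : |(Ω μ t x).2.2.2 - x.2.2.2| ≤ 1 / 1000000000 := by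
  have := Ω_G_drift h0 h1 x ht
  rw [Ω_zero h0 h1] at this
  refine this.trans ?_
  nlinarith

theorem ret_v_ge {c : ℝ} {x : FS} (hx : x ∈ Oset c) (hN : x ∉ Nset μ) :
    -(1 / 4000) ≤ (Ω μ (ret μ x) x).2.1 := by
  obtain ⟨a, b, d, -, e⟩ := ret_spec h0 h1 hx hN
  obtain ⟨z, hz, hvz⟩ : ∃ z ∈ Icc 0 (ret μ x), (Ω μ z x).2.1 = 0 :=
    intermediate_value_Icc' a.le (Ω_continuous_v h0 h1 x).continuousOn
      ⟨e.le, by rw [Ω_zero h0 h1]; exact hx.2.1.le⟩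
  have hz0 : 0 < z := by
    rcases hz.1.eq_or_lt with h | h
    · rw [← h, Ω_zero h0 h1] at hvz; exact absurd hvz hx.2.1.ne'
    · exact h
  refine descent_speed h0 h1 hz.2 hvz fun s hs => ?_
  rcases hs.2.eq_or_lt with h | h
  · rw [h, b]
  · exact (d s ⟨by linarith [hs.1], h⟩).le

theorem ret_good {c : ℝ} (hc : c ≤ 1 / 4) {x : FS} (hx : x ∈ Oset c) (hN : x ∉ Nset μ) {t : ℝ}
    (ht : t ∈ Icc 0 (ret μ x)) : Good (Ω μ t x) := by
  obtain ⟨a, b, d, -, e⟩ := ret_spec h0 h1 hx hN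
  have hv := (Ω_v_strictAnti h0 h1 x).antitone
  have v1 := hv ht.1
  have v2 := hv ht.2
  simp only [Ω_zero h0 h1] at v1 v2
  have v3 := ret_v_ge h0 h1 hx hN
  have v4 := hx.2.2.1
  have g := abs_le.1 (Ω_G_close h0 h1 ht.1 hx.2.2.1 (by linarith))
  have g2 := abs_le.1 hx.2.2.2
  refine ⟨?_, abs_le.2 ⟨by linarith, by linarith⟩, abs_le.2 ⟨by linarith, by linarith⟩⟩
  rcases ht.2.eq_or_lt with h | h
  · rw [h, b]
  rcases ht.1.eq_or_lt with h' | h'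
  · rw [← h', Ω_zero h0 h1, hx.1]
  exact (d t ⟨h', h⟩).le

theorem Nset_good {c : ℝ} (hc : c ≤ 1 / 4) {x : FS} (hx : x ∈ Oset c) (hN : x ∈ Nset μ) {t : ℝ}
    (ht : 0 ≤ t) : Good (Ω μ t x) := by
  have v1 := (Ω_v_strictAnti h0 h1 x).antitone ht
  simp only [Ω_zero h0 h1] at v1
  have v3 := hN t ht
  have v4 := hx.2.2.1
  have g := abs_le.1 (Ω_G_close h0 h1 ht hx.2.2.1 (by linarith))
  have g2 := abs_le.1 hx.2.2.2
  refine ⟨?_, abs_le.2 ⟨by linarith, by linarith⟩, abs_le.2 ⟨by linarith, by linarith⟩⟩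
  rcases ht.eq_or_lt with h' | h'
  · rw [← h', Ω_zero h0 h1, hx.1]
  have := Nset_r_gt h0 h1 hN h'
  rw [hx.1] at this
  exact this.le

theorem hasDerivAt_Jb {x : FS} {t : ℝ} (h : Good (Ω μ t x)) :
    HasDerivAt (fun s => Jb μ (Ω μ s x)) 0 t := by
  obtain ⟨a, b, d, e⟩ := Ω_deriv h0 h1 x t
  rw [farField_good h] at b d e
  rw [cl_eq h.2.1] at a
  have hr0 : (Ω μ t x).1 ≠ 0 := by linarith [h.1]
  have hp := hasDerivAt_pot h0 h1 (by linarith [h.1]) a d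
  refine (((((b.pow 2).div_const 2).add ((((e.pow 2).mul ((a.inv hr0).pow 2))).div_const 2)).add
    hp).sub e).congr_deriv ?_
  simp only [Pi.pow_apply, Pi.inv_apply]
  field_simp
  ring_nf
  field_simp
  ring

theorem Jb_eq {x : FS} {t : ℝ} (ht : 0 ≤ t) (h : ∀ s ∈ Icc 0 t, Good (Ω μ s x)) :
    Jb μ (Ω μ t x) = Jb μ x := by
  have a := le_of_hasDerivAt_nonneg ht (fun s hs => hasDerivAt_Jb h0 h1 (h s hs)) fun _ _ => le_rfl
  have b := le_of_hasDerivAt_nonneg ht (fun s hs => (hasDerivAt_Jb h0 h1 (h s hs)).neg)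
    fun _ _ => by simp
  simp only [Ω_zero h0 h1, Pi.neg_apply] at a b
  linarith

theorem Ω_hat {x : FS} (t : ℝ) : Ω μ t (hat μ x) = rev (Ω μ (ret μ x - t) x) := by
  rw [hat, Ω_rev h0 h1, ← Ω_add h0 h1]
  congr 2
  ring

theorem hat_mem_Oset {c : ℝ} {x : FS} (hx : x ∈ Oset c) (hN : x ∉ Nset μ) :
    hat μ x ∈ Oset (c + 1 / 1000000000) ∧ |(hat μ x).2.2.2 - x.2.2.2| ≤ 1 / 1000000000 := by
  obtain ⟨a, b, d, -, e⟩ := ret_spec h0 h1 hx hN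
  have v3 := ret_v_ge h0 h1 hx hN
  have g := Ω_G_close h0 h1 a.le hx.2.2.1 v3
  have g1 := abs_le.1 g
  have g2 := abs_le.1 hx.2.2.2
  refine ⟨⟨b, ?_, ?_, ?_⟩, g⟩
  · simp only [hat, rev]; linarith
  · simp only [hat, rev]; linarith
  · simp only [hat, rev]; exact abs_le.2 ⟨by linarith, by linarith⟩

theorem hat_not_mem_Nset {c : ℝ} {x : FS} (hx : x ∈ Oset c) (hN : x ∉ Nset μ) :
    hat μ x ∉ Nset μ := by
  intro h
  have := h _ (ret_spec h0 h1 hx hN).1.le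
  rw [Ω_hat h0 h1, sub_self, Ω_zero h0 h1] at this
  simp only [rev] at this
  linarith [hx.2.1]

theorem ret_hat {c : ℝ} {x : FS} (hx : x ∈ Oset c) (hN : x ∉ Nset μ) :
    ret μ (hat μ x) = ret μ x := by
  refine ret_eq h0 h1 (hat_mem_Oset h0 h1 hx hN).1 (hat_not_mem_Nset h0 h1 hx hN)
    (ret_spec h0 h1 hx hN).1 ?_
  rw [Ω_hat h0 h1, sub_self, Ω_zero h0 h1]
  exact hx.1

theorem hat_continuousOn (c : ℝ) : ContinuousOn (hat μ) (Oset c \ Nset μ) :=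
  continuous_rev.comp_continuousOn ((Ω_continuous h0 h1).comp_continuousOn
    ((ret_continuousOn h0 h1 c).prodMk continuousOn_id))

theorem Jb_hat {c : ℝ} (hc : c ≤ 1 / 4) {x : FS} (hx : x ∈ Oset c) (hN : x ∉ Nset μ) :
    Jb μ (hat μ x) = Jb μ x := by
  rw [hat, Jb_rev]
  exact Jb_eq h0 h1 (ret_spec h0 h1 hx hN).1.le fun s hs => ret_good h0 h1 hc hx hN hs

theorem hat_angle_ge {c : ℝ} {x : FS} (hx : x ∈ Oset c) (hN : x ∉ Nset μ) :
    ret μ x / 2 - x.2.2.1 ≤ (hat μ x).2.2.1 := by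
  have := le_of_hasDerivAt_nonneg (ret_spec h0 h1 hx hN).1.le (fun s _ =>
    (Ω_deriv h0 h1 x s).2.2.1.neg.sub ((hasDerivAt_id s).const_mul (1 / 2))) fun s _ => by
      have hG := abs_le.1 (abs_cl_le (by norm_num : (0 : ℝ) ≤ 1 / 2) (Ω μ s x).2.2.2)
      obtain ⟨i0, i1⟩ := inv_max_pos (Ω μ s x).1
      have : (max (Ω μ s x).1 ℛ)⁻¹ ^ 2 ≤ 1 := pow_le_one₀ i0.le (by linarith)
      simp only [farField]
      nlinarith [pow_pos i0 2]
  simp only [Pi.sub_apply, Pi.neg_apply, Ω_zero h0 h1, id] at this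
  simp only [hat, rev]
  linarith

theorem one_le_sq_mul_of_mem_Nset {x : FS} (hN : x ∈ Nset μ) (hr : ℛ ≤ x.1) (hv : x.2.1 ≤ 1) :
    1 ≤ x.2.1 ^ 2 * x.1 := by
  by_contra! hc
  have hva := (Ω_v_strictAnti h0 h1 x).antitone
  have hrt : ∀ t, 0 ≤ t → x.1 ≤ (Ω μ t x).1 := fun t ht => by
    rcases ht.eq_or_lt with h | h
    · rw [← h, Ω_zero h0 h1]
    · exact (Nset_r_gt h0 h1 hN h).le
  have hv1 : ∀ t, 0 ≤ t → |(Ω μ t x).2.1| ≤ 1 := fun t ht => by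
    have := hva ht
    simp only [Ω_zero h0 h1] at this
    exact abs_le.2 ⟨by linarith [hN t ht], by linarith⟩
  have hx0 : 0 < x.1 := by linarith
  have hi : 0 < x.1⁻¹ := inv_pos.2 hx0
  have bound : ∀ t, 0 ≤ t → (4 / 9) * x.1⁻¹ ≤ (Ω μ t x).1⁻¹ := by
    intro t ht
    have := le_of_hasDerivAt_nonneg ht (fun u hu => (hasDerivAt_energy h0 h1 0.9 x
        (hr.trans (hrt u hu.1)) (hv1 u hu.1)).neg) fun u hu => by
      have b := (Ω_v_bounds h0 h1 (hr.trans (hrt u hu.1))).2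
      have := hN u hu.1
      nlinarith
    simp only [Pi.neg_apply, Ω_zero h0 h1] at this
    have h2 : x.2.1 ^ 2 ≤ x.1⁻¹ := by
      rw [← one_div, le_div_iff₀ hx0]; exact hc.le
    nlinarith [sq_nonneg (Ω μ t x).2.1]
  set κ := 0.9 * ((4 / 9) * x.1⁻¹) ^ 2 with hκ
  have hκ0 : 0 < κ := by positivity
  have := le_of_hasDerivAt_nonneg (by positivity : 0 ≤ 2 / κ) (fun u _ =>
    ((Ω_deriv h0 h1 x u).2.1.neg.sub ((hasDerivAt_id u).const_mul κ))) fun u hu => by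
      have b := (Ω_v_bounds h0 h1 (hr.trans (hrt u hu.1))).2
      have : ((4 / 9) * x.1⁻¹) ^ 2 ≤ (Ω μ u x).1⁻¹ ^ 2 := by gcongr; exact bound u hu.1
      linarith
  simp only [Pi.sub_apply, Pi.neg_apply, Ω_zero h0 h1, id] at this
  have e : κ * (2 / κ) = 2 := by field_simp
  have := hN (2 / κ) (by positivity)
  linarith

theorem mem_Nset_of_energy {x : FS} (hr : ℛ ≤ x.1) (hv : x.2.1 ≤ 1) (hv0 : 0 ≤ x.2.1)
    (h : 1.1 * x.1⁻¹ < x.2.1 ^ 2 / 2) : x ∈ Nset μ := by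
  by_contra hN
  obtain ⟨t₁, ht₁, hvt₁⟩ : ∃ t, 0 ≤ t ∧ (Ω μ t x).2.1 < 0 := by
    simpa [Nset, not_forall, not_le] using hN
  have hva := (Ω_v_strictAnti h0 h1 x).antitone
  obtain ⟨z, hz, hvz⟩ : ∃ z ∈ Icc 0 t₁, (Ω μ z x).2.1 = 0 :=
    intermediate_value_Icc' ht₁ (Ω_continuous_v h0 h1 x).continuousOn
      ⟨hvt₁.le, by rw [Ω_zero h0 h1]; exact hv0⟩
  have hv' : ∀ u ∈ Icc 0 z, 0 ≤ (Ω μ u x).2.1 ∧ (Ω μ u x).2.1 ≤ 1 := fun u hu => by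
    have a := hva hu.1
    have b := hva hu.2
    simp only [Ω_zero h0 h1, hvz] at a b
    exact ⟨b, a.trans hv⟩
  have hr' : ∀ u ∈ Icc 0 z, x.1 ≤ (Ω μ u x).1 := fun u hu => by
    have := le_of_hasDerivAt_nonneg hu.1 (fun s _ => (Ω_deriv h0 h1 x s).1) fun s hs => by
      have hs' : s ∈ Icc 0 z := ⟨hs.1, hs.2.trans hu.2⟩
      rw [cl_eq (abs_le.2 ⟨by linarith [(hv' s hs').1], (hv' s hs').2⟩)]
      exact (hv' s hs').1
    rwa [Ω_zero h0 h1] at this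
  have := le_of_hasDerivAt_nonneg hz.1 (fun u hu => hasDerivAt_energy h0 h1 1.1 x
    (hr.trans (hr' u hu)) (abs_le.2 ⟨by linarith [(hv' u hu).1], (hv' u hu).2⟩)) fun u hu =>
      mul_nonneg (hv' u hu).1 (by linarith [(Ω_v_bounds h0 h1 (hr.trans (hr' u hu))).1])
  simp only [Ω_zero h0 h1, hvz] at this
  have hi : 0 < (Ω μ z x).1⁻¹ := inv_pos.2 (by linarith [hr' z ⟨hz.1, le_rfl⟩])
  linarith

theorem mem_interior_Nset {x : FS} {T : ℝ} (hr : ℛ < (Ω μ T x).1)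
    (hv : (Ω μ T x).2.1 < 1) (hv0 : 0 < (Ω μ T x).2.1)
    (h : 1.1 * (Ω μ T x).1⁻¹ < (Ω μ T x).2.1 ^ 2 / 2) : x ∈ interior (Nset μ) := by
  rw [mem_interior_iff_mem_nhds]
  have c1 : Continuous fun y => (Ω μ T y).1 := continuous_fst.comp (Ω_continuous_right h0 h1 T)
  have c2 : Continuous fun y => (Ω μ T y).2.1 :=
    (continuous_fst.comp continuous_snd).comp (Ω_continuous_right h0 h1 T)
  have c3 : ContinuousAt (fun y => (Ω μ T y).2.1 ^ 2 / 2 - 1.1 * (Ω μ T y).1⁻¹) x :=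
    ((c2.pow 2).div_const 2).continuousAt.sub
      ((c1.continuousAt.inv₀ (by linarith)).const_mul 1.1)
  filter_upwards [c1.continuousAt.eventually_const_lt hr, c2.continuousAt.eventually_lt_const hv,
    c2.continuousAt.eventually_const_lt hv0, c3.eventually_const_lt (sub_pos.2 h)] with y a b c d
  have hy : Ω μ T y ∈ Nset μ := mem_Nset_of_energy h0 h1 a.le b.le c.le (sub_pos.1 d)
  intro t ht
  rcases le_total t T with h' | h'
  · exact c.le.trans ((Ω_v_strictAnti h0 h1 y).antitone h')
  · have := hy (t - T) (by linarith)
    rwa [← Ω_add h0 h1, sub_add_cancel] at this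

end

end PCRTBP

namespace PCRTBP

open Set

section

variable {μ : ℝ} (h0 : 0 ≤ μ) (h1 : μ ≤ 1 / 1000000)
include h0 h1

set_option maxHeartbeats 1000000 in
theorem energy_comparison {x y : FS} (hr : ℛ ≤ x.1) (hxy : x.1 ≤ y.1)
    (hGx : |x.2.2.2| ≤ 3 / 50) (hGy : |y.2.2.2| ≤ 3 / 50) (hG : x.2.2.2 < y.2.2.2) {K : ℝ}
    (hK : K * x.1⁻¹ ≤ 1 / 1000) (hφ : μ * |y.2.2.1 - x.2.2.1| ≤ K * (y.2.2.2 - x.2.2.2))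
    (hJ : Jb μ y = Jb μ x) :
    0.9 * ((y.2.1 ^ 2 - x.2.1 ^ 2) / 2 + 0.8 * (x.1⁻¹ - y.1⁻¹)) ≤ y.2.2.2 - x.2.2.2 ∧
      y.2.2.2 - x.2.2.2 ≤ 1.1 * ((y.2.1 ^ 2 - x.2.1 ^ 2) / 2 + 1.2 * (x.1⁻¹ - y.1⁻¹)) := by
  have hr' : ℛ ≤ y.1 := hr.trans hxy
  have p1 := pot_sub_radius_bounds h0 (by linarith) (by linarith : 2000 ≤ x.1) hxy x.2.2.1
  have p2 := abs_pot_sub_angle_le h0 (by linarith) (by linarith : 2000 ≤ y.1) x.2.2.1 y.2.2.1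
  unfold Jb at hJ
  obtain ⟨r, v, φ, G⟩ := x
  obtain ⟨r', v', φ', G'⟩ := y
  simp only at *
  have hr0 : 0 < r := by linarith
  set a := r⁻¹ with ha
  set b := r'⁻¹ with hb
  have ha0 : 0 < a := inv_pos.2 hr0
  have hb0 : 0 < b := inv_pos.2 (by linarith)
  have hba : b ≤ a := inv_anti₀ hr0 hxy
  have ha1 : a ≤ 1 / ℛ := by rw [ha, one_div]; exact inv_anti₀ (by norm_num) hr
  have a1 : a ≤ 1 / 1000000 := by norm_num at ha1 ⊢; linarith
  have p3 : |pot μ r' φ' - pot μ r' φ| ≤ 1 / 100 * (G' - G) := by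
    refine p2.trans ?_
    have h3 : b ^ 3 ≤ a ^ 3 := by gcongr
    have : 4 * μ * b ^ 3 * |φ' - φ| = 4 * b ^ 3 * (μ * |φ' - φ|) := by ring
    rw [this]
    calc 4 * b ^ 3 * (μ * |φ' - φ|) ≤ 4 * b ^ 3 * (K * (G' - G)) := by gcongr
      _ ≤ 4 * b ^ 2 * (b * (K * (G' - G))) := by linarith
      _ ≤ 4 * 1 * (a * (K * (G' - G))) := by
          have : b ^ 2 ≤ 1 := pow_le_one₀ hb0.le (by linarith)
          have : 0 ≤ K * (G' - G) := le_trans (by positivity) hφ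
          gcongr
      _ = 4 * (K * a) * (G' - G) := by ring
      _ ≤ 4 * (1 / 1000) * (G' - G) := by gcongr
      _ ≤ _ := by linarith
  have p4 := abs_le.1 p3
  have g1 := abs_le.1 hGx
  have g2 := abs_le.1 hGy
  have e1 : |(G' ^ 2 * b ^ 2 - G ^ 2 * a ^ 2) / 2| ≤ 1 / 1000 * (G' - G) + 1 / 1000 * (a - b) := by
    have e : (G' ^ 2 * b ^ 2 - G ^ 2 * a ^ 2) / 2 =
        (G' - G) * ((G' + G) * b ^ 2 / 2) - (a - b) * (G ^ 2 * (a + b) / 2) := by ring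
    have b1 : |(G' + G) * b ^ 2 / 2| ≤ 1 / 1000 := by
      have hb2 : b ^ 2 ≤ (1 / 1000) ^ 2 := pow_le_pow_left₀ hb0.le (by linarith) 2
      have : |G' + G| ≤ 1 := abs_le.2 ⟨by linarith, by linarith⟩
      rw [abs_div, abs_mul, abs_of_pos (by positivity : 0 < b ^ 2), abs_two]
      have := mul_le_mul this hb2 (by positivity) one_pos.le
      linarith
    have b2 : |G ^ 2 * (a + b) / 2| ≤ 1 / 1000 := by
      rw [abs_of_nonneg (by positivity)]
      have : G ^ 2 ≤ 1 := by rw [sq_le_one_iff_abs_le_one]; linarith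
      have := mul_le_mul this (by linarith : a + b ≤ 1 / 1000) (by positivity) one_pos.le
      linarith
    rw [e]
    refine (abs_sub _ _).trans ?_
    rw [abs_mul, abs_mul, abs_of_pos (by linarith : 0 < G' - G), abs_of_nonneg (by linarith : 0 ≤ a - b)]
    have := mul_le_mul_of_nonneg_left b1 (by linarith : 0 ≤ G' - G)
    have := mul_le_mul_of_nonneg_left b2 (by linarith : 0 ≤ a - b)
    linarith
  have e2 := abs_le.1 e1
  constructor <;> linarith

set_option maxHeartbeats 1000000 in
theorem radial_comparison {x y : FS} (hr : ℛ ≤ x.1) (hxy : x.1 ≤ y.1)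
    (hGx : |x.2.2.2| ≤ 3 / 50) (hGy : |y.2.2.2| ≤ 3 / 50) (hG : x.2.2.2 < y.2.2.2) {K : ℝ}
    (hK : K * x.1⁻¹ ≤ 1 / 1000) (hφ : μ * |y.2.2.1 - x.2.2.1| ≤ K * (y.2.2.2 - x.2.2.2))
    (hJ : Jb μ y = Jb μ x) (hv0 : 0 ≤ x.2.1) (hv : x.2.1 ≤ y.2.1) (hv1 : y.2.1 ≤ 1 / 1000) :
    -(x.1⁻¹ ^ 2 * (y.2.1 - x.2.1)) ≤ (y.2.2.2 ^ 2 * y.1⁻¹ ^ 3 + fr μ y.1 y.2.2.1) -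
      (x.2.2.2 ^ 2 * x.1⁻¹ ^ 3 + fr μ x.1 x.2.2.1) := by
  have E := (energy_comparison h0 h1 hr hxy hGx hGy hG hK hφ hJ).2
  have hr' : ℛ ≤ y.1 := hr.trans hxy
  have p1 := fr_sub_radius_ge h0 (by linarith) (by linarith : 2000 ≤ x.1) hxy x.2.2.1
  have p2 := abs_fr_sub_angle_le h0 (by linarith) (by linarith : 2000 ≤ y.1) x.2.2.1 y.2.2.1
  clear hJ
  obtain ⟨r, v, φ, G⟩ := x
  obtain ⟨r', v', φ', G'⟩ := y
  simp only at *
  have hr0 : 0 < r := by linarith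
  set a := r⁻¹ with ha
  set b := r'⁻¹ with hb
  have ha0 : 0 < a := inv_pos.2 hr0
  have hb0 : 0 < b := inv_pos.2 (by linarith)
  have hba : b ≤ a := inv_anti₀ hr0 hxy
  have ha1 : a ≤ 1 / ℛ := by rw [ha, one_div]; exact inv_anti₀ (by norm_num) hr
  have a1 : a ≤ 1 / 1000000 := by norm_num at ha1 ⊢; linarith
  have p3 : |fr μ r' φ' - fr μ r' φ| ≤ 3 / 100 * a ^ 3 * (G' - G) := by
    refine p2.trans ?_
    have : 30 * μ * b ^ 4 * |φ' - φ| = 30 * b ^ 4 * (μ * |φ' - φ|) := by ring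
    rw [this]
    have hpos : 0 ≤ K * (G' - G) := le_trans (by positivity) hφ
    calc 30 * b ^ 4 * (μ * |φ' - φ|) ≤ 30 * a ^ 4 * (K * (G' - G)) := by gcongr
      _ = 30 * (K * a) * (a ^ 3 * (G' - G)) := by ring
      _ ≤ 30 * (1 / 1000) * (a ^ 3 * (G' - G)) := by
          have : 0 ≤ a ^ 3 * (G' - G) := mul_nonneg (by positivity) (by linarith)
          gcongr
      _ = _ := by ring
  have p4 := abs_le.1 p3
  have g1 := abs_le.1 hGx
  have g2 := abs_le.1 hGy
  have e1 : -(0.12 * a ^ 3 * (G' - G)) - 0.01 * a * (a - b) ≤ G' ^ 2 * b ^ 3 - G ^ 2 * a ^ 3 := by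
    have e : G' ^ 2 * b ^ 3 - G ^ 2 * a ^ 3 =
        (G' - G) * ((G' + G) * b ^ 3) - (a - b) * (G ^ 2 * (a ^ 2 + a * b + b ^ 2)) := by ring
    have b1 : -(0.12 * a ^ 3) ≤ (G' + G) * b ^ 3 := by
      have h3 : b ^ 3 ≤ a ^ 3 := by gcongr
      have h4 : 0 < b ^ 3 := by positivity
      have := mul_le_mul_of_nonneg_right (by linarith : -0.12 ≤ G' + G) h4.le
      linarith
    have b2 : G ^ 2 * (a ^ 2 + a * b + b ^ 2) ≤ 0.01 * a := by
      have h4 : G ^ 2 ≤ 1 := by rw [sq_le_one_iff_abs_le_one]; linarith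
      have h5 : a ^ 2 + a * b + b ^ 2 ≤ 0.01 * a := by
        have i1 : a * b ≤ a * (1 / 1000000) := by gcongr; linarith
        have i2 : a * a ≤ a * (1 / 1000000) := by gcongr
        have i3 : b * b ≤ a * (1 / 1000000) := by gcongr; linarith
        linarith
      have := mul_le_mul h4 h5 (by positivity) one_pos.le
      linarith
    rw [e]
    have := mul_le_mul_of_nonneg_left b1 (by linarith : 0 ≤ G' - G)
    have := mul_le_mul_of_nonneg_left b2 (by linarith : 0 ≤ a - b)
    linarith
  have e2 : a * (a - b) ≤ a ^ 2 - b ^ 2 := by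
    have := mul_nonneg hb0.le (by linarith : 0 ≤ a - b)
    linarith
  have e3 : (v' ^ 2 - v ^ 2) / 2 ≤ 1 / 1000 * (v' - v) := by
    have := mul_nonneg (by linarith : 0 ≤ v' - v) (by linarith : 0 ≤ 2 / 1000 - v' - v)
    linarith
  have e4 : a ^ 3 * (G' - G) ≤ a ^ 3 * (0.0011 * (v' - v) + 1.32 * (a - b)) := by
    gcongr; linarith
  have e5 : a ^ 3 * (v' - v) ≤ a ^ 2 * (v' - v) := by
    have : 0 ≤ v' - v := by linarith
    have : a ^ 3 ≤ a ^ 2 := pow_le_pow_of_le_one ha0.le (by linarith) (by norm_num)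
    gcongr
  have e6 : a ^ 3 * (a - b) ≤ a * (a - b) := by
    have : 0 ≤ a - b := by linarith
    have : a ^ 3 ≤ a ^ 1 := pow_le_pow_of_le_one ha0.le (by linarith) (by norm_num)
    rw [pow_one] at this
    gcongr
  have e7 : 0 ≤ a ^ 2 * (v' - v) := mul_nonneg (by positivity) (by linarith)
  have e8 : 0 ≤ a * (a - b) := mul_nonneg ha0.le (by linarith)
  linarith

set_option maxHeartbeats 1000000 in
theorem angular_comparison {x y : FS} (hr : ℛ ≤ x.1) (hxy : x.1 ≤ y.1)
    (hGx : |x.2.2.2| ≤ 3 / 50) (hGy : |y.2.2.2| ≤ 3 / 50) (hG : x.2.2.2 < y.2.2.2) {K : ℝ}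
    (hK0 : 0 ≤ K) (hK : K * x.1⁻¹ ≤ 1 / 1000) (hK2 : K ^ 2 * x.1⁻¹ ≤ 1 / 100000)
    (hφ : μ * |y.2.2.1 - x.2.2.1| ≤ K * (y.2.2.2 - x.2.2.2))
    (hJ : Jb μ y = Jb μ x) (hv0 : 0 ≤ x.2.1) (hv : x.2.1 ≤ y.2.1) :
    K * |tq μ y.1 y.2.2.1 - tq μ x.1 x.2.2.1| +
      μ * |(y.2.2.2 * y.1⁻¹ ^ 2 - 1) - (x.2.2.2 * x.1⁻¹ ^ 2 - 1)| ≤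
      (0.5 * x.1⁻¹ ^ 2 + 2 * μ * x.1⁻¹) * (y.2.2.2 - x.2.2.2) := by
  have E := (energy_comparison h0 h1 hr hxy hGx hGy hG hK hφ hJ).1
  have hr' : ℛ ≤ y.1 := hr.trans hxy
  have p1 := abs_tq_sub_radius_le h0 (by linarith) (by linarith : 2000 ≤ x.1) hxy x.2.2.1
  have p2 := abs_tq_sub_angle_le h0 (by linarith) (by linarith : 2000 ≤ y.1) x.2.2.1 y.2.2.1
  clear hJ
  obtain ⟨r, v, φ, G⟩ := x
  obtain ⟨r', v', φ', G'⟩ := y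
  simp only at *
  have hr0 : 0 < r := by linarith
  set a := r⁻¹ with ha
  set b := r'⁻¹ with hb
  have ha0 : 0 < a := inv_pos.2 hr0
  have hb0 : 0 < b := inv_pos.2 (by linarith)
  have hba : b ≤ a := inv_anti₀ hr0 hxy
  have ha1 : a ≤ 1 / ℛ := by rw [ha, one_div]; exact inv_anti₀ (by norm_num) hr
  have a1 : a ≤ 1 / 1000000 := by norm_num at ha1 ⊢; linarith
  have hD : 0 < G' - G := by linarith
  have g1 := abs_le.1 hGx
  have hι : a - b ≤ 1.4 * (G' - G) := by
    have := mul_nonneg (by linarith : 0 ≤ v' - v) (by linarith : 0 ≤ v' + v)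
    linarith
  have hι0 : 0 ≤ a - b := by linarith
  have hc2 : a ^ 2 + a * b + b ^ 2 ≤ 3 * a ^ 2 := by
    have : a * b ≤ a * a := by gcongr
    have : b * b ≤ a * a := by gcongr
    linarith
  have t1 : K * |tq μ r' φ - tq μ r φ| ≤ 0.05 * (μ * a * (G' - G)) := by
    calc K * |tq μ r' φ - tq μ r φ| ≤ K * (10 * μ * ((a - b) * (a ^ 2 + a * b + b ^ 2))) := by
          gcongr; refine p1.trans_eq ?_; ring
      _ ≤ K * (10 * μ * ((1.4 * (G' - G)) * (3 * a ^ 2))) := by gcongr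
      _ = 42 * (K * a) * (μ * a * (G' - G)) := by ring
      _ ≤ 42 * (1 / 1000) * (μ * a * (G' - G)) := by gcongr
      _ ≤ _ := by
          have : 0 ≤ μ * a * (G' - G) := by positivity
          linarith
  have t2 : K * |tq μ r' φ' - tq μ r' φ| ≤ 0.1 * (a ^ 2 * (G' - G)) := by
    calc K * |tq μ r' φ' - tq μ r' φ| ≤ K * (12 * μ * b ^ 3 * |φ' - φ|) := by gcongr
      _ = 12 * K * b ^ 3 * (μ * |φ' - φ|) := by ring
      _ ≤ 12 * K * a ^ 3 * (K * (G' - G)) := by gcongr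
      _ = 12 * (K ^ 2 * a) * (a ^ 2 * (G' - G)) := by ring
      _ ≤ 12 * (1 / 100000) * (a ^ 2 * (G' - G)) := by gcongr
      _ ≤ _ := by
          have : 0 ≤ a ^ 2 * (G' - G) := by positivity
          linarith
  have t3 : K * |tq μ r' φ' - tq μ r φ| ≤ 0.05 * (μ * a * (G' - G)) + 0.1 * (a ^ 2 * (G' - G)) := by
    calc K * |tq μ r' φ' - tq μ r φ| ≤ K * (|tq μ r' φ' - tq μ r' φ| + |tq μ r' φ - tq μ r φ|) := by
          gcongr; exact abs_sub_le _ _ _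
      _ ≤ _ := by linarith
  have t4 : |(G' * b ^ 2 - 1) - (G * a ^ 2 - 1)| ≤ (a ^ 2 + 0.2 * a) * (G' - G) := by
    have e : (G' * b ^ 2 - 1) - (G * a ^ 2 - 1) = (G' - G) * b ^ 2 - G * ((a - b) * (a + b)) := by ring
    rw [e]
    refine (abs_sub _ _).trans ?_
    rw [abs_mul, abs_mul, abs_of_pos hD, abs_of_pos (by positivity : 0 < b ^ 2),
      abs_of_nonneg (mul_nonneg hι0 (by positivity) : 0 ≤ (a - b) * (a + b))]
    calc (G' - G) * b ^ 2 + |G| * ((a - b) * (a + b))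
        ≤ (G' - G) * a ^ 2 + 3 / 50 * ((1.4 * (G' - G)) * (a + a)) := by gcongr
      _ ≤ _ := by have := mul_pos ha0 hD; linarith
  have t5 : μ * |(G' * b ^ 2 - 1) - (G * a ^ 2 - 1)| ≤ μ * ((a ^ 2 + 0.2 * a) * (G' - G)) := by gcongr
  have t6 : 0 ≤ μ * a * (G' - G) := by positivity
  have t7 : 0 ≤ a ^ 2 * (G' - G) := by positivity
  have t8 : μ * (a ^ 2 * (G' - G)) ≤ 1 / 1000000 * (a ^ 2 * (G' - G)) := by gcongr
  linarith

set_option maxHeartbeats 1000000 in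
theorem mem_interior_Nset_of_lt {x y : FS} (hx : x ∈ Oset (1 / 20)) (hy : y ∈ Oset (1 / 20))
    (hN : x ∈ Nset μ) (hJ : Jb μ y = Jb μ x) (hG : x.2.2.2 < y.2.2.2)
    (hφ : μ * |y.2.2.1 - x.2.2.1| < 8 * (y.2.2.2 - x.2.2.2)) : y ∈ interior (Nset μ) := by
  have hμ1 : μ ≤ 1 := by linarith
  have gx : ∀ t, 0 ≤ t → Good (Ω μ t x) := fun t ht => Nset_good h0 hμ1 (by norm_num) hx hN ht
  have vx : ∀ t, 0 ≤ t → 0 < (Ω μ t x).2.1 := fun t ht => Nset_v_pos h0 hμ1 hN ht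
  have vx1 : ∀ t, 0 ≤ t → (Ω μ t x).2.1 ≤ x.2.1 := fun t ht => by
    have := (Ω_v_strictAnti h0 hμ1 x).antitone ht
    simpa only [Ω_zero h0 hμ1] using this
  have vy1 : ∀ t, 0 ≤ t → (Ω μ t y).2.1 ≤ y.2.1 := fun t ht => by
    have := (Ω_v_strictAnti h0 hμ1 y).antitone ht
    simpa only [Ω_zero h0 hμ1] using this
  have hGx : ∀ t, 0 ≤ t → |(Ω μ t x).2.2.2| ≤ 3 / 50 := fun t ht => by
    have g := abs_le.1 (Ω_G_close h0 hμ1 ht hx.2.2.1 (by linarith [vx t ht]))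
    have g2 := abs_le.1 hx.2.2.2
    exact abs_le.2 ⟨by linarith, by linarith⟩
  have wpos : ∀ t, 0 ≤ t → 0 < √(Ω μ t x).1 := fun t ht => sqrt_pos.2 (by linarith [(gx t ht).1])
  set K : ℝ → ℝ := fun t => 8 + (x.2.1 - (Ω μ t x).2.1) + 8 * μ * (√(Ω μ t x).1 - √ℛ) with hK
  set K' : ℝ → ℝ := fun t => -(farField μ (Ω μ t x)).2.1 + 8 * μ * ((Ω μ t x).2.1 / (2 * √(Ω μ t x).1))
    with hK'
  have dK : ∀ t, 0 ≤ t → HasDerivAt K (K' t) t := by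
    intro t ht
    obtain ⟨a, b, -, -⟩ := Ω_deriv h0 hμ1 x t
    rw [cl_eq (gx t ht).2.1] at a
    have hr0 : (Ω μ t x).1 ≠ 0 := by linarith [(gx t ht).1]
    refine (((b.const_sub x.2.1).const_add 8).add
      (((a.sqrt hr0).sub_const _).const_mul (8 * μ))).congr_deriv ?_
    rfl
  set u : Fin 3 → ℝ → ℝ := ![fun t => ((Ω μ t y).2.1 - (Ω μ t x).2.1) * exp (-2 * (Ω μ t x).2.1),
    fun t => K t * ((Ω μ t y).2.2.2 - (Ω μ t x).2.2.2) + μ * ((Ω μ t y).2.2.1 - (Ω μ t x).2.2.1),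
    fun t => K t * ((Ω μ t y).2.2.2 - (Ω μ t x).2.2.2) - μ * ((Ω μ t y).2.2.1 - (Ω μ t x).2.2.1)]
    with hu
  set u' : Fin 3 → ℝ → ℝ := ![fun t => ((farField μ (Ω μ t y)).2.1 - (farField μ (Ω μ t x)).2.1 -
      2 * (farField μ (Ω μ t x)).2.1 * ((Ω μ t y).2.1 - (Ω μ t x).2.1)) * exp (-2 * (Ω μ t x).2.1),
    fun t => K' t * ((Ω μ t y).2.2.2 - (Ω μ t x).2.2.2) +
      K t * ((farField μ (Ω μ t y)).2.2.2 - (farField μ (Ω μ t x)).2.2.2) +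
      μ * ((farField μ (Ω μ t y)).2.2.1 - (farField μ (Ω μ t x)).2.2.1),
    fun t => K' t * ((Ω μ t y).2.2.2 - (Ω μ t x).2.2.2) +
      K t * ((farField μ (Ω μ t y)).2.2.2 - (farField μ (Ω μ t x)).2.2.2) -
      μ * ((farField μ (Ω μ t y)).2.2.1 - (farField μ (Ω μ t x)).2.2.1)]
    with hu'
  have hder : ∀ i t, 0 ≤ t → HasDerivAt (u i) (u' i t) t := by
    intro i t ht
    obtain ⟨-, b, c, d⟩ := Ω_deriv h0 hμ1 x t
    obtain ⟨-, b', c', d'⟩ := Ω_deriv h0 hμ1 y t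
    fin_cases i
    · refine ((b'.sub b).mul (b.const_mul (-2)).exp).congr_deriv ?_
      simp only [hu', Pi.sub_apply]
      simp
      ring
    · exact ((dK t ht).mul (d'.sub d)).add ((c'.sub c).const_mul μ)
    · exact ((dK t ht).mul (d'.sub d)).sub ((c'.sub c).const_mul μ)
  have hy0 : y.1 = x.1 := hy.1.trans hx.1.symm
  have hG0 : 0 < y.2.2.2 - x.2.2.2 := by linarith
  have hφ' := abs_lt.1 (show |μ * (y.2.2.1 - x.2.2.1)| < _ by rwa [abs_mul, abs_of_nonneg h0])
  have hK0 : K 0 = 8 := by simp [hK, Ω_zero h0 hμ1, hx.1]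
  have hv0 : x.2.1 < y.2.1 := by
    have := (energy_comparison h0 h1 hx.1.ge hy0.ge (by linarith [hx.2.2.2]) (by linarith [hy.2.2.2])
      hG (K := 8) (by rw [hx.1]; norm_num) hφ.le hJ).2
    rw [hy0, sub_self] at this
    have h3 : 0 < (y.2.1 - x.2.1) * (y.2.1 + x.2.1) := by linarith
    have := (pos_iff_pos_of_mul_pos h3).2 (by linarith [hx.2.1, hy.2.1])
    linarith
  have hpos0 : ∀ i, 0 < u i 0 := by
    intro i
    fin_cases i
    · simp only [hu]
      simp [Ω_zero h0 hμ1, hv0, exp_pos]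
    · change 0 < K 0 * _ + _
      simp only [hK0, Ω_zero h0 hμ1]
      linarith
    · change 0 < K 0 * _ - _
      simp only [hK0, Ω_zero h0 hμ1]
      linarith
  have Kpos : ∀ t, 0 ≤ t → 8 ≤ K t := fun t ht => by
    have : √ℛ ≤ √(Ω μ t x).1 := sqrt_le_sqrt (gx t ht).1
    have := mul_nonneg h0 (sub_nonneg.2 this)
    simp only [hK]
    linarith [vx1 t ht]
  have hmono : ∀ t, 0 ≤ t → (∀ j, ∀ s ∈ Icc 0 t, 0 < u j s) → ∀ i, 0 ≤ u' i t := by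
    intro t ht hp
    have pv : ∀ s ∈ Icc 0 t, (Ω μ s x).2.1 < (Ω μ s y).2.1 := fun s hs => by
      have := hp 0 s hs
      simp only [hu, Matrix.cons_val_zero] at this
      linarith [pos_of_mul_pos_left this (exp_pos _).le]
    have pr : ∀ s ∈ Icc 0 t, (Ω μ s x).1 ≤ (Ω μ s y).1 := fun s hs => by
      have := le_of_hasDerivAt_nonneg hs.1 (fun w _ => (Ω_deriv h0 hμ1 y w).1.sub
        (Ω_deriv h0 hμ1 x w).1) fun w hw => sub_nonneg.2 (cl_mono 1 (pv w ⟨hw.1, hw.2.trans hs.2⟩).le)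
      simp only [Pi.sub_apply, Ω_zero h0 hμ1, hy0] at this
      linarith
    have vy : ∀ s ∈ Icc 0 t, 0 < (Ω μ s y).2.1 := fun s hs => (vx s hs.1).trans (pv s hs)
    have hGy : ∀ s ∈ Icc 0 t, |(Ω μ s y).2.2.2| ≤ 3 / 50 := fun s hs => by
      have g := abs_le.1 (Ω_G_close h0 hμ1 hs.1 hy.2.2.1 (by linarith [vy s hs]))
      have g2 := abs_le.1 hy.2.2.2
      exact abs_le.2 ⟨by linarith, by linarith⟩
    have gy : ∀ s ∈ Icc 0 t, Good (Ω μ s y) := fun s hs => ⟨(gx s hs.1).1.trans (pr s hs),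
      abs_le.2 ⟨by linarith [vy s hs], by linarith [vy1 s hs.1, hy.2.2.1]⟩, by linarith [hGy s hs]⟩
    have hJt : Jb μ (Ω μ t y) = Jb μ (Ω μ t x) := by
      rw [Jb_eq h0 hμ1 ht gy, Jb_eq h0 hμ1 ht fun s hs => gx s hs.1, hJ]
    have tt : t ∈ Icc 0 t := ⟨ht, le_rfl⟩
    have p1 : 0 < K t * ((Ω μ t y).2.2.2 - (Ω μ t x).2.2.2) + μ * ((Ω μ t y).2.2.1 - (Ω μ t x).2.2.1) :=
      hp 1 t tt
    have p2 : 0 < K t * ((Ω μ t y).2.2.2 - (Ω μ t x).2.2.2) - μ * ((Ω μ t y).2.2.1 - (Ω μ t x).2.2.1) :=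
      hp 2 t tt
    have Kt := Kpos t ht
    have pG : (Ω μ t x).2.2.2 < (Ω μ t y).2.2.2 := by
      have : 0 < K t * ((Ω μ t y).2.2.2 - (Ω μ t x).2.2.2) := by linarith
      linarith [pos_of_mul_pos_right this (by linarith)]
    have pφ : μ * |(Ω μ t y).2.2.1 - (Ω μ t x).2.2.1| ≤ K t * ((Ω μ t y).2.2.2 - (Ω μ t x).2.2.2) := by
      rw [← abs_of_nonneg h0, ← abs_mul, abs_of_nonneg h0]
      exact abs_le.2 ⟨by linarith, by linarith⟩
    set w := √(Ω μ t x).1 with hw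
    have w0 : 0 < w := wpos t ht
    have wsq : w ^ 2 = (Ω μ t x).1 := sq_sqrt (by linarith [(gx t ht).1])
    have w7 : 7000 ≤ w := by
      rw [hw]; exact le_sqrt_of_sq_le (by linarith [(gx t ht).1])
    have aw : (Ω μ t x).1⁻¹ = w⁻¹ ^ 2 := by rw [← wsq, inv_pow]
    have wi0 : 0 < w⁻¹ := inv_pos.2 w0
    have wi : w⁻¹ ≤ 1 / 7000 := by rw [one_div]; exact inv_anti₀ (by norm_num) w7
    have ww : w * w⁻¹ = 1 := mul_inv_cancel₀ w0.ne'
    have Kle : K t ≤ 9 + w / 100000 := by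
      have : 8 * μ * (w - √ℛ) ≤ 8 * (1 / 1000000) * w := by
        have : 8 * μ * (w - √ℛ) ≤ 8 * μ * w := by
          have := mul_nonneg h0 (sqrt_nonneg ℛ)
          linarith
        have : μ * w ≤ 1 / 1000000 * w := by gcongr
        linarith
      have := vx t ht
      have := hx.2.2.1
      simp only [hK]
      linarith
    have hKa : K t * (Ω μ t x).1⁻¹ ≤ 1 / 1000 := by
      rw [aw]
      calc K t * w⁻¹ ^ 2 ≤ (9 + w / 100000) * w⁻¹ ^ 2 := by gcongr
        _ = 9 * (w⁻¹ * w⁻¹) + (w * w⁻¹) / 100000 * w⁻¹ := by ring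
        _ ≤ 9 * ((1 / 7000) * (1 / 7000)) + (w * w⁻¹) / 100000 * (1 / 7000) := by
          rw [ww]; gcongr
        _ ≤ _ := by rw [ww]; norm_num
    have hKa2 : K t ^ 2 * (Ω μ t x).1⁻¹ ≤ 1 / 100000 := by
      rw [aw, ← mul_pow]
      have : K t * w⁻¹ ≤ 13 / 10000 + 1 / 100000 := by
        calc K t * w⁻¹ ≤ (9 + w / 100000) * w⁻¹ := by gcongr
          _ = 9 * w⁻¹ + (w * w⁻¹) / 100000 := by ring
          _ ≤ 9 * (1 / 7000) + (w * w⁻¹) / 100000 := by gcongr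
          _ ≤ _ := by rw [ww]; norm_num
      have := pow_le_pow_left₀ (by positivity : 0 ≤ K t * w⁻¹) this 2
      linarith
    have R := radial_comparison h0 h1 (gx t ht).1 (pr t tt) (hGx t ht) (hGy t tt) pG hKa pφ hJt
      (vx t ht).le (pv t tt).le (by linarith [vy1 t ht, hy.2.2.1])
    have A := angular_comparison h0 h1 (gx t ht).1 (pr t tt) (hGx t ht) (hGy t tt) pG (by linarith)
      hKa hKa2 pφ hJt (vx t ht).le (pv t tt).le
    have B := (Ω_v_bounds h0 hμ1 (gx t ht).1).2
    have V := one_le_sq_mul_of_mem_Nset h0 hμ1 (Nset_forward h0 hμ1 hN ht) (gx t ht).1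
      (abs_le.1 (gx t ht).2.1).2
    have V' : (Ω μ t x).1⁻¹ ≤ (Ω μ t x).2.1 / w := by
      rw [← wsq, ← mul_pow] at V
      have : 1 ≤ (Ω μ t x).2.1 * w := by
        have := (one_le_sq_iff₀ (by have := vx t ht; positivity)).1 V
        exact this
      rw [aw, le_div_iff₀ w0]
      calc w⁻¹ ^ 2 * w = w⁻¹ * (w * w⁻¹) := by ring
        _ = w⁻¹ * 1 := by rw [ww]
        _ ≤ w⁻¹ * ((Ω μ t x).2.1 * w) := by gcongr
        _ = (Ω μ t x).2.1 * (w * w⁻¹) := by ring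
        _ = _ := by rw [ww, mul_one]
    have hKl : 0.9 * (Ω μ t x).1⁻¹ ^ 2 + 4 * μ * (Ω μ t x).1⁻¹ ≤ K' t := by
      have e : 8 * μ * ((Ω μ t x).2.1 / (2 * w)) = 4 * μ * ((Ω μ t x).2.1 / w) := by
        field_simp; ring
      have := mul_le_mul_of_nonneg_left V' (by linarith : 0 ≤ 4 * μ)
      simp only [hK', ← hw]
      rw [e]
      linarith
    have hKG := mul_le_mul_of_nonneg_right hKl (by linarith : 0 ≤ (Ω μ t y).2.2.2 - (Ω μ t x).2.2.2)
    have ia : 0 < (Ω μ t x).1⁻¹ := by rw [aw]; positivity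
    have e1 : (farField μ (Ω μ t y)).2.2.2 - (farField μ (Ω μ t x)).2.2.2 =
        tq μ (Ω μ t y).1 (Ω μ t y).2.2.1 - tq μ (Ω μ t x).1 (Ω μ t x).2.2.1 := by
      rw [farField_good (gx t ht), farField_good (gy t tt)]
    have e2 : (farField μ (Ω μ t y)).2.2.1 - (farField μ (Ω μ t x)).2.2.1 =
        ((Ω μ t y).2.2.2 * (Ω μ t y).1⁻¹ ^ 2 - 1) - ((Ω μ t x).2.2.2 * (Ω μ t x).1⁻¹ ^ 2 - 1) := by
      rw [farField_good (gx t ht), farField_good (gy t tt)]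
    have e3 : (farField μ (Ω μ t y)).2.1 - (farField μ (Ω μ t x)).2.1 =
        ((Ω μ t y).2.2.2 ^ 2 * (Ω μ t y).1⁻¹ ^ 3 + fr μ (Ω μ t y).1 (Ω μ t y).2.2.1) -
        ((Ω μ t x).2.2.2 ^ 2 * (Ω μ t x).1⁻¹ ^ 3 + fr μ (Ω μ t x).1 (Ω μ t x).2.2.1) := by
      rw [farField_good (gx t ht), farField_good (gy t tt)]
    rw [← e1, ← e2] at A
    rw [← e3] at R
    have D := sub_pos.2 pG
    have q1 : 0 ≤ (Ω μ t x).1⁻¹ ^ 2 * ((Ω μ t y).2.2.2 - (Ω μ t x).2.2.2) := by positivity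
    have q2 : 0 ≤ μ * (Ω μ t x).1⁻¹ * ((Ω μ t y).2.2.2 - (Ω μ t x).2.2.2) := by positivity
    have s1 := abs_le.1 (abs_mul (K t) ((farField μ (Ω μ t y)).2.2.2 - (farField μ (Ω μ t x)).2.2.2)).le
    have s2 := abs_le.1 (abs_mul μ ((farField μ (Ω μ t y)).2.2.1 - (farField μ (Ω μ t x)).2.2.1)).le
    rw [abs_of_nonneg (by linarith : 0 ≤ K t)] at s1
    rw [abs_of_nonneg h0] at s2
    intro i
    fin_cases i
    · refine mul_nonneg ?_ (exp_pos _).le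
      have := mul_nonneg (by linarith : 0 ≤ -(farField μ (Ω μ t x)).2.1 - 0.9 * (Ω μ t x).1⁻¹ ^ 2)
        (sub_nonneg.2 (pv t tt).le)
      have := mul_nonneg (sq_nonneg (Ω μ t x).1⁻¹) (sub_nonneg.2 (pv t tt).le)
      linarith
    · change 0 ≤ K' t * _ + _ + _
      linarith [s1.1, s2.1]
    · change 0 ≤ K' t * _ + _ - _
      linarith [s1.1, s2.2]
  have key := le_of_monotone_while_pos hder hpos0 hmono 0
  set η := u 0 0 with hη
  have η0 : 0 < η := hpos0 0
  have hvη : ∀ t, 0 ≤ t → η ≤ (Ω μ t y).2.1 := fun t ht => by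
    have h3 : η ≤ ((Ω μ t y).2.1 - (Ω μ t x).2.1) * exp (-2 * (Ω μ t x).2.1) := key t ht
    have h4 : exp (-2 * (Ω μ t x).2.1) ≤ 1 := exp_le_one_iff.2 (by linarith [vx t ht])
    have h5 := pos_of_mul_pos_left (η0.trans_le h3) (exp_pos _).le
    have := mul_le_mul_of_nonneg_left h4 h5.le
    linarith [vx t ht]
  have hη1 : η ≤ 1 := by
    have := hvη 0 le_rfl
    rw [Ω_zero h0 hμ1] at this
    linarith [hy.2.2.1]
  have hr : ∀ t, 0 ≤ t → ℛ + η * t ≤ (Ω μ t y).1 := fun t ht => by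
    have := le_of_hasDerivAt_nonneg ht (fun s _ => (Ω_deriv h0 hμ1 y s).1.sub
      ((hasDerivAt_id s).const_mul η)) fun s hs => by
        have := hvη s hs.1
        rw [cl_eq (abs_le.2 ⟨by linarith, by linarith [vy1 s hs.1, hy.2.2.1]⟩)]
        linarith
    simp only [Pi.sub_apply, Ω_zero h0 hμ1, hy.1, id] at this
    linarith
  set T := 3 / η ^ 3 with hT
  have hT0 : 0 < T := by positivity
  have hrT := hr T hT0.le
  have hηT : η * T = 3 / η ^ 2 := by rw [hT]; field_simp
  have hrT2 : 3 / η ^ 2 < (Ω μ T y).1 := by linarith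
  refine mem_interior_Nset h0 hμ1 (T := T) ?_ ?_ ?_ ?_
  · have : 0 < η * T := by positivity
    linarith
  · linarith [vy1 T hT0.le, hy.2.2.1]
  · exact η0.trans_le (hvη T hT0.le)
  · have h3 : (Ω μ T y).1⁻¹ < η ^ 2 / 3 := by
      have := inv_strictAnti₀ (by positivity) hrT2
      rwa [inv_div] at this
    have := pow_le_pow_left₀ η0.le (hvη T hT0.le) 2
    linarith [sq_nonneg η, sq_pos_of_pos η0]

end

end PCRTBP

namespace PCRTBP

open Set

/-! ### Cartesian solutions -/

/-- The Hamiltonian vector field in the coordinates `(q₁, q₂, p₁, p₂)`. -/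
noncomputable def cart (μ : ℝ) (a : FS) : FS :=
  (a.2.2.1 + a.2.1, a.2.2.2 - a.1,
    a.2.2.2 - (1 - μ) * (a.1 + μ) / (dS μ a.1 a.2.1) ^ 3
      - μ * (a.1 - (1 - μ)) / (dJ μ a.1 a.2.1) ^ 3,
    -a.2.2.1 - (1 - μ) * a.2.1 / (dS μ a.1 a.2.1) ^ 3 - μ * a.2.1 / (dJ μ a.1 a.2.1) ^ 3)

/-- The point is not a collision. -/
def NC (μ : ℝ) (a : FS) : Prop := (a.1, a.2.1) ≠ (-μ, 0) ∧ (a.1, a.2.1) ≠ (1 - μ, 0)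

/-- A curve solves the equations of motion at time `t`. -/
def SolAt (μ : ℝ) (y : ℝ → FS) (t : ℝ) : Prop := NC μ (y t) ∧ HasDerivAt y (cart μ (y t)) t

/-- Some solution leads from `a` to `b` in time `T` and visits all points of `S`. -/
def Reach (μ T : ℝ) (a b : FS) (S : Set FS) : Prop :=
  0 < T ∧ ∃ y : ℝ → FS, y 0 = a ∧ y T = b ∧ (∀ t ∈ Icc 0 T, SolAt μ y t) ∧ S ⊆ y '' Icc 0 T

/-- The reversing symmetry in Cartesian coordinates. -/
def rc (a : FS) : FS := (a.1, -a.2.1, -a.2.2.1, a.2.2.2)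

theorem dS_neg (μ x y : ℝ) : dS μ x (-y) = dS μ x y := by simp [dS]
theorem dJ_neg (μ x y : ℝ) : dJ μ x (-y) = dJ μ x y := by simp [dJ]

theorem hasDerivAt_glue {f g : ℝ → FS} {c : ℝ} {d : FS} (hf : HasDerivAt f d c)
    (hg : HasDerivAt g d c) (h : f c = g c) :
    HasDerivAt (fun t => if t < c then f t else g t) d c := by
  have h1 : HasDerivWithinAt (fun t => if t < c then f t else g t) d (Iic c) c :=
    hf.hasDerivWithinAt.congr_of_mem (fun t ht => by
      rcases lt_or_eq_of_le (mem_Iic.1 ht) with h' | rfl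
      · simp [h']
      · simp [h]) (mem_Iic.2 le_rfl)
  have h2 : HasDerivWithinAt (fun t => if t < c then f t else g t) d (Ici c) c :=
    hg.hasDerivWithinAt.congr_of_mem (fun t ht => by
      simp [not_lt.2 (mem_Ici.1 ht)]) (mem_Ici.2 le_rfl)
  have := h1.union h2
  rwa [Iic_union_Ici, hasDerivWithinAt_univ] at this

theorem SolAt.congr {μ : ℝ} {y z : ℝ → FS} {t : ℝ} (h : SolAt μ y t) (he : z =ᶠ[𝓝 t] y) :
    SolAt μ z t := by
  obtain ⟨h1, h2⟩ := h
  have := he.eq_of_nhds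
  exact ⟨by rwa [this], by rw [this]; exact h2.congr_of_eventuallyEq he⟩

theorem SolAt.glue {μ : ℝ} {f g : ℝ → FS} {c : ℝ} (hf : SolAt μ f c)
    (hg : SolAt μ g c) (h : f c = g c) : SolAt μ (fun t => if t < c then f t else g t) c := by
  have := hasDerivAt_glue hf.2 (by rw [h]; exact hg.2) h
  refine ⟨by simpa using hg.1, ?_⟩
  simp only [lt_irrefl, if_false]
  rwa [h] at this

theorem SolAt.of_lt {μ : ℝ} {f g : ℝ → FS} {c t : ℝ} (hf : SolAt μ f t) (h : t < c) :
    SolAt μ (fun t => if t < c then f t else g t) t :=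
  hf.congr (by filter_upwards [eventually_lt_nhds h] with s hs; simp [hs])

theorem SolAt.of_gt {μ : ℝ} {f g : ℝ → FS} {c t : ℝ} (hg : SolAt μ g t) (h : c < t) :
    SolAt μ (fun t => if t < c then f t else g t) t :=
  hg.congr (by filter_upwards [eventually_gt_nhds h] with s hs; simp [hs.not_gt])

theorem SolAt.shift {μ : ℝ} {y : ℝ → FS} {t c : ℝ} (h : SolAt μ y (t - c)) :
    SolAt μ (fun s => y (s - c)) t :=
  ⟨h.1, h.2.comp_sub_const t c⟩

theorem SolAt.reverse {μ : ℝ} {y : ℝ → FS} {t c : ℝ} (h : SolAt μ y (c - t)) :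
    SolAt μ (fun s => rc (y (c - s))) t := by
  obtain ⟨⟨h1, h2⟩, h3⟩ := h
  refine ⟨⟨fun h => h1 ?_, fun h => h2 ?_⟩, ?_⟩
  · simpa [rc] using h
  · simpa [rc] using h
  have hd := h3.scomp t ((hasDerivAt_id t).const_sub c)
  rw [hasDerivAt_FS] at hd ⊢
  obtain ⟨d1, d2, d3, d4⟩ := hd
  refine ⟨d1.congr_deriv ?_, d2.neg.congr_deriv ?_, d3.neg.congr_deriv ?_, d4.congr_deriv ?_⟩ <;>
  · simp only [cart, rc, Prod.smul_fst, Prod.smul_snd, smul_eq_mul, dS_neg, dJ_neg]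
    ring

theorem Reach.trans {μ T₁ T₂ : ℝ} {a b c : FS} {S₁ S₂ : Set FS} (h₁ : Reach μ T₁ a b S₁)
    (h₂ : Reach μ T₂ b c S₂) : Reach μ (T₁ + T₂) a c (S₁ ∪ S₂) := by
  obtain ⟨hT₁, y, y0, y1, hy, hS₁⟩ := h₁
  obtain ⟨hT₂, z, z0, z1, hz, hS₂⟩ := h₂
  refine ⟨by positivity, fun t => if t < T₁ then y t else z (t - T₁), by simp [hT₁, y0], ?_, ?_, ?_⟩
  · simp [hT₂.le, z1]
  · intro t ht
    rcases lt_trichotomy t T₁ with h | h | h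
    · exact (hy t ⟨ht.1, h.le⟩).of_lt h
    · subst h
      exact (hy t ⟨ht.1, le_rfl⟩).glue (hz (t - t) (by simp [hT₂.le])).shift (by simp [y1, z0])
    · exact (hz (t - T₁) ⟨by linarith, by linarith [ht.2]⟩).shift.of_gt h
  · rintro s (hs | hs)
    · obtain ⟨t, ht, rfl⟩ := hS₁ hs
      refine ⟨t, ⟨ht.1, by linarith [ht.2]⟩, ?_⟩
      rcases lt_or_eq_of_le ht.2 with h | h
      · simp [h]
      · simp [h, y1, z0]
    · obtain ⟨t, ht, rfl⟩ := hS₂ hs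
      refine ⟨t + T₁, ⟨by linarith [ht.1], by linarith [ht.2]⟩, ?_⟩
      simp [ht.1]

theorem Reach.reverse {μ T : ℝ} {a b : FS} {S : Set FS} (h : Reach μ T a b S) :
    Reach μ T (rc b) (rc a) (rc '' S) := by
  obtain ⟨hT, y, y0, y1, hy, hS⟩ := h
  refine ⟨hT, fun t => rc (y (T - t)), by simp [y1], by simp [y0], fun t ht => ?_, ?_⟩
  · exact SolAt.reverse (hy _ ⟨by linarith [ht.2], by linarith [ht.1]⟩)
  · rintro _ ⟨s, hs, rfl⟩
    obtain ⟨t, ht, rfl⟩ := hS hs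
    exact ⟨T - t, ⟨by linarith [ht.2], by linarith [ht.1]⟩, by simp⟩

theorem Reach.mono {μ T : ℝ} {a b : FS} {S S' : Set FS} (h : Reach μ T a b S) (hS : S' ⊆ S) :
    Reach μ T a b S' :=
  let ⟨hT, y, y0, y1, hy, hS'⟩ := h
  ⟨hT, y, y0, y1, hy, hS.trans hS'⟩

/-- Cartesian coordinates of a state in polar coordinates. -/
noncomputable def toC (x : FS) : FS :=
  (x.1 * cos x.2.2.1, x.1 * sin x.2.2.1, x.2.1 * cos x.2.2.1 - x.2.2.2 * x.1⁻¹ * sin x.2.2.1,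
    x.2.1 * sin x.2.2.1 + x.2.2.2 * x.1⁻¹ * cos x.2.2.1)

theorem toC_rev (x : FS) : toC (rev x) = rc (toC x) := by
  simp only [toC, rev, rc, cos_neg, sin_neg, Prod.mk.injEq, true_and]
  refine ⟨by ring, by ring, by ring⟩

theorem toC_rot (k : ℤ) (x : FS) : toC (rot (k * (2 * π)) x) = toC x := by
  simp only [toC, rot, cos_add_int_mul_two_pi, sin_add_int_mul_two_pi]

theorem nrm2_polar {r : ℝ} (hr : 0 ≤ r) (φ : ℝ) : nrm2 (r * cos φ) (r * sin φ) = r := by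
  rw [nrm2, Real.sqrt_eq_iff_mul_self_eq (by positivity) hr]
  linear_combination r ^ 2 * cos_sq_add_sin_sq φ

theorem nrm2_toC_p_le (x : FS) : nrm2 (toC x).2.2.1 (toC x).2.2.2 ≤ |x.2.1| + |x.2.2.2 * x.1⁻¹| := by
  refine Real.sqrt_le_iff.2 ⟨by positivity, ?_⟩
  have h : (toC x).2.2.1 ^ 2 + (toC x).2.2.2 ^ 2 = x.2.1 ^ 2 + (x.2.2.2 * x.1⁻¹) ^ 2 := by
    simp only [toC]
    linear_combination (x.2.1 ^ 2 + (x.2.2.2 * x.1⁻¹) ^ 2) * cos_sq_add_sin_sq x.2.2.1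
  rw [h]
  nlinarith [abs_nonneg x.2.1, abs_nonneg (x.2.2.2 * x.1⁻¹), sq_abs x.2.1, sq_abs (x.2.2.2 * x.1⁻¹)]

theorem inv_dist_eq (c r φ : ℝ) :
    (√((r * cos φ + c) ^ 2 + (r * sin φ) ^ 2))⁻¹ = iD c r φ := by
  rw [iD]
  congr 2
  linear_combination r ^ 2 * cos_sq_add_sin_sq φ

theorem toC_NC {μ : ℝ} (h0 : 0 ≤ μ) (h1 : μ ≤ 1) {x : FS} (h : Good x) : NC μ (toC x) := by
  have hr : (2 : ℝ) < x.1 := by linarith [h.1]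
  have key : (toC x).1 ^ 2 + (toC x).2.1 ^ 2 = x.1 ^ 2 := by
    simp only [toC]; linear_combination x.1 ^ 2 * cos_sq_add_sin_sq x.2.2.1
  constructor <;> intro he <;> simp only [Prod.mk.injEq] at he <;> rw [he.1, he.2] at key <;> nlinarith

theorem toC_sol {μ : ℝ} (h0 : 0 ≤ μ) (h1 : μ ≤ 1) {x : FS} {t : ℝ} (h : Good (Ω μ t x)) :
    SolAt μ (fun s => toC (Ω μ s x)) t := by
  refine ⟨toC_NC h0 h1 h, ?_⟩
  have hr : (Ω μ t x).1 ≠ 0 := by have := h.1; positivity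
  have hd := (Ω_spec h0 h1).2.1 x t
  rw [farField_good h, hasDerivAt_FS] at hd
  obtain ⟨dr, dv, dφ, dG⟩ := hd
  simp only at dr dv dφ dG
  have hr1 : (Ω μ t x).1 * (Ω μ t x).1⁻¹ = 1 := mul_inv_cancel₀ hr
  have dri : HasDerivAt (fun s => (Ω μ s x).1⁻¹) (-(Ω μ t x).2.1 * (Ω μ t x).1⁻¹ ^ 2) t :=
    (dr.fun_inv hr).congr_deriv (by simp only [div_eq_mul_inv, inv_pow])
  have dGr : HasDerivAt (fun s => (Ω μ s x).2.2.2 * (Ω μ s x).1⁻¹) _ t := dG.mul dri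
  have e1 : (dS μ (toC (Ω μ t x)).1 (toC (Ω μ t x)).2.1)⁻¹ = iD μ (Ω μ t x).1 (Ω μ t x).2.2.1 :=
    inv_dist_eq _ _ _
  have e2 : (dJ μ (toC (Ω μ t x)).1 (toC (Ω μ t x)).2.1)⁻¹ =
      iD (μ - 1) (Ω μ t x).1 (Ω μ t x).2.2.1 := by
    rw [← inv_dist_eq, dJ, toC]; congr 4; ring
  rw [hasDerivAt_FS]
  simp only [cart, div_eq_mul_inv, ← inv_pow, e1, e2]
  simp only [toC]
  have hcs := cos_sq_add_sin_sq (Ω μ t x).2.2.1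
  refine ⟨(dr.mul dφ.cos).congr_deriv ?_, (dr.mul dφ.sin).congr_deriv ?_,
    ((dv.mul dφ.cos).sub (dGr.mul dφ.sin)).congr_deriv ?_,
    ((dv.mul dφ.sin).add (dGr.mul dφ.cos)).congr_deriv ?_⟩
  all_goals
    try simp only [fr, tq]
    generalize iD μ (Ω μ t x).1 (Ω μ t x).2.2.1 = A
    generalize iD (μ - 1) (Ω μ t x).1 (Ω μ t x).2.2.1 = B
    generalize cos (Ω μ t x).2.2.1 = c at *
    generalize sin (Ω μ t x).2.2.1 = s at *
    generalize (Ω μ t x).1⁻¹ = ρ at *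
    generalize (Ω μ t x).1 = r at *
  · linear_combination (-s * (Ω μ t x).2.2.2 * ρ) * hr1
  · linear_combination (c * (Ω μ t x).2.2.2 * ρ) * hr1
  · linear_combination (-μ * (1 - μ) * (A ^ 3 - B ^ 3)) * hcs -
      μ * (1 - μ) * s ^ 2 * (A ^ 3 - B ^ 3) * hr1
  · linear_combination (c * s * μ * (1 - μ) * (A ^ 3 - B ^ 3)) * hr1

theorem reach_far {μ : ℝ} (h0 : 0 ≤ μ) (h1 : μ ≤ 1) {x : FS} {T : ℝ} (hT : 0 < T)
    (h : ∀ t ∈ Icc 0 T, Good (Ω μ t x)) :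
    Reach μ T (toC x) (toC (Ω μ T x)) ((fun t => toC (Ω μ t x)) '' Icc 0 T) :=
  ⟨hT, fun t => toC (Ω μ t x), by simp only [Ω_zero h0 h1], rfl, fun t ht => toC_sol h0 h1 (h t ht),
    Subset.rfl⟩

end PCRTBP

namespace PCRTBP

open Set

/-! ### Levi-Civita regularisation of the first primary -/

/-- States `(x, y, u, w, t, J, μ)`: Levi-Civita position and velocity, physical time, energy
and mass ratio. -/
abbrev LS : Type := ℝ × ℝ × ℝ × ℝ × ℝ × ℝ × ℝ

/-- Squared distance to the second primary. -/
noncomputable def sqD (x y t : ℝ) : ℝ := ((x ^ 2 - y ^ 2) / 2 + cos t) ^ 2 + (x * y + sin t) ^ 2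

/-- Inverse distance to the second primary. -/
noncomputable def lD (x y t : ℝ) : ℝ := (√(sqD x y t))⁻¹

/-- First component of the force of the second primary, per unit mass ratio. -/
noncomputable def lf₁ (x y t : ℝ) : ℝ := cos t - ((x ^ 2 - y ^ 2) / 2 + cos t) * lD x y t ^ 3

/-- Second component of the force of the second primary, per unit mass ratio. -/
noncomputable def lf₂ (x y t : ℝ) : ℝ := sin t - (x * y + sin t) * lD x y t ^ 3

/-- Potential of the second primary, per unit mass ratio. -/
noncomputable def lV (x y t : ℝ) : ℝ :=
  -lD x y t - ((x ^ 2 - y ^ 2) / 2 * cos t + x * y * sin t)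

/-- The Kepler energy. -/
noncomputable def lh (Y : LS) : ℝ :=
  Y.2.2.2.2.2.1 + (Y.1 * Y.2.2.2.1 - Y.2.1 * Y.2.2.1) -
    Y.2.2.2.2.2.2 * lV Y.1 Y.2.1 Y.2.2.2.2.1

/-- The regularised vector field. -/
noncomputable def lc (Y : LS) : LS :=
  (Y.2.2.1, Y.2.2.2.1,
    lh Y / 2 * Y.1 + Y.2.2.2.2.2.2 * ((Y.1 ^ 2 + Y.2.1 ^ 2) / 4) *
      (Y.1 * lf₁ Y.1 Y.2.1 Y.2.2.2.2.1 + Y.2.1 * lf₂ Y.1 Y.2.1 Y.2.2.2.2.1),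
    lh Y / 2 * Y.2.1 + Y.2.2.2.2.2.2 * ((Y.1 ^ 2 + Y.2.1 ^ 2) / 4) *
      (Y.1 * lf₂ Y.1 Y.2.1 Y.2.2.2.2.1 - Y.2.1 * lf₁ Y.1 Y.2.1 Y.2.2.2.2.1),
    (Y.1 ^ 2 + Y.2.1 ^ 2) / 2, 0, 0)

/-- The regularised field is defined away from the second primary. -/
def lU : Set LS := {Y | 0 < sqD Y.1 Y.2.1 Y.2.2.2.2.1}

/-- The conserved quantity which vanishes on physical orbits. -/
noncomputable def lK (Y : LS) : ℝ :=
  Y.2.2.1 ^ 2 + Y.2.2.2.1 ^ 2 - (1 - Y.2.2.2.2.2.2) - lh Y * ((Y.1 ^ 2 + Y.2.1 ^ 2) / 2)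

/-- Cartesian coordinates of a regularised state. -/
noncomputable def lcC (Y : LS) : FS :=
  (-((Y.1 ^ 2 - Y.2.1 ^ 2) / 2 * cos Y.2.2.2.2.1 + Y.1 * Y.2.1 * sin Y.2.2.2.2.1)
      - Y.2.2.2.2.2.2,
    -(Y.1 * Y.2.1 * cos Y.2.2.2.2.1 - (Y.1 ^ 2 - Y.2.1 ^ 2) / 2 * sin Y.2.2.2.2.1),
    -((Y.1 ^ 2 + Y.2.1 ^ 2) / 2)⁻¹ * ((Y.1 * Y.2.2.1 - Y.2.1 * Y.2.2.2.1) * cos Y.2.2.2.2.1 +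
      (Y.1 * Y.2.2.2.1 + Y.2.1 * Y.2.2.1) * sin Y.2.2.2.2.1),
    -((Y.1 ^ 2 + Y.2.1 ^ 2) / 2)⁻¹ * ((Y.1 * Y.2.2.2.1 + Y.2.1 * Y.2.2.1) * cos Y.2.2.2.2.1 -
      (Y.1 * Y.2.2.1 - Y.2.1 * Y.2.2.2.1) * sin Y.2.2.2.2.1) - Y.2.2.2.2.2.2)

theorem hasDerivAt_LS {γ : ℝ → LS} {d : LS} {s : ℝ} : HasDerivAt γ d s ↔
    HasDerivAt (fun s => (γ s).1) d.1 s ∧ HasDerivAt (fun s => (γ s).2.1) d.2.1 s ∧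
      HasDerivAt (fun s => (γ s).2.2.1) d.2.2.1 s ∧
      HasDerivAt (fun s => (γ s).2.2.2.1) d.2.2.2.1 s ∧
      HasDerivAt (fun s => (γ s).2.2.2.2.1) d.2.2.2.2.1 s ∧
      HasDerivAt (fun s => (γ s).2.2.2.2.2.1) d.2.2.2.2.2.1 s ∧
      HasDerivAt (fun s => (γ s).2.2.2.2.2.2) d.2.2.2.2.2.2 s := by
  simp only [hasDerivAt_prod_iff]

theorem lD_sq {x y t : ℝ} (h : 0 < sqD x y t) : lD x y t ^ 2 * sqD x y t = 1 := by
  rw [lD, inv_pow, Real.sq_sqrt h.le, inv_mul_cancel₀ h.ne']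

theorem hasDerivAt_lD {x y t : ℝ → ℝ} {x' y' t' s : ℝ} (hx : HasDerivAt x x' s)
    (hy : HasDerivAt y y' s) (ht : HasDerivAt t t' s) (h : 0 < sqD (x s) (y s) (t s)) :
    HasDerivAt (fun s => lD (x s) (y s) (t s))
      (-(lD (x s) (y s) (t s) ^ 3 *
        ((((x s) ^ 2 - (y s) ^ 2) / 2 + cos (t s)) * (x s * x' - y s * y' - sin (t s) * t') +
          (x s * y s + sin (t s)) * (x' * y s + x s * y' + cos (t s) * t')))) s := by
  have h1 := ((((hx.fun_pow 2).sub (hy.fun_pow 2)).div_const 2).add ht.cos).fun_pow 2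
  have h2 := ((hx.mul hy).add ht.sin).fun_pow 2
  have h3 := ((h1.add h2).sqrt h.ne').fun_inv (Real.sqrt_pos.2 h).ne'
  refine h3.congr_deriv ?_
  have e : √(((x s ^ 2 - y s ^ 2) / 2 + cos (t s)) ^ 2 + (x s * y s + sin (t s)) ^ 2) =
    √(sqD (x s) (y s) (t s)) := rfl
  simp only [lD, Pi.add_apply, Pi.sub_apply, Pi.mul_apply, e]
  have := (Real.sqrt_pos.2 h).ne'
  field_simp
  push_cast
  ring

theorem hasDerivAt_lV {x y t : ℝ → ℝ} {x' y' t' s : ℝ} (hx : HasDerivAt x x' s)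
    (hy : HasDerivAt y y' s) (ht : HasDerivAt t t' s) (h : 0 < sqD (x s) (y s) (t s)) :
    HasDerivAt (fun s => lV (x s) (y s) (t s))
      (-((x s * x' - y s * y') * lf₁ (x s) (y s) (t s) +
          (x' * y s + x s * y') * lf₂ (x s) (y s) (t s)) +
        t' * (((x s) ^ 2 - (y s) ^ 2) / 2 * lf₂ (x s) (y s) (t s) -
          x s * y s * lf₁ (x s) (y s) (t s))) s := by
  have h1 := ((((hx.fun_pow 2).sub (hy.fun_pow 2)).div_const 2).mul ht.cos)
  have h2 := (hx.mul hy).mul ht.sin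
  have h3 := (hasDerivAt_lD hx hy ht h).fun_neg.sub (h1.add h2)
  refine h3.congr_deriv ?_
  simp only [lf₁, lf₂, Pi.sub_apply, Pi.mul_apply]
  push_cast
  ring

/-- The data of a curve following the regularised flow. -/
theorem lc_deriv {Y : ℝ → LS} {s : ℝ} (h : HasDerivAt Y (lc (Y s)) s) :
    HasDerivAt (fun s => (Y s).1) (Y s).2.2.1 s ∧ HasDerivAt (fun s => (Y s).2.1) (Y s).2.2.2.1 s ∧
      HasDerivAt (fun s => (Y s).2.2.1) (lc (Y s)).2.2.1 s ∧
      HasDerivAt (fun s => (Y s).2.2.2.1) (lc (Y s)).2.2.2.1 s ∧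
      HasDerivAt (fun s => (Y s).2.2.2.2.1) (((Y s).1 ^ 2 + (Y s).2.1 ^ 2) / 2) s ∧
      HasDerivAt (fun s => (Y s).2.2.2.2.2.1) 0 s ∧
      HasDerivAt (fun s => (Y s).2.2.2.2.2.2) 0 s :=
  hasDerivAt_LS.1 h

/-- The torque about the first primary, per unit mass ratio. -/
noncomputable def ltq (x y t : ℝ) : ℝ :=
  (x ^ 2 + y ^ 2) / 2 * ((x ^ 2 - y ^ 2) / 2 * lf₂ x y t - x * y * lf₁ x y t)

theorem hasDerivAt_lG {Y : ℝ → LS} {s : ℝ} (h : HasDerivAt Y (lc (Y s)) s) :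
    HasDerivAt (fun s => (Y s).1 * (Y s).2.2.2.1 - (Y s).2.1 * (Y s).2.2.1)
      ((Y s).2.2.2.2.2.2 * ltq (Y s).1 (Y s).2.1 (Y s).2.2.2.2.1) s := by
  obtain ⟨dx, dy, du, dw, -⟩ := lc_deriv h
  refine ((dx.mul dw).sub (dy.mul du)).congr_deriv ?_
  simp only [lc, ltq]
  ring

theorem hasDerivAt_lh {Y : ℝ → LS} {s : ℝ} (h : HasDerivAt Y (lc (Y s)) s) (hU : Y s ∈ lU) :
    HasDerivAt (fun s => lh (Y s))
      ((Y s).2.2.2.2.2.2 *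
        (((Y s).1 * (Y s).2.2.1 - (Y s).2.1 * (Y s).2.2.2.1) *
          lf₁ (Y s).1 (Y s).2.1 (Y s).2.2.2.2.1 +
        ((Y s).2.2.1 * (Y s).2.1 + (Y s).1 * (Y s).2.2.2.1) *
          lf₂ (Y s).1 (Y s).2.1 (Y s).2.2.2.2.1)) s := by
  obtain ⟨dx, dy, du, dw, dt, dJ', dμ⟩ := lc_deriv h
  refine ((dJ'.add (hasDerivAt_lG h)).sub (dμ.mul (hasDerivAt_lV dx dy dt hU))).congr_deriv ?_
  simp only [ltq]
  ring

theorem hasDerivAt_lK {Y : ℝ → LS} {s : ℝ} (h : HasDerivAt Y (lc (Y s)) s) (hU : Y s ∈ lU) :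
    HasDerivAt (fun s => lK (Y s)) 0 s := by
  obtain ⟨dx, dy, du, dw, dt, dJ', dμ⟩ := lc_deriv h
  refine ((((du.fun_pow 2).add (dw.fun_pow 2)).sub (dμ.const_sub 1)).sub
    ((hasDerivAt_lh h hU).mul (((dx.fun_pow 2).add (dy.fun_pow 2)).div_const 2))).congr_deriv ?_
  simp only [lc, Pi.add_apply]
  push_cast
  ring

theorem dS_lcC (Y : LS) : dS Y.2.2.2.2.2.2 (lcC Y).1 (lcC Y).2.1 = (Y.1 ^ 2 + Y.2.1 ^ 2) / 2 := by
  rw [dS, Real.sqrt_eq_iff_mul_self_eq (by positivity) (by positivity)]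
  simp only [lcC]
  linear_combination ((Y.1 ^ 2 + Y.2.1 ^ 2) / 2) ^ 2 * cos_sq_add_sin_sq Y.2.2.2.2.1

theorem dJ_lcC (Y : LS) :
    dJ Y.2.2.2.2.2.2 (lcC Y).1 (lcC Y).2.1 = √(sqD Y.1 Y.2.1 Y.2.2.2.2.1) := by
  rw [dJ]
  congr 1
  simp only [lcC, sqD]
  linear_combination (((Y.1 ^ 2 + Y.2.1 ^ 2) / 2) ^ 2 - 1) * cos_sq_add_sin_sq Y.2.2.2.2.1

theorem lcC_NC {Y : LS} (hU : Y ∈ lU) (hz : 0 < Y.1 ^ 2 + Y.2.1 ^ 2) : NC Y.2.2.2.2.2.2 (lcC Y) := by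
  constructor <;> intro he <;> simp only [Prod.mk.injEq] at he
  · have := dS_lcC Y
    rw [he.1, he.2] at this
    simp [dS] at this
    linarith
  · have := dJ_lcC Y
    rw [he.1, he.2] at this
    have h2 := Real.sqrt_pos.2 hU
    rw [← this] at h2
    simp [dJ] at h2

theorem hasDerivAt_lcC {Y : ℝ → LS} {s : ℝ} (h : HasDerivAt Y (lc (Y s)) s)
    (hz : 0 < (Y s).1 ^ 2 + (Y s).2.1 ^ 2) (hK : lK (Y s) = 0) :
    HasDerivAt (fun s => lcC (Y s))
      ((((Y s).1 ^ 2 + (Y s).2.1 ^ 2) / 2) • cart (Y s).2.2.2.2.2.2 (lcC (Y s))) s := by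
  obtain ⟨dx, dy, du, dw, dt, dJ', dμ⟩ := lc_deriv h
  have hi := (((dx.fun_pow 2).fun_add (dy.fun_pow 2)).div_const 2).fun_inv (by positivity)
  have hQ1 := ((dx.fun_pow 2).fun_sub (dy.fun_pow 2)).div_const 2
  have hQ2 := dx.fun_mul dy
  have hR1 := (dx.fun_mul du).fun_sub (dy.fun_mul dw)
  have hR2 := (dx.fun_mul dw).fun_add (dy.fun_mul du)
  have e1 := dS_lcC (Y s)
  have e2 := dJ_lcC (Y s)
  have e3 : (√(sqD (Y s).1 (Y s).2.1 (Y s).2.2.2.2.1))⁻¹ = lD (Y s).1 (Y s).2.1 (Y s).2.2.2.2.1 := rfl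
  rw [hasDerivAt_FS]
  simp only [cart, e1, e2, Prod.smul_fst, Prod.smul_snd, smul_eq_mul]
  simp only [div_eq_mul_inv, ← inv_pow, e3]
  simp only [lcC]
  refine ⟨(((hQ1.fun_mul dt.cos).fun_add (hQ2.fun_mul dt.sin)).fun_neg.fun_sub dμ).congr_deriv ?_,
    ((hQ2.fun_mul dt.cos).fun_sub (hQ1.fun_mul dt.sin)).fun_neg.congr_deriv ?_,
    (hi.fun_neg.fun_mul ((hR1.fun_mul dt.cos).fun_add (hR2.fun_mul dt.sin))).congr_deriv ?_,
    ((hi.fun_neg.fun_mul ((hR2.fun_mul dt.cos).fun_sub (hR1.fun_mul dt.sin))).fun_sub dμ).congr_deriv ?_⟩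
  all_goals
    simp only [lc, lf₁, lf₂, lK] at *
    generalize lD (Y s).1 (Y s).2.1 (Y s).2.2.2.2.1 = δ at *
    generalize lh (Y s) = H at *
    have hcs := cos_sq_add_sin_sq (Y s).2.2.2.2.1
    generalize cos (Y s).2.2.2.2.1 = c at *
    generalize sin (Y s).2.2.2.2.1 = k at *
    generalize (Y s).1 = x at *
    generalize (Y s).2.1 = y at *
    generalize (Y s).2.2.1 = u at *
    generalize (Y s).2.2.2.1 = w at *
    generalize (Y s).2.2.2.2.2.2 = m at *
    clear e1 e2 e3 hi hQ1 hQ2 hR1 hR2 dx dy du dw dt dJ' dμ h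
    push_cast
    field_simp
  · ring
  · ring
  · linear_combination (-8 * m * (x ^ 2 + y ^ 2) ^ 3 * (1 - δ ^ 3)) * hcs +
      (32 * (c * (x ^ 2 - y ^ 2) + 2 * k * x * y)) * hK
  · linear_combination (32 * (2 * x * y * c - k * (x ^ 2 - y ^ 2))) * hK

theorem exists_reparametrization {t t' : ℝ → ℝ} {a b : ℝ}
    (ht : ∀ s ∈ Icc a b, HasDerivAt t (t' s) s) (hpos : ∀ s ∈ Icc a b, 0 < t' s) :
    StrictMonoOn t (Icc a b) ∧ ∃ σ : ℝ → ℝ, (∀ s ∈ Icc a b, σ (t s) = s) ∧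
      ∀ s ∈ Ioo a b, HasDerivAt σ (t' s)⁻¹ (t s) := by
  have hc : ContinuousOn t (Icc a b) := fun s hs => (ht s hs).continuousAt.continuousWithinAt
  have hm : StrictMonoOn t (Icc a b) := fun x hx y hy hxy =>
    lt_of_hasDerivAt_pos hxy (fun s hs => ht s ⟨hx.1.trans hs.1, hs.2.trans hy.2⟩)
      (fun s hs => hpos s ⟨hx.1.trans hs.1.le, hs.2.le.trans hy.2⟩)
  have hσ : ∀ s ∈ Icc a b, Function.invFunOn t (Icc a b) (t s) = s := fun s hs =>
    hm.injOn (Function.invFunOn_mem ⟨s, hs, rfl⟩) hs (Function.invFunOn_eq ⟨s, hs, rfl⟩)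
  refine ⟨hm, Function.invFunOn t (Icc a b), hσ, fun s hs => ?_⟩
  have hab : a < b := hs.1.trans hs.2
  have ia : a ∈ Icc a b := ⟨le_rfl, hab.le⟩
  have ib : b ∈ Icc a b := ⟨hab.le, le_rfl⟩
  have is := Ioo_subset_Icc_self hs
  have him : Ioo (t a) (t b) ⊆ t '' Ioo a b := intermediate_value_Ioo hab.le hc
  have hn : Ioo (t a) (t b) ∈ 𝓝 (t s) := Ioo_mem_nhds (hm ia is hs.1) (hm is ib hs.2)
  have hcont : ContinuousAt (Function.invFunOn t (Icc a b)) (t s) := by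
    refine StrictMonoOn.continuousAt_of_image_mem_nhds (s := t '' Ioo a b) ?_
      (mem_of_superset hn him) ?_
    · rintro _ ⟨x, hx, rfl⟩ _ ⟨y, hy, rfl⟩ hxy
      rw [hσ x (Ioo_subset_Icc_self hx), hσ y (Ioo_subset_Icc_self hy)]
      exact (hm.lt_iff_lt (Ioo_subset_Icc_self hx) (Ioo_subset_Icc_self hy)).1 hxy
    · rw [hσ s is]
      refine mem_of_superset (Ioo_mem_nhds hs.1 hs.2) fun x hx => ?_
      exact ⟨t x, ⟨x, hx, rfl⟩, hσ x (Ioo_subset_Icc_self hx)⟩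
  have hd := ht s is
  rw [← hσ s is] at hd
  rw [hσ s is] at hd
  refine HasDerivAt.of_local_left_inverse hcont (by rw [hσ s is]; exact hd) (hpos s is).ne' ?_
  filter_upwards [hn] with y hy
  obtain ⟨x, hx, rfl⟩ := him hy
  rw [hσ x (Ioo_subset_Icc_self hx)]

theorem reach_lc {μ a b S : ℝ} {Y : ℝ → LS} (ha : a < 0) (hS : 0 < S) (hb : S < b)
    (hY : ∀ s ∈ Icc a b, HasDerivAt Y (lc (Y s)) s) (hU : ∀ s ∈ Icc a b, Y s ∈ lU)
    (hz : ∀ s ∈ Icc a b, 0 < (Y s).1 ^ 2 + (Y s).2.1 ^ 2) (hK : lK (Y 0) = 0)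
    (hμ : (Y 0).2.2.2.2.2.2 = μ) : ∃ T, Reach μ T (lcC (Y 0)) (lcC (Y S)) ∅ := by
  have hconst : ∀ {f : ℝ → ℝ}, (∀ s ∈ Icc a b, HasDerivAt f 0 s) → ∀ s ∈ Icc a b, f s = f 0 := by
    intro f hf s hs
    have := (convex_Icc a b).norm_image_sub_le_of_norm_hasDerivWithin_le (C := 0)
      (fun x hx => (hf x hx).hasDerivWithinAt) (by simp) ⟨ha.le, (hS.trans hb).le⟩ hs
    simpa [sub_eq_zero] using this
  have hK' : ∀ s ∈ Icc a b, lK (Y s) = 0 := fun s hs =>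
    (hconst (fun s hs => hasDerivAt_lK (hY s hs) (hU s hs)) s hs).trans hK
  have hμ' : ∀ s ∈ Icc a b, (Y s).2.2.2.2.2.2 = μ := fun s hs =>
    (hconst (fun s hs => (lc_deriv (hY s hs)).2.2.2.2.2.2) s hs).trans hμ
  obtain ⟨hm, σ, hσ, hσ'⟩ := exists_reparametrization
    (fun s hs => (lc_deriv (hY s hs)).2.2.2.2.1) (fun s hs => half_pos (hz s hs))
  have i0 : (0 : ℝ) ∈ Icc a b := ⟨ha.le, (hS.trans hb).le⟩
  have iS : S ∈ Icc a b := ⟨(ha.trans hS).le, hb.le⟩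
  have h0S := hm i0 iS hS
  refine ⟨(Y S).2.2.2.2.1 - (Y 0).2.2.2.2.1, sub_pos.2 h0S,
    fun τ => lcC (Y (σ (τ + (Y 0).2.2.2.2.1))), by simp [hσ 0 i0], by simp [hσ S iS], ?_, by simp⟩
  intro τ hτ
  have hcont : ContinuousOn (fun s => (Y s).2.2.2.2.1) (Icc 0 S) := fun s hs =>
    (lc_deriv (hY s ⟨ha.le.trans hs.1, hs.2.trans hb.le⟩)).2.2.2.2.1.continuousAt.continuousWithinAt
  obtain ⟨s, hs, hsτ⟩ := intermediate_value_Icc hS.le hcont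
    (show τ + (Y 0).2.2.2.2.1 ∈ Icc _ _ from ⟨by linarith [hτ.1], by linarith [hτ.2]⟩)
  simp only at hsτ
  have is : s ∈ Ioo a b := ⟨by linarith [hs.1], by linarith [hs.2]⟩
  have is' := Ioo_subset_Icc_self is
  have e : σ (τ + (Y 0).2.2.2.2.1) = s := by rw [← hsτ, hσ s is']
  have hσd := hσ' s is
  rw [hsτ] at hσd
  have hd := hasDerivAt_lcC (hY s is') (hz s is') (hK' s is')
  rw [← e] at hd
  have h := hd.scomp (τ + (Y 0).2.2.2.2.1) hσd
  rw [e, hμ' s is', smul_smul, inv_mul_cancel₀ (half_pos (hz s is')).ne', one_smul] at h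
  refine ⟨?_, ?_⟩
  · simp only [e]
    rw [← hμ' s is']
    exact lcC_NC (hU s is') (hz s is')
  · simp only [e]
    exact h.comp_add_const τ (Y 0).2.2.2.2.1

/-! ### From the regularised flow to the far region -/

/-- Position relative to the barycentre in the inertial frame. -/
noncomputable def lX₁ (Y : LS) : ℝ := (Y.1 ^ 2 - Y.2.1 ^ 2) / 2 + Y.2.2.2.2.2.2 * cos Y.2.2.2.2.1
/-- Position relative to the barycentre in the inertial frame. -/
noncomputable def lX₂ (Y : LS) : ℝ := Y.1 * Y.2.1 + Y.2.2.2.2.2.2 * sin Y.2.2.2.2.1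
/-- Velocity in the inertial frame. -/
noncomputable def lP₁ (Y : LS) : ℝ :=
  ((Y.1 ^ 2 + Y.2.1 ^ 2) / 2)⁻¹ * (Y.1 * Y.2.2.1 - Y.2.1 * Y.2.2.2.1) -
    Y.2.2.2.2.2.2 * sin Y.2.2.2.2.1
/-- Velocity in the inertial frame. -/
noncomputable def lP₂ (Y : LS) : ℝ :=
  ((Y.1 ^ 2 + Y.2.1 ^ 2) / 2)⁻¹ * (Y.1 * Y.2.2.2.1 + Y.2.1 * Y.2.2.1) +
    Y.2.2.2.2.2.2 * cos Y.2.2.2.2.1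

/-- Polar coordinates of a regularised state. -/
noncomputable def lcF (Y : LS) : FS :=
  (√(lX₁ Y ^ 2 + lX₂ Y ^ 2), (lP₁ Y * lX₁ Y + lP₂ Y * lX₂ Y) * (√(lX₁ Y ^ 2 + lX₂ Y ^ 2))⁻¹,
    π - Y.2.2.2.2.1 + arctan (lX₂ Y / lX₁ Y), lP₂ Y * lX₁ Y - lP₁ Y * lX₂ Y)

theorem cos_lcF {Y : LS} (h : 0 < lX₁ Y) : (lcF Y).1 * cos (lcF Y).2.2.1 =
    -(lX₁ Y * cos Y.2.2.2.2.1 + lX₂ Y * sin Y.2.2.2.2.1) ∧ (lcF Y).1 * sin (lcF Y).2.2.1 =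
    lX₁ Y * sin Y.2.2.2.2.1 - lX₂ Y * cos Y.2.2.2.2.1 := by
  have hr : 0 < √(lX₁ Y ^ 2 + lX₂ Y ^ 2) := Real.sqrt_pos.2 (by positivity)
  have hq : √(1 + (lX₂ Y / lX₁ Y) ^ 2) = √(lX₁ Y ^ 2 + lX₂ Y ^ 2) / lX₁ Y := by
    rw [show 1 + (lX₂ Y / lX₁ Y) ^ 2 = (lX₁ Y ^ 2 + lX₂ Y ^ 2) / lX₁ Y ^ 2 by field_simp,
      Real.sqrt_div (by positivity), Real.sqrt_sq h.le]
  have hc : √(lX₁ Y ^ 2 + lX₂ Y ^ 2) * cos (arctan (lX₂ Y / lX₁ Y)) = lX₁ Y := by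
    rw [cos_arctan, hq]; field_simp
  have hs : √(lX₁ Y ^ 2 + lX₂ Y ^ 2) * sin (arctan (lX₂ Y / lX₁ Y)) = lX₂ Y := by
    rw [sin_arctan, hq]; field_simp
  have e : (lcF Y).2.2.1 = π - (Y.2.2.2.2.1 - arctan (lX₂ Y / lX₁ Y)) := by
    simp only [lcF]; ring
  rw [e, cos_pi_sub, sin_pi_sub, cos_sub, sin_sub]
  simp only [lcF]
  constructor
  · linear_combination (-cos Y.2.2.2.2.1) * hc - sin Y.2.2.2.2.1 * hs
  · linear_combination sin Y.2.2.2.2.1 * hc - cos Y.2.2.2.2.1 * hs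

theorem toC_lcF {Y : LS} (h : 0 < lX₁ Y) : toC (lcF Y) = lcC Y := by
  obtain ⟨hc, hs⟩ := cos_lcF h
  have hr : 0 < √(lX₁ Y ^ 2 + lX₂ Y ^ 2) := Real.sqrt_pos.2 (by positivity)
  have hr' : (lcF Y).1 = √(lX₁ Y ^ 2 + lX₂ Y ^ 2) := rfl
  have hsq : (lcF Y).1 ^ 2 = lX₁ Y ^ 2 + lX₂ Y ^ 2 := by rw [hr', Real.sq_sqrt (by positivity)]
  have hv : (lcF Y).2.1 = (lP₁ Y * lX₁ Y + lP₂ Y * lX₂ Y) * (lcF Y).1⁻¹ := rfl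
  have hG : (lcF Y).2.2.2 = lP₂ Y * lX₁ Y - lP₁ Y * lX₂ Y := rfl
  rw [← hr'] at hr
  have hcs := cos_sq_add_sin_sq Y.2.2.2.2.1
  have h3 : (lcF Y).2.1 * cos (lcF Y).2.2.1 - (lcF Y).2.2.2 * (lcF Y).1⁻¹ * sin (lcF Y).2.2.1 =
      -(lP₁ Y * cos Y.2.2.2.2.1 + lP₂ Y * sin Y.2.2.2.2.1) := by
    refine mul_left_cancel₀ (pow_pos hr 2).ne' ?_
    rw [hv, hG]
    have : (lcF Y).1 ^ 2 * ((lP₁ Y * lX₁ Y + lP₂ Y * lX₂ Y) * (lcF Y).1⁻¹ * cos (lcF Y).2.2.1 -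
        (lP₂ Y * lX₁ Y - lP₁ Y * lX₂ Y) * (lcF Y).1⁻¹ * sin (lcF Y).2.2.1) =
        (lP₁ Y * lX₁ Y + lP₂ Y * lX₂ Y) * ((lcF Y).1 * cos (lcF Y).2.2.1) -
        (lP₂ Y * lX₁ Y - lP₁ Y * lX₂ Y) * ((lcF Y).1 * sin (lcF Y).2.2.1) := by field_simp
    rw [this, hc, hs, hsq]
    ring
  have h4 : (lcF Y).2.1 * sin (lcF Y).2.2.1 + (lcF Y).2.2.2 * (lcF Y).1⁻¹ * cos (lcF Y).2.2.1 =
      -(lP₂ Y * cos Y.2.2.2.2.1 - lP₁ Y * sin Y.2.2.2.2.1) := by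
    refine mul_left_cancel₀ (pow_pos hr 2).ne' ?_
    rw [hv, hG]
    have : (lcF Y).1 ^ 2 * ((lP₁ Y * lX₁ Y + lP₂ Y * lX₂ Y) * (lcF Y).1⁻¹ * sin (lcF Y).2.2.1 +
        (lP₂ Y * lX₁ Y - lP₁ Y * lX₂ Y) * (lcF Y).1⁻¹ * cos (lcF Y).2.2.1) =
        (lP₁ Y * lX₁ Y + lP₂ Y * lX₂ Y) * ((lcF Y).1 * sin (lcF Y).2.2.1) +
        (lP₂ Y * lX₁ Y - lP₁ Y * lX₂ Y) * ((lcF Y).1 * cos (lcF Y).2.2.1) := by field_simp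
    rw [this, hc, hs, hsq]
    ring
  simp only [toC, hc, hs, h3, h4, lcC, Prod.mk.injEq, lX₁, lX₂, lP₁, lP₂]
  refine ⟨?_, ?_, ?_, ?_⟩
  · linear_combination (-Y.2.2.2.2.2.2) * hcs
  · ring
  · ring
  · linear_combination (-Y.2.2.2.2.2.2) * hcs

theorem lcF_G {Y : LS} (hz : 0 < Y.1 ^ 2 + Y.2.1 ^ 2) : (lcF Y).2.2.2 =
    (Y.1 * Y.2.2.2.1 - Y.2.1 * Y.2.2.1) + Y.2.2.2.2.2.2 *
      ((Y.1 ^ 2 - Y.2.1 ^ 2) / 2 * cos Y.2.2.2.2.1 + Y.1 * Y.2.1 * sin Y.2.2.2.2.1 +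
      ((Y.1 ^ 2 + Y.2.1 ^ 2) / 2)⁻¹ * ((Y.1 * Y.2.2.2.1 + Y.2.1 * Y.2.2.1) * cos Y.2.2.2.2.1 -
        (Y.1 * Y.2.2.1 - Y.2.1 * Y.2.2.2.1) * sin Y.2.2.2.2.1)) + Y.2.2.2.2.2.2 ^ 2 := by
  have hcs := cos_sq_add_sin_sq Y.2.2.2.2.1
  have hi : ((Y.1 ^ 2 + Y.2.1 ^ 2) / 2)⁻¹ * ((Y.1 ^ 2 + Y.2.1 ^ 2) / 2) = 1 :=
    inv_mul_cancel₀ (half_pos hz).ne'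
  simp only [lcF, lX₁, lX₂, lP₁, lP₂]
  linear_combination Y.2.2.2.2.2.2 ^ 2 * hcs + (Y.1 * Y.2.2.2.1 - Y.2.1 * Y.2.2.1) * hi

theorem Jb_lcF {Y : LS} (h : 0 < lX₁ Y) (hz : 0 < Y.1 ^ 2 + Y.2.1 ^ 2) (hK : lK Y = 0) :
    Jb Y.2.2.2.2.2.2 (lcF Y) = Y.2.2.2.2.2.1 - Y.2.2.2.2.2.2 ^ 2 / 2 := by
  have hC := toC_lcF h
  have i1 : iD Y.2.2.2.2.2.2 (lcF Y).1 (lcF Y).2.2.1 = ((Y.1 ^ 2 + Y.2.1 ^ 2) / 2)⁻¹ := by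
    rw [← dS_lcC, ← hC, ← inv_dist_eq]; rfl
  have i2 : iD (Y.2.2.2.2.2.2 - 1) (lcF Y).1 (lcF Y).2.2.1 = lD Y.1 Y.2.1 Y.2.2.2.2.1 := by
    rw [lD, ← dJ_lcC, ← hC, ← inv_dist_eq, dJ, toC]; congr 4; ring
  have hr : 0 < lX₁ Y ^ 2 + lX₂ Y ^ 2 := by positivity
  have hkin : (lcF Y).2.1 ^ 2 + ((lcF Y).2.2.2 * (lcF Y).1⁻¹) ^ 2 = lP₁ Y ^ 2 + lP₂ Y ^ 2 := by
    simp only [lcF]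
    rw [mul_pow, mul_pow, inv_pow, Real.sq_sqrt hr.le]
    field_simp
    ring
  have hJ : Jb Y.2.2.2.2.2.2 (lcF Y) =
      ((lcF Y).2.1 ^ 2 + ((lcF Y).2.2.2 * (lcF Y).1⁻¹) ^ 2) / 2 +
        pot Y.2.2.2.2.2.2 (lcF Y).1 (lcF Y).2.2.1 - (lcF Y).2.2.2 := by
    simp only [Jb]; ring
  rw [hJ, hkin, pot, i1, i2, lcF_G hz]
  have hi : ((Y.1 ^ 2 + Y.2.1 ^ 2) / 2)⁻¹ * ((Y.1 ^ 2 + Y.2.1 ^ 2) / 2) = 1 :=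
    inv_mul_cancel₀ (half_pos hz).ne'
  have hcs := cos_sq_add_sin_sq Y.2.2.2.2.1
  simp only [lP₁, lP₂]
  simp only [lK, lh, lV] at hK
  generalize ((Y.1 ^ 2 + Y.2.1 ^ 2) / 2)⁻¹ = ι at *
  linear_combination ι * hK + ((Y.2.2.2.2.2.1 + (Y.1 * Y.2.2.2.1 - Y.2.1 * Y.2.2.1) -
    Y.2.2.2.2.2.2 * (-lD Y.1 Y.2.1 Y.2.2.2.2.1 - ((Y.1 ^ 2 - Y.2.1 ^ 2) / 2 *
    cos Y.2.2.2.2.1 + Y.1 * Y.2.1 * sin Y.2.2.2.2.1))) + ι * (Y.2.2.1 ^ 2 + Y.2.2.2.1 ^ 2)) * hi +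
    (Y.2.2.2.2.2.2 ^ 2 / 2) * hcs

end PCRTBP

namespace PCRTBP

open Set

/-! ### The ideal collision orbit and its Melnikov derivative -/

theorem near_linear {E F : Type*} [NormedAddCommGroup E] [NormedSpace ℝ E]
    [NormedAddCommGroup F] [NormedSpace ℝ F] {f : E → F} {U : Set E} (hU : IsOpen U)
    (hf : ContDiffOn ℝ 1 f U) {γ : ℝ → E} {a b : ℝ} (hγ : ContinuousOn γ (Icc a b))
    (hγU : ∀ s ∈ Icc a b, γ s ∈ U) (e : E) :
    ∃ C > 0, ∀ ε > 0, ∃ ρ > 0, ∀ s ∈ Icc a b, ∀ y y', dist y (γ s) ≤ ρ → dist y' (γ s) ≤ ρ →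
      ∀ δ : ℝ, ‖f y - f y' + δ • fderiv ℝ f (γ s) e‖ ≤ ε * |δ| + C * ‖y - y' + δ • e‖ := by
  have hcont : ContinuousOn (fun s => fderiv ℝ f (γ s)) (Icc a b) :=
    (hf.continuousOn_fderiv_of_isOpen hU le_rfl).comp hγ hγU
  obtain ⟨M, hM⟩ := isCompact_Icc.exists_bound_of_continuousOn hcont
  refine ⟨|M| + 1, by positivity, fun ε hε => ?_⟩
  obtain ⟨ρ, hρ, h⟩ := uniform_hasFDerivAt_near_curve hU hf hγ hγU
    (ε := min 1 (ε / (‖e‖ + 1))) (by positivity)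
  refine ⟨ρ, hρ, fun s hs y y' hy hy' δ => ?_⟩
  have h1 := (h s hs y y' hy hy').2
  have hn : ‖y - y'‖ ≤ ‖y - y' + δ • e‖ + |δ| * ‖e‖ := by
    have := norm_sub_le (y - y' + δ • e) (δ • e)
    rwa [add_sub_cancel_right, norm_smul, norm_eq_abs] at this
  have h2 : ‖fderiv ℝ f (γ s) (y - y' + δ • e)‖ ≤ |M| * ‖y - y' + δ • e‖ :=
    (ContinuousLinearMap.le_opNorm _ _).trans
      (by gcongr; exact (hM s hs).trans (le_abs_self M))
  have e1 : f y - f y' + δ • fderiv ℝ f (γ s) e =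
      (f y - f y' - fderiv ℝ f (γ s) (y - y')) + fderiv ℝ f (γ s) (y - y' + δ • e) := by
    rw [map_add, map_smul]; abel
  rw [e1]
  refine (norm_add_le _ _).trans ?_
  have h3 : min 1 (ε / (‖e‖ + 1)) * ‖y - y'‖ ≤ ‖y - y' + δ • e‖ + ε * |δ| := by
    have he : ε / (‖e‖ + 1) * ‖e‖ ≤ ε := by
      rw [div_mul_eq_mul_div, div_le_iff₀ (by positivity)]
      nlinarith [norm_nonneg e]
    calc min 1 (ε / (‖e‖ + 1)) * ‖y - y'‖
        ≤ min 1 (ε / (‖e‖ + 1)) * (‖y - y' + δ • e‖ + |δ| * ‖e‖) := by gcongr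
      _ = min 1 (ε / (‖e‖ + 1)) * ‖y - y' + δ • e‖ +
          min 1 (ε / (‖e‖ + 1)) * (|δ| * ‖e‖) := by ring
      _ ≤ 1 * ‖y - y' + δ • e‖ + ε / (‖e‖ + 1) * (|δ| * ‖e‖) := by
        gcongr
        · exact min_le_left _ _
        · exact min_le_right _ _
      _ ≤ _ := by nlinarith [abs_nonneg δ]
  linarith

/-- The ejection orbit of the unperturbed problem at zero energy. -/
noncomputable def ideal (s : ℝ) : LS := (s, 0, 1, 0, s ^ 3 / 6, 0, 0)

theorem hasDerivAt_ideal (s : ℝ) : HasDerivAt ideal (lc (ideal s)) s := by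
  rw [hasDerivAt_LS]
  simp only [ideal, lc, lh]
  refine ⟨hasDerivAt_id s, (hasDerivAt_const s 0).congr_deriv (by ring),
    (hasDerivAt_const s 1).congr_deriv (by ring), (hasDerivAt_const s 0).congr_deriv (by ring),
    ((hasDerivAt_pow 3 s).div_const 6).congr_deriv (by push_cast; ring),
    hasDerivAt_const s 0, hasDerivAt_const s 0⟩

theorem sqD_ideal (s : ℝ) :
    sqD s 0 (s ^ 3 / 6) = 1 + (s ^ 2 / 2) ^ 2 + 2 * (s ^ 2 / 2) * cos (s ^ 3 / 6) := by
  simp only [sqD]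
  linear_combination cos_sq_add_sin_sq (s ^ 3 / 6)

theorem sqD_ideal_pos (s : ℝ) : 0 < sqD s 0 (s ^ 3 / 6) := by
  rw [sqD_ideal]
  by_contra! h
  have hc := neg_one_le_cos (s ^ 3 / 6)
  have hr : 0 ≤ s ^ 2 / 2 := by positivity
  have h1 : (1 - s ^ 2 / 2) ^ 2 ≤ 0 := by nlinarith
  have h2 : s ^ 2 = 2 := by
    have := pow_eq_zero_iff (two_ne_zero) |>.1 (le_antisymm h1 (sq_nonneg _))
    linarith
  have h3 : cos (s ^ 3 / 6) ≤ -1 := by rw [h2] at h; norm_num at h; linarith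
  have h4 := one_sub_sq_div_two_le_cos (x := s ^ 3 / 6)
  have h5 : (s ^ 3 / 6) ^ 2 = 8 / 36 := by
    rw [show (s ^ 3 / 6) ^ 2 = (s ^ 2) ^ 3 / 36 by ring, h2]; norm_num
  linarith

theorem ideal_mem_lU (s : ℝ) : ideal s ∈ lU := sqD_ideal_pos s

/-- The derivative of the torque in the time variable along the ideal orbit. -/
noncomputable def dtq (s : ℝ) : ℝ :=
  (s ^ 2 / 2) ^ 2 * cos (s ^ 3 / 6) - ((s ^ 2 / 2) ^ 2 * cos (s ^ 3 / 6) * lD s 0 (s ^ 3 / 6) ^ 3 +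
    3 * (s ^ 2 / 2) ^ 3 * sin (s ^ 3 / 6) ^ 2 * lD s 0 (s ^ 3 / 6) ^ 5)

theorem hasDerivAt_ltq (s : ℝ) : HasDerivAt (fun t => ltq s 0 t) (dtq s) (s ^ 3 / 6) := by
  have h := hasDerivAt_lD (hasDerivAt_const (s ^ 3 / 6) s) (hasDerivAt_const (s ^ 3 / 6) 0)
    (hasDerivAt_id (s ^ 3 / 6)) (sqD_ideal_pos s)
  have h2 := (((hasDerivAt_sin (s ^ 3 / 6)).mul (h.fun_pow 3)).const_mul ((s ^ 2 / 2) ^ 2))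
  have h3 := ((hasDerivAt_sin (s ^ 3 / 6)).const_mul ((s ^ 2 / 2) ^ 2)).fun_sub h2
  refine (h3.congr_deriv ?_).congr_of_eventuallyEq (Eventually.of_forall fun t => ?_)
  · simp only [dtq, id]; push_cast; ring
  · simp only [ltq, lf₂, id, Pi.mul_apply]; ring

theorem continuous_dtq : Continuous dtq := by
  have h : Continuous fun s : ℝ => lD s 0 (s ^ 3 / 6) := by
    refine Continuous.inv₀ ?_ fun s => (Real.sqrt_pos.2 (sqD_ideal_pos s)).ne'
    simp only [sqD]
    fun_prop
  unfold dtq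
  fun_prop

theorem sub_cube_le_sin {t : ℝ} (ht : 0 ≤ t) : t - t ^ 3 / 6 ≤ sin t := by
  have h := le_of_hasDerivAt_nonneg (f := fun t => sin t - (t - t ^ 3 / 6)) ht
    (fun x _ => (hasDerivAt_sin x).fun_sub
      ((hasDerivAt_id x).fun_sub ((hasDerivAt_pow 3 x).div_const 6)))
    (fun x _ => by push_cast; linarith [one_sub_sq_div_two_le_cos (x := x)])
  simp only [sin_zero] at h
  linarith

theorem dtq_early {s : ℝ} (h0 : 0 ≤ s) (h1 : s ≤ 12 / 5) :
    0 ≤ (s ^ 2 / 2) ^ 2 * cos (s ^ 3 / 6) - dtq s := by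
  have hd := lD_sq (sqD_ideal_pos s)
  have hd0 : 0 ≤ lD s 0 (s ^ 3 / 6) := inv_nonneg.2 (Real.sqrt_nonneg _)
  have hD := sqD_ideal s
  have hcs := cos_sq_add_sin_sq (s ^ 3 / 6)
  have e : (s ^ 2 / 2) ^ 2 * cos (s ^ 3 / 6) - dtq s = (s ^ 2 / 2) ^ 2 * lD s 0 (s ^ 3 / 6) ^ 5 *
      (3 * (s ^ 2 / 2) * sin (s ^ 3 / 6) ^ 2 + cos (s ^ 3 / 6) * sqD s 0 (s ^ 3 / 6)) := by
    simp only [dtq]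
    linear_combination (-(s ^ 2 / 2) ^ 2 * cos (s ^ 3 / 6) * lD s 0 (s ^ 3 / 6) ^ 3) * hd
  rw [e]
  refine mul_nonneg (by positivity) ?_
  rcases le_or_gt 0 (cos (s ^ 3 / 6)) with hc | hc
  · have := (sqD_ideal_pos s).le
    positivity
  · have hπ := pi_gt_d2
    have hs : 2 ≤ s := by
      by_contra! h
      have : s ^ 3 ≤ 2 ^ 3 := by gcongr
      have := cos_nonneg_of_neg_pi_div_two_le_of_le (x := s ^ 3 / 6)
        (by have : 0 ≤ s ^ 3 := by positivity
            linarith) (by linarith)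
      linarith
    have ht : s ^ 3 ≤ (12 / 5) ^ 3 := by gcongr
    have hc2 : -(7342 / 10000) ≤ cos (s ^ 3 / 6) := by
      have h := sin_le (x := s ^ 3 / 6 - π / 2) ?_
      · rw [sin_sub_pi_div_two] at h
        linarith
      · by_contra! hn
        have := cos_nonneg_of_neg_pi_div_two_le_of_le (x := s ^ 3 / 6)
          (by have : 0 ≤ s ^ 3 := by positivity
              linarith) (by linarith)
        linarith
    have hr1 : 2 ≤ s ^ 2 / 2 := by nlinarith
    have hr2 : s ^ 2 / 2 ≤ 72 / 25 := by nlinarith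
    rw [hD]
    generalize s ^ 2 / 2 = r at *
    generalize cos (s ^ 3 / 6) = c at *
    have e2 : 3 * r * sin (s ^ 3 / 6) ^ 2 + c * (1 + r ^ 2 + 2 * r * c) =
        3 * r + c * (1 + r ^ 2) - r * c ^ 2 := by linear_combination 3 * r * hcs
    rw [e2]
    have h3 : c ^ 2 ≤ (7342 / 10000) ^ 2 := by nlinarith
    have h4 : r * c ^ 2 ≤ r * (7342 / 10000) ^ 2 := by gcongr
    have h5 : -(7342 / 10000) * (1 + r ^ 2) ≤ c * (1 + r ^ 2) := by gcongr
    nlinarith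

theorem dtq_late {s : ℝ} (h1 : 12 / 5 ≤ s) :
    -(12 / s ^ 4 + 112 / s ^ 6) ≤ (s ^ 2 / 2) ^ 2 * cos (s ^ 3 / 6) - dtq s -
      2 / s ^ 2 * cos (s ^ 3 / 6) := by
  have hd := lD_sq (sqD_ideal_pos s)
  have hd0 : 0 ≤ lD s 0 (s ^ 3 / 6) := inv_nonneg.2 (Real.sqrt_nonneg _)
  have hD := sqD_ideal s
  have hs : 0 < s := by linarith
  have hc1 := neg_one_le_cos (s ^ 3 / 6)
  have hc2 := cos_le_one (s ^ 3 / 6)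
  have hr : 72 / 25 ≤ s ^ 2 / 2 := by nlinarith
  have eρ : 2 / s ^ 2 = (s ^ 2 / 2)⁻¹ := by rw [inv_div]
  have e1 : 12 / s ^ 4 + 112 / s ^ 6 = 3 * (s ^ 2 / 2)⁻¹ ^ 2 + 14 * (s ^ 2 / 2)⁻¹ ^ 3 := by
    field_simp; ring
  rw [eρ, e1]
  simp only [dtq]
  rw [hD] at hd
  generalize s ^ 2 / 2 = r at *
  generalize cos (s ^ 3 / 6) = c at *
  have hr0 : 0 < r := by linarith
  generalize lD s 0 (s ^ 3 / 6) = d' at *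
  set ρ := r⁻¹ with hρ
  have hρr : ρ * r = 1 := inv_mul_cancel₀ hr0.ne'
  have hρ0 : 0 < ρ := by positivity
  have hρ1 : ρ ≤ 25 / 72 := by
    rw [hρ, inv_le_comm₀ hr0 (by norm_num)]; linarith
  obtain ⟨e, he⟩ : ∃ e, d' = ρ * e := ⟨d' * r, by linear_combination (-d') * hρr⟩
  have he0 : 0 ≤ e := by
    by_contra! h
    have : ρ * e < 0 := by nlinarith
    linarith
  have hee : e ^ 2 * (ρ ^ 2 + 1 + 2 * ρ * c) = 1 := by
    rw [he] at hd
    have : (ρ * e) ^ 2 * (1 + r ^ 2 + 2 * r * c) = e ^ 2 * (ρ ^ 2 + 1 + 2 * ρ * c) := by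
      linear_combination e ^ 2 * (ρ * r + 1 + 2 * ρ * c) * hρr
    linarith
  have hup : e * (1 - ρ) ≤ 1 := by
    have h : (e * (1 - ρ)) ^ 2 ≤ 1 ^ 2 := by
      have : 0 ≤ e ^ 2 * (2 * ρ * (c + 1)) := by
        have : 0 ≤ c + 1 := by linarith
        positivity
      nlinarith
    exact (abs_le_of_sq_le_sq' h (by norm_num)).2
  have hlo : 1 ≤ e * (1 + ρ) := by
    have h : 1 ^ 2 ≤ (e * (1 + ρ)) ^ 2 := by
      have : 0 ≤ e ^ 2 * (2 * ρ * (1 - c)) := by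
        have : 0 ≤ 1 - c := by linarith
        positivity
      nlinarith
    exact (pow_le_pow_iff_left₀ (by norm_num) (by positivity) two_ne_zero).1 h
  have hup3 : e ^ 3 ≤ 1 + 3 * ρ + 14 * ρ ^ 2 := by
    have h : (e * (1 - ρ)) ^ 3 ≤ 1 := pow_le_one₀ (mul_nonneg he0 (by linarith)) hup
    have h2 : 1 ≤ (1 + 3 * ρ + 14 * ρ ^ 2) * (1 - ρ) ^ 3 := by
      have : (1 + 3 * ρ + 14 * ρ ^ 2) * (1 - ρ) ^ 3 - 1 =
        ρ ^ 2 * (8 - 34 * ρ + 39 * ρ ^ 2 - 14 * ρ ^ 3) := by ring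
      have h3 : 0 ≤ 8 - 34 * ρ + 39 * ρ ^ 2 - 14 * ρ ^ 3 := by
        nlinarith [mul_nonneg hρ0.le (sub_nonneg.2 hρ1), mul_nonneg (mul_nonneg hρ0.le hρ0.le)
          (sub_nonneg.2 hρ1), mul_nonneg (sub_nonneg.2 hρ1) (sub_nonneg.2 hρ1)]
      have := mul_nonneg (sq_nonneg ρ) h3
      linarith
    have h3 : 0 < (1 - ρ) ^ 3 := by
      have : 0 < 1 - ρ := by linarith
      positivity
    by_contra! h4
    have := mul_lt_mul_of_pos_right h4 h3
    rw [mul_pow] at h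
    linarith
  have hlo3 : 1 - 3 * ρ ≤ e ^ 3 := by
    have h5 : 1 - ρ ≤ e := by
      by_contra! h
      have : e * (1 + ρ) < (1 - ρ) * (1 + ρ) := by gcongr
      nlinarith
    have : (1 - ρ) ^ 3 ≤ e ^ 3 := by
      have : 0 ≤ 1 - ρ := by linarith
      gcongr
    nlinarith [mul_nonneg (mul_nonneg hρ0.le hρ0.le) (show 0 ≤ 3 - ρ by linarith)]
  have hd3 : r ^ 2 * d' ^ 3 = ρ * e ^ 3 := by
    rw [he]; linear_combination (ρ * e ^ 3 * (ρ * r + 1)) * hρr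
  have hpos : 0 ≤ 3 * r ^ 3 * sin (s ^ 3 / 6) ^ 2 * d' ^ 5 := by positivity
  have key : -(3 * ρ ^ 2 + 14 * ρ ^ 3) ≤ c * (ρ * (e ^ 3 - 1)) := by
    have ha : |c * (ρ * (e ^ 3 - 1))| ≤ 1 * (ρ * (3 * ρ + 14 * ρ ^ 2)) := by
      rw [abs_mul, abs_mul, abs_of_pos hρ0]
      gcongr
      · exact abs_le.2 ⟨hc1, hc2⟩
      · exact abs_le.2 ⟨by nlinarith, by linarith⟩
    have := (abs_le.1 ha).1
    linarith
  have e3 : r ^ 2 * c - (r ^ 2 * c - (r ^ 2 * c * d' ^ 3 + 3 * r ^ 3 * sin (s ^ 3 / 6) ^ 2 * d' ^ 5)) -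
      ρ * c = c * (ρ * (e ^ 3 - 1)) + 3 * r ^ 3 * sin (s ^ 3 / 6) ^ 2 * d' ^ 5 := by
    linear_combination c * hd3
  rw [e3]
  linarith

/-- The Melnikov derivative. -/
theorem exists_melnikov : ∃ A : ℝ → ℝ, (∀ s, HasDerivAt A (dtq s) s) ∧ A 0 = 0 ∧
    1 / 4 ≤ -A 10000 + ((10000 : ℝ) ^ 2 / 2 * sin (10000 ^ 3 / 6) +
      2 / 10000 * cos (10000 ^ 3 / 6)) := by
  refine ⟨fun s => ∫ x in (0 : ℝ)..s, dtq x, fun s =>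
    intervalIntegral.integral_hasDerivAt_right (continuous_dtq.intervalIntegrable _ _)
      (continuous_dtq.stronglyMeasurableAtFilter _ _) continuous_dtq.continuousAt,
    intervalIntegral.integral_same, ?_⟩
  set A : ℝ → ℝ := fun s => ∫ x in (0 : ℝ)..s, dtq x
  have hA : ∀ s, HasDerivAt A (dtq s) s := fun s =>
    intervalIntegral.integral_hasDerivAt_right (continuous_dtq.intervalIntegrable _ _)
      (continuous_dtq.stronglyMeasurableAtFilter _ _) continuous_dtq.continuousAt
  have hA0 : A 0 = 0 := intervalIntegral.integral_same
  change 1 / 4 ≤ -A 10000 + _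
  have ht : ∀ s : ℝ, HasDerivAt (fun s : ℝ => s ^ 3 / 6) (s ^ 2 / 2) s := fun s =>
    ((hasDerivAt_pow 3 s).div_const 6).congr_deriv (by push_cast; ring)
  have hrk : ∀ s : ℝ, HasDerivAt (fun s : ℝ => s ^ 2 / 2 * sin (s ^ 3 / 6))
      (s * sin (s ^ 3 / 6) + (s ^ 2 / 2) ^ 2 * cos (s ^ 3 / 6)) s := fun s =>
    (((hasDerivAt_pow 2 s).div_const 2).mul (ht s).sin).congr_deriv (by push_cast; ring)
  have early := le_of_hasDerivAt_nonneg (a := 0) (b := 12 / 5)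
    (f := fun s => -A s + s ^ 2 / 2 * sin (s ^ 3 / 6) - (s ^ 5 / 30 - s ^ 11 / 14256)) (by norm_num)
    (fun s _ => ((hA s).fun_neg.fun_add (hrk s)).fun_sub
      (((hasDerivAt_pow 5 s).div_const 30).fun_sub ((hasDerivAt_pow 11 s).div_const 14256)))
    (fun s hs => by
      have h1 := dtq_early hs.1 hs.2
      have h2 := mul_le_mul_of_nonneg_left
        (sub_cube_le_sin (t := s ^ 3 / 6) (by have := hs.1; positivity)) hs.1
      push_cast
      nlinarith)
  have late := le_of_hasDerivAt_nonneg (a := 12 / 5) (b := 10000)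
    (f := fun s => -A s + s ^ 2 / 2 * sin (s ^ 3 / 6) + 2 * s⁻¹ * cos (s ^ 3 / 6) -
      (4 * s⁻¹ ^ 3 + 112 / 5 * s⁻¹ ^ 5)) (by norm_num)
    (fun s hs => by
      have hi := hasDerivAt_inv (x := s) (by linarith [hs.1])
      exact (((hA s).fun_neg.fun_add (hrk s)).fun_add ((hi.const_mul 2).fun_mul (ht s).cos)).fun_sub
        (((hi.fun_pow 3).const_mul 4).fun_add ((hi.fun_pow 5).const_mul (112 / 5))))
    (fun s hs => by
      have h1 := dtq_late hs.1
      have hs0 : 0 < s := by linarith [hs.1]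
      refine le_of_le_of_eq (sub_nonneg.2 h1) ?_
      push_cast
      field_simp
      ring)
  simp only [hA0] at early late
  have hc : -(7342 / 10000) ≤ cos ((12 / 5) ^ 3 / 6) := by
    have hπ := pi_gt_d2
    have h := sin_le (x := (12 / 5) ^ 3 / 6 - π / 2) (by linarith [pi_lt_d2])
    rw [sin_sub_pi_div_two] at h
    linarith
  norm_num at early late hc ⊢
  linarith

end PCRTBP

namespace PCRTBP

open Set

/-! ### Smoothness of the regularised data -/

theorem isOpen_lU : IsOpen lU := by
  refine isOpen_lt continuous_const ?_
  simp only [sqD]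
  fun_prop

theorem contDiffAt_lD {Y : LS} (h : Y ∈ lU) :
    ContDiffAt ℝ 1 (fun Y : LS => lD Y.1 Y.2.1 Y.2.2.2.2.1) Y := by
  have h1 : ContDiffAt ℝ 1 (fun Y : LS => sqD Y.1 Y.2.1 Y.2.2.2.2.1) Y := by
    simp only [sqD]
    fun_prop
  exact (h1.sqrt (ne_of_gt h)).inv (Real.sqrt_pos.2 h).ne'

theorem contDiffAt_lf₁ {Y : LS} (h : Y ∈ lU) :
    ContDiffAt ℝ 1 (fun Y : LS => lf₁ Y.1 Y.2.1 Y.2.2.2.2.1) Y := by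
  have := contDiffAt_lD h
  simp only [lf₁]
  fun_prop

theorem contDiffAt_lf₂ {Y : LS} (h : Y ∈ lU) :
    ContDiffAt ℝ 1 (fun Y : LS => lf₂ Y.1 Y.2.1 Y.2.2.2.2.1) Y := by
  have := contDiffAt_lD h
  simp only [lf₂]
  fun_prop

theorem contDiffAt_lV {Y : LS} (h : Y ∈ lU) :
    ContDiffAt ℝ 1 (fun Y : LS => lV Y.1 Y.2.1 Y.2.2.2.2.1) Y := by
  have := contDiffAt_lD h
  simp only [lV]
  fun_prop

theorem contDiffOn_lc : ContDiffOn ℝ 1 lc lU := by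
  intro Y h
  have h1 := contDiffAt_lf₁ h
  have h2 := contDiffAt_lf₂ h
  have h3 := contDiffAt_lV h
  refine ContDiffAt.contDiffWithinAt ?_
  unfold lc lh
  fun_prop

theorem contDiffOn_ltq : ContDiffOn ℝ 1 (fun Y : LS => ltq Y.1 Y.2.1 Y.2.2.2.2.1) lU := by
  intro Y h
  have h1 := contDiffAt_lf₁ h
  have h2 := contDiffAt_lf₂ h
  refine ContDiffAt.contDiffWithinAt ?_
  unfold ltq
  fun_prop

theorem contDiff_lX₁ : ContDiff ℝ 1 lX₁ := by unfold lX₁; fun_prop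

theorem contDiff_lX₂ : ContDiff ℝ 1 lX₂ := by unfold lX₂; fun_prop

/-- The region in which far coordinates are defined. -/
def lW : Set LS := {Y | 0 < lX₁ Y ∧ 0 < Y.1}

theorem isOpen_lW : IsOpen lW :=
  (isOpen_lt continuous_const contDiff_lX₁.continuous).inter
    (isOpen_lt continuous_const continuous_fst)

theorem contDiffOn_lcF : ContDiffOn ℝ 1 lcF lW := by
  intro Y h
  have hi : ContDiffAt ℝ 1 (fun Y : LS => ((Y.1 ^ 2 + Y.2.1 ^ 2) / 2)⁻¹) Y := by
    have := h.2
    refine ContDiffAt.inv (by fun_prop) (by positivity)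
  have h1 := contDiff_lX₁.contDiffAt (x := Y)
  have h2 := contDiff_lX₂.contDiffAt (x := Y)
  have h3 : ContDiffAt ℝ 1 lP₁ Y := by unfold lP₁; fun_prop
  have h4 : ContDiffAt ℝ 1 lP₂ Y := by unfold lP₂; fun_prop
  have hp := h.1
  have h5 : ContDiffAt ℝ 1 (fun Y => √(lX₁ Y ^ 2 + lX₂ Y ^ 2)) Y :=
    ContDiffAt.sqrt (by fun_prop) (by positivity)
  have h6 : ContDiffAt ℝ 1 (fun Y => (√(lX₁ Y ^ 2 + lX₂ Y ^ 2))⁻¹) Y :=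
    h5.inv (Real.sqrt_pos.2 (by positivity)).ne'
  have h7 : ContDiffAt ℝ 1 (fun Y => arctan (lX₂ Y / lX₁ Y)) Y :=
    (h2.div h1 hp.ne').arctan
  refine ContDiffAt.contDiffWithinAt ?_
  unfold lcF
  fun_prop

/-- The part of the angular momentum that is of first order in the mass ratio. -/
noncomputable def lB (Y : LS) : ℝ :=
  (Y.1 ^ 2 - Y.2.1 ^ 2) / 2 * cos Y.2.2.2.2.1 + Y.1 * Y.2.1 * sin Y.2.2.2.2.1 +
    ((Y.1 ^ 2 + Y.2.1 ^ 2) / 2)⁻¹ * ((Y.1 * Y.2.2.2.1 + Y.2.1 * Y.2.2.1) * cos Y.2.2.2.2.1 -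
      (Y.1 * Y.2.2.1 - Y.2.1 * Y.2.2.2.1) * sin Y.2.2.2.2.1)

theorem contDiffOn_lB : ContDiffOn ℝ 1 lB lW := by
  intro Y h
  have hi : ContDiffAt ℝ 1 (fun Y : LS => ((Y.1 ^ 2 + Y.2.1 ^ 2) / 2)⁻¹) Y := by
    have := h.2
    refine ContDiffAt.inv (by fun_prop) (by positivity)
  refine ContDiffAt.contDiffWithinAt ?_
  unfold lB
  fun_prop

/-- The time direction. -/
noncomputable def et : LS := (0, 0, 0, 0, 1, 0, 0)

theorem fderiv_apply_eq {E F : Type*} [NormedAddCommGroup E] [NormedSpace ℝ E]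
    [NormedAddCommGroup F] [NormedSpace ℝ F] {f : E → F} {y e : E} {d : F}
    (hf : DifferentiableAt ℝ f y) (h : HasDerivAt (fun t : ℝ => f (y + t • e)) d 0) :
    fderiv ℝ f y e = d := by
  have h1 : HasDerivAt (fun t : ℝ => y + t • e) e 0 := by
    simpa using ((hasDerivAt_id (0 : ℝ)).smul_const e).const_add y
  have h2 : HasFDerivAt f (fderiv ℝ f y) (y + (0 : ℝ) • e) := by simpa using hf.hasFDerivAt
  exact (h2.comp_hasDerivAt 0 h1).unique h

theorem ideal_add (s t : ℝ) : ideal s + t • et = (s, 0, 1, 0, s ^ 3 / 6 + t, 0, 0) := by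
  simp [ideal, et]

theorem fderiv_lc_et (s : ℝ) : fderiv ℝ lc (ideal s) et = 0 := by
  refine fderiv_apply_eq ((contDiffOn_lc.contDiffAt
    (isOpen_lU.mem_nhds (ideal_mem_lU s))).differentiableAt one_ne_zero) ?_
  have : (fun t : ℝ => lc (ideal s + t • et)) = fun _ => lc (ideal s) := by
    ext1 t
    rw [ideal_add]
    simp [lc, lh, ideal]
  rw [this]
  exact hasDerivAt_const _ _

theorem fderiv_ltq_et (s : ℝ) :
    fderiv ℝ (fun Y : LS => ltq Y.1 Y.2.1 Y.2.2.2.2.1) (ideal s) et = dtq s := by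
  refine fderiv_apply_eq ((contDiffOn_ltq.contDiffAt
    (isOpen_lU.mem_nhds (ideal_mem_lU s))).differentiableAt one_ne_zero) ?_
  simp only [ideal_add]
  have h := hasDerivAt_ltq s
  rw [← add_zero (s ^ 3 / 6)] at h
  exact h.comp_const_add (s ^ 3 / 6) 0

theorem ideal_mem_lW {s : ℝ} (hs : 0 < s) : ideal s ∈ lW := by
  refine ⟨?_, hs⟩
  simp only [lX₁, ideal]
  have : 0 < s ^ 2 := by positivity
  linarith

theorem lcF_ideal_add {s : ℝ} (hs : 0 < s) (t : ℝ) :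
    lcF (ideal s + t • et) = (s ^ 2 / 2, 2 / s, π - (s ^ 3 / 6 + t), 0) := by
  have h : √((s ^ 2 / 2) ^ 2) = s ^ 2 / 2 := Real.sqrt_sq (by positivity)
  rw [ideal_add]
  simp only [lcF, lX₁, lX₂, lP₁, lP₂, Prod.mk.injEq]
  norm_num [h]
  field_simp

theorem lcF_ideal {s : ℝ} (hs : 0 < s) :
    lcF (ideal s) = (s ^ 2 / 2, 2 / s, π - s ^ 3 / 6, 0) := by
  simpa using lcF_ideal_add hs 0

theorem fderiv_lcF_et {s : ℝ} (hs : 0 < s) : fderiv ℝ lcF (ideal s) et = (0, 0, -1, 0) := by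
  refine fderiv_apply_eq ((contDiffOn_lcF.contDiffAt
    (isOpen_lW.mem_nhds (ideal_mem_lW hs))).differentiableAt one_ne_zero) ?_
  simp only [lcF_ideal_add hs]
  rw [hasDerivAt_FS]
  exact ⟨hasDerivAt_const _ _, hasDerivAt_const _ _,
    (((hasDerivAt_id (0 : ℝ)).const_add (s ^ 3 / 6)).const_sub π), hasDerivAt_const _ _⟩

theorem fderiv_lcF_lc {s : ℝ} (hs : 0 < s) : (fderiv ℝ lcF (ideal s) (lc (ideal s))).1 = s := by
  have h2 := ((contDiffOn_lcF.contDiffAt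
    (isOpen_lW.mem_nhds (ideal_mem_lW hs))).differentiableAt one_ne_zero).hasFDerivAt
  have h3 := (hasDerivAt_FS.1 (h2.comp_hasDerivAt s (hasDerivAt_ideal s))).1
  have h4 : HasDerivAt (fun s : ℝ => s ^ 2 / 2) s s :=
    ((hasDerivAt_pow 2 s).div_const 2).congr_deriv (by push_cast; ring)
  refine h3.unique (h4.congr_of_eventuallyEq ?_)
  filter_upwards [lt_mem_nhds hs] with x hx
  simp only [Function.comp, lcF_ideal hx]

theorem fderiv_lB_et {s : ℝ} (hs : 0 < s) : fderiv ℝ lB (ideal s) et =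
    -(s ^ 2 / 2 * sin (s ^ 3 / 6) + 2 / s * cos (s ^ 3 / 6)) := by
  refine fderiv_apply_eq ((contDiffOn_lB.contDiffAt
    (isOpen_lW.mem_nhds (ideal_mem_lW hs))).differentiableAt one_ne_zero) ?_
  have hf : (fun t : ℝ => lB (ideal s + t • et)) =
      fun t => s ^ 2 / 2 * cos (s ^ 3 / 6 + t) - 2 / s * sin (s ^ 3 / 6 + t) := by
    ext1 t
    rw [ideal_add]
    simp only [lB]
    field_simp
    ring
  rw [hf]
  have h1 := (hasDerivAt_id (0 : ℝ)).const_add (s ^ 3 / 6)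
  refine ((h1.cos.const_mul _).fun_sub (h1.sin.const_mul _)).congr_deriv ?_
  simp only [id, add_zero]
  ring

theorem flow_near_linear {E : Type*} [NormedAddCommGroup E] [NormedSpace ℝ E] {f : E → E}
    {U : Set E} (hU : IsOpen U) (hf : ContDiffOn ℝ 1 f U) {γ : ℝ → E} {b : ℝ}
    (hγ : ContinuousOn γ (Icc 0 b)) (hγU : ∀ s ∈ Icc 0 b, γ s ∈ U) {e : E}
    (he : ∀ s ∈ Icc 0 b, fderiv ℝ f (γ s) e = 0) :
    ∃ C > 0, ∀ ε > 0, ∃ ρ > 0, ∀ Y Y' : ℝ → E,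
      (∀ s ∈ Icc 0 b, HasDerivAt Y (f (Y s)) s ∧ dist (Y s) (γ s) ≤ ρ) →
      (∀ s ∈ Icc 0 b, HasDerivAt Y' (f (Y' s)) s ∧ dist (Y' s) (γ s) ≤ ρ) →
      ∀ δ : ℝ, ∀ s ∈ Icc 0 b, ‖Y s - Y' s + δ • e‖ ≤ ε * |δ| + C * ‖Y 0 - Y' 0 + δ • e‖ := by
  obtain ⟨C, hC, h⟩ := near_linear hU hf hγ hγU e
  refine ⟨exp (C * b), exp_pos _, fun ε hε => ?_⟩
  obtain ⟨ρ, hρ, hρ'⟩ := h (ε * C * exp (-(C * b))) (by positivity)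
  refine ⟨ρ, hρ, fun Y Y' hY hY' δ s hs => ?_⟩
  have hd : ∀ s ∈ Icc 0 b, HasDerivAt (fun s => Y s - Y' s + δ • e) (f (Y s) - f (Y' s)) s :=
    fun s hs => ((hY s hs).1.fun_sub (hY' s hs).1).add_const _
  have hg := norm_le_gronwallBound_of_norm_deriv_right_le
    (fun x hx => (hd x hx).continuousAt.continuousWithinAt)
    (fun x hx => (hd x (Ico_subset_Icc_self hx)).hasDerivWithinAt) le_rfl
    (K := C) (ε := ε * C * exp (-(C * b)) * |δ|)
    (fun x hx => by
      have hx' := Ico_subset_Icc_self hx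
      have := hρ' x hx' (Y x) (Y' x) (hY x hx').2 (hY' x hx').2 δ
      rw [he x hx', smul_zero, add_zero] at this
      linarith) s hs
  rw [gronwallBound_of_K_ne_0 hC.ne', sub_zero] at hg
  have h1 : exp (C * s) ≤ exp (C * b) := exp_le_exp.2 (by gcongr; exact hs.2)
  have h2 : ε * C * exp (-(C * b)) * |δ| / C * (exp (C * s) - 1) ≤ ε * |δ| := by
    have : exp (-(C * b)) * (exp (C * s) - 1) ≤ 1 := by
      calc exp (-(C * b)) * (exp (C * s) - 1) ≤ exp (-(C * b)) * exp (C * b) := by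
            gcongr; linarith
        _ = 1 := by rw [← exp_add]; simp
    calc _ = ε * |δ| * (exp (-(C * b)) * (exp (C * s) - 1)) := by field_simp
      _ ≤ ε * |δ| * 1 := by gcongr
      _ = _ := mul_one _
  have h3 : ‖Y 0 - Y' 0 + δ • e‖ * exp (C * s) ≤ exp (C * b) * ‖Y 0 - Y' 0 + δ • e‖ := by
    rw [mul_comm]; gcongr
  linarith

end PCRTBP

namespace PCRTBP

open Set

/-! ### The hitting map of the inner region -/

theorem exists_tube {E : Type*} [NormedAddCommGroup E] {γ : ℝ → E} {a b : ℝ} {V : Set E}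
    (hγ : ContinuousOn γ (Icc a b)) (hV : IsOpen V) (h : ∀ s ∈ Icc a b, γ s ∈ V) :
    ∃ ρ > 0, ∀ s ∈ Icc a b, ∀ y, dist y (γ s) ≤ ρ → y ∈ V := by
  have hZ : IsCompact (γ '' Icc a b) := isCompact_Icc.image_of_continuousOn hγ
  obtain ⟨r, hr, hrV⟩ := hZ.exists_cthickening_subset_open hV
    (by rintro _ ⟨s, hs, rfl⟩; exact h s hs)
  exact ⟨r, hr, fun s hs y hy => hrV (Metric.mem_cthickening_of_dist_le _ _ _ _ ⟨s, hs, rfl⟩ hy)⟩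

/-- The target region of the inner flow. -/
def lT : Set LS := {Y | Y ∈ lU ∩ lW ∧ ((0 < (lcF Y).2.1 ∧ (lcF Y).2.1 < 1 / 1000) ∧
  -(1 / 100) < (lcF Y).2.2.2 ∧ (lcF Y).2.2.2 < 1 / 100) ∧ 1 < (fderiv ℝ lcF Y (lc Y)).1}

theorem isOpen_lT : IsOpen lT := by
  have ho : IsOpen (lU ∩ lW) := isOpen_lU.inter isOpen_lW
  have h1 : ContinuousOn lcF (lU ∩ lW) := contDiffOn_lcF.continuousOn.mono inter_subset_right
  have h2 : ContinuousOn (fun Y => (fderiv ℝ lcF Y (lc Y)).1) (lU ∩ lW) :=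
    (((contDiffOn_lcF.continuousOn_fderiv_of_isOpen isOpen_lW le_rfl).mono
      inter_subset_right).clm_apply (contDiffOn_lc.continuousOn.mono inter_subset_left)).fst
  have h3 : IsOpen {x : FS × ℝ | ((0 < x.1.2.1 ∧ x.1.2.1 < 1 / 1000) ∧
      -(1 / 100) < x.1.2.2.2 ∧ x.1.2.2.2 < 1 / 100) ∧ 1 < x.2} :=
    (((isOpen_lt (by fun_prop) (by fun_prop)).and (isOpen_lt (by fun_prop) (by fun_prop))).and
      ((isOpen_lt (by fun_prop) (by fun_prop)).and (isOpen_lt (by fun_prop) (by fun_prop)))).and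
      (isOpen_lt (by fun_prop) (by fun_prop))
  exact (h1.prodMk h2).isOpen_inter_preimage ho h3

theorem ideal_mem_lT {s : ℝ} (hs : 9999 ≤ s) : ideal s ∈ lT := by
  have h0 : 0 < s := by linarith
  refine ⟨⟨ideal_mem_lU s, ideal_mem_lW h0⟩, ⟨⟨?_, ?_⟩, ?_, ?_⟩, ?_⟩
  · rw [lcF_ideal h0]; simp only; positivity
  · rw [lcF_ideal h0]; simp only; rw [div_lt_iff₀ h0]; linarith
  · rw [lcF_ideal h0]; norm_num
  · rw [lcF_ideal h0]; norm_num
  · rw [fderiv_lcF_lc h0]; linarith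

theorem continuous_ideal : Continuous ideal := by unfold ideal; fun_prop

/-- An orbit in the inner region close to the ideal one, and its hitting time. -/
structure InnerOrbit (Y : ℝ → LS) (κ : ℝ) : Prop where
  deriv : ∀ s ∈ Icc (-1 : ℝ) 10001, HasDerivAt Y (lc (Y s)) s
  mem : ∀ s ∈ Icc (-1 : ℝ) 10001, Y s ∈ lU
  u_pos : ∀ s ∈ Icc (-1 : ℝ) 10001, 1 / 2 < (Y s).2.2.1
  target : ∀ s ∈ Icc (9999 : ℝ) 10001, Y s ∈ lT
  hit_mem : κ ∈ Ioo (9999 : ℝ) 10001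
  hit : (lcF (Y κ)).1 = ℛ

theorem hasDerivAt_lcF {Y : ℝ → LS} {s : ℝ} (h : HasDerivAt Y (lc (Y s)) s) (hW : Y s ∈ lW) :
    HasDerivAt (fun s => (lcF (Y s)).1) (fderiv ℝ lcF (Y s) (lc (Y s))).1 s :=
  (hasDerivAt_FS.1 (((contDiffOn_lcF.contDiffAt
    (isOpen_lW.mem_nhds hW)).differentiableAt one_ne_zero).hasFDerivAt.comp_hasDerivAt s h)).1

theorem exists_inner_orbits : ∃ ρ > 0, ∃ K > 0, ∃ Φ : ℝ → LS → LS, ∃ κ : LS → ℝ,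
    ∀ y, dist y (ideal 0) < ρ → Φ 0 y = y ∧ InnerOrbit (fun s => Φ s y) (κ y) ∧
      ∀ s ∈ Icc (-1 : ℝ) 10001, dist (Φ s y) (ideal s) ≤ K * dist y (ideal 0) := by
  obtain ⟨ρ₀, hρ₀, K, hK, Φ, -, hΦ0, -, hΦ⟩ := exists_flow_near_curve isOpen_lU contDiffOn_lc
    (γ := ideal) (a := -1) (b := 10001) (by norm_num) (by norm_num)
    (fun s _ => hasDerivAt_ideal s) (fun s _ => ideal_mem_lU s)
  obtain ⟨ρ₁, hρ₁, h1⟩ := exists_tube (V := {Y : LS | 1 / 2 < Y.2.2.1}) (a := -1) (b := 10001)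
    continuous_ideal.continuousOn
    (isOpen_lt (by fun_prop) (by fun_prop)) (fun s _ => show (1 / 2 : ℝ) < 1 by norm_num)
  obtain ⟨ρ₂, hρ₂, h2⟩ := exists_tube (a := 9999) (b := 10001) continuous_ideal.continuousOn
    isOpen_lT (fun s hs => ideal_mem_lT hs.1)
  obtain ⟨ρ₃, hρ₃, C, hC, h3⟩ := uniform_lipschitz_near_curve (a := 9999) (b := 10001) isOpen_lW
    contDiffOn_lcF continuous_ideal.continuousOn (fun s hs => ideal_mem_lW (by linarith [hs.1]))
  have hex : ∀ y, dist y (ideal 0) < min ρ₀ (min ρ₁ (min ρ₂ (min ρ₃ (1 / C))) / K) → ∃ κ,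
      InnerOrbit (fun s => Φ s y) κ := by
    intro y hy
    have hy0 := hy.trans_le (min_le_left _ _)
    have hy1 := hy.trans_le (min_le_right _ _)
    rw [lt_div_iff₀ hK, lt_min_iff, lt_min_iff, lt_min_iff, mul_comm] at hy1
    obtain ⟨a1, a2, a3, a4⟩ := hy1
    have hd : ∀ s ∈ Icc (-1 : ℝ) 10001, HasDerivAt (fun s => Φ s y) (lc (Φ s y)) s :=
      fun s hs => (hΦ y hy0 s hs).1
    have hW : Icc (9999 : ℝ) 10001 ⊆ Icc (-1) 10001 := Icc_subset_Icc_left (by norm_num)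
    have hT : ∀ s ∈ Icc (9999 : ℝ) 10001, Φ s y ∈ lT := fun s hs =>
      h2 s hs _ ((hΦ y hy0 s (hW hs)).2.2.trans a2.le)
    have hr : ∀ s ∈ Icc (9999 : ℝ) 10001, |(lcF (Φ s y)).1 - s ^ 2 / 2| ≤ 1 := by
      intro s hs
      have hds := (hΦ y hy0 s (hW hs)).2.2
      have := (h3 s hs (Φ s y) (ideal s) (hds.trans a3.le) (by simp [hρ₃.le])).2
      have h4 : ‖Φ s y - ideal s‖ ≤ 1 / C := by
        rw [← dist_eq_norm]; exact hds.trans a4.le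
      have h5 : C * ‖Φ s y - ideal s‖ ≤ 1 := by
        rw [le_div_iff₀ hC] at h4; linarith
      rw [lcF_ideal (by linarith [hs.1])] at this
      exact ((norm_fst_le _).trans this).trans h5
    have hc : ContinuousOn (fun s => (lcF (Φ s y)).1) (Icc 9999 10001) := fun s hs =>
      (hasDerivAt_lcF (hd s (hW hs)) (hT s hs).1.2).continuousAt.continuousWithinAt
    have hl := abs_le.1 (hr 9999 ⟨le_rfl, by norm_num⟩)
    have hu := abs_le.1 (hr 10001 ⟨by norm_num, le_rfl⟩)
    norm_num at hl hu
    obtain ⟨κ, hκ, hκ'⟩ := intermediate_value_Ioo (by norm_num) hc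
      (show ℛ ∈ Ioo _ _ from ⟨by linarith, by linarith⟩)
    exact ⟨κ, hd, fun s hs => (hΦ y hy0 s hs).2.1,
      fun s hs => h1 s hs _ ((hΦ y hy0 s hs).2.2.trans a1.le), hT, hκ, hκ'⟩
  choose! κ hκ using hex
  refine ⟨_, by positivity, K, hK, Φ, κ, fun y hy => ⟨hΦ0 y, hκ y hy, fun s hs =>
    (hΦ y (hy.trans_le (min_le_left _ _)) s hs).2.2⟩⟩

/-- Quantities which are small relative to a time shift and bounded by the remaining difference
of initial data. -/
def NL {ι : Type} (f : ι → LS → LS → ℝ → ℝ) : Prop :=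
  ∃ C > 0, ∀ ε > 0, ∃ ρ > 0, ∀ i y y', dist y (ideal 0) < ρ → dist y' (ideal 0) < ρ → ∀ δ : ℝ,
    f i y y' δ ≤ ε * |δ| + C * ‖y - y' + δ • et‖

theorem NL.of_le {ι κ : Type} {f : ι → LS → LS → ℝ → ℝ} {g : κ → LS → LS → ℝ → ℝ} (hg : NL g)
    (φ : LS → LS → ι → κ)
    (h : ∃ C > 0, ∀ ε > 0, ∃ ρ > 0, ∀ i y y', dist y (ideal 0) < ρ → dist y' (ideal 0) < ρ →
      ∀ δ : ℝ, f i y y' δ ≤ ε * |δ| + C * g (φ y y' i) y y' δ) : NL f := by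
  obtain ⟨C, hC, h⟩ := h
  obtain ⟨D, hD, hg⟩ := hg
  refine ⟨C * D, by positivity, fun ε hε => ?_⟩
  obtain ⟨ρ₁, hρ₁, h1⟩ := h (ε / 2) (by positivity)
  obtain ⟨ρ₂, hρ₂, h2⟩ := hg (ε / (2 * C)) (by positivity)
  refine ⟨min ρ₁ ρ₂, by positivity, fun i y y' hy hy' δ => ?_⟩
  have a := h1 i y y' (hy.trans_le (min_le_left _ _)) (hy'.trans_le (min_le_left _ _)) δ
  have b := h2 (φ y y' i) y y' (hy.trans_le (min_le_right _ _)) (hy'.trans_le (min_le_right _ _)) δ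
  have c := mul_le_mul_of_nonneg_left b hC.le
  have e : C * (ε / (2 * C) * |δ| + D * ‖y - y' + δ • et‖) =
      ε / 2 * |δ| + C * D * ‖y - y' + δ • et‖ := by field_simp
  linarith

theorem NL.add {ι : Type} {f g : ι → LS → LS → ℝ → ℝ} (hf : NL f) (hg : NL g) :
    NL (fun i y y' δ => f i y y' δ + g i y y' δ) := by
  obtain ⟨C, hC, hf⟩ := hf
  obtain ⟨D, hD, hg⟩ := hg
  refine ⟨C + D, by positivity, fun ε hε => ?_⟩
  obtain ⟨ρ₁, hρ₁, h1⟩ := hf (ε / 2) (by positivity)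
  obtain ⟨ρ₂, hρ₂, h2⟩ := hg (ε / 2) (by positivity)
  refine ⟨min ρ₁ ρ₂, by positivity, fun i y y' hy hy' δ => ?_⟩
  have a := h1 i y y' (hy.trans_le (min_le_left _ _)) (hy'.trans_le (min_le_left _ _)) δ
  have b := h2 i y y' (hy.trans_le (min_le_right _ _)) (hy'.trans_le (min_le_right _ _)) δ
  linarith

end PCRTBP

namespace PCRTBP

open Set

theorem NL.comp {ι κ : Type} {g : κ → LS → LS → ℝ → ℝ} (hg : NL g) (φ : LS → LS → ι → κ) :
    NL (fun i y y' δ => g (φ y y' i) y y' δ) :=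
  hg.of_le φ ⟨1, one_pos, fun ε hε => ⟨1, one_pos, fun i y y' _ _ δ => by
    have : 0 ≤ ε * |δ| := by positivity
    linarith⟩⟩

theorem NL.const_mul {ι : Type} {g : ι → LS → LS → ℝ → ℝ} (hg : NL g) {c : ℝ} (hc : 0 < c) :
    NL (fun i y y' δ => c * g i y y' δ) :=
  hg.of_le (fun _ _ i => i) ⟨c, hc, fun ε hε => ⟨1, one_pos, fun i y y' _ _ δ => by
    have : 0 ≤ ε * |δ| := by positivity
    linarith⟩⟩

theorem abs_sub_le_of_one_le_deriv {R R' : ℝ → ℝ} {a b s t : ℝ}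
    (hR : ∀ x ∈ Icc a b, HasDerivAt R (R' x) x) (h1 : ∀ x ∈ Icc a b, 1 ≤ R' x)
    (hs : s ∈ Icc a b) (ht : t ∈ Icc a b) : |s - t| ≤ |R s - R t| := by
  wlog h : t ≤ s generalizing s t
  · rw [abs_sub_comm, abs_sub_comm (R s)]
    exact this ht hs (le_of_not_ge h)
  have := le_of_hasDerivAt_nonneg h (f := fun x => R x - x) (f' := fun x => R' x - 1)
    (fun x hx => (hR x ⟨ht.1.trans hx.1, hx.2.trans hs.2⟩).fun_sub (hasDerivAt_id x))
    (fun x hx => sub_nonneg.2 (h1 x ⟨ht.1.trans hx.1, hx.2.trans hs.2⟩))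
  rw [abs_of_nonneg (by linarith)]
  exact le_trans (by linarith) (le_abs_self _)

/-- A family of inner orbits together with their hitting times. -/
structure InnerFamily (ρ K : ℝ) (Φ : ℝ → LS → LS) (κ : LS → ℝ) : Prop where
  rho_pos : 0 < ρ
  K_pos : 0 < K
  start_eq : ∀ y, dist y (ideal 0) < ρ → Φ 0 y = y
  orbit : ∀ y, dist y (ideal 0) < ρ → InnerOrbit (fun s => Φ s y) (κ y)
  close : ∀ y, dist y (ideal 0) < ρ → ∀ s ∈ Icc (-1 : ℝ) 10001,
    dist (Φ s y) (ideal s) ≤ K * dist y (ideal 0)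

theorem exists_innerFamily : ∃ ρ K Φ κ, InnerFamily ρ K Φ κ := by
  obtain ⟨ρ, hρ, K, hK, Φ, κ, h⟩ := exists_inner_orbits
  exact ⟨ρ, K, Φ, κ, hρ, hK, fun y hy => (h y hy).1, fun y hy => (h y hy).2.1,
    fun y hy => (h y hy).2.2⟩

namespace InnerFamily

variable {ρ K : ℝ} {Φ : ℝ → LS → LS} {κ : LS → ℝ}

theorem close_le (F : InnerFamily ρ K Φ κ) {r : ℝ} {y : LS}
    (hy : dist y (ideal 0) < min ρ (r / K)) {s : ℝ} (hs : s ∈ Icc (-1 : ℝ) 10001) :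
    dist (Φ s y) (ideal s) ≤ r := by
  have h1 := F.close y (hy.trans_le (min_le_left _ _)) s hs
  have h2 := hy.trans_le (min_le_right _ _)
  rw [lt_div_iff₀ F.K_pos] at h2
  linarith

theorem nl_flow (F : InnerFamily ρ K Φ κ) :
    NL (fun (s : Icc (0 : ℝ) 10001) y y' δ => ‖Φ s y - Φ s y' + δ • et‖) := by
  obtain ⟨C, hC, h⟩ := flow_near_linear isOpen_lU contDiffOn_lc (b := 10001)
    continuous_ideal.continuousOn (fun s _ => ideal_mem_lU s) (fun s _ => fderiv_lc_et s)
  refine ⟨C, hC, fun ε hε => ?_⟩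
  obtain ⟨r, hr, h⟩ := h ε hε
  refine ⟨min ρ (r / K), lt_min F.rho_pos (div_pos hr F.K_pos), fun s y y' hy hy' δ => ?_⟩
  have hy1 := hy.trans_le (min_le_left _ _)
  have hy1' := hy'.trans_le (min_le_left _ _)
  have := h (fun s => Φ s y) (fun s => Φ s y')
    (fun s hs => ⟨(F.orbit y hy1).deriv s ⟨by linarith [hs.1], hs.2⟩,
      F.close_le hy ⟨by linarith [hs.1], hs.2⟩⟩)
    (fun s hs => ⟨(F.orbit y' hy1').deriv s ⟨by linarith [hs.1], hs.2⟩,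
      F.close_le hy' ⟨by linarith [hs.1], hs.2⟩⟩) δ s s.2
  simpa only [F.start_eq y hy1, F.start_eq y' hy1'] using this

theorem hit_mem (F : InnerFamily ρ K Φ κ) {y : LS} (hy : dist y (ideal 0) < ρ) :
    κ y ∈ Icc (0 : ℝ) 10001 :=
  ⟨by linarith [(F.orbit y hy).hit_mem.1], (F.orbit y hy).hit_mem.2.le⟩

theorem projIcc_hit (F : InnerFamily ρ K Φ κ) {y : LS} (hy : dist y (ideal 0) < ρ) :
    ((projIcc (0 : ℝ) 10001 (by norm_num) (κ y) : Icc (0 : ℝ) 10001) : ℝ) = κ y := by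
  rw [projIcc_of_mem _ (F.hit_mem hy)]

theorem nl_hit (F : InnerFamily ρ K Φ κ) : NL (fun (_ : Unit) y y' _ => |κ y - κ y'|) := by
  refine F.nl_flow.of_le (fun _ y' _ => projIcc 0 10001 (by norm_num) (κ y')) ?_
  obtain ⟨C, hC, h⟩ := near_linear (a := 9999) (b := 10001) isOpen_lW contDiffOn_lcF
    continuous_ideal.continuousOn (fun s hs => ideal_mem_lW (by linarith [hs.1])) et
  refine ⟨C, hC, fun ε hε => ?_⟩
  obtain ⟨r, hr, h⟩ := h ε hε
  refine ⟨min ρ (r / K), lt_min F.rho_pos (div_pos hr F.K_pos), fun _ y y' hy hy' δ => ?_⟩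
  have hy1 := hy.trans_le (min_le_left _ _)
  have hy1' := hy'.trans_le (min_le_left _ _)
  have hκ := (F.orbit y hy1).hit_mem
  have hκ' := (F.orbit y' hy1').hit_mem
  have hs : κ y' ∈ Icc (-1 : ℝ) 10001 := ⟨by linarith [hκ'.1], hκ'.2.le⟩
  have h1 := h (κ y') ⟨hκ'.1.le, hκ'.2.le⟩ (Φ (κ y') y) (Φ (κ y') y') (F.close_le hy hs)
    (F.close_le hy' hs) δ
  rw [fderiv_lcF_et (by linarith [hκ'.1])] at h1
  simp only [F.projIcc_hit hy1']
  refine le_trans ?_ h1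
  have h2 := abs_sub_le_of_one_le_deriv
    (fun x (hx : x ∈ Icc (9999 : ℝ) 10001) => hasDerivAt_lcF
      ((F.orbit y hy1).deriv x ⟨by linarith [hx.1], hx.2⟩) ((F.orbit y hy1).target x hx).1.2)
    (fun x hx => ((F.orbit y hy1).target x hx).2.2.le)
    (Ioo_subset_Icc_self hκ) (Ioo_subset_Icc_self hκ')
  refine h2.trans ?_
  rw [(F.orbit y hy1).hit, ← (F.orbit y' hy1').hit, abs_sub_comm]
  refine le_trans (le_of_eq ?_) (norm_fst_le _)
  simp [Real.norm_eq_abs]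

theorem flow_ideal (F : InnerFamily ρ K Φ κ) {s : ℝ} (hs : s ∈ Icc (-1 : ℝ) 10001) :
    Φ s (ideal 0) = ideal s := by
  have := F.close (ideal 0) (by simpa using F.rho_pos) s hs
  simpa using this

theorem hit_ideal (F : InnerFamily ρ K Φ κ) : κ (ideal 0) = 10000 := by
  have h := F.orbit (ideal 0) (by simpa using F.rho_pos)
  have h1 := h.hit
  have h2 := h.hit_mem
  rw [F.flow_ideal ⟨by linarith [h2.1], h2.2.le⟩, lcF_ideal (by linarith [h2.1])] at h1
  nlinarith [h2.1]

theorem tendsto_hit (F : InnerFamily ρ K Φ κ) : Tendsto κ (𝓝 (ideal 0)) (𝓝 10000) := by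
  obtain ⟨C, hC, h⟩ := F.nl_hit
  obtain ⟨r, hr, h⟩ := h 1 one_pos
  rw [Metric.tendsto_nhds_nhds]
  intro ε hε
  refine ⟨min r (ε / C), by positivity, fun {y} hy => ?_⟩
  have h1 := h () y (ideal 0) (hy.trans_le (min_le_left _ _)) (by simpa using hr) 0
  have h2 := hy.trans_le (min_le_right _ _)
  rw [lt_div_iff₀ hC, dist_eq_norm] at h2
  simp only [F.hit_ideal, abs_zero, mul_zero, zero_smul, add_zero, zero_add] at h1
  rw [Real.dist_eq]
  linarith

theorem tendsto_hit_point (F : InnerFamily ρ K Φ κ) :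
    Tendsto (fun y => Φ (κ y) y) (𝓝 (ideal 0)) (𝓝 (ideal 10000)) := by
  have h1 : Tendsto (fun y => ideal (κ y)) (𝓝 (ideal 0)) (𝓝 (ideal 10000)) :=
    (continuous_ideal.tendsto _).comp F.tendsto_hit
  have h2 : Tendsto (fun y : LS => K * dist y (ideal 0)) (𝓝 (ideal 0)) (𝓝 0) := by
    have : Continuous (fun y : LS => K * dist y (ideal 0)) := by fun_prop
    simpa using this.tendsto (ideal 0)
  refine tendsto_iff_of_dist ?_ |>.2 h1
  refine squeeze_zero' (Eventually.of_forall fun _ => dist_nonneg) ?_ h2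
  filter_upwards [Metric.ball_mem_nhds (ideal 0) F.rho_pos] with y hy
  have := (F.orbit y hy).hit_mem
  exact F.close y hy _ ⟨by linarith [this.1], this.2.le⟩

theorem exists_hit_close (F : InnerFamily ρ K Φ κ) {r : ℝ} (hr : 0 < r) :
    ∃ ρ' > 0, ∀ y, dist y (ideal 0) < ρ' → dist (Φ (κ y) y) (ideal 10000) ≤ r := by
  obtain ⟨ρ', h, h'⟩ := Metric.tendsto_nhds_nhds.1 F.tendsto_hit_point r hr
  exact ⟨ρ', h, fun y hy => (h' hy).le⟩

theorem exists_bound {E : Type*} [NormedAddCommGroup E] [NormedSpace ℝ E] {f : LS → E}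
    (F : InnerFamily ρ K Φ κ) (hf : ContDiffOn ℝ 1 f lU) :
    ∃ L > 0, ∃ ρ' > 0, ρ' ≤ ρ ∧ ∀ y, dist y (ideal 0) < ρ' → ∀ s ∈ Icc (9999 : ℝ) 10001,
      ‖f (Φ s y)‖ ≤ L := by
  obtain ⟨r, hr, C, hC, h⟩ := uniform_lipschitz_near_curve (a := 9999) (b := 10001) isOpen_lU
    hf continuous_ideal.continuousOn (fun s _ => ideal_mem_lU s)
  obtain ⟨M, hM⟩ := (isCompact_Icc (a := (9999 : ℝ)) (b := 10001)).exists_bound_of_continuousOn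
    (f := fun s => f (ideal s))
    (hf.continuousOn.comp continuous_ideal.continuousOn (fun s _ => ideal_mem_lU s))
  have hM0 : 0 ≤ M := (norm_nonneg _).trans (hM 10000 ⟨by norm_num, by norm_num⟩)
  refine ⟨M + C * r, by positivity, min ρ (r / K), lt_min F.rho_pos (div_pos hr F.K_pos),
    min_le_left _ _, fun y hy s hs => ?_⟩
  have hd := F.close_le hy (s := s) ⟨by linarith [hs.1], hs.2⟩
  have h1 := (h s hs (Φ s y) (ideal s) hd (by simpa using hr.le)).2
  have h2 : C * ‖Φ s y - ideal s‖ ≤ C * r := by rw [← dist_eq_norm]; gcongr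
  have h3 := norm_le_norm_add_norm_sub (f (ideal s)) (f (Φ s y))
  rw [norm_sub_rev] at h3
  linarith [hM s hs]

theorem nl_hit_point (F : InnerFamily ρ K Φ κ) :
    NL (fun (_ : Unit) y y' δ => ‖Φ (κ y) y - Φ (κ y') y' + δ • et‖) := by
  obtain ⟨L, hL, ρ', hρ', hle, hb⟩ := F.exists_bound contDiffOn_lc
  refine ((F.nl_hit.const_mul hL).add (F.nl_flow.comp
    (fun _ y' (_ : Unit) => projIcc 0 10001 (by norm_num) (κ y')))).of_le (fun _ _ i => i)
    ⟨1, one_pos, fun ε hε => ⟨ρ', hρ', fun _ y y' hy hy' δ => ?_⟩⟩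
  have hy1 := hy.trans_le hle
  have hy1' := hy'.trans_le hle
  simp only [F.projIcc_hit hy1']
  have h1 : ‖Φ (κ y) y - Φ (κ y') y‖ ≤ L * ‖κ y - κ y'‖ :=
    (convex_Icc (9999 : ℝ) 10001).norm_image_sub_le_of_norm_hasDerivWithin_le
      (f := fun s => Φ s y) (fun x hx => ((F.orbit y hy1).deriv x
        ⟨by linarith [hx.1], hx.2⟩).hasDerivWithinAt) (fun x hx => hb y hy x hx)
      (Ioo_subset_Icc_self (F.orbit y' hy1').hit_mem)
      (Ioo_subset_Icc_self (F.orbit y hy1).hit_mem)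
  have h2 : Φ (κ y) y - Φ (κ y') y' + δ • et =
      (Φ (κ y) y - Φ (κ y') y) + (Φ (κ y') y - Φ (κ y') y' + δ • et) := by abel
  have h3 : 0 ≤ ε * |δ| := by positivity
  rw [h2]
  refine (norm_add_le _ _).trans ?_
  rw [Real.norm_eq_abs] at h1
  linarith

theorem nl_hit_comp {E : Type*} [NormedAddCommGroup E] [NormedSpace ℝ E] {f : LS → E}
    (F : InnerFamily ρ K Φ κ) (hf : ContDiffOn ℝ 1 f lW) :
    NL (fun (_ : Unit) y y' δ => ‖f (Φ (κ y) y) - f (Φ (κ y') y') +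
      δ • fderiv ℝ f (ideal 10000) et‖) := by
  refine F.nl_hit_point.of_le (fun _ _ i => i) ?_
  obtain ⟨C, hC, h⟩ := near_linear (a := 10000) (b := 10000) isOpen_lW hf
    continuous_ideal.continuousOn (fun s hs => ideal_mem_lW (by linarith [hs.1])) et
  refine ⟨C, hC, fun ε hε => ?_⟩
  obtain ⟨r, hr, h⟩ := h ε hε
  obtain ⟨ρ', hρ', hc⟩ := F.exists_hit_close hr
  exact ⟨ρ', hρ', fun _ y y' hy hy' δ => h 10000 ⟨le_rfl, le_rfl⟩ _ _ (hc y hy) (hc y' hy') δ⟩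

theorem nl_torque (F : InnerFamily ρ K Φ κ) :
    NL (fun (s : Icc (0 : ℝ) 10001) y y' δ => |ltq (Φ s y).1 (Φ s y).2.1 (Φ s y).2.2.2.2.1 -
      ltq (Φ s y').1 (Φ s y').2.1 (Φ s y').2.2.2.2.1 + δ * dtq s|) := by
  refine F.nl_flow.of_le (fun _ _ i => i) ?_
  obtain ⟨C, hC, h⟩ := near_linear (a := 0) (b := 10001) isOpen_lU contDiffOn_ltq
    continuous_ideal.continuousOn (fun s _ => ideal_mem_lU s) et
  refine ⟨C, hC, fun ε hε => ?_⟩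
  obtain ⟨r, hr, h⟩ := h ε hε
  refine ⟨min ρ (r / K), lt_min F.rho_pos (div_pos hr F.K_pos), fun s y y' hy hy' δ => ?_⟩
  have hs : (s : ℝ) ∈ Icc (-1 : ℝ) 10001 := ⟨by linarith [s.2.1], s.2.2⟩
  have := h s s.2 _ _ (F.close_le hy hs) (F.close_le hy' hs) δ
  rwa [fderiv_ltq_et, smul_eq_mul, Real.norm_eq_abs] at this

theorem nl_continuous (F : InnerFamily ρ K Φ κ) {A : ℝ → ℝ} (hA : Continuous A) :
    NL (fun (_ : Unit) _ y' δ => |δ| * |A (κ y') - A 10000|) := by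
  refine ⟨1, one_pos, fun ε hε => ?_⟩
  obtain ⟨r, hr, h⟩ := Metric.tendsto_nhds_nhds.1 ((hA.tendsto 10000).comp F.tendsto_hit) ε hε
  refine ⟨r, hr, fun _ y y' _ hy' δ => ?_⟩
  have := (h hy').le
  rw [Real.dist_eq] at this
  have h2 := mul_le_mul_of_nonneg_left this (abs_nonneg δ)
  simp only [Function.comp] at h2
  nlinarith [norm_nonneg (y - y' + δ • et)]

theorem flow_mu (F : InnerFamily ρ K Φ κ) {y : LS} (hy : dist y (ideal 0) < ρ) {s : ℝ}
    (hs : s ∈ Icc (0 : ℝ) 10001) : (Φ s y).2.2.2.2.2.2 = y.2.2.2.2.2.2 := by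
  have := (constant_of_has_deriv_right_zero (f := fun s => (Φ s y).2.2.2.2.2.2) (a := 0)
    (b := 10001)
    (fun x hx => (lc_deriv ((F.orbit y hy).deriv x
      ⟨by linarith [hx.1], hx.2⟩)).2.2.2.2.2.2.continuousAt.continuousWithinAt)
    (fun x hx => (lc_deriv ((F.orbit y hy).deriv x
      ⟨by linarith [hx.1], hx.2.le⟩)).2.2.2.2.2.2.hasDerivWithinAt)) s hs
  simpa only [F.start_eq y hy] using this

/-- The effect of a time shift on the angular momentum at the hitting time. -/
theorem angular_momentum_shift (F : InnerFamily ρ K Φ κ) : ∃ M : ℝ, 1 / 4 ≤ M ∧ ∃ C > 0,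
    ∀ ε > 0, ∃ ρ' > 0, ∀ y y', dist y (ideal 0) < ρ' → dist y' (ideal 0) < ρ' →
      y.2.2.2.2.2.2 = y'.2.2.2.2.2.2 → 0 ≤ y.2.2.2.2.2.2 → ∀ δ : ℝ,
      |(lcF (Φ (κ y) y)).2.2.2 - (lcF (Φ (κ y') y')).2.2.2 -
          ((y.1 * y.2.2.2.1 - y.2.1 * y.2.2.1) - (y'.1 * y'.2.2.2.1 - y'.2.1 * y'.2.2.1)) -
          y.2.2.2.2.2.2 * M * δ| ≤
        y.2.2.2.2.2.2 * (ε * |δ| + C * ‖y - y' + δ • et‖) := by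
  obtain ⟨A, hA, hA0, hM⟩ := exists_melnikov
  set P : ℝ := (10000 : ℝ) ^ 2 / 2 * sin (10000 ^ 3 / 6) + 2 / 10000 * cos (10000 ^ 3 / 6) with hP
  have hAc : Continuous A := continuous_iff_continuousAt.2 fun s => (hA s).continuousAt
  obtain ⟨L, hL, ρ₁, hρ₁, hle, hb⟩ := F.exists_bound contDiffOn_ltq
  have N := (((F.nl_torque.const_mul (c := 10001) (by norm_num)).add
    ((F.nl_hit.const_mul hL).comp fun _ _ (_ : Icc (0 : ℝ) 10001) => ())).add
    ((F.nl_hit_comp contDiffOn_lB).comp fun _ _ (_ : Icc (0 : ℝ) 10001) => ())).add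
    ((F.nl_continuous hAc).comp fun _ _ (_ : Icc (0 : ℝ) 10001) => ())
  rw [fderiv_lB_et (by norm_num), ← hP] at N
  obtain ⟨C, hC, N⟩ := N
  refine ⟨-A 10000 + P, hM, C, hC, fun ε hε => ?_⟩
  obtain ⟨ρ₂, hρ₂, N⟩ := N ε hε
  refine ⟨min ρ₁ ρ₂, by positivity, fun y y' hy hy' hμ hμ0 δ => ?_⟩
  have hb' := hb y (hy.trans_le (min_le_left _ _))
  have N' := fun s => N s y y' (hy.trans_le (min_le_right _ _)) (hy'.trans_le (min_le_right _ _)) δ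
  have hy1 := (hy.trans_le (min_le_left _ _)).trans_le hle
  have hy1' := (hy'.trans_le (min_le_left _ _)).trans_le hle
  clear N hb
  have hκ := F.hit_mem hy1
  have hκ' := F.hit_mem hy1'
  have hmul := fun s (hs : s ∈ Icc (0 : ℝ) 10001) => F.flow_mu hy1 hs
  have hmul' := fun s (hs : s ∈ Icc (0 : ℝ) 10001) => F.flow_mu hy1' hs
  rw [← hμ] at hmul'
  set m := y.2.2.2.2.2.2 with hm
  set E := ε * |δ| + C * ‖y - y' + δ • et‖ with hE
  set g : LS → ℝ := fun Y => Y.1 * Y.2.2.2.1 - Y.2.1 * Y.2.2.1 with hg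
  set rest := L * |κ y - κ y'| + ‖lB (Φ (κ y) y) - lB (Φ (κ y') y') + δ • -P‖ +
    |δ| * |A (κ y') - A 10000| with hrest
  have hdg : ∀ s ∈ Icc (0 : ℝ) 10001, HasDerivAt (fun s => g (Φ s y))
      (m * ltq (Φ s y).1 (Φ s y).2.1 (Φ s y).2.2.2.2.1) s := fun s hs => by
    have := hasDerivAt_lG ((F.orbit y hy1).deriv s ⟨by linarith [hs.1], hs.2⟩)
    rwa [hmul s hs] at this
  have hdg' : ∀ s ∈ Icc (0 : ℝ) 10001, HasDerivAt (fun s => g (Φ s y'))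
      (m * ltq (Φ s y').1 (Φ s y').2.1 (Φ s y').2.2.2.2.1) s := fun s hs => by
    have := hasDerivAt_lG ((F.orbit y' hy1').deriv s ⟨by linarith [hs.1], hs.2⟩)
    rwa [hmul' s hs] at this
  have hB : 0 ≤ (E - rest) / 10001 := by
    have := N' ⟨0, by norm_num, by norm_num⟩
    simp only at this
    have h2 := abs_nonneg (ltq (Φ 0 y).1 (Φ 0 y).2.1 (Φ 0 y).2.2.2.2.1 -
      ltq (Φ 0 y').1 (Φ 0 y').2.1 (Φ 0 y').2.2.2.2.1 + δ * dtq 0)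
    refine div_nonneg ?_ (by norm_num)
    simp only [hrest]
    linarith
  have h1 : ‖(fun s => g (Φ s y) - g (Φ s y') + m * δ * A s) (κ y') -
      (fun s => g (Φ s y) - g (Φ s y') + m * δ * A s) 0‖ ≤
        m * ((E - rest) / 10001) * ‖κ y' - 0‖ := by
    refine (convex_Icc (0 : ℝ) 10001).norm_image_sub_le_of_norm_hasDerivWithin_le
      (f' := fun s => m * ltq (Φ s y).1 (Φ s y).2.1 (Φ s y).2.2.2.2.1 -
        m * ltq (Φ s y').1 (Φ s y').2.1 (Φ s y').2.2.2.2.1 + m * δ * dtq s)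
      (fun x hx => (((hdg x hx).fun_sub (hdg' x hx)).fun_add
        ((hA x).const_mul _)).hasDerivWithinAt) (fun x hx => ?_) ⟨le_rfl, by norm_num⟩ hκ'
    have := N' ⟨x, hx⟩
    simp only at this
    rw [show m * ltq (Φ x y).1 (Φ x y).2.1 (Φ x y).2.2.2.2.1 -
        m * ltq (Φ x y').1 (Φ x y').2.1 (Φ x y').2.2.2.2.1 + m * δ * dtq x =
        m * (ltq (Φ x y).1 (Φ x y).2.1 (Φ x y).2.2.2.2.1 -
        ltq (Φ x y').1 (Φ x y').2.1 (Φ x y').2.2.2.2.1 + δ * dtq x) by ring, norm_mul,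
      Real.norm_eq_abs, Real.norm_eq_abs, abs_of_nonneg hμ0]
    refine mul_le_mul_of_nonneg_left ?_ hμ0
    rw [le_div_iff₀ (by norm_num)]
    simp only [hrest]
    linarith
  have h2 : ‖g (Φ (κ y) y) - g (Φ (κ y') y)‖ ≤ m * L * ‖κ y - κ y'‖ := by
    refine (convex_Icc (9999 : ℝ) 10001).norm_image_sub_le_of_norm_hasDerivWithin_le
      (f := fun s => g (Φ s y))
      (fun x hx => (hdg x ⟨by linarith [hx.1], hx.2⟩).hasDerivWithinAt) (fun x hx => ?_)
      (Ioo_subset_Icc_self (F.orbit y' hy1').hit_mem)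
      (Ioo_subset_Icc_self (F.orbit y hy1).hit_mem)
    rw [norm_mul, Real.norm_eq_abs m, abs_of_nonneg hμ0]
    exact mul_le_mul_of_nonneg_left (hb' x hx) hμ0
  have hz : ∀ z, dist z (ideal 0) < ρ → 0 < (Φ (κ z) z).1 ^ 2 + (Φ (κ z) z).2.1 ^ 2 := fun z hz =>
    have := ((F.orbit z hz).target _ (Ioo_subset_Icc_self (F.orbit z hz).hit_mem)).1.2.2
    by positivity
  rw [lcF_G (hz y hy1), lcF_G (hz y' hy1'), hmul _ hκ, hmul' _ hκ']
  simp only [F.start_eq y hy1, F.start_eq y' hy1', hA0, Real.norm_eq_abs, sub_zero] at h1 h2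
  rw [abs_of_nonneg hκ'.1] at h1
  have h3 : m * ((E - rest) / 10001) * κ y' ≤ m * (E - rest) := by
    have : (E - rest) / 10001 * κ y' ≤ (E - rest) / 10001 * 10001 := by
      gcongr
      exact hκ'.2
    calc _ = m * ((E - rest) / 10001 * κ y') := by ring
      _ ≤ m * ((E - rest) / 10001 * 10001) := by gcongr
      _ = _ := by ring
  change |g (Φ (κ y) y) + m * lB (Φ (κ y) y) + m ^ 2 - (g (Φ (κ y') y') + m * lB (Φ (κ y') y') +
    m ^ 2) - (g y - g y') - m * (-A 10000 + P) * δ| ≤ _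
  have h4 : g (Φ (κ y) y) + m * lB (Φ (κ y) y) + m ^ 2 - (g (Φ (κ y') y') + m * lB (Φ (κ y') y') +
      m ^ 2) - (g y - g y') - m * (-A 10000 + P) * δ =
      (g (Φ (κ y') y) - g (Φ (κ y') y') + m * δ * A (κ y') - (g y - g y' + m * δ * 0)) +
      (g (Φ (κ y) y) - g (Φ (κ y') y)) +
      m * (lB (Φ (κ y) y) - lB (Φ (κ y') y') + δ • -P) + -(m * δ * (A (κ y') - A 10000)) := by
    simp only [smul_eq_mul]; ring
  rw [h4]
  refine (abs_add_le _ _).trans (add_le_add ((abs_add_le _ _).trans (add_le_add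
    ((abs_add_le _ _).trans (add_le_add h1 h2)) le_rfl)) le_rfl) |>.trans ?_
  rw [abs_neg, abs_mul, abs_mul, abs_mul, abs_of_nonneg hμ0]
  have h5 : m * rest = m * L * |κ y - κ y'| +
      m * |lB (Φ (κ y) y) - lB (Φ (κ y') y') + δ • -P| + m * |δ| * |A (κ y') - A 10000| := by
    rw [hrest, Real.norm_eq_abs]; ring
  linarith

end InnerFamily

end PCRTBP

namespace PCRTBP

open Set

namespace InnerFamily

variable {ρ K : ℝ} {Φ : ℝ → LS → LS} {κ : LS → ℝ}

theorem eq_of_deriv_zero (F : InnerFamily ρ K Φ κ) {y : LS} (hy : dist y (ideal 0) < ρ) {f : LS → ℝ}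
    (hf : ∀ s ∈ Icc (-1 : ℝ) 10001, HasDerivAt (fun s => f (Φ s y)) 0 s) {s : ℝ}
    (hs : s ∈ Icc (-1 : ℝ) 10001) : f (Φ s y) = f y := by
  have := (convex_Icc (-1 : ℝ) 10001).norm_image_sub_le_of_norm_hasDerivWithin_le (C := 0)
    (fun x hx => (hf x hx).hasDerivWithinAt) (by simp) ⟨by norm_num, by norm_num⟩ hs (x := 0)
  rw [F.start_eq y hy] at this
  simpa [sub_eq_zero] using this

theorem flow_lK (F : InnerFamily ρ K Φ κ) {y : LS} (hy : dist y (ideal 0) < ρ) {s : ℝ}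
    (hs : s ∈ Icc (-1 : ℝ) 10001) : lK (Φ s y) = lK y :=
  F.eq_of_deriv_zero hy
    (fun s hs => hasDerivAt_lK ((F.orbit y hy).deriv s hs) ((F.orbit y hy).mem s hs)) hs

theorem flow_J (F : InnerFamily ρ K Φ κ) {y : LS} (hy : dist y (ideal 0) < ρ) {s : ℝ}
    (hs : s ∈ Icc (-1 : ℝ) 10001) : (Φ s y).2.2.2.2.2.1 = y.2.2.2.2.2.1 :=
  F.eq_of_deriv_zero hy (f := fun Y => Y.2.2.2.2.2.1)
    (fun s hs => (lc_deriv ((F.orbit y hy).deriv s hs)).2.2.2.2.2.1) hs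

theorem hit_mem_target (F : InnerFamily ρ K Φ κ) {y : LS} (hy : dist y (ideal 0) < ρ) :
    Φ (κ y) y ∈ lT :=
  (F.orbit y hy).target _ (Ioo_subset_Icc_self (F.orbit y hy).hit_mem)

theorem hit_mem_Oset (F : InnerFamily ρ K Φ κ) {y : LS} (hy : dist y (ideal 0) < ρ) :
    lcF (Φ (κ y) y) ∈ Oset (1 / 100) := by
  obtain ⟨-, ⟨⟨h1, h2⟩, h3, h4⟩, -⟩ := F.hit_mem_target hy
  exact ⟨(F.orbit y hy).hit, h1, h2.le, abs_le.2 ⟨h3.le, h4.le⟩⟩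

theorem Jb_hit (F : InnerFamily ρ K Φ κ) {y : LS} (hy : dist y (ideal 0) < ρ) (hK : lK y = 0) :
    Jb y.2.2.2.2.2.2 (lcF (Φ (κ y) y)) = y.2.2.2.2.2.1 - y.2.2.2.2.2.2 ^ 2 / 2 := by
  obtain ⟨⟨-, h1, h2⟩, -⟩ := F.hit_mem_target hy
  have hκ := F.hit_mem hy
  have hκ' : κ y ∈ Icc (-1 : ℝ) 10001 := ⟨by linarith [hκ.1], hκ.2⟩
  have := Jb_lcF h1 (by positivity) ((F.flow_lK hy hκ').trans hK)
  rwa [F.flow_J hy hκ', F.flow_mu hy hκ] at this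

theorem reach_hit (F : InnerFamily ρ K Φ κ) {y : LS} (hy : dist y (ideal 0) < ρ) (hK : lK y = 0)
    (hx : y.1 = 0) (hx' : y.2.1 ≠ 0) :
    ∃ T, Reach y.2.2.2.2.2.2 T (lcC y) (toC (lcF (Φ (κ y) y))) ∅ := by
  have hκ := (F.orbit y hy).hit_mem
  rw [toC_lcF (F.hit_mem_target hy).1.2.1]
  have hz : ∀ s ∈ Icc (-1 : ℝ) 10001, 0 < (Φ s y).1 ^ 2 + (Φ s y).2.1 ^ 2 := by
    intro s hs
    have hd : ∀ s ∈ Icc (-1 : ℝ) 10001, HasDerivAt (fun s => (Φ s y).1) (Φ s y).2.2.1 s :=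
      fun s hs => (lc_deriv ((F.orbit y hy).deriv s hs)).1
    have hm : StrictMonoOn (fun s => (Φ s y).1) (Icc (-1 : ℝ) 10001) := by
      refine strictMonoOn_of_deriv_pos (convex_Icc _ _)
        (fun s hs => (hd s hs).continuousAt.continuousWithinAt) (fun s hs => ?_)
      rw [interior_Icc] at hs
      rw [(hd s (Ioo_subset_Icc_self hs)).deriv]
      linarith [(F.orbit y hy).u_pos s (Ioo_subset_Icc_self hs)]
    have h0 : (Φ 0 y).1 = 0 := by rw [F.start_eq y hy, hx]
    have i0 : (0 : ℝ) ∈ Icc (-1 : ℝ) 10001 := ⟨by norm_num, by norm_num⟩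
    rcases lt_trichotomy s 0 with h | h | h
    · have := hm hs i0 h
      simp only [h0] at this
      nlinarith [sq_nonneg (Φ s y).2.1]
    · rw [h, F.start_eq y hy]; positivity
    · have := hm i0 hs h
      simp only [h0] at this
      nlinarith [sq_nonneg (Φ s y).2.1]
  have := reach_lc (μ := y.2.2.2.2.2.2) (a := -1) (b := 10001) (S := κ y) (Y := fun s => Φ s y)
    (by norm_num) (by linarith [hκ.1]) hκ.2 (F.orbit y hy).deriv (F.orbit y hy).mem hz
    (by simpa only [F.start_eq y hy] using hK) (by simp only [F.start_eq y hy])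
  simpa only [F.start_eq y hy] using this

end InnerFamily

/-! ### Initial data near collision -/

/-- The parameter `J - μ V` of the data near collision. -/
noncomputable def iE (P : FS) : ℝ := P.2.2.1 - P.2.2.2 * lV 0 (-P.1) (-P.2.1)

/-- The speed of the data near collision, as a function of `(α, e, μ)`. -/
noncomputable def iS (z : ℝ × ℝ × ℝ) : ℝ :=
  z.1 ^ 3 / 4 + √(z.1 ^ 6 / 16 + (1 - z.2.2) + z.2.1 * z.1 ^ 2 / 2)

/-- The speed of the data near collision, as a function of `(α, θ, J, μ)`. -/
noncomputable def iB (P : FS) : ℝ := iS (P.1, iE P, P.2.2.2)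

/-- Initial data with parameters `(α, θ, J, μ)`. -/
noncomputable def iY (P : FS) : LS := (0, -P.1, iB P, 0, -P.2.1, P.2.2.1, P.2.2.2)

/-- Parameters for which the initial data are defined. -/
def iP : Set FS := {P | 0 < sqD 0 (-P.1) (-P.2.1) ∧
  0 < P.1 ^ 6 / 16 + (1 - P.2.2.2) + iE P * P.1 ^ 2 / 2}

theorem contDiffOn_lV' : ContDiffOn ℝ 1 (fun P : FS => lV 0 (-P.1) (-P.2.1))
    {P | 0 < sqD 0 (-P.1) (-P.2.1)} := by
  intro P hP
  have h1 := contDiffAt_lV (Y := (0, -P.1, 0, 0, -P.2.1, 0, 0)) hP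
  exact (h1.comp P (f := fun P : FS => (((0 : ℝ), -P.1, (0 : ℝ), (0 : ℝ), -P.2.1, (0 : ℝ), (0 : ℝ)) : LS))
    (by fun_prop)).contDiffWithinAt

theorem isOpen_sqD' : IsOpen {P : FS | 0 < sqD 0 (-P.1) (-P.2.1)} := by
  refine isOpen_lt continuous_const ?_
  unfold sqD
  fun_prop

theorem contDiffOn_iE : ContDiffOn ℝ 1 iE {P | 0 < sqD 0 (-P.1) (-P.2.1)} := by
  have := contDiffOn_lV'
  unfold iE
  fun_prop

theorem isOpen_iP : IsOpen iP := by
  have h : ContinuousOn (fun P : FS => P.1 ^ 6 / 16 + (1 - P.2.2.2) + iE P * P.1 ^ 2 / 2)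
      {P | 0 < sqD 0 (-P.1) (-P.2.1)} := by
    have := contDiffOn_iE.continuousOn
    fun_prop
  exact h.isOpen_inter_preimage isOpen_sqD' isOpen_Ioi

theorem contDiffOn_iY : ContDiffOn ℝ 1 iY iP := by
  intro P hP
  have h1 : ContDiffAt ℝ 1 iE P := contDiffOn_iE.contDiffAt (isOpen_sqD'.mem_nhds hP.1)
  have h2 : ContDiffAt ℝ 1 (fun P : FS =>
      √(P.1 ^ 6 / 16 + (1 - P.2.2.2) + iE P * P.1 ^ 2 / 2)) P :=
    ContDiffAt.sqrt (by fun_prop) hP.2.ne'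
  refine ContDiffAt.contDiffWithinAt ?_
  unfold iY iB iS
  fun_prop

theorem sqD_zero_angle (θ : ℝ) : sqD 0 (-0) θ = 1 := by
  simp [sqD]

theorem zero_mem_iP : (0 : FS) ∈ iP := by
  refine ⟨?_, ?_⟩
  · show 0 < sqD 0 (-0) (-0)
    rw [sqD_zero_angle]; exact one_pos
  · simp

theorem iY_axis (θ : ℝ) : iY (0, θ, 0, 0) = (0, 0, 1, 0, -θ, 0, 0) := by
  simp [iY, iB, iS]

theorem iY_zero : iY 0 = ideal 0 := by
  have h : iY 0 = (0, 0, 1, 0, -0, 0, 0) := iY_axis 0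
  rw [h, ideal]
  norm_num

theorem fderiv_iY : fderiv ℝ iY 0 (0, 1, 0, 0) = -et := by
  refine fderiv_apply_eq ((contDiffOn_iY.contDiffAt
    (isOpen_iP.mem_nhds zero_mem_iP)).differentiableAt one_ne_zero) ?_
  have : (fun t : ℝ => iY (0 + t • ((0, 1, 0, 0) : FS))) = fun t => ((0, 0, 1, 0, -t, 0, 0) : LS) := by
    ext1 t
    rw [← iY_axis t]
    simp
  rw [this, hasDerivAt_LS]
  simp only [et, Prod.neg_mk, neg_zero]
  exact ⟨hasDerivAt_const _ _, hasDerivAt_const _ _, hasDerivAt_const _ _, hasDerivAt_const _ _,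
    (hasDerivAt_id (0 : ℝ)).fun_neg, hasDerivAt_const _ _, hasDerivAt_const _ _⟩

theorem iY_shift : ∃ C > 0, ∀ ε > 0, ∃ ρ > 0, ∀ P P' : FS, ‖P‖ ≤ ρ → ‖P'‖ ≤ ρ →
    ‖iY P - iY P' + (P.2.1 - P'.2.1) • et‖ ≤ ε * |P.2.1 - P'.2.1| +
      C * (|P.1 - P'.1| + |P.2.2.1 - P'.2.2.1| + |P.2.2.2 - P'.2.2.2|) := by
  obtain ⟨C, hC, h⟩ := near_linear (a := 0) (b := 0) (γ := fun _ => (0 : FS)) isOpen_iP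
    contDiffOn_iY continuousOn_const (fun _ _ => zero_mem_iP) (0, 1, 0, 0)
  refine ⟨C, hC, fun ε hε => ?_⟩
  obtain ⟨ρ, hρ, h⟩ := h ε hε
  refine ⟨ρ, hρ, fun P P' hP hP' => ?_⟩
  have := h 0 ⟨le_rfl, le_rfl⟩ P P' (by simpa using hP) (by simpa using hP') (-(P.2.1 - P'.2.1))
  rw [fderiv_iY, smul_neg, neg_smul, neg_neg, abs_neg] at this
  refine this.trans (add_le_add le_rfl (mul_le_mul_of_nonneg_left ?_ hC.le))
  have e : P - P' + -(P.2.1 - P'.2.1) • ((0, 1, 0, 0) : FS) =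
      (P.1 - P'.1, 0, P.2.2.1 - P'.2.2.1, P.2.2.2 - P'.2.2.2) := by
    ext <;> simp
  rw [e]
  simp only [Prod.norm_mk, Real.norm_eq_abs, abs_zero]
  have h1 := abs_nonneg (P.1 - P'.1)
  have h2 := abs_nonneg (P.2.2.1 - P'.2.2.1)
  have h3 := abs_nonneg (P.2.2.2 - P'.2.2.2)
  refine max_le (by linarith) (max_le (by linarith) (max_le (by linarith) (by linarith)))

theorem iB_sq {P : FS} (hP : P ∈ iP) :
    iB P ^ 2 = (1 - P.2.2.2) + (iE P + P.1 * iB P) * P.1 ^ 2 / 2 := by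
  have h := Real.sq_sqrt hP.2.le
  simp only [iB, iS]
  linear_combination h

theorem lK_iY {P : FS} (hP : P ∈ iP) : lK (iY P) = 0 := by
  have := iB_sq hP
  simp only [iE] at this
  simp only [lK, lh, iY]
  linear_combination this

theorem lV_even (α θ : ℝ) : lV 0 (-α) (-θ) = lV 0 (-α) θ := by
  simp [lV, lD, sqD]

theorem iB_even (α θ J μ : ℝ) : iB (α, -θ, J, μ) = iB (α, θ, J, μ) := by
  simp only [iB, iE, neg_neg, lV_even]

/-- The state of the massless body with parameters `(α, θ, J, μ)`. -/
noncomputable def iC (P : FS) : FS := lcC (iY P)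

theorem iC_eq (α θ J μ : ℝ) : iC (α, θ, J, μ) = (α ^ 2 / 2 * cos θ - μ, α ^ 2 / 2 * sin θ,
    -(α ^ 2 / 2)⁻¹ * (α * iB (α, θ, J, μ) * sin θ),
    (α ^ 2 / 2)⁻¹ * (α * iB (α, θ, J, μ) * cos θ) - μ) := by
  simp only [iC, lcC, iY, cos_neg, sin_neg, Prod.mk.injEq]
  refine ⟨by ring, by ring, by ring, by ring⟩

theorem rc_iC (α θ J μ : ℝ) : rc (iC (α, θ, J, μ)) = iC (α, -θ, J, μ) := by
  simp only [iC_eq, rc, cos_neg, sin_neg, iB_even, Prod.mk.injEq]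
  refine ⟨trivial, by ring, by ring, trivial⟩


theorem iS_strict : HasStrictFDerivAt (fun z : ℝ × ℝ × ℝ => z.1 * iS z)
    (ContinuousLinearMap.fst ℝ ℝ (ℝ × ℝ)) 0 := by
  have hs : HasStrictFDerivAt (fun z : ℝ × ℝ × ℝ =>
      √(z.1 ^ 6 / 16 + (1 - z.2.2) + z.2.1 * z.1 ^ 2 / 2)) _ 0 :=
    ContDiffAt.hasStrictFDerivAt (n := 1)
      (ContDiffAt.sqrt (by fun_prop) (by simp)) one_ne_zero
  have h3 : HasStrictFDerivAt (fun z : ℝ × ℝ × ℝ => z.1 ^ 3 / 4) _ 0 :=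
    ContDiffAt.hasStrictFDerivAt (n := 1) (by fun_prop) one_ne_zero
  have h1 : HasStrictFDerivAt (fun z : ℝ × ℝ × ℝ => z.1) (ContinuousLinearMap.fst ℝ ℝ (ℝ × ℝ)) 0 :=
    hasStrictFDerivAt_fst
  refine (h1.mul (h3.add hs)).congr_fderiv ?_
  simp

theorem iB_shift : ∀ ε > 0, ∃ ρ > 0, ∀ P P' : FS, ‖P‖ ≤ ρ → ‖P'‖ ≤ ρ → P.2.2 = P'.2.2 →
    0 ≤ P.2.2.2 →
    |P.1 * iB P - P'.1 * iB P' - (P.1 - P'.1)| ≤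
      ε * (|P.1 - P'.1| + P.2.2.2 * |P.2.1 - P'.2.1|) := by
  intro ε hε
  obtain ⟨r, hr, C, hC, h⟩ := uniform_lipschitz_near_curve (a := 0) (b := 0)
    (γ := fun _ => (0 : FS)) isOpen_sqD' contDiffOn_lV' continuousOn_const
    (fun _ _ => zero_mem_iP.1)
  have hs := iS_strict.isLittleO.def (c := ε / (2 + C)) (by positivity)
  have hcont : ContinuousAt (fun P : FS => ((P.1, iE P, P.2.2.2) : ℝ × ℝ × ℝ)) 0 := by
    have : ContinuousAt iE 0 :=
      contDiffOn_iE.continuousOn.continuousAt (isOpen_sqD'.mem_nhds zero_mem_iP.1)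
    fun_prop
  have hz : ((((0 : FS).1, iE 0, (0 : FS).2.2.2) : ℝ × ℝ × ℝ)) = 0 := by simp [iE]
  have hcont' := (hcont.tendsto.prodMap hcont.tendsto)
  rw [hz, ← nhds_prod_eq, ← nhds_prod_eq] at hcont'
  have hev := hcont'.eventually hs
  obtain ⟨r', hr', hb⟩ := Metric.nhds_basis_closedBall.eventually_iff.1 hev
  refine ⟨min (min r 1) r', by positivity, fun P P' hP hP' hPP hμ => ?_⟩
  have h1 : ‖P‖ ≤ r := hP.trans ((min_le_left _ _).trans (min_le_left _ _))
  have h1' : ‖P'‖ ≤ r := hP'.trans ((min_le_left _ _).trans (min_le_left _ _))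
  have h2 : P.2.2.2 ≤ 1 := (le_abs_self _).trans (((norm_snd_le P.2.2).trans
    ((norm_snd_le P.2).trans (norm_snd_le P))).trans
      (hP.trans ((min_le_left _ _).trans (min_le_right _ _))))
  have h3 := hb (x := (P, P')) (by
    rw [Metric.mem_closedBall, Prod.dist_eq]
    exact max_le (by simpa using hP.trans (min_le_right _ _))
      (by simpa using hP'.trans (min_le_right _ _)))
  have h4 := (h 0 ⟨le_rfl, le_rfl⟩ P P' (by simpa using h1) (by simpa using h1')).2
  have h5 : |iE P - iE P'| ≤ P.2.2.2 * |lV 0 (-P.1) (-P.2.1) - lV 0 (-P'.1) (-P'.2.1)| := by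
    rw [iE, iE, ← hPP, ← abs_of_nonneg hμ, ← abs_mul, ← abs_neg, abs_of_nonneg hμ]
    exact (congrArg _ (by ring)).le
  have h6 : ‖P - P'‖ ≤ |P.1 - P'.1| + |P.2.1 - P'.2.1| := by
    have e : P - P' = (P.1 - P'.1, P.2.1 - P'.2.1, 0, 0) := by
      ext <;> simp [hPP]
    rw [e]
    simp only [Prod.norm_mk, Real.norm_eq_abs, abs_zero]
    have := abs_nonneg (P.1 - P'.1)
    have := abs_nonneg (P.2.1 - P'.2.1)
    refine max_le (by linarith) (max_le (by linarith) (max_le (by linarith) (by linarith)))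
  have h7 : |iE P - iE P'| ≤ C * (|P.1 - P'.1| + P.2.2.2 * |P.2.1 - P'.2.1|) := by
    have h8 : |lV 0 (-P.1) (-P.2.1) - lV 0 (-P'.1) (-P'.2.1)| ≤
        C * (|P.1 - P'.1| + |P.2.1 - P'.2.1|) := h4.trans (by gcongr)
    have h9 := mul_le_mul_of_nonneg_left h8 hμ
    have h10 : P.2.2.2 * |P.1 - P'.1| ≤ 1 * |P.1 - P'.1| := by gcongr
    nlinarith
  simp only [Prod.map_apply, Prod.mk_sub_mk, Prod.norm_mk, Real.norm_eq_abs,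
    ContinuousLinearMap.coe_fst'] at h3
  refine h3.trans ?_
  have h11 : 0 ≤ P.2.2.2 * |P.2.1 - P'.2.1| := by positivity
  have h12 := abs_nonneg (P.1 - P'.1)
  rw [← hPP, sub_self, abs_zero]
  have h13 : max |P.1 - P'.1| (max |iE P - iE P'| 0) ≤
      (2 + C) * (|P.1 - P'.1| + P.2.2.2 * |P.2.1 - P'.2.1|) := by
    refine max_le ?_ (max_le ?_ ?_) <;> nlinarith [mul_nonneg hC.le (add_nonneg h12 h11)]
  calc _ ≤ ε / (2 + C) * ((2 + C) * (|P.1 - P'.1| + P.2.2.2 * |P.2.1 - P'.2.1|)) := by gcongr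
    _ = _ := by field_simp

end PCRTBP

namespace PCRTBP

open Set

/-! ### The inner map -/

/-- The properties of the map leading from the vicinity of collision to the far section. -/
structure InnerMap (I : FS → FS) (M C r : ℝ) : Prop where
  M_ge : 1 / 4 ≤ M
  C_pos : 0 < C
  r_pos : 0 < r
  r_le : r ≤ 1
  mem_Oset : ∀ P, ‖P‖ ≤ r → I P ∈ Oset (1 / 100)
  Jb_eq : ∀ P, ‖P‖ ≤ r → Jb P.2.2.2 (I P) = P.2.2.1 - P.2.2.2 ^ 2 / 2
  dG : ∀ P P', ‖P‖ ≤ r → ‖P'‖ ≤ r → P.2.2 = P'.2.2 → 0 ≤ P.2.2.2 →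
    |(I P).2.2.2 - (I P').2.2.2 - (P.1 - P'.1) - P.2.2.2 * M * (P.2.1 - P'.2.1)| ≤
      1 / 16 * (|P.1 - P'.1| + P.2.2.2 * |P.2.1 - P'.2.1|)
  dφ : ∀ P P', ‖P‖ ≤ r → ‖P'‖ ≤ r → P.2.2 = P'.2.2 →
    |(I P).2.2.1 - (I P').2.2.1 - (P.2.1 - P'.2.1)| ≤
      C * |P.1 - P'.1| + 1 / 16 * |P.2.1 - P'.2.1|
  reach : ∀ P, ‖P‖ ≤ r → P.1 ≠ 0 → ∃ T, Reach P.2.2.2 T (iC P) (toC (I P)) ∅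
  continuousOn : ContinuousOn I {P | ‖P‖ ≤ r}
  G_le : ∀ P, ‖P‖ ≤ r → P.1 = 0 → |(I P).2.2.2| ≤ C * |P.2.2.2|
  half_le_iB : ∀ P, ‖P‖ ≤ r → 1 / 2 ≤ iB P

theorem continuousAt_iY : ContinuousAt iY 0 :=
  contDiffOn_iY.continuousOn.continuousAt (isOpen_iP.mem_nhds zero_mem_iP)

theorem exists_iY_close {r : ℝ} (hr : 0 < r) :
    ∃ ρ > 0, ∀ P, ‖P‖ ≤ ρ → dist (iY P) (ideal 0) < r ∧ P ∈ iP ∧ 1 / 2 ≤ iB P := by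
  have h1 : ∀ᶠ P in 𝓝 (0 : FS), dist (iY P) (ideal 0) < r := by
    have := continuousAt_iY.tendsto
    rw [iY_zero] at this
    exact this.eventually (Metric.ball_mem_nhds _ hr)
  have h2 : ∀ᶠ P in 𝓝 (0 : FS), 1 / 2 < iB P := by
    have : ContinuousAt (fun P => (iY P).2.2.1) 0 := continuousAt_iY.snd.snd.fst
    have h : 1 / 2 < (iY 0).2.2.1 := by rw [iY_zero]; simp only [ideal]; norm_num
    exact this.eventually (lt_mem_nhds h)
  obtain ⟨ρ, hρ, h⟩ := Metric.nhds_basis_closedBall.eventually_iff.1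
    (h1.and ((isOpen_iP.mem_nhds zero_mem_iP |> Filter.Eventually.and) h2))
  refine ⟨ρ, hρ, fun P hP => ?_⟩
  have := h (show P ∈ Metric.closedBall 0 ρ by simpa using hP)
  exact ⟨this.1, this.2.1, this.2.2.le⟩

theorem exists_innerMap : ∃ I M C r, InnerMap I M C r := by
  obtain ⟨ρ, K, Φ, κ, F⟩ := exists_innerFamily
  obtain ⟨C₁, hC₁, S⟩ := iY_shift
  obtain ⟨C₂, hC₂, N⟩ := F.nl_hit_comp contDiffOn_lcF
  rw [fderiv_lcF_et (by norm_num)] at N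
  obtain ⟨M, hM, C₃, hC₃, A⟩ := F.angular_momentum_shift
  obtain ⟨ρ₁, hρ₁, S⟩ := S (min (1 / (32 * C₂)) (1 / (64 * C₃))) (by positivity)
  obtain ⟨ρ₂, hρ₂, N⟩ := N (1 / 32) (by norm_num)
  obtain ⟨ρ₃, hρ₃, A⟩ := A (1 / 64) (by norm_num)
  obtain ⟨ρ₄, hρ₄, B⟩ := iB_shift (1 / 64) (by norm_num)
  obtain ⟨ρ₅, hρ₅, hY⟩ := exists_iY_close (lt_min F.rho_pos (lt_min hρ₂ hρ₃))
  set r := min (min ρ₁ (min ρ₄ ρ₅)) (min 1 (1 / (64 * C₃ * C₁))) with hr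
  have r1 : r ≤ ρ₁ := (min_le_left _ _).trans (min_le_left _ _)
  have r4 : r ≤ ρ₄ := (min_le_left _ _).trans ((min_le_right _ _).trans (min_le_left _ _))
  have r5 : r ≤ ρ₅ := (min_le_left _ _).trans ((min_le_right _ _).trans (min_le_right _ _))
  have r6 : r ≤ 1 := (min_le_right _ _).trans (min_le_left _ _)
  have r7 : r ≤ 1 / (64 * C₃ * C₁) := (min_le_right _ _).trans (min_le_right _ _)
  have hd : ∀ P, ‖P‖ ≤ r → dist (iY P) (ideal 0) < ρ := fun P hP =>
    (hY P (hP.trans r5)).1.trans_le (min_le_left _ _)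
  have hd2 : ∀ P, ‖P‖ ≤ r → dist (iY P) (ideal 0) < ρ₂ := fun P hP =>
    (hY P (hP.trans r5)).1.trans_le ((min_le_right _ _).trans (min_le_left _ _))
  have hd3 : ∀ P, ‖P‖ ≤ r → dist (iY P) (ideal 0) < ρ₃ := fun P hP =>
    (hY P (hP.trans r5)).1.trans_le ((min_le_right _ _).trans (min_le_right _ _))
  have hS : ∀ P P', ‖P‖ ≤ r → ‖P'‖ ≤ r → ‖iY P - iY P' + (P.2.1 - P'.2.1) • et‖ ≤
      min (1 / (32 * C₂)) (1 / (64 * C₃)) * |P.2.1 - P'.2.1| +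
      C₁ * (|P.1 - P'.1| + |P.2.2.1 - P'.2.2.1| + |P.2.2.2 - P'.2.2.2|) :=
    fun P P' hP hP' => S P P' (hP.trans r1) (hP'.trans r1)
  set I : FS → FS := fun P => lcF (Φ (κ (iY P)) (iY P)) with hI
  have hN : ∀ P P', ‖P‖ ≤ r → ‖P'‖ ≤ r →
      ‖I P - I P' + (P.2.1 - P'.2.1) • ((0, 0, -1, 0) : FS)‖ ≤ 1 / 16 * |P.2.1 - P'.2.1| +
        C₂ * C₁ * (|P.1 - P'.1| + |P.2.2.1 - P'.2.2.1| + |P.2.2.2 - P'.2.2.2|) := by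
    intro P P' hP hP'
    refine (N () (iY P) (iY P') (hd2 P hP) (hd2 P' hP') (P.2.1 - P'.2.1)).trans ?_
    have h1 := mul_le_mul_of_nonneg_left (hS P P' hP hP') hC₂.le
    have h2 : C₂ * min (1 / (32 * C₂)) (1 / (64 * C₃)) ≤ 1 / 32 := by
      calc _ ≤ C₂ * (1 / (32 * C₂)) := by gcongr; exact min_le_left _ _
        _ = 1 / 32 := by field_simp
    have h3 := mul_le_mul_of_nonneg_right h2 (abs_nonneg (P.2.1 - P'.2.1))
    linarith
  have hcoord : ∀ {x : FS} {b : ℝ}, ‖x‖ ≤ b → |x.2.2.1| ≤ b ∧ |x.2.2.2| ≤ b := fun {x b} h =>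
    ⟨((norm_fst_le x.2.2).trans ((norm_snd_le x.2).trans (norm_snd_le x))).trans h,
      ((norm_snd_le x.2.2).trans ((norm_snd_le x.2).trans (norm_snd_le x))).trans h⟩
  refine ⟨I, M, C₂ * C₁, r, ⟨hM, by positivity, by positivity, r6,
    fun P hP => F.hit_mem_Oset (hd P hP),
    fun P hP => F.Jb_hit (hd P hP) (lK_iY (hY P (hP.trans r5)).2.1), ?_, ?_, ?_, ?_, ?_,
    fun P hP => (hY P (hP.trans r5)).2.2⟩⟩
  · intro P P' hP hP' hPP hμ
    have h1 := A (iY P) (iY P') (hd3 P hP) (hd3 P' hP') (congrArg Prod.snd hPP) hμ (P.2.1 - P'.2.1)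
    have h2 := B P P' (hP.trans r4) (hP'.trans r4) hPP hμ
    have h3 := mul_le_mul_of_nonneg_left (hS P P' hP hP') hC₃.le
    have h4 : C₃ * min (1 / (32 * C₂)) (1 / (64 * C₃)) ≤ 1 / 64 := by
      calc _ ≤ C₃ * (1 / (64 * C₃)) := by gcongr; exact min_le_right _ _
        _ = 1 / 64 := by field_simp
    have h5 := mul_le_mul_of_nonneg_right h4 (abs_nonneg (P.2.1 - P'.2.1))
    rw [hPP, sub_self, sub_self, abs_zero, add_zero, add_zero] at h3
    have h6 : P.2.2.2 * (C₃ * C₁) ≤ 1 / 64 := by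
      have : P.2.2.2 ≤ 1 / (64 * C₃ * C₁) := (le_abs_self _).trans (((hcoord hP).2).trans r7)
      calc _ ≤ 1 / (64 * C₃ * C₁) * (C₃ * C₁) := by gcongr
        _ = 1 / 64 := by field_simp
    have h7 := mul_le_mul_of_nonneg_right h6 (abs_nonneg (P.1 - P'.1))
    have h8 : P.2.2.2 * (1 / 64 * |P.2.1 - P'.2.1| + C₃ * ‖iY P - iY P' + (P.2.1 - P'.2.1) • et‖) ≤
        P.2.2.2 * (1 / 64 * |P.2.1 - P'.2.1| + (1 / 64 * |P.2.1 - P'.2.1| +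
          C₃ * C₁ * |P.1 - P'.1|)) := mul_le_mul_of_nonneg_left (by linarith) hμ
    have e : (I P).2.2.2 - (I P').2.2.2 - (P.1 - P'.1) - P.2.2.2 * M * (P.2.1 - P'.2.1) =
        ((I P).2.2.2 - (I P').2.2.2 - (((iY P).1 * (iY P).2.2.2.1 - (iY P).2.1 * (iY P).2.2.1) -
        ((iY P').1 * (iY P').2.2.2.1 - (iY P').2.1 * (iY P').2.2.1)) -
        P.2.2.2 * M * (P.2.1 - P'.2.1)) + (P.1 * iB P - P'.1 * iB P' - (P.1 - P'.1)) := by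
      simp only [iY]; ring
    rw [e]
    refine (abs_add_le _ _).trans ((add_le_add (h1.trans h8) h2).trans ?_)
    have h9 := mul_nonneg hμ (abs_nonneg (P.2.1 - P'.2.1))
    have h10 := abs_nonneg (P.1 - P'.1)
    nlinarith
  · intro P P' hP hP' hPP
    have h1 := (hcoord (hN P P' hP hP')).1
    rw [hPP, sub_self, sub_self, abs_zero, add_zero, add_zero] at h1
    rw [add_comm]
    convert h1 using 2
    simp
    ring
  · intro P hP hP1
    exact F.reach_hit (hd P hP) (lK_iY (hY P (hP.trans r5)).2.1) rfl (neg_ne_zero.2 hP1)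
  · refine LipschitzOnWith.continuousOn (K := (2 + 3 * (C₂ * C₁)).toNNReal)
      (LipschitzOnWith.of_dist_le_mul fun P hP P' hP' => ?_)
    rw [Real.coe_toNNReal _ (by positivity), dist_eq_norm, dist_eq_norm]
    have h1 := hN P P' hP hP'
    have h2 : ‖(P.2.1 - P'.2.1) • ((0, 0, -1, 0) : FS)‖ = |P.2.1 - P'.2.1| := by
      rw [norm_smul]; simp [Prod.norm_mk]
    have h3 := norm_le_norm_add_norm_sub' (I P - I P') (-((P.2.1 - P'.2.1) • ((0, 0, -1, 0) : FS)))
    rw [norm_neg, sub_neg_eq_add, h2] at h3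
    have b1 : |P.1 - P'.1| ≤ ‖P - P'‖ := norm_fst_le (P - P')
    have b2 : |P.2.1 - P'.2.1| ≤ ‖P - P'‖ := (norm_fst_le (P - P').2).trans (norm_snd_le (P - P'))
    have b3 := hcoord (le_refl ‖P - P'‖)
    simp only [Prod.snd_sub, Prod.fst_sub] at b3
    have h4 : C₂ * C₁ * (|P.1 - P'.1| + |P.2.2.1 - P'.2.2.1| + |P.2.2.2 - P'.2.2.2|) ≤
        C₂ * C₁ * (3 * ‖P - P'‖) := by
      gcongr
      linarith
    nlinarith [norm_nonneg (P - P')]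
  · intro P hP hP1
    set P' : FS := (P.1, P.2.1, P.2.2.1, 0) with hP'def
    have hP' : ‖P'‖ ≤ r := by
      refine le_trans ?_ hP
      simp only [hP'def, Prod.norm_def, norm_zero]
      gcongr
      positivity
    have hP0 : ‖(0 : FS)‖ ≤ r := by rw [norm_zero]; positivity
    have h1 := (hcoord (hN P P' hP hP')).2
    simp only [hP'def, sub_self, abs_zero, mul_zero, zero_add, sub_zero, zero_smul, add_zero] at h1
    have h2 := A (iY P') (iY 0) (hd3 P' hP') (hd3 0 hP0) rfl (le_refl (0 : ℝ)) 0
    have h3 : (I 0).2.2.2 = 0 := by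
      simp only [hI, iY_zero]
      rw [F.hit_ideal, F.flow_ideal ⟨by norm_num, by norm_num⟩, lcF_ideal (by norm_num)]
    have h4 : (I P').2.2.2 = 0 := by
      have e1 : (iY P').2.2.2.2.2.2 = 0 := rfl
      have e2 : (iY P').2.1 = 0 := by simp [iY, hP'def, hP1]
      have e3 : (iY P').1 = 0 := rfl
      have e4 : (iY 0).2.1 = 0 := by simp [iY]
      have e5 : (iY 0).1 = 0 := rfl
      rw [e1, e2, e3, e4, e5] at h2
      change |(I P').2.2.2 - (I 0).2.2.2 - _ - _| ≤ _ at h2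
      rw [h3] at h2
      simpa using h2
    have h5 : (I P - I P').2.2.2 = (I P).2.2.2 := by
      rw [show (I P - I P').2.2.2 = (I P).2.2.2 - (I P').2.2.2 from rfl, h4, sub_zero]
    rwa [h5] at h1

end PCRTBP

namespace PCRTBP

open Set

/-! ### The critical value of the Jacobi constant -/

theorem exists_far_point {μ : ℝ} (h0 : 0 ≤ μ) (h1 : μ ≤ 1) {x : FS} {R T : ℝ} (hR : 0 < R)
    (hT : 3 * R ^ 2 ≤ T) (hg : ∀ t ∈ Icc 0 T, Good (Ω μ t x)) :
    ∃ t ∈ Icc 0 T, R < (Ω μ t x).1 := by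
  by_contra! hc
  have hT0 : 0 ≤ T := le_trans (by positivity) hT
  have := le_of_hasDerivAt_nonneg (f := fun t => -(Ω μ t x).2.1 - 0.9 * R⁻¹ ^ 2 * t) hT0
    (fun t _ => (Ω_deriv h0 h1 x t).2.1.neg.sub ((hasDerivAt_id t).const_mul (0.9 * R⁻¹ ^ 2)))
    fun t ht => by
      have g := hg t ht
      have hr : 0 < (Ω μ t x).1 := lt_of_lt_of_le (by norm_num) g.1
      have h2 : R⁻¹ ≤ (Ω μ t x).1⁻¹ := inv_anti₀ hr (hc t ht)
      have h3 : R⁻¹ ^ 2 ≤ (Ω μ t x).1⁻¹ ^ 2 := by gcongr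
      have := (Ω_v_bounds h0 h1 g.1).2
      linarith
  have g0 := abs_le.1 (hg 0 ⟨le_rfl, hT0⟩).2.1
  have g1 := abs_le.1 (hg T ⟨hT0, le_rfl⟩).2.1
  have h4 : 0.9 * R⁻¹ ^ 2 * (3 * R ^ 2) ≤ 0.9 * R⁻¹ ^ 2 * T := by gcongr
  have h5 : 0.9 * R⁻¹ ^ 2 * (3 * R ^ 2) = 2.7 := by field_simp; norm_num
  linarith

theorem pot_bounds {μ r φ : ℝ} (h0 : 0 ≤ μ) (h1 : μ ≤ 1) (hr : 2000 ≤ r) :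
    -(1.001 * r⁻¹) ≤ pot μ r φ ∧ pot μ r φ ≤ 0 := by
  have a := iD_bounds φ (abs_le.2 ⟨by linarith, h1⟩) hr
  have b := iD_bounds (c := μ - 1) φ (abs_le.2 ⟨by linarith, by linarith⟩) hr
  have : 0 < r⁻¹ := by positivity
  unfold pot
  constructor <;> nlinarith

theorem exists_frontier_of_isPreconnected {X : Type*} [TopologicalSpace X] {s t : Set X}
    (hs : IsPreconnected s) (ht : IsClosed t) {a b : X} (ha : a ∈ s) (hb : b ∈ s) (hat : a ∈ t)
    (hbt : b ∉ t) : ∃ x ∈ s, x ∈ t ∧ x ∉ interior t := by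
  by_contra! hc
  obtain ⟨x, -, hx, hx'⟩ := hs (interior t) tᶜ isOpen_interior ht.isOpen_compl
    (fun x hx => (em (x ∈ t)).imp (hc x hx) id) ⟨a, ha, hc a ha hat⟩ ⟨b, hb, hbt⟩
  exact hx' (interior_subset hx)

theorem norm_FS_le {r α θ J μ : ℝ} (h1 : |α| ≤ r) (h2 : |θ| ≤ r) (h3 : |J| ≤ r) (h4 : |μ| ≤ r) :
    ‖((α, θ, J, μ) : FS)‖ ≤ r := by
  simp only [Prod.norm_mk, Real.norm_eq_abs, sup_le_iff]
  exact ⟨h1, h2, h3, h4⟩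

theorem mem_Nset_of_Jb {μ C r : ℝ} (h0 : 0 ≤ μ) (h1 : μ ≤ 1) (hr : 0 < r) (hr1 : r ≤ 1)
    (hC : 0 < C) (hμ : μ * (C + 1) ≤ r / 8) {x : FS} (hx : x ∈ Oset (1 / 100))
    (hJ : Jb μ x = r - μ ^ 2 / 2) (hG : |x.2.2.2| ≤ C * μ) : x ∈ Nset μ := by
  by_contra hN
  obtain ⟨a, b, d, -, e⟩ := ret_spec h0 h1 hx hN
  obtain ⟨z, hz, hvz⟩ : ∃ z ∈ Icc 0 (ret μ x), (Ω μ z x).2.1 = 0 :=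
    intermediate_value_Icc' a.le (Ω_continuous_v h0 h1 x).continuousOn
      ⟨e.le, by rw [Ω_zero h0 h1]; exact hx.2.1.le⟩
  have g := fun t ht => ret_good h0 h1 (by norm_num : (1 : ℝ) / 100 ≤ 1 / 4) hx hN (t := t) ht
  have hJz := Jb_eq h0 h1 hz.1 fun s hs => g s ⟨hs.1, hs.2.trans hz.2⟩
  have hdr := Ω_G_drift h0 h1 x hz.1
  rw [Ω_zero h0 h1, hvz] at hdr
  have gz := g z hz
  have hp := (pot_bounds h0 h1 (φ := (Ω μ z x).2.2.1) (le_trans (by norm_num) gz.1)).2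
  rw [hJ] at hJz
  unfold Jb at hJz
  rw [hvz] at hJz
  have hri : (Ω μ z x).1⁻¹ ≤ 1 := inv_le_one_of_one_le₀ (le_trans (by norm_num) gz.1)
  have hri0 : 0 < (Ω μ z x).1⁻¹ := inv_pos.2 (lt_of_lt_of_le (by norm_num) gz.1)
  have hG1 : |(Ω μ z x).2.2.2| ≤ μ * (C + 1) := by
    have h3 : μ / 10000000 * (x.2.1 - 0) ≤ μ := by
      have := hx.2.2.1
      have := mul_le_mul_of_nonneg_left hx.2.2.1 h0
      linarith
    have := abs_sub_abs_le_abs_sub (Ω μ z x).2.2.2 x.2.2.2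
    linarith
  have h5 : (Ω μ z x).2.2.2 ^ 2 * (Ω μ z x).1⁻¹ ^ 2 ≤ |(Ω μ z x).2.2.2| := by
    have h6 : (Ω μ z x).2.2.2 ^ 2 ≤ |(Ω μ z x).2.2.2| := by
      rw [← sq_abs]
      have := gz.2.2
      nlinarith [abs_nonneg (Ω μ z x).2.2.2]
    have h7 : (Ω μ z x).1⁻¹ ^ 2 ≤ 1 := pow_le_one₀ hri0.le hri
    calc _ ≤ (Ω μ z x).2.2.2 ^ 2 * 1 := by gcongr
      _ ≤ _ := by linarith
  have h8 : μ ^ 2 ≤ μ := by nlinarith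
  have h9 : μ ≤ μ * (C + 1) := by nlinarith
  have := neg_abs_le (Ω μ z x).2.2.2
  linarith

theorem not_mem_Nset_of_Jb {μ C r : ℝ} (h0 : 0 ≤ μ) (h1 : μ ≤ 1) (hr : 0 < r)
    (hμ : μ * (C + 1) ≤ r / 8) {x : FS} (hx : x ∈ Oset (1 / 100))
    (hJ : Jb μ x = -r - μ ^ 2 / 2) (hG : |x.2.2.2| ≤ C * μ) : x ∉ Nset μ := by
  intro hN
  have g := fun t ht => Nset_good h0 h1 (by norm_num : (1 : ℝ) / 100 ≤ 1 / 4) hx hN (t := t) ht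
  obtain ⟨z, hz, hzr⟩ := exists_far_point h0 h1 (x := x) (R := 2 / r) (by positivity) le_rfl
    fun t ht => g t ht.1
  have hJz := Jb_eq h0 h1 hz.1 fun s hs => g s hs.1
  have hdr := Ω_G_drift h0 h1 x hz.1
  have hvz := Nset_v_pos h0 h1 hN hz.1
  rw [Ω_zero h0 h1] at hdr
  have gz := g z hz.1
  have hp := (pot_bounds h0 h1 (φ := (Ω μ z x).2.2.1) (le_trans (by norm_num) gz.1)).1
  rw [hJ] at hJz
  unfold Jb at hJz
  have hri : (Ω μ z x).1⁻¹ ≤ r / 2 := by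
    rw [← inv_div]
    exact inv_anti₀ (by positivity) hzr.le
  have hG1 : |(Ω μ z x).2.2.2| ≤ μ * (C + 1) := by
    have h3 : μ / 10000000 * (x.2.1 - (Ω μ z x).2.1) ≤ μ := by
      have := mul_le_mul_of_nonneg_left (show x.2.1 - (Ω μ z x).2.1 ≤ 1 / 1000 by
        linarith [hx.2.2.1]) h0
      linarith
    have := abs_sub_abs_le_abs_sub (Ω μ z x).2.2.2 x.2.2.2
    linarith
  have h5 : 0 ≤ (Ω μ z x).2.2.2 ^ 2 * (Ω μ z x).1⁻¹ ^ 2 := by positivity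
  have := le_abs_self (Ω μ z x).2.2.2
  nlinarith [sq_nonneg (Ω μ z x).2.1, sq_nonneg μ]

theorem InnerMap.exists_critical {I : FS → FS} {M C r : ℝ} (F : InnerMap I M C r) {μ : ℝ}
    (h0 : 0 ≤ μ) (hμ : μ * (C + 1) ≤ r / 8) :
    ∃ J, |J| ≤ r ∧ I (0, 0, J, μ) ∈ Nset μ ∧ I (0, 0, J, μ) ∉ interior (Nset μ) := by
  have hr := F.r_pos
  have hC := F.C_pos
  have hμr : μ ≤ r := by nlinarith
  have h1 : μ ≤ 1 := hμr.trans F.r_le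
  have hP : ∀ J ∈ Icc (-r) r, ‖((0, 0, J, μ) : FS)‖ ≤ r := fun J hJ =>
    norm_FS_le (by simpa using hr.le) (by simpa using hr.le) (abs_le.2 hJ)
      (by rwa [abs_of_nonneg h0])
  have hc : ContinuousOn (fun J => I (0, 0, J, μ)) (Icc (-r) r) :=
    F.continuousOn.comp (by fun_prop) fun J hJ => hP J hJ
  have hG : ∀ J ∈ Icc (-r) r, |(I (0, 0, J, μ)).2.2.2| ≤ C * μ := fun J hJ => by
    have := F.G_le _ (hP J hJ) rfl
    simpa only [abs_of_nonneg h0] using this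
  have hr' : r ∈ Icc (-r) r := ⟨by linarith, le_rfl⟩
  have hr'' : -r ∈ Icc (-r) r := ⟨le_rfl, by linarith⟩
  obtain ⟨_, ⟨J, hJ, rfl⟩, h⟩ := exists_frontier_of_isPreconnected (isPreconnected_Icc.image _ hc)
    (Nset_isClosed h0 h1) (mem_image_of_mem _ hr') (mem_image_of_mem _ hr'')
    (mem_Nset_of_Jb h0 h1 hr F.r_le hC hμ (F.mem_Oset _ (hP r hr')) (F.Jb_eq _ (hP r hr'))
      (hG r hr'))
    (not_mem_Nset_of_Jb h0 h1 hr hμ (F.mem_Oset _ (hP _ hr'')) (F.Jb_eq _ (hP _ hr''))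
      (hG _ hr''))
  exact ⟨J, abs_le.2 hJ, h⟩

end PCRTBP

namespace PCRTBP

open Set

/-! ### Coordinates on the far section -/

theorem exists_chart {g : ℝ × ℝ → ℝ × ℝ} {N r : ℝ} (hN : 0 < N)
    (h1 : ∀ σ τ : ℝ × ℝ, |σ.1| < r → |σ.2| < r → |τ.1| < r → |τ.2| < r →
      |N * ((g σ).1 - (g τ).1) - N * (σ.1 - τ.1)| ≤
        1 / 4 * max (N * |σ.1 - τ.1|) |σ.2 - τ.2|)
    (h2 : ∀ σ τ : ℝ × ℝ, |σ.1| < r → |σ.2| < r → |τ.1| < r → |τ.2| < r →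
      |(g σ).2 - (g τ).2 - (σ.2 - τ.2)| ≤ 1 / 4 * max (N * |σ.1 - τ.1|) |σ.2 - τ.2|) :
    ∃ (e : ℝ × ℝ → ℝ × ℝ) (V : Set (ℝ × ℝ)), IsOpen V ∧ ContinuousOn e V ∧
      (∀ σ : ℝ × ℝ, |σ.1| < r → |σ.2| < r → g σ ∈ V ∧ e (g σ) = σ) ∧
      ∀ y ∈ V, |(e y).1| < r ∧ |(e y).2| < r ∧ g (e y) = y := by
  set f : ℝ × ℝ → ℝ × ℝ := fun s => (N * (g (s.1 / N, s.2)).1, (g (s.1 / N, s.2)).2) with hf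
  set s : Set (ℝ × ℝ) := {s | |s.1 / N| < r ∧ |s.2| < r} with hs
  have so : IsOpen s := by
    refine IsOpen.and ?_ ?_
    · exact isOpen_lt (by fun_prop) continuous_const
    · exact isOpen_lt (by fun_prop) continuous_const
  have hA : ApproximatesLinearOn f (ContinuousLinearEquiv.refl ℝ (ℝ × ℝ) : ℝ × ℝ →L[ℝ] ℝ × ℝ) s
      (1 / 4) := by
    intro x hx y hy
    have e1 : N * |x.1 / N - y.1 / N| = |x.1 - y.1| := by
      rw [← sub_div, abs_div, abs_of_pos hN]
      field_simp
    have a := h1 (x.1 / N, x.2) (y.1 / N, y.2) hx.1 hx.2 hy.1 hy.2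
    have b := h2 (x.1 / N, x.2) (y.1 / N, y.2) hx.1 hx.2 hy.1 hy.2
    simp only [e1] at a b
    have e2 : N * (x.1 / N - y.1 / N) = x.1 - y.1 := by field_simp
    rw [e2] at a
    have e3 : ((1 / 4 : NNReal) : ℝ) = 1 / 4 := by norm_num
    simp only [hf, ContinuousLinearEquiv.coe_refl, ContinuousLinearMap.id_apply, Prod.norm_def,
      Prod.fst_sub, Prod.snd_sub, Real.norm_eq_abs, e3, sup_le_iff]
    refine ⟨?_, b⟩
    rwa [← mul_sub]
  have hc : Subsingleton (ℝ × ℝ) ∨ (1 / 4 : NNReal) <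
      ‖((ContinuousLinearEquiv.refl ℝ (ℝ × ℝ)).symm : ℝ × ℝ →L[ℝ] ℝ × ℝ)‖₊⁻¹ := by
    right
    have : ((ContinuousLinearEquiv.refl ℝ (ℝ × ℝ)).symm : ℝ × ℝ →L[ℝ] ℝ × ℝ) =
        ContinuousLinearMap.id ℝ (ℝ × ℝ) := rfl
    rw [this, ← NNReal.coe_lt_coe]
    simp
    norm_num
  set H := hA.toOpenPartialHomeomorph f s hc so with hH
  have Hf : ∀ x, H x = f x := fun x => rfl
  refine ⟨fun y => ((H.symm (N * y.1, y.2)).1 / N, (H.symm (N * y.1, y.2)).2),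
    {y | (N * y.1, y.2) ∈ H.target}, H.open_target.preimage (by fun_prop), ?_, ?_, ?_⟩
  · have : ContinuousOn (fun y : ℝ × ℝ => H.symm (N * y.1, y.2)) {y | (N * y.1, y.2) ∈ H.target} :=
      H.continuousOn_symm.comp (by fun_prop) fun y hy => hy
    exact (this.fst.div_const N).prodMk this.snd
  · intro σ hσ1 hσ2
    have e1 : N * σ.1 / N = σ.1 := by field_simp
    have hm : (N * σ.1, σ.2) ∈ H.source := show _ ∈ s from ⟨by rwa [e1], hσ2⟩
    have e2 : (N * (g σ).1, (g σ).2) = H (N * σ.1, σ.2) := by rw [Hf]; simp only [hf, e1]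
    constructor
    · show (N * (g σ).1, (g σ).2) ∈ H.target
      rw [e2]; exact H.map_source hm
    · simp only [e2, H.left_inv hm, e1]
  · intro y hy
    have hm : H.symm (N * y.1, y.2) ∈ s := H.map_target hy
    have e1 := H.right_inv hy
    rw [Hf] at e1
    refine ⟨hm.1, hm.2, ?_⟩
    have e2 := congrArg Prod.fst e1
    have e3 := congrArg Prod.snd e1
    simp only [hf] at e2 e3
    exact Prod.ext (mul_left_cancel₀ hN.ne' e2) e3

end PCRTBP

namespace PCRTBP

open Set

/-! ### Launching data -/

def box (r : ℝ) : Set (ℝ × ℝ) := {σ | |σ.1| < r ∧ |σ.2| < r}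

/-- A two parameter family of initial data `c` near collision with a common Jacobi constant `h`,
together with the map `f` to the far section, coordinates `e` on the section inverting `f`, and
the condition that the orbit of `c 0` lies on the boundary of the set of escaping orbits. -/
structure Launch (μ h r : ℝ) (f c : ℝ × ℝ → FS) (e : ℝ × ℝ → ℝ × ℝ) (V : Set (ℝ × ℝ)) : Prop where
  r_pos : 0 < r
  isOpen_V : IsOpen V
  mem_Oset : ∀ σ ∈ box r, f σ ∈ Oset (1 / 100)
  Jb_eq : ∀ σ ∈ box r, Jb μ (f σ) = h
  f_cont : ContinuousOn f (box r)
  e_cont : ContinuousOn e V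
  e_f : ∀ σ ∈ box r, (f σ).2.2.swap ∈ V ∧ e (f σ).2.2.swap = σ
  f_e : ∀ x : FS, x.2.2.swap ∈ V → x ∈ Oset (1 / 20) → Jb μ x = h →
    e x.2.2.swap ∈ box r ∧ f (e x.2.2.swap) = x
  mono : ∀ σ ∈ box r, ∀ τ ∈ box r, σ.1 ≤ τ.1 → σ.2 ≤ τ.2 → σ ≠ τ → f σ ∈ Nset μ →
    f τ ∈ interior (Nset μ)
  angle_pos : ∀ σ ∈ box r, 8 * |(f σ).2.2.2 - (f 0).2.2.2| ≤ μ * |(f σ).2.2.1 - (f 0).2.2.1| →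
    (f 0).2.2.1 < (f σ).2.2.1 → 0 < σ.2
  angle_neg : ∀ σ ∈ box r, 8 * |(f σ).2.2.2 - (f 0).2.2.2| ≤ μ * |(f σ).2.2.1 - (f 0).2.2.1| →
    (f σ).2.2.1 < (f 0).2.2.1 → σ.2 < 0
  critical : f 0 ∈ Nset μ ∧ f 0 ∉ interior (Nset μ)
  reach : ∀ σ ∈ box r, σ.1 ≠ 0 → ∃ T, Reach μ T (c σ) (toC (f σ)) ∅
  rc_eq : ∀ α θ : ℝ, rc (c (α, θ)) = c (α, -θ)
  q_eq : ∀ σ ∈ box r, dS μ (c σ).1 (c σ).2.1 = σ.1 ^ 2 / 2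
  le_p : ∀ σ ∈ box r, σ.1 ≠ 0 → |σ.1|⁻¹ - 1 ≤ nrm2 (c σ).2.2.1 (c σ).2.2.2

theorem abs_sub_le_nrm2 (a b x y m : ℝ) (h : nrm2 x y = b) (hm : |m| ≤ a) :
    b - a ≤ nrm2 x (y - m) := by
  have h2 := sqrt_nonneg (x ^ 2 + (y - m) ^ 2)
  have h1 := sq_sqrt (show 0 ≤ x ^ 2 + (y - m) ^ 2 by positivity)
  have : nrm2 x y ≤ nrm2 x (y - m) + |m| := by
    refine Real.sqrt_le_iff.2 ⟨add_nonneg h2 (abs_nonneg m), ?_⟩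
    have h3 : |y - m| ≤ √(x ^ 2 + (y - m) ^ 2) := abs_le_sqrt (by nlinarith)
    have h4 : (y - m) * m ≤ |y - m| * |m| := by rw [← abs_mul]; exact le_abs_self _
    have h5 : |y - m| * |m| ≤ √(x ^ 2 + (y - m) ^ 2) * |m| := by gcongr
    have h6 := sq_abs m
    unfold nrm2
    nlinarith
  linarith

theorem InnerMap.exists_launch {I : FS → FS} {M C r : ℝ} (F : InnerMap I M C r) {μ : ℝ}
    (h0 : 0 < μ) (h1 : μ ≤ 1 / 1000000) (hμ : μ * (C + 1) ≤ r / 8)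
    (hμ2 : C * (μ * (M + 1)) ≤ 1 / 128) :
    ∃ h f c e V, Launch μ h r f c e V := by
  obtain ⟨J, hJ, hN, hN'⟩ := F.exists_critical h0.le hμ
  have hr := F.r_pos
  have hC := F.C_pos
  have hM := F.M_ge
  have hμr : μ ≤ r := by nlinarith
  set Q : ℝ × ℝ → FS := fun σ => (σ.1, σ.2, J, μ) with hQ
  have nQ : ∀ σ ∈ box r, ‖Q σ‖ ≤ r := fun σ hσ => norm_FS_le hσ.1.le hσ.2.le hJ
    (by rwa [abs_of_pos h0])
  have m0 : (0 : ℝ × ℝ) ∈ box r := by simp [box, hr]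
  set f : ℝ × ℝ → FS := fun σ => I (Q σ) with hf
  have dG : ∀ σ ∈ box r, ∀ τ ∈ box r,
      |(f σ).2.2.2 - (f τ).2.2.2 - (σ.1 - τ.1) - μ * M * (σ.2 - τ.2)| ≤
        1 / 16 * (|σ.1 - τ.1| + μ * |σ.2 - τ.2|) := fun σ hσ τ hτ =>
    F.dG _ _ (nQ σ hσ) (nQ τ hτ) rfl h0.le
  have dφ : ∀ σ ∈ box r, ∀ τ ∈ box r, |(f σ).2.2.1 - (f τ).2.2.1 - (σ.2 - τ.2)| ≤
      C * |σ.1 - τ.1| + 1 / 16 * |σ.2 - τ.2| := fun σ hσ τ hτ =>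
    F.dφ _ _ (nQ σ hσ) (nQ τ hτ) rfl
  have hO : ∀ σ ∈ box r, f σ ∈ Oset (1 / 100) := fun σ hσ => F.mem_Oset _ (nQ σ hσ)
  have hO' : ∀ σ ∈ box r, f σ ∈ Oset (1 / 20) := fun σ hσ =>
    ⟨(hO σ hσ).1, (hO σ hσ).2.1, (hO σ hσ).2.2.1, (hO σ hσ).2.2.2.trans (by norm_num)⟩
  have hJb : ∀ σ ∈ box r, Jb μ (f σ) = J - μ ^ 2 / 2 := fun σ hσ => F.Jb_eq _ (nQ σ hσ)
  have hp : 0 < μ * (M + 1) := by positivity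
  set N := 1 / (8 * (μ * (M + 1))) with hNdef
  have Npos : 0 < N := by positivity
  have hNM : N * (μ * (M + 1)) = 1 / 8 := by rw [hNdef]; field_simp
  have hCN : C ≤ 1 / 16 * N := by
    have := mul_le_mul_of_nonneg_left hμ2 Npos.le
    linear_combination 8 * this - 8 * C * hNM
  obtain ⟨e, V, hV, eV, a, b⟩ := exists_chart (g := fun σ => (f σ).2.2.swap) (N := N) (r := r) Npos
    (fun σ τ h1 h2 h3 h4 => by
      have a1 := dG σ ⟨h1, h2⟩ τ ⟨h3, h4⟩
      have m1 := le_max_left (N * |σ.1 - τ.1|) |σ.2 - τ.2|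
      have m2 := le_max_right (N * |σ.1 - τ.1|) |σ.2 - τ.2|
      simp only [Prod.fst_swap]
      have e1 : N * ((f σ).2.2.2 - (f τ).2.2.2) - N * (σ.1 - τ.1) =
          N * ((f σ).2.2.2 - (f τ).2.2.2 - (σ.1 - τ.1) - μ * M * (σ.2 - τ.2)) +
            N * (μ * M) * (σ.2 - τ.2) := by ring
      rw [e1]
      refine (abs_add_le _ _).trans ?_
      rw [abs_mul, abs_mul, abs_of_pos Npos, abs_of_nonneg (show 0 ≤ N * (μ * M) by positivity)]
      have a2 := mul_le_mul_of_nonneg_left a1 Npos.le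
      have a3 : 0 ≤ N * μ * |σ.2 - τ.2| := by positivity
      have a4 : N * (μ * (M + 1)) * |σ.2 - τ.2| = 1 / 8 * |σ.2 - τ.2| := by rw [hNM]
      linarith [abs_nonneg (σ.2 - τ.2)])
    (fun σ τ h1 h2 h3 h4 => by
      have a1 := dφ σ ⟨h1, h2⟩ τ ⟨h3, h4⟩
      have m1 := le_max_left (N * |σ.1 - τ.1|) |σ.2 - τ.2|
      have m2 := le_max_right (N * |σ.1 - τ.1|) |σ.2 - τ.2|
      simp only [Prod.snd_swap]
      have a2 : C * |σ.1 - τ.1| ≤ 1 / 16 * N * |σ.1 - τ.1| := by gcongr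
      linarith [abs_nonneg (σ.2 - τ.2)])
  have hsign : ∀ σ ∈ box r,
      8 * |(f σ).2.2.2 - (f 0).2.2.2| ≤ μ * |(f σ).2.2.1 - (f 0).2.2.1| →
      |(f σ).2.2.1 - (f 0).2.2.1 - σ.2| ≤
        1 / 4 * |(f σ).2.2.1 - (f 0).2.2.1| + 1 / 4 * |σ.2| := by
    intro σ hσ hh
    have a1 := dG σ hσ 0 m0
    have a2 := dφ σ hσ 0 m0
    simp only [Prod.fst_zero, Prod.snd_zero, sub_zero] at a1 a2
    have a3 : |σ.1| ≤ 2 * (|(f σ).2.2.2 - (f 0).2.2.2| + μ * (M + 1) * |σ.2|) := by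
      have b1 : σ.1 = ((f σ).2.2.2 - (f 0).2.2.2) - μ * M * σ.2 -
        ((f σ).2.2.2 - (f 0).2.2.2 - σ.1 - μ * M * σ.2) := by ring
      have b2 : |σ.1| ≤ |(f σ).2.2.2 - (f 0).2.2.2| + μ * M * |σ.2| +
          |(f σ).2.2.2 - (f 0).2.2.2 - σ.1 - μ * M * σ.2| := by
        conv_lhs => rw [b1]
        have : |μ * M * σ.2| = μ * M * |σ.2| := by rw [abs_mul, abs_of_nonneg (by positivity)]
        rw [← this]
        exact (abs_sub _ _).trans (by gcongr; exact abs_sub _ _)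
      have b3 : 0 ≤ μ * |σ.2| := by positivity
      have b4 : 0 ≤ μ * M * |σ.2| := by positivity
      linarith [abs_nonneg ((f σ).2.2.2 - (f 0).2.2.2)]
    have a4 : C * |σ.1| ≤ C * (2 * (|(f σ).2.2.2 - (f 0).2.2.2| + μ * (M + 1) * |σ.2|)) := by gcongr
    have a5 : C * |(f σ).2.2.2 - (f 0).2.2.2| ≤ C * (μ * |(f σ).2.2.1 - (f 0).2.2.1|) := by
      gcongr; linarith [abs_nonneg ((f σ).2.2.2 - (f 0).2.2.2)]
    have a6 : C * (μ * (M + 1)) * |σ.2| ≤ 1 / 128 * |σ.2| := by gcongr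
    have a7 : C * μ ≤ 1 / 128 := by nlinarith [mul_pos hC h0]
    have a8 : C * μ * |(f σ).2.2.1 - (f 0).2.2.1| ≤ 1 / 128 * |(f σ).2.2.1 - (f 0).2.2.1| := by
      gcongr
    linarith [abs_nonneg σ.2, abs_nonneg ((f σ).2.2.1 - (f 0).2.2.1)]
  refine ⟨J - μ ^ 2 / 2, f, fun σ => iC (Q σ), e, V, hr, hV, hO, hJb, ?_, eV,
    fun σ hσ => a σ hσ.1 hσ.2, ?_, ?_, ?_, ?_, ⟨hN, hN'⟩, ?_, fun α θ => rc_iC _ _ _ _, ?_, ?_⟩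
  · exact F.continuousOn.comp (by fun_prop) fun σ hσ => nQ σ hσ
  · intro x hx hxO hxJ
    obtain ⟨b1, b2, b3⟩ := b _ hx
    have hb : e x.2.2.swap ∈ box r := ⟨b1, b2⟩
    refine ⟨hb, ?_⟩
    have o := hO _ hb
    have e1 := congrArg Prod.fst b3
    have e2 := congrArg Prod.snd b3
    simp only [Prod.fst_swap, Prod.snd_swap] at e1 e2
    have e3 := (hJb _ hb).trans hxJ.symm
    unfold Jb at e3
    rw [e1, e2, o.1, hxO.1] at e3
    have e4 : (f (e x.2.2.swap)).2.1 = x.2.1 := by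
      have := o.2.1
      have := hxO.2.1
      refine (sq_eq_sq₀ (by positivity) (by positivity)).1 (by linarith)
    exact Prod.ext (o.1.trans hxO.1.symm) (Prod.ext e4 (Prod.ext e2 e1))
  · intro σ hσ τ hτ hα hθ hne hs
    have a1 := abs_le.1 (dG τ hτ σ hσ)
    have a2 := abs_le.1 (dφ τ hτ σ hσ)
    have p1 : 0 ≤ τ.1 - σ.1 := sub_nonneg.2 hα
    have p2 : 0 ≤ τ.2 - σ.2 := sub_nonneg.2 hθ
    rw [abs_of_nonneg p1, abs_of_nonneg p2] at a1 a2
    have a7 : C * μ ≤ 1 / 128 := by nlinarith [mul_pos hC h0]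
    have p3 : 0 < τ.1 - σ.1 ∨ 0 < τ.2 - σ.2 := by
      by_contra! h
      exact hne (Prod.ext (by linarith [h.1]) (by linarith [h.2]))
    have p4 : 0 < (τ.1 - σ.1) + μ * (τ.2 - σ.2) := by
      rcases p3 with h | h
      · positivity
      · positivity
    have p5 : C * μ * (τ.1 - σ.1) ≤ 1 / 128 * (τ.1 - σ.1) := by gcongr
    have p6 : μ * (τ.2 - σ.2) * (1 / 4) ≤ μ * (τ.2 - σ.2) * M := by gcongr
    have p7 : 0 ≤ μ * (τ.2 - σ.2) := by positivity
    refine mem_interior_Nset_of_lt h0.le h1 (hO' σ hσ) (hO' τ hτ) hs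
      ((hJb τ hτ).trans (hJb σ hσ).symm) (by nlinarith) ?_
    have p8 : |(f τ).2.2.1 - (f σ).2.2.1| ≤ C * (τ.1 - σ.1) + 17 / 16 * (τ.2 - σ.2) :=
      abs_le.2 ⟨by linarith, by linarith⟩
    have p9 := mul_le_mul_of_nonneg_left p8 h0.le
    nlinarith
  · intro σ hσ hh hlt
    by_contra! hc
    have := hsign σ hσ hh
    rw [abs_of_nonneg (by linarith), abs_of_nonneg (sub_nonneg.2 hlt.le), abs_of_nonpos hc] at this
    linarith
  · intro σ hσ hh hlt
    by_contra! hc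
    have := hsign σ hσ hh
    rw [abs_of_nonpos (by linarith), abs_of_nonpos (sub_nonpos.2 hlt.le), abs_of_nonneg hc] at this
    linarith
  · exact fun σ hσ hα => F.reach _ (nQ σ hσ) hα
  · intro σ hσ
    simp only [hQ, iC_eq, dS]
    rw [show (σ.1 ^ 2 / 2 * cos σ.2 - μ + μ) ^ 2 + (σ.1 ^ 2 / 2 * sin σ.2) ^ 2 =
      (σ.1 ^ 2 / 2) ^ 2 by linear_combination (σ.1 ^ 2 / 2) ^ 2 * sin_sq_add_cos_sq σ.2]
    exact sqrt_sq (by positivity)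
  · intro σ hσ hα
    have hb := F.half_le_iB _ (nQ σ hσ)
    have hα' : 0 < |σ.1| := abs_pos.2 hα
    simp only [hQ, iC_eq] at hb ⊢
    refine le_trans ?_ (abs_sub_le_nrm2 1 (2 * iB (σ.1, σ.2, J, μ) * |σ.1|⁻¹) _ _ μ ?_
      (by rw [abs_of_pos h0]; linarith))
    · have : 0 < |σ.1|⁻¹ := by positivity
      nlinarith
    · unfold nrm2
      rw [← sqrt_sq (show 0 ≤ 2 * iB (σ.1, σ.2, J, μ) * |σ.1|⁻¹ by positivity)]
      congr 1
      rw [mul_pow (2 * iB _), inv_pow, sq_abs]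
      field_simp
      linear_combination sin_sq_add_cos_sq σ.2

end PCRTBP

namespace PCRTBP

open Set

/-! ### Long excursions -/

theorem exists_window {ψ : ℝ → ℝ} {t₁ lo hi : ℝ} (h0 : 0 ≤ t₁) (hψ : ContinuousOn ψ (Icc 0 t₁))
    (hlo : ψ 0 ≤ lo) (h : lo ≤ hi) (hhi : hi ≤ ψ t₁) :
    ∃ a b, 0 ≤ a ∧ a ≤ b ∧ b ≤ t₁ ∧ ψ a = lo ∧ ψ b = hi ∧ ∀ t ∈ Icc a b, ψ t ∈ Icc lo hi := by
  have cc : ∀ {s : ℝ} {K : Set ℝ}, s ≤ t₁ → IsClosed K → IsCompact (Icc 0 s ∩ ψ ⁻¹' K) :=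
    fun hs hK => isCompact_Icc.of_isClosed_subset
      ((hψ.mono (Icc_subset_Icc_right hs)).preimage_isClosed_of_isClosed isClosed_Icc hK)
      inter_subset_left
  obtain ⟨b, ⟨hb, hbhi⟩, hbl⟩ := (cc le_rfl (isClosed_Ici (a := hi))).exists_isLeast
    ⟨t₁, ⟨h0, le_rfl⟩, hhi⟩
  obtain ⟨a, ⟨ha, halo⟩, hag⟩ := (cc hb.2 (isClosed_Iic (a := lo))).exists_isGreatest
    ⟨0, ⟨le_rfl, hb.1⟩, hlo⟩
  have eb : ψ b = hi := by
    obtain ⟨t, ht, e⟩ := intermediate_value_Icc hb.1 (hψ.mono (Icc_subset_Icc_right hb.2))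
      ⟨hlo.trans h, hbhi⟩
    have : b ≤ t := hbl ⟨⟨ht.1, ht.2.trans hb.2⟩, e.ge⟩
    rwa [le_antisymm ht.2 this] at e
  have ea : ψ a = lo := by
    obtain ⟨t, ht, e⟩ := intermediate_value_Icc ha.2 (hψ.mono (Icc_subset_Icc ha.1 hb.2))
      ⟨halo, h.trans eb.ge⟩
    have : t ≤ a := hag ⟨⟨ha.1.trans ht.1, ht.2⟩, e.le⟩
    rwa [le_antisymm this ht.1] at e
  refine ⟨a, b, ha.1, ha.2, hb.2, ea, eb, fun t ht => ⟨?_, ?_⟩⟩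
  · by_contra! hc
    have : t ≤ a := hag ⟨⟨ha.1.trans ht.1, ht.2⟩, hc.le⟩
    rw [le_antisymm this ht.1, ea] at hc
    exact hc.false
  · by_contra! hc
    have : b ≤ t := hbl ⟨⟨ha.1.trans ht.1, ht.2.trans hb.2⟩, hc.le⟩
    rw [le_antisymm ht.2 this, eb] at hc
    exact hc.false

section Excursion

variable {μ : ℝ} (h0 : 0 ≤ μ) (h1 : μ ≤ 1)
include h0 h1

theorem hat_angle_le {c : ℝ} {x : FS} (hx : x ∈ Oset c) (hN : x ∉ Nset μ) :
    (hat μ x).2.2.1 ≤ 2 * ret μ x - x.2.2.1 := by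
  have := le_of_hasDerivAt_nonneg (ret_spec h0 h1 hx hN).1.le (fun s _ =>
    (Ω_deriv h0 h1 x s).2.2.1.add ((hasDerivAt_id s).const_mul 2)) fun s _ => by
      have hG := abs_le.1 (abs_cl_le (by norm_num : (0 : ℝ) ≤ 1 / 2) (Ω μ s x).2.2.2)
      obtain ⟨i0, i1⟩ := inv_max_pos (Ω μ s x).1
      have : (max (Ω μ s x).1 ℛ)⁻¹ ^ 2 ≤ 1 := pow_le_one₀ i0.le (by linarith)
      simp only [farField]
      nlinarith [pow_pos i0 2]
  simp only [Pi.add_apply, Ω_zero h0 h1, id] at this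
  simp only [hat, rev]
  linarith

theorem rot_mem_Nset {k : ℤ} {x : FS} : rot (k * (2 * π)) x ∈ Nset μ ↔ x ∈ Nset μ := by
  unfold Nset
  refine forall₂_congr fun t _ => ?_
  rw [Ω_rot h0 h1]
  rfl

theorem exists_lt_of_not_mem_Nset {x : FS} (hr : x.1 = ℛ) (hv : 0 ≤ x.2.1)
    (hv1 : x.2.1 ≤ 1 / 1000) (hN : x ∉ Nset μ) : ∃ s, 0 < s ∧ (Ω μ s x).1 < ℛ := by
  rcases hv.eq_or_lt with h | h
  · refine ⟨1, one_pos, ?_⟩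
    have := lt_of_hasDerivAt_pos one_pos (fun s _ => (Ω_deriv h0 h1 x s).1.neg) fun s hs => by
      have h3 := Ω_v_strictAnti h0 h1 x hs.1
      simp only [Ω_zero h0 h1, ← h] at h3
      exact neg_pos.2 ((cl_neg_iff one_pos).2 h3)
    simp only [Pi.neg_apply, Ω_zero h0 h1, hr] at this
    linarith
  · obtain ⟨T, a, -, -, b, -⟩ := exists_return h0 h1 (c := |x.2.2.2|) ⟨hr, h, hv1, le_rfl⟩ hN
    exact ⟨T + 1, by linarith, b _ (by linarith)⟩

/-- Limits of points of the section with return times tending to infinity escape. -/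
theorem mem_Nset_of_ret_tendsto {c : ℝ} {z : ℕ → FS} {x : FS} (hz : ∀ n, z n ∈ Oset c)
    (hN : ∀ n, z n ∉ Nset μ) (hx : Tendsto z atTop (𝓝 x))
    (hret : Tendsto (fun n => ret μ (z n)) atTop atTop) :
    x ∈ Oset c ∧ x ∈ Nset μ ∧ x ∉ interior (Nset μ) := by
  have t1 : Tendsto (fun n => (z n).1) atTop (𝓝 x.1) := (continuous_fst.tendsto x).comp hx
  have t2 : Tendsto (fun n => (z n).2.1) atTop (𝓝 x.2.1) :=
    ((continuous_fst.comp continuous_snd).tendsto x).comp hx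
  have t3 : Tendsto (fun n => |(z n).2.2.2|) atTop (𝓝 |x.2.2.2|) :=
    (((continuous_snd.comp (continuous_snd.comp continuous_snd)).abs).tendsto x).comp hx
  have r1 : x.1 = ℛ := tendsto_nhds_unique t1 (by simp only [(hz _).1]; exact tendsto_const_nhds)
  have v0 : 0 ≤ x.2.1 := ge_of_tendsto' t2 fun n => (hz n).2.1.le
  have v1 : x.2.1 ≤ 1 / 1000 := le_of_tendsto' t2 fun n => (hz n).2.2.1
  have hxN : x ∈ Nset μ := by
    by_contra hc
    obtain ⟨s, hs, hlt⟩ := exists_lt_of_not_mem_Nset h0 h1 r1 v0 v1 hc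
    have t4 : Tendsto (fun n => (Ω μ s (z n)).1) atTop (𝓝 (Ω μ s x).1) :=
      ((continuous_fst.comp (Ω_continuous_right h0 h1 s)).tendsto x).comp hx
    obtain ⟨n, a, b⟩ := ((t4.eventually (gt_mem_nhds hlt)).and
      (hret.eventually (eventually_ge_atTop s))).exists
    exact (ret_lt h0 h1 (hz n) (hN n) hs a).not_ge b
  have v2 := Nset_v_pos h0 h1 hxN le_rfl
  rw [Ω_zero h0 h1] at v2
  refine ⟨⟨r1, v2, v1, le_of_tendsto' t3 fun n => (hz n).2.2.2⟩, hxN, fun hi => ?_⟩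
  obtain ⟨n, hn⟩ := (hx.eventually (isOpen_interior.mem_nhds hi)).exists
  exact hN n (interior_subset hn)

end Excursion

namespace Launch

variable {μ h r : ℝ} {f c : ℝ × ℝ → FS} {e : ℝ × ℝ → ℝ × ℝ} {V : Set (ℝ × ℝ)}
  (L : Launch μ h r f c e V)
include L

theorem zero_mem : (0 : ℝ × ℝ) ∈ box r := by simp [box, L.r_pos]

theorem boundary_slope (h0 : 0 ≤ μ) (h1 : μ ≤ 1 / 1000000) {z : FS} (hz : z ∈ Oset (1 / 20))
    (hJ : Jb μ z = h) (hN : z ∈ Nset μ) (hN' : z ∉ interior (Nset μ)) :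
    8 * |z.2.2.2 - (f 0).2.2.2| ≤ μ * |z.2.2.1 - (f 0).2.2.1| := by
  have o := L.mem_Oset 0 L.zero_mem
  have o' : f 0 ∈ Oset (1 / 20) := ⟨o.1, o.2.1, o.2.2.1, o.2.2.2.trans (by norm_num)⟩
  have hJ0 := L.Jb_eq 0 L.zero_mem
  by_contra! hc
  rcases lt_trichotomy (f 0).2.2.2 z.2.2.2 with hl | hl | hl
  · rw [abs_of_pos (sub_pos.2 hl)] at hc
    exact hN' (mem_interior_Nset_of_lt h0 h1 o' hz L.critical.1 (hJ.trans hJ0.symm) hl hc)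
  · rw [hl, sub_self, abs_zero, mul_zero] at hc
    exact hc.not_ge (by positivity)
  · rw [abs_of_neg (sub_neg.2 hl), abs_sub_comm] at hc
    exact L.critical.2 (mem_interior_Nset_of_lt h0 h1 hz o' hN (hJ0.trans hJ.symm) hl
      (by linarith))

end Launch

end PCRTBP

namespace PCRTBP

open Set

/-! ### Paths of launching parameters -/

/-- A path of launching parameters along which the orbits return from the far region, except for
the end point of the path, whose orbit escapes. -/
structure LaunchPath (μ r : ℝ) (f : ℝ × ℝ → FS) (σ : ℝ → ℝ × ℝ) : Prop where
  cont : ContinuousOn σ (Icc 0 1)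
  mem : ∀ t ∈ Icc 0 1, σ t ∈ box r
  neg : ∀ t ∈ Ico 0 1, (σ t).1 < 0
  not_mem : ∀ t ∈ Ico 0 1, f (σ t) ∉ Nset μ
  end_mem : f (σ 1) ∈ Nset μ

section Rot

variable {μ : ℝ} (h0 : 0 ≤ μ) (h1 : μ ≤ 1)

theorem rot_mem_Oset {a c : ℝ} {x : FS} : rot a x ∈ Oset c ↔ x ∈ Oset c := Iff.rfl

include h0 h1

theorem ret_rot {c : ℝ} {k : ℤ} {x : FS} (hx : x ∈ Oset c) (hN : x ∉ Nset μ) :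
    ret μ (rot (k * (2 * π)) x) = ret μ x := by
  obtain ⟨a, b, -⟩ := ret_spec h0 h1 hx hN
  refine ret_eq h0 h1 (c := c) (rot_mem_Oset.2 hx) (mt (rot_mem_Nset h0 h1).1 hN) a ?_
  rw [Ω_rot h0 h1]
  exact b

theorem tendsto_Jb {c : ℝ} {z : ℕ → FS} {x : FS} (hz : ∀ n, z n ∈ Oset c) (hx1 : x.1 = ℛ)
    (hx : Tendsto z atTop (𝓝 x)) : Tendsto (fun n => Jb μ (z n)) atTop (𝓝 (Jb μ x)) := by
  have hp : Continuous fun φ => pot μ ℛ φ := continuous_iff_continuousAt.2 fun φ =>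
    (hasDerivAt_pot h0 h1 (r := fun _ => ℛ) (φ := fun s => s) (by norm_num)
      (hasDerivAt_const φ ℛ) (hasDerivAt_id φ)).continuousAt
  have hc : Continuous fun y : FS => y.2.1 ^ 2 / 2 + y.2.2.2 ^ 2 * (ℛ)⁻¹ ^ 2 / 2 +
      pot μ ℛ y.2.2.1 - y.2.2.2 :=
    (((((continuous_snd.fst).pow 2).div_const 2).add
      ((((continuous_snd.snd.snd).pow 2).mul_const _).div_const 2)).add
      (hp.comp continuous_snd.snd.fst)).sub continuous_snd.snd.snd
  have := (hc.tendsto x).comp hx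
  unfold Jb
  simp only [hx1, (hz _).1]
  exact this

end Rot

namespace Launch

variable {μ h r : ℝ} {f c : ℝ × ℝ → FS} {e : ℝ × ℝ → ℝ × ℝ} {V : Set (ℝ × ℝ)}
  (L : Launch μ h r f c e V) (h0 : 0 ≤ μ) (h1 : μ ≤ 1 / 1000000) {σ : ℝ → ℝ × ℝ}
  (P : LaunchPath μ r f σ)
include L P

theorem f_cont_path : ContinuousOn (fun t => f (σ t)) (Icc 0 1) :=
  L.f_cont.comp P.cont P.mem

theorem path_mem_Oset {t : ℝ} (ht : t ∈ Ico 0 1) :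
    f (σ t) ∈ Oset (1 / 100) ∧ f (σ t) ∉ Nset μ :=
  ⟨L.mem_Oset _ (P.mem t (Ico_subset_Icc_self ht)), P.not_mem t ht⟩

include h0 h1

theorem rot_hat_props {k : ℤ} {t : ℝ} (ht : t ∈ Ico 0 1) :
    rot (k * (2 * π)) (hat μ (f (σ t))) ∈ Oset (1 / 20) ∧
      rot (k * (2 * π)) (hat μ (f (σ t))) ∉ Nset μ ∧
      Jb μ (rot (k * (2 * π)) (hat μ (f (σ t)))) = h ∧
      ret μ (rot (k * (2 * π)) (hat μ (f (σ t)))) = ret μ (f (σ t)) := by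
  have h1' : μ ≤ 1 := by linarith
  obtain ⟨o, n⟩ := L.path_mem_Oset P ht
  have a := (hat_mem_Oset h0 h1' o n).1
  have b := hat_not_mem_Nset h0 h1' o n
  refine ⟨⟨a.1, a.2.1, a.2.2.1, a.2.2.2.trans (by norm_num)⟩, mt (rot_mem_Nset h0 h1').1 b, ?_, ?_⟩
  · rw [Jb_rot, Jb_hat h0 h1' (by norm_num) o n, L.Jb_eq _ (P.mem t (Ico_subset_Icc_self ht))]
  · rw [ret_rot h0 h1' a b, ret_hat h0 h1' o n]

theorem eventually_window {l u : ℝ} {p : FS → Prop}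
    (hp : ∀ z ∈ Oset (1 / 20), Jb μ z = h → z ∈ Nset μ → z ∉ interior (Nset μ) →
      z.2.2.1 ∈ Icc l u → ∀ᶠ y in 𝓝 z, p y) (m : ℝ) :
    ∃ K : ℤ, ∀ k ≥ K, ∀ t ∈ Ico (0 : ℝ) 1,
      (rot (((-k : ℤ) : ℝ) * (2 * π)) (hat μ (f (σ t)))).2.2.1 ∈ Icc l u →
        p (rot (((-k : ℤ) : ℝ) * (2 * π)) (hat μ (f (σ t)))) ∧ m ≤ ret μ (f (σ t)) := by
  have h1' : μ ≤ 1 := by linarith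
  by_contra! hc
  choose k hk t ht hw hpm using fun n : ℕ => hc n
  set z : ℕ → FS := fun n => rot (((-k n : ℤ) : ℝ) * (2 * π)) (hat μ (f (σ (t n)))) with hz
  have Z := fun n => L.rot_hat_props h0 h1 P (k := -k n) (ht n)
  obtain ⟨B, hB⟩ : ∃ B, ∀ s ∈ Icc (0 : ℝ) 1, |(f (σ s)).2.2.1| ≤ B := by
    obtain ⟨B, hB⟩ := isCompact_Icc.exists_bound_of_continuousOn (L.f_cont_path P).snd.snd.fst
    exact ⟨B, fun s hs => hB s hs⟩
  have hret : Tendsto (fun n => ret μ (f (σ (t n)))) atTop atTop := by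
    refine tendsto_atTop_mono (f := fun n : ℕ => ((n : ℝ) + (l - B)) / 2) (fun n => ?_)
      ((tendsto_natCast_atTop_atTop.atTop_add tendsto_const_nhds).atTop_div_const two_pos)
    obtain ⟨o, nn⟩ := L.path_mem_Oset P (ht n)
    have a := hat_angle_le h0 h1' o nn
    have b := (abs_le.1 (hB _ (Ico_subset_Icc_self (ht n)))).1
    have d := (hw n).1
    have e1 : (n : ℝ) ≤ k n := by exact_mod_cast hk n
    have e2 : (k n : ℝ) ≤ k n * (2 * π) := by
      have := pi_gt_three
      have : (0 : ℝ) ≤ k n := (Nat.cast_nonneg n).trans e1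
      nlinarith
    simp only [rot] at d
    push_cast at d
    linarith
  obtain ⟨x, -, φ, hφ, hx⟩ := (isCompact_Icc (a := ((ℛ, 0, l, -(1 / 20)) : FS))
    (b := (ℛ, 1 / 1000, u, 1 / 20))).tendsto_subseq (x := z) (fun n => by
      obtain ⟨o1, o2, o3, o4⟩ := (Z n).1
      have := abs_le.1 o4
      exact ⟨⟨o1.ge, o2.le, (hw n).1, this.1⟩, ⟨o1.le, o3, (hw n).2, this.2⟩⟩)
  have hret' := hret.comp hφ.tendsto_atTop
  obtain ⟨a1, a2, a3⟩ := mem_Nset_of_ret_tendsto h0 h1' (fun n => (Z (φ n)).1)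
    (fun n => (Z (φ n)).2.1) hx (hret'.congr fun n => ((Z (φ n)).2.2.2).symm)
  have hJ : Jb μ x = h := tendsto_nhds_unique
    (tendsto_Jb h0 h1' (fun n => (Z (φ n)).1) a1.1 hx)
    (tendsto_const_nhds.congr fun n => ((Z (φ n)).2.2.1).symm)
  have hφx : x.2.2.1 ∈ Icc l u := isClosed_Icc.mem_of_tendsto
    ((continuous_snd.snd.fst.tendsto x).comp hx) (Eventually.of_forall fun n => hw (φ n))
  obtain ⟨n, b1, b2⟩ := ((hx.eventually (hp x a1 hJ a2 a3 hφx)).and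
    (hret'.eventually (eventually_ge_atTop m))).exists
  exact (hpm (φ n) b1).not_ge b2

end Launch

end PCRTBP

namespace PCRTBP

open Set

namespace Launch

variable {μ h r : ℝ} {f c : ℝ × ℝ → FS} {e : ℝ × ℝ → ℝ × ℝ} {V : Set (ℝ × ℝ)}
  (L : Launch μ h r f c e V) (h0 : 0 ≤ μ) (h1 : μ ≤ 1 / 1000000) {σ : ℝ → ℝ × ℝ}
  (P : LaunchPath μ r f σ)
include L

theorem pos_of_le {τ : ℝ × ℝ} (hτ : τ ∈ box r) (a : 0 ≤ τ.1) (b : 0 ≤ τ.2) (hne : τ ≠ 0) :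
    f τ ∈ interior (Nset μ) :=
  L.mono 0 L.zero_mem τ hτ a b hne.symm L.critical.1

theorem mem_of_nonneg {τ : ℝ × ℝ} (hτ : τ ∈ box r) (a : 0 ≤ τ.1) (b : 0 ≤ τ.2) :
    f τ ∈ Nset μ := by
  by_cases hne : τ = 0
  · rw [hne]; exact L.critical.1
  · exact interior_subset (L.pos_of_le hτ a b hne)

theorem not_mem_of_nonpos {τ : ℝ × ℝ} (hτ : τ ∈ box r) (a : τ.1 ≤ 0) (b : τ.2 ≤ 0) (hne : τ ≠ 0) :
    f τ ∉ Nset μ := fun hN => L.critical.2 (L.mono τ hτ 0 L.zero_mem a b hne hN)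

include h0 h1 P

theorem reach_excursion {t : ℝ} (ht : t ∈ Ico 0 1) {k : ℤ} {τ : ℝ × ℝ} (hτ : τ ∈ box r)
    (hα : τ.1 ≠ 0) (hf : f τ = rot (k * (2 * π)) (hat μ (f (σ t)))) {n : ℝ} (hn : 0 < n)
    (hr1 : 1 ≤ ret μ (f (σ t))) (hr2 : 3 * n ^ 2 ≤ ret μ (f (σ t))) :
    ∃ T, 1 ≤ T ∧ ∃ z w : FS, n ≤ nrm2 z.1 z.2.1 ∧ nrm2 w.2.2.1 w.2.2.2 ≤ 2 ∧
      Reach μ T (c (σ t)) (c (τ.1, -τ.2)) {z, w} := by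
  have h1' : μ ≤ 1 := by linarith
  obtain ⟨o, nn⟩ := L.path_mem_Oset P ht
  set x := f (σ t) with hx
  obtain ⟨T₁, R₁⟩ := L.reach (σ t) (P.mem t (Ico_subset_Icc_self ht)) (P.neg t ht).ne
  obtain ⟨T₃, R₃⟩ := L.reach τ hτ hα
  have g := fun s hs => ret_good h0 h1' (by norm_num : (1 : ℝ) / 100 ≤ 1 / 4) o nn (t := s) hs
  have hR : 0 < ret μ x := by linarith
  have R₂ := reach_far h0 h1' hR g
  have e1 : toC (Ω μ (ret μ x) x) = rc (toC (f τ)) := by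
    rw [hf, toC_rot, ← toC_rev, hat, rev_rev]
  rw [e1] at R₂
  have R₄ := R₃.reverse
  have e2 : rc (c τ) = c (τ.1, -τ.2) := L.rc_eq τ.1 τ.2
  rw [e2] at R₄
  have R := (R₁.trans R₂).trans R₄
  obtain ⟨s, hs, hsr⟩ := exists_far_point h0 h1' hn hr2 g
  refine ⟨_, ?_, toC (Ω μ s x), toC (Ω μ 0 x), ?_, ?_, R.mono ?_⟩
  · have := R₁.1
    have := R₃.1
    linarith
  · have : 0 ≤ (Ω μ s x).1 := hn.le.trans hsr.le
    simp only [toC, nrm2_polar this]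
    exact hsr.le
  · refine (nrm2_toC_p_le _).trans ?_
    obtain ⟨g1, g2, g3⟩ := g 0 ⟨le_rfl, hR.le⟩
    have i0 : 0 < (Ω μ 0 x).1⁻¹ := inv_pos.2 (lt_of_lt_of_le (by norm_num) g1)
    have i1 : (Ω μ 0 x).1⁻¹ ≤ 1 := inv_le_one_of_one_le₀ (le_trans (by norm_num) g1)
    rw [abs_mul, abs_of_pos i0]
    nlinarith [abs_nonneg (Ω μ 0 x).2.2.2]
  · rintro y (rfl | rfl)
    · exact Or.inl (Or.inr ⟨s, hs, rfl⟩)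
    · exact Or.inl (Or.inr ⟨0, ⟨le_rfl, hR.le⟩, rfl⟩)

omit P in
/-- Coordinates of the points where the boundary of the escaping set meets a small window. -/
theorem boundary_coords {z : FS} (hV : z.2.2.swap ∈ V) (hz : z ∈ Oset (1 / 20))
    (hJ : Jb μ z = h) (hN : z ∈ Nset μ) (hN' : z ∉ interior (Nset μ)) :
    ((f 0).2.2.1 < z.2.2.1 → (e z.2.2.swap).1 < 0 ∧ 0 < (e z.2.2.swap).2) ∧
      (z.2.2.1 < (f 0).2.2.1 → 0 < (e z.2.2.swap).1 ∧ (e z.2.2.swap).2 < 0) := by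
  obtain ⟨a, b⟩ := L.f_e z hV hz hJ
  have s := L.boundary_slope h0 h1 hz hJ hN hN'
  rw [← b] at s
  constructor <;> intro hlt <;> rw [← b] at hlt
  · have h2 := L.angle_pos _ a s hlt
    refine ⟨?_, h2⟩
    by_contra! hc
    refine hN' ?_
    rw [← b]
    exact L.pos_of_le a hc h2.le fun h => by rw [h] at h2; exact h2.false
  · have h2 := L.angle_neg _ a s hlt
    refine ⟨?_, h2⟩
    by_contra! hc
    refine L.not_mem_of_nonpos a hc h2.le (fun h => by rw [h] at h2; exact h2.false) ?_
    rwa [b]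

end Launch

end PCRTBP

namespace PCRTBP

open Set

namespace Launch

variable {μ h r : ℝ} {f c : ℝ × ℝ → FS} {e : ℝ × ℝ → ℝ × ℝ} {V : Set (ℝ × ℝ)}
  (L : Launch μ h r f c e V) (h0 : 0 ≤ μ) (h1 : μ ≤ 1 / 1000000) {σ : ℝ → ℝ × ℝ}
  (P : LaunchPath μ r f σ)
include L h0 h1

theorem exists_small_window {ε : ℝ} (hε : 0 < ε) : ∃ δ > 0,
    (∀ z : FS, |z.2.2.2 - (f 0).2.2.2| < δ → |z.2.2.1 - (f 0).2.2.1| ≤ δ →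
      z.2.2.swap ∈ V ∧ |(e z.2.2.swap).1| < ε) ∧
    ∀ z ∈ Oset (1 / 20), Jb μ z = h → z ∈ Nset μ → z ∉ interior (Nset μ) →
      |z.2.2.1 - (f 0).2.2.1| ≤ δ → |z.2.2.2 - (f 0).2.2.2| < δ := by
  obtain ⟨a, b⟩ := L.e_f 0 L.zero_mem
  have hc : ContinuousAt e (f 0).2.2.swap := L.e_cont.continuousAt (L.isOpen_V.mem_nhds a)
  have hc1 : Tendsto (fun y => |(e y).1|) (𝓝 (f 0).2.2.swap) (𝓝 0) := by
    have := hc.fst.abs.tendsto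
    rw [b] at this
    simpa using this
  obtain ⟨δ, hδ, H⟩ := Metric.nhds_basis_closedBall.eventually_iff.1
    ((L.isOpen_V.eventually_mem a).and (hc1.eventually (gt_mem_nhds hε)))
  refine ⟨δ, hδ, fun z hG hφ => H ?_, fun z hz hJ hN hN' hφ => ?_⟩
  · rw [mem_closedBall_iff_norm, Prod.norm_def]
    exact sup_le hG.le hφ
  · have := L.boundary_slope h0 h1 hz hJ hN hN'
    nlinarith [abs_nonneg (z.2.2.1 - (f 0).2.2.1)]

include P

theorem exists_late {m : ℝ} : ∃ t ∈ Ico (0 : ℝ) 1, m ≤ (hat μ (f (σ t))).2.2.1 := by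
  have h1' : μ ≤ 1 := by linarith
  obtain ⟨B, hB⟩ : ∃ B, ∀ s ∈ Icc (0 : ℝ) 1, |(f (σ s)).2.2.1| ≤ B := by
    obtain ⟨B, hB⟩ := isCompact_Icc.exists_bound_of_continuousOn (L.f_cont_path P).snd.snd.fst
    exact ⟨B, fun s hs => hB s hs⟩
  have t1 : Tendsto (fun t => f (σ t)) (𝓝[Ico 0 1] 1) (𝓝[Oset (1 / 100) \ Nset μ] f (σ 1)) := by
    refine tendsto_nhdsWithin_iff.2 ⟨?_, eventually_mem_nhdsWithin.mono fun t ht =>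
      L.path_mem_Oset P ht⟩
    exact ((L.f_cont_path P) 1 ⟨zero_le_one, le_rfl⟩).mono_left
      (nhdsWithin_mono _ Ico_subset_Icc_self)
  have t2 := (ret_tendsto h0 h1' (L.mem_Oset _ (P.mem 1 ⟨zero_le_one, le_rfl⟩)) P.end_mem).comp t1
  have : (𝓝[Ico (0 : ℝ) 1] 1).NeBot := by
    rw [← mem_closure_iff_nhdsWithin_neBot, closure_Ico (by norm_num)]
    exact ⟨zero_le_one, le_rfl⟩
  obtain ⟨t, a, ht⟩ := ((t2.eventually (eventually_ge_atTop (2 * (m + B)))).and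
    eventually_mem_nhdsWithin).exists
  refine ⟨t, ht, ?_⟩
  obtain ⟨o, nn⟩ := L.path_mem_Oset P ht
  have := hat_angle_ge h0 h1' o nn
  have := (abs_le.1 (hB t (Ico_subset_Icc_self ht))).2
  simp only [Function.comp_apply] at a
  linarith

theorem hat_cont_path : ContinuousOn (fun t => hat μ (f (σ t))) (Ico 0 1) :=
  (hat_continuousOn h0 (by linarith : μ ≤ 1) (1 / 100)).comp
    ((L.f_cont_path P).mono Ico_subset_Icc_self) fun _ ht => L.path_mem_Oset P ht

/-- The restriction of a path to one excursion whose end points are again launching parameters. -/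
theorem exists_excursion {ε m : ℝ} (hε : 0 < ε) : ∃ (k : ℤ) (a b : ℝ) (τ : ℝ → ℝ × ℝ),
    0 ≤ a ∧ a ≤ b ∧ b < 1 ∧ ContinuousOn τ (Icc a b) ∧
      (∀ t ∈ Icc a b, τ t ∈ box r ∧ |(τ t).1| < ε ∧ f (τ t) ∉ Nset μ ∧
        f (τ t) = rot (k * (2 * π)) (hat μ (f (σ t))) ∧ m ≤ ret μ (f (σ t))) ∧
      (0 < (τ a).1 ∧ (τ a).2 < 0) ∧ (τ b).1 < 0 ∧ 0 < (τ b).2 := by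
  obtain ⟨δ, hδ, H1, H2⟩ := L.exists_small_window h0 h1 hε
  set φ₀ := (f 0).2.2.1 with hφ₀
  obtain ⟨K₁, hK₁⟩ := L.eventually_window h0 h1 P (l := φ₀ - δ) (u := φ₀ + δ)
    (p := fun z => |z.2.2.2 - (f 0).2.2.2| < δ) (fun z hz hJ hN hN' hφ => by
      have := H2 z hz hJ hN hN' (abs_le.2 ⟨by linarith [hφ.1], by linarith [hφ.2]⟩)
      have hcont : Continuous fun y : FS => |y.2.2.2 - (f 0).2.2.2| := by fun_prop
      exact hcont.continuousAt.eventually (gt_mem_nhds this)) m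
  have ec : ∀ z ∈ Oset (1 / 20), Jb μ z = h → z ∈ Nset μ → z ∉ interior (Nset μ) →
      |z.2.2.1 - φ₀| ≤ δ → z.2.2.swap ∈ V ∧ ContinuousAt (fun y : FS => e y.2.2.swap) z := by
    intro z hz hJ hN hN' hφ
    have hV := (H1 z (H2 z hz hJ hN hN' hφ) hφ).1
    refine ⟨hV, ContinuousAt.comp (f := fun y : FS => y.2.2.swap)
      (L.e_cont.continuousAt (L.isOpen_V.mem_nhds hV)) ?_⟩
    exact (continuous_swap.comp continuous_snd.snd).continuousAt
  obtain ⟨K₂, hK₂⟩ := L.eventually_window h0 h1 P (l := φ₀ - δ) (u := φ₀ - δ)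
    (p := fun z => 0 < (e z.2.2.swap).1 ∧ (e z.2.2.swap).2 < 0) (fun z hz hJ hN hN' hφ => by
      have e1 : z.2.2.1 = φ₀ - δ := le_antisymm hφ.2 hφ.1
      obtain ⟨hV, hc⟩ := ec z hz hJ hN hN' (by rw [e1, sub_sub_cancel_left, abs_neg, abs_of_pos hδ])
      obtain ⟨b1, b2⟩ := (L.boundary_coords h0 h1 hV hz hJ hN hN').2 (by rw [e1]; linarith)
      exact (hc.fst.eventually (lt_mem_nhds b1)).and (hc.snd.eventually (gt_mem_nhds b2))) m
  obtain ⟨K₃, hK₃⟩ := L.eventually_window h0 h1 P (l := φ₀ + δ) (u := φ₀ + δ)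
    (p := fun z => (e z.2.2.swap).1 < 0 ∧ 0 < (e z.2.2.swap).2) (fun z hz hJ hN hN' hφ => by
      have e1 : z.2.2.1 = φ₀ + δ := le_antisymm hφ.2 hφ.1
      obtain ⟨hV, hc⟩ := ec z hz hJ hN hN' (by rw [e1, add_sub_cancel_left, abs_of_pos hδ])
      obtain ⟨b1, b2⟩ := (L.boundary_coords h0 h1 hV hz hJ hN hN').1 (by rw [e1]; linarith)
      exact (hc.fst.eventually (gt_mem_nhds b1)).and (hc.snd.eventually (lt_mem_nhds b2))) m
  obtain ⟨K₄, hK₄⟩ := exists_nat_ge ((hat μ (f (σ 0))).2.2.1 - φ₀ + δ)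
  set k : ℤ := max (max K₁ K₂) (max K₃ K₄) with hk
  have k1 : k ≥ K₁ := (le_max_left _ _).trans (le_max_left _ _)
  have k2 : k ≥ K₂ := (le_max_right _ _).trans (le_max_left _ _)
  have k3 : k ≥ K₃ := (le_max_left _ _).trans (le_max_right _ _)
  have k4 : (K₄ : ℝ) ≤ k := by
    have : (K₄ : ℤ) ≤ k := (le_max_right _ _).trans (le_max_right _ _)
    exact_mod_cast this
  set A : ℝ := ((-k : ℤ) : ℝ) * (2 * π) with hA
  have hA' : A ≤ -k := by
    rw [hA]
    push_cast
    have : (0 : ℝ) ≤ k := (Nat.cast_nonneg K₄).trans k4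
    nlinarith [pi_gt_three]
  set Z : ℝ → FS := fun t => rot A (hat μ (f (σ t))) with hZ
  have hZc : ContinuousOn Z (Ico 0 1) := by
    have : Continuous (rot A) := by unfold rot; fun_prop
    exact this.comp_continuousOn (L.hat_cont_path h0 h1 P)
  obtain ⟨t₁, ht₁, hl⟩ := L.exists_late h0 h1 P (m := φ₀ + δ - A)
  obtain ⟨a, b, ha, hab, hb, ea, eb, hw⟩ := exists_window (ψ := fun t => (Z t).2.2.1) ht₁.1
    (lo := φ₀ - δ) (hi := φ₀ + δ) ((hZc.mono fun t ht => ⟨ht.1, ht.2.trans_lt ht₁.2⟩).snd.snd.fst)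
    (by simp only [hZ, rot]; linarith) (by linarith) (by simp only [hZ, rot]; linarith)
  have hI : ∀ t ∈ Icc a b, t ∈ Ico (0 : ℝ) 1 := fun t ht =>
    ⟨ha.trans ht.1, (ht.2.trans hb).trans_lt ht₁.2⟩
  have hmem : ∀ t ∈ Icc a b, (Z t).2.2.swap ∈ V ∧ |(e (Z t).2.2.swap).1| < ε := fun t ht =>
    H1 _ (hK₁ k k1 t (hI t ht) (hw t ht)).1
      (abs_le.2 ⟨by linarith [(hw t ht).1], by linarith [(hw t ht).2]⟩)
  refine ⟨-k, a, b, fun t => e (Z t).2.2.swap, ha, hab, hb.trans_lt ht₁.2, ?_, fun t ht => ?_,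
    (hK₂ k k2 a (hI a ⟨le_rfl, hab⟩) ⟨ea.ge, ea.le⟩).1,
    (hK₃ k k3 b (hI b ⟨hab, le_rfl⟩) ⟨eb.ge, eb.le⟩).1⟩
  · exact L.e_cont.comp ((continuous_swap.comp continuous_snd.snd).comp_continuousOn
      (hZc.mono hI)) fun t ht => (hmem t ht).1
  · obtain ⟨p1, p2, p3, -⟩ := L.rot_hat_props h0 h1 P (k := -k) (hI t ht)
    obtain ⟨q1, q2⟩ := L.f_e (Z t) (hmem t ht).1 p1 p3
    refine ⟨q1, (hmem t ht).2, ?_, q2, (hK₁ k k1 t (hI t ht) (hw t ht)).2⟩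
    rw [q2]
    exact p2

end Launch

end PCRTBP

namespace PCRTBP

open Set

namespace Launch

variable {μ h r : ℝ} {f c : ℝ × ℝ → FS} {e : ℝ × ℝ → ℝ × ℝ} {V : Set (ℝ × ℝ)}
  (L : Launch μ h r f c e V)
include L

theorem exists_launchPath {ε : ℝ} (hε : 0 < ε) :
    ∃ σ, LaunchPath μ r f σ ∧ ∀ t ∈ Icc (0 : ℝ) 1, |(σ t).1| < ε ∧ (σ t).2 = 0 := by
  obtain ⟨η, hη, hη'⟩ := exists_between (lt_min L.r_pos hε)
  obtain ⟨a, b⟩ := lt_min_iff.1 hη'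
  have hb : ∀ t ∈ Icc (0 : ℝ) 1, |-η * (1 - t)| ≤ η := fun t ht => by
    rw [abs_le]; constructor <;> nlinarith [ht.1, ht.2]
  have hmem : ∀ t ∈ Icc (0 : ℝ) 1, (-η * (1 - t), (0 : ℝ)) ∈ box r := fun t ht =>
    ⟨(hb t ht).trans_lt a, by simpa using L.r_pos⟩
  have hneg : ∀ t ∈ Ico (0 : ℝ) 1, -η * (1 - t) < 0 := fun t ht => by nlinarith [ht.2]
  refine ⟨fun t => (-η * (1 - t), 0), ⟨by fun_prop, hmem, hneg, fun t ht => ?_, ?_⟩,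
    fun t ht => ⟨(hb t ht).trans_lt b, rfl⟩⟩
  · exact L.not_mem_of_nonpos (hmem t (Ico_subset_Icc_self ht)) (hneg t ht).le le_rfl
      fun h => (hneg t ht).ne (congrArg Prod.fst h)
  · have : (-η * (1 - 1), (0 : ℝ)) = 0 := by simp
    simp only [this]
    exact L.critical.1

variable (h0 : 0 ≤ μ) (h1 : μ ≤ 1 / 1000000) {σ : ℝ → ℝ × ℝ} (P : LaunchPath μ r f σ)
include h0 h1 P

/-- Every path of launching parameters contains a subpath whose orbits make an excursion with
distance at least `n` and come back along another path of launching parameters, closer to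
collision. -/
theorem exists_next {ε n : ℝ} (hε : 0 < ε) (hn : 0 < n) :
    ∃ p ∈ Ico (0 : ℝ) 1, ∃ q ∈ Ico (0 : ℝ) 1, ∃ β, LaunchPath μ r f β ∧
      ∀ u ∈ Icc (0 : ℝ) 1, |(β u).1| < ε ∧ (β u).1 < 0 ∧
        ∃ T, 1 ≤ T ∧ ∃ z w : FS, n ≤ nrm2 z.1 z.2.1 ∧ nrm2 w.2.2.1 w.2.2.2 ≤ 2 ∧
          Reach μ T (c (σ (p + (q - p) * u))) (c (β u)) {z, w} := by
  obtain ⟨k, a, b, τ, ha, hab, hb, hτ, H, ⟨a1, a2⟩, b1, b2⟩ :=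
    L.exists_excursion h0 h1 P (m := max 1 (3 * n ^ 2)) hε
  have hB : ∀ t ∈ Icc a b, ((τ t).1, -(τ t).2) ∈ box r := fun t ht =>
    ⟨(H t ht).1.1, by simpa using (H t ht).1.2⟩
  have hBc : ContinuousOn (fun t => ((τ t).1, -(τ t).2)) (Icc a b) := hτ.fst.prodMk hτ.snd.neg
  have hfB : ContinuousOn (fun t => f ((τ t).1, -(τ t).2)) (Icc a b) := L.f_cont.comp hBc hB
  have hcl : IsClosed (Icc a b ∩ (fun t => f ((τ t).1, -(τ t).2)) ⁻¹' Nset μ) :=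
    hfB.preimage_isClosed_of_isClosed isClosed_Icc (Nset_isClosed h0 (by linarith))
  have hne : (Icc a b ∩ (fun t => f ((τ t).1, -(τ t).2)) ⁻¹' Nset μ).Nonempty :=
    ⟨a, ⟨le_rfl, hab⟩, L.mem_of_nonneg (hB a ⟨le_rfl, hab⟩) a1.le (by simpa using a2.le)⟩
  obtain ⟨s, ⟨hs, hsN⟩, hmax⟩ :=
    (isCompact_Icc.of_isClosed_subset hcl inter_subset_left).exists_isGreatest hne
  have hbN : f ((τ b).1, -(τ b).2) ∉ Nset μ :=
    L.not_mem_of_nonpos (hB b ⟨hab, le_rfl⟩) b1.le (by simpa using b2.le)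
      fun h => b1.ne (congrArg Prod.fst h)
  have hsb : s < b := lt_of_le_of_ne hs.2 fun h => hbN (h ▸ hsN)
  have hout : ∀ t, s < t → t ≤ b → f ((τ t).1, -(τ t).2) ∉ Nset μ := fun t h h' hN =>
    (hmax ⟨⟨hs.1.trans h.le, h'⟩, hN⟩).not_gt h
  have hsnd : ∀ t ∈ Icc a b, 0 ≤ (τ t).1 → (τ t).2 < 0 := fun t ht h => by
    by_contra! h'
    exact (H t ht).2.2.1 (L.mem_of_nonneg (H t ht).1 h h')
  have hneg : ∀ t ∈ Icc s b, (τ t).1 < 0 := by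
    intro t ht
    by_contra! h
    have htab : t ∈ Icc a b := ⟨hs.1.trans ht.1, ht.2⟩
    have h2 := hsnd t htab h
    rcases ht.1.eq_or_lt with rfl | hlt
    · have hi : f ((τ s).1, -(τ s).2) ∈ interior (Nset μ) :=
        L.pos_of_le (hB s htab) h (by simpa using h2.le)
          fun h => h2.ne (by simpa using congrArg Prod.snd h)
      have hev := ((hfB s htab).mono (Icc_subset_Icc_left hs.1)).eventually
        (isOpen_interior.mem_nhds hi)
      have hev' : ∀ᶠ t in 𝓝[Ioc s b] s, f ((τ t).1, -(τ t).2) ∈ interior (Nset μ) :=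
        hev.filter_mono (nhdsWithin_mono _ Ioc_subset_Icc_self)
      have : (𝓝[Ioc s b] s).NeBot := by
        rw [← mem_closure_iff_nhdsWithin_neBot, closure_Ioc hsb.ne]
        exact ⟨le_rfl, hsb.le⟩
      obtain ⟨t, ht1, ht2⟩ := (hev'.and eventually_mem_nhdsWithin).exists
      exact hout t ht2.1 ht2.2 (interior_subset ht1)
    · exact hout t hlt ht.2 (L.mem_of_nonneg (hB t htab) h (by simpa using h2.le))
  have hι : ∀ u ∈ Icc (0 : ℝ) 1, b + (s - b) * u ∈ Icc s b := fun u hu =>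
    ⟨by nlinarith [hu.2], by nlinarith [hu.1]⟩
  have hι' : ∀ u ∈ Icc (0 : ℝ) 1, b + (s - b) * u ∈ Icc a b := fun u hu =>
    Icc_subset_Icc_left hs.1 (hι u hu)
  refine ⟨b, ⟨ha.trans hab, hb⟩, s, ⟨ha.trans hs.1, hsb.trans hb⟩,
    fun u => ((τ (b + (s - b) * u)).1, -(τ (b + (s - b) * u)).2),
    ⟨hBc.comp (by fun_prop) hι', fun u hu => hB _ (hι' u hu),
      fun u hu => hneg _ (hι u (Ico_subset_Icc_self hu)), fun u hu => ?_, ?_⟩, fun u hu => ?_⟩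
  · exact hout _ (by nlinarith [hu.2]) (hι u (Ico_subset_Icc_self hu)).2
  · simpa using hsN
  · obtain ⟨i, j, -, k', l⟩ := H _ (hι' u hu)
    refine ⟨j, hneg _ (hι u hu), ?_⟩
    exact L.reach_excursion h0 h1 P ⟨ha.trans (hι' u hu).1, (hι' u hu).2.trans_lt hb⟩ i
      (hneg _ (hι u hu)).ne k' hn ((le_max_left _ _).trans l) ((le_max_right _ _).trans l)

end Launch

end PCRTBP

namespace PCRTBP

open Set

theorem exists_coherent_finite {X : Type*} [Nonempty X] (N : ℕ) (A : ℕ → X → X) :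
    ∃ x : ℕ → X, ∀ n < N, x n = A n (x (n + 1)) := by
  induction N generalizing A with
  | zero => exact ⟨fun _ => Classical.arbitrary X, fun n hn => absurd hn n.not_lt_zero⟩
  | succ N ih =>
    obtain ⟨x, hx⟩ := ih fun n => A (n + 1)
    refine ⟨fun n => Nat.casesOn n (A 0 (x 0)) x, fun n hn => ?_⟩
    cases n with
    | zero => rfl
    | succ n => exact hx n (by omega)

/-- An inverse sequence of continuous self-maps of a compact space has a coherent point. -/
theorem exists_coherent {X : Type*} [TopologicalSpace X] [CompactSpace X] [T2Space X] [Nonempty X]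
    (A : ℕ → X → X) (hA : ∀ n, Continuous (A n)) : ∃ x : ℕ → X, ∀ n, x n = A n (x (n + 1)) := by
  have hcl : ∀ N, IsClosed {x : ℕ → X | ∀ n < N, x n = A n (x (n + 1))} := fun N => by
    simp only [ofPred_forall]
    exact isClosed_iInter fun n => isClosed_iInter fun _ => isClosed_eq (continuous_apply n)
      ((hA n).comp (continuous_apply (n + 1)))
  obtain ⟨x, hx⟩ := IsCompact.nonempty_iInter_of_sequence_nonempty_isCompact_isClosed
    (fun N => {x : ℕ → X | ∀ n < N, x n = A n (x (n + 1))})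
    (fun N x hx n hn => hx n (by omega)) (fun N => exists_coherent_finite N A)
    (hcl 0).isCompact hcl
  exact ⟨x, fun n => mem_iInter.1 hx (n + 1) n n.lt_succ_self⟩

theorem Launch.exists_sequence {μ h r : ℝ} {f c : ℝ × ℝ → FS} {e : ℝ × ℝ → ℝ × ℝ}
    {V : Set (ℝ × ℝ)} (L : Launch μ h r f c e V) (h0 : 0 ≤ μ) (h1 : μ ≤ 1 / 1000000) :
    ∃ s : ℕ → ℝ × ℝ, (s 0).2 = 0 ∧ ∀ n : ℕ, s n ∈ box r ∧ (s n).1 < 0 ∧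
      |(s n).1| < 1 / (n + 1) ∧ ∃ T, 1 ≤ T ∧ ∃ z w : FS, (n : ℝ) ≤ nrm2 z.1 z.2.1 ∧
        nrm2 w.2.2.1 w.2.2.2 ≤ 2 ∧ Reach μ T (c (s n)) (c (s (n + 1))) {z, w} := by
  obtain ⟨σ₀, P₀, hσ₀⟩ := L.exists_launchPath zero_lt_one
  choose p hp q hq β hβ H using fun (n : ℕ) (σ : {σ // LaunchPath μ r f σ}) =>
    L.exists_next h0 h1 σ.2 (ε := 1 / ((n + 1 : ℕ) + 1)) (n := n + 1) (by positivity)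
      (by positivity)
  let Q : ℕ → {σ // LaunchPath μ r f σ} := fun n =>
    Nat.rec ⟨σ₀, P₀⟩ (fun n σ => ⟨β n σ, hβ n σ⟩) n
  have hA : ∀ n, ∀ u ∈ Icc (0 : ℝ) 1, p n (Q n) + (q n (Q n) - p n (Q n)) * u ∈ Ico (0 : ℝ) 1 := by
    intro n u hu
    have hp := hp n (Q n)
    have hq := hq n (Q n)
    constructor
    · nlinarith [mul_nonneg hp.1 (sub_nonneg.2 hu.2), mul_nonneg hq.1 hu.1]
    · rcases hu.1.eq_or_lt with rfl | h
      · simpa using hp.2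
      · nlinarith [mul_nonneg (sub_nonneg.2 hp.2.le) (sub_nonneg.2 hu.2),
          mul_pos (sub_pos.2 hq.2) h]
  obtain ⟨u, hu⟩ := exists_coherent (X := Icc (0 : ℝ) 1)
    (fun n u => ⟨p n (Q n) + (q n (Q n) - p n (Q n)) * u, Ico_subset_Icc_self (hA n u u.2)⟩)
    (fun n => by fun_prop)
  have hu' : ∀ n, (u n : ℝ) = p n (Q n) + (q n (Q n) - p n (Q n)) * u (n + 1) := fun n =>
    congrArg Subtype.val (hu n)
  have huI : ∀ n, (u n : ℝ) ∈ Ico (0 : ℝ) 1 := fun n => hu' n ▸ hA n _ (u (n + 1)).2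
  refine ⟨fun n => (Q n).1 (u n), (hσ₀ _ (u 0).2).2, fun n =>
    ⟨(Q n).2.mem _ (u n).2, (Q n).2.neg _ (huI n), ?_, ?_⟩⟩
  · cases n with
    | zero => exact (hσ₀ _ (u 0).2).1.trans_eq (by simp)
    | succ n => exact (H n (Q n) _ (u (n + 1)).2).1
  · obtain ⟨-, -, T, hT, z, w, hz, hw, hR⟩ := H n (Q n) _ (u (n + 1)).2
    rw [← hu' n] at hR
    exact ⟨T, hT, z, w, by linarith, hw, hR⟩

/-- Concatenation of infinitely many orbit segments. -/
theorem exists_solution_of_reach {μ : ℝ} {a : ℕ → FS} {T : ℕ → ℝ} {S : ℕ → Set FS}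
    (hT : ∀ n, 1 ≤ T n) (h : ∀ n, Reach μ (T n) (a n) (a (n + 1)) (S n)) :
    ∃ y : ℝ → FS, (∀ t, 0 ≤ t → SolAt μ y t) ∧ y 0 = a 0 ∧
      ∀ n : ℕ, ∀ x ∈ insert (a n) (S n), ∃ t, (n : ℝ) ≤ t ∧ y t = x := by
  choose hT0 y y0 y1 hy hS using h
  set t : ℕ → ℝ := fun n => ∑ i ∈ Finset.range n, T i with ht
  have ts : ∀ n, t (n + 1) = t n + T n := fun n => Finset.sum_range_succ _ _
  have tn : ∀ n : ℕ, (n : ℝ) ≤ t n := fun n => by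
    induction n with
    | zero => simp [ht]
    | succ n ih => push_cast; linarith [ts n, hT n]
  have tm : StrictMono t := strictMono_nat_of_lt_succ fun n => by linarith [ts n, hT n]
  have hex : ∀ s : ℝ, ∃ n : ℕ, s < t (n + 1) := fun s => by
    obtain ⟨n, hn⟩ := exists_nat_gt s
    exact ⟨n, hn.trans_le ((tn n).trans (tm.monotone n.le_succ))⟩
  classical
  let N : ℝ → ℕ := fun s => Nat.find (hex s)
  have hN : ∀ n : ℕ, ∀ s, (n = 0 ∨ t n ≤ s) → s < t (n + 1) → N s = n := by
    intro n s h h'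
    refine (Nat.find_eq_iff (hex s)).2 ⟨h', fun m hm => ?_⟩
    rcases h with rfl | h
    · exact absurd hm m.not_lt_zero
    · exact not_lt.2 ((tm.monotone (show m + 1 ≤ n from hm)).trans h)
  let Y : ℝ → FS := fun s => y (N s) (s - t (N s))
  have hY : ∀ n : ℕ, ∀ s, (n = 0 ∨ t n ≤ s) → s < t (n + 1) → Y s = y n (s - t n) := by
    intro n s h h'
    simp only [Y, hN n s h h']
  have hY' : ∀ n : ℕ, ∀ s ∈ Icc (t n) (t (n + 1)), Y s = y n (s - t n) := by
    intro n s hs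
    rcases hs.2.eq_or_lt with rfl | h
    · rw [hY (n + 1) _ (Or.inr le_rfl) (tm (by omega)), sub_self, y0, ts, add_sub_cancel_left, y1]
    · exact hY n s (Or.inr hs.1) h
  have t0 : t 0 = 0 := by simp [ht]
  refine ⟨Y, fun s hs => ?_, ?_, fun n x hx => ?_⟩
  · have hs' : s < t (N s + 1) := Nat.find_spec (hex s)
    have hs2 : t (N s) ≤ s := by
      rcases Nat.eq_zero_or_pos (N s) with h | h
      · rw [h, t0]; exact hs
      · have := not_lt.1 (Nat.find_min (hex s) (Nat.sub_lt h one_pos))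
        rwa [show Nat.find (hex s) - 1 + 1 = N s from Nat.sub_add_cancel h] at this
    have hsol : SolAt μ (fun s' => y (N s) (s' - t (N s))) s :=
      SolAt.shift (hy _ _ ⟨by linarith, by linarith [ts (N s)]⟩)
    by_cases hl : N s = 0 ∨ t (N s) < s
    · refine hsol.congr ?_
      have e1 : ∀ᶠ s' in 𝓝 s, N s = 0 ∨ t (N s) ≤ s' := by
        rcases hl with hl | hl
        · exact Eventually.of_forall fun _ => Or.inl hl
        · exact (eventually_gt_nhds hl).mono fun _ h => Or.inr h.le
      filter_upwards [e1, eventually_lt_nhds hs'] with s' h h'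
      exact hY _ _ h h'
    · push Not at hl
      obtain ⟨m, hm⟩ := Nat.exists_eq_succ_of_ne_zero hl.1
      generalize N s = n at *
      subst hm
      obtain rfl : s = t (m + 1) := le_antisymm hl.2 hs2
      have hsol' : SolAt μ (fun s' => y m (s' - t m)) (t (m + 1)) :=
        SolAt.shift (hy _ _ ⟨by linarith [tm m.lt_succ_self], by linarith [ts m]⟩)
      refine (hsol'.glue hsol ?_).congr ?_
      · simp only [sub_self, y0, ts, add_sub_cancel_left, y1]
      · filter_upwards [eventually_lt_nhds hs', eventually_gt_nhds (tm m.lt_succ_self)]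
          with s' h h'
        split_ifs with hc
        · exact hY m s' (Or.inr h'.le) hc
        · exact hY (m + 1) s' (Or.inr (not_lt.1 hc)) h
  · rw [hY' 0 0 ⟨t0.le, t0 ▸ (tm one_pos).le⟩, t0, sub_self, y0]
  · obtain ⟨s, hs, hsx⟩ : x ∈ y n '' Icc 0 (T n) := by
      rcases hx with rfl | hx
      · exact ⟨0, ⟨le_rfl, (hT0 n).le⟩, y0 n⟩
      · exact hS n hx
    refine ⟨t n + s, by linarith [tn n, hs.1], ?_⟩
    rw [hY' n _ ⟨by linarith [hs.1], by linarith [hs.2, ts n]⟩, add_sub_cancel_left, hsx]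

/-- A solution on the positive half line starting at a symmetric state extends by symmetry. -/
theorem exists_symmetric_solution {μ : ℝ} {y : ℝ → FS} (hy : ∀ t, 0 ≤ t → SolAt μ y t)
    (h : rc (y 0) = y 0) : ∃ x : ℝ → FS, (∀ t, SolAt μ x t) ∧
      ∀ t, 0 ≤ t → x t = y t ∧ x (-t) = rc (y t) := by
  have hr : ∀ t, t ≤ 0 → SolAt μ (fun s => rc (y (0 - s))) t := fun t ht =>
    SolAt.reverse (hy _ (by linarith))
  refine ⟨fun t => if t < 0 then rc (y (0 - t)) else y t, fun t => ?_, fun t ht => ?_⟩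
  · rcases lt_trichotomy t 0 with ht | rfl | ht
    · exact (hr t ht.le).of_lt ht
    · exact (hr 0 le_rfl).glue (hy 0 le_rfl) (by simpa using h)
    · exact (hy t ht.le).of_gt ht
  · refine ⟨by simp [ht.not_gt], ?_⟩
    rcases ht.eq_or_lt with rfl | ht
    · simpa using h.symm
    · simp [ht]

theorem limsup_eq_top {F : Filter ℝ} {g : ℝ → ℝ} (h : ∀ n : ℕ, ∃ᶠ t in F, (n : ℝ) ≤ g t) :
    limsup (fun t => (g t : EReal)) F = ⊤ := by
  refine EReal.eq_top_iff_forall_lt _ |>.2 fun b => ?_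
  obtain ⟨n, hn⟩ := exists_nat_gt b
  exact (EReal.coe_lt_coe_iff.2 hn).trans_le
    (le_limsup_of_frequently_le ((h n).mono fun t ht => EReal.coe_le_coe_iff.2 ht))

theorem liminf_eq_zero {F : Filter ℝ} {g : ℝ → ℝ} (h0 : ∀ t, 0 ≤ g t)
    (h : ∀ n : ℕ, ∃ᶠ t in F, g t ≤ 1 / (n + 1)) : liminf (fun t => (g t : EReal)) F = 0 := by
  refine le_antisymm ?_ (le_liminf_of_le (h := Eventually.of_forall fun t => ?_))
  · refine EReal.le_of_forall_lt_iff_le.1 fun b hb => ?_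
    obtain ⟨n, hn⟩ := exists_nat_one_div_lt (EReal.coe_pos.1 hb)
    exact liminf_le_of_frequently_le
      ((h n).mono fun t ht => EReal.coe_le_coe_iff.2 (ht.trans hn.le))
  · exact EReal.coe_nonneg.2 (h0 t)

theorem liminf_lt_top {F : Filter ℝ} {g : ℝ → ℝ} {b : ℝ} (h : ∃ᶠ t in F, g t ≤ b) :
    liminf (fun t => (g t : EReal)) F < ⊤ :=
  (liminf_le_of_frequently_le (h.mono fun _ ht => EReal.coe_le_coe_iff.2 ht)).trans_lt
    (EReal.coe_lt_top b)

theorem frequently_symmetric {x y : ℝ → FS} (hx : ∀ t, 0 ≤ t → x t = y t ∧ x (-t) = rc (y t))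
    {p : FS → Prop} (hp : ∀ a, p a → p (rc a)) (h : ∀ n : ℕ, ∃ t, (n : ℝ) ≤ t ∧ p (y t)) :
    (∃ᶠ t in atTop, p (x t)) ∧ ∃ᶠ t in atBot, p (x t) := by
  rw [frequently_atTop, frequently_atBot]
  refine ⟨fun b => ?_, fun b => ?_⟩
  · obtain ⟨n, hn⟩ := exists_nat_gt b
    obtain ⟨t, ht, hpt⟩ := h n
    exact ⟨t, hn.le.trans ht, by rwa [(hx t (n.cast_nonneg.trans ht)).1]⟩
  · obtain ⟨n, hn⟩ := exists_nat_gt (-b)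
    obtain ⟨t, ht, hpt⟩ := h n
    exact ⟨-t, by linarith, by rw [(hx t (n.cast_nonneg.trans ht)).2]; exact hp _ hpt⟩

theorem Launch.exists_oscillatory {μ h r : ℝ} {f c : ℝ × ℝ → FS} {e : ℝ × ℝ → ℝ × ℝ}
    {V : Set (ℝ × ℝ)} (L : Launch μ h r f c e V) (h0 : 0 ≤ μ) (h1 : μ ≤ 1 / 1000000) :
    ∃ x : ℝ → FS, (∀ t, SolAt μ x t) ∧ ∀ F ∈ ({atTop, atBot} : Set (Filter ℝ)),
      (∀ n : ℕ, ∃ᶠ t in F, (n : ℝ) ≤ nrm2 (x t).1 (x t).2.1) ∧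
      (∀ n : ℕ, ∃ᶠ t in F, dS μ (x t).1 (x t).2.1 ≤ 1 / (n + 1)) ∧
      (∀ n : ℕ, ∃ᶠ t in F, (n : ℝ) ≤ nrm2 (x t).2.2.1 (x t).2.2.2) ∧
      ∃ᶠ t in F, nrm2 (x t).2.2.1 (x t).2.2.2 ≤ 2 := by
  obtain ⟨s, s0, hs⟩ := L.exists_sequence h0 h1
  choose hbox hneg hsmall T hT z w hz hw hR using hs
  obtain ⟨y, hy, y0, hyt⟩ := exists_solution_of_reach hT hR
  have hsym : rc (y 0) = y 0 := by
    have : s 0 = ((s 0).1, 0) := Prod.ext rfl s0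
    rw [y0, this, L.rc_eq, neg_zero]
  obtain ⟨x, hx, hxy⟩ := exists_symmetric_solution hy hsym
  have key : ∀ (n : ℕ) (p : FS → Prop), (∀ a, p a → p (rc a)) →
      (∀ m : ℕ, n ≤ m → ∃ a ∈ (insert (c (s m)) {z m, w m} : Set FS), p a) →
      ∀ F ∈ ({atTop, atBot} : Set (Filter ℝ)), ∃ᶠ t in F, p (x t) := by
    intro n p hp H F hF
    have := frequently_symmetric hxy hp fun m => by
      obtain ⟨a, ha, hpa⟩ := H (max n m) (le_max_left _ _)
      obtain ⟨t, ht, rfl⟩ := hyt _ a ha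
      exact ⟨t, (Nat.cast_le.2 (le_max_right n m)).trans ht, hpa⟩
    rcases hF with rfl | rfl
    exacts [this.1, this.2]
  have hinv : ∀ n m : ℕ, n ≤ m → |(s m).1| < 1 / ((n : ℝ) + 1) := fun n m hnm =>
    (hsmall m).trans_le (by gcongr)
  refine ⟨x, hx, fun F hF => ⟨fun n => ?_, fun n => ?_, fun n => ?_, ?_⟩⟩
  · exact key n (fun a => (n : ℝ) ≤ nrm2 a.1 a.2.1) (fun a ha => by simpa [rc, nrm2] using ha)
      (fun m hm => ⟨z m, by simp, (Nat.cast_le.2 hm).trans (hz m)⟩) F hF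
  · refine key n (fun a => dS μ a.1 a.2.1 ≤ 1 / (n + 1)) (fun a ha => by simpa [rc, dS] using ha)
      (fun m hm => ⟨c (s m), by simp, ?_⟩) F hF
    rw [L.q_eq _ (hbox m), ← sq_abs]
    have h2 := hinv n m hm
    have h3 : 1 / ((n : ℝ) + 1) ≤ 1 := by
      rw [div_le_one (by positivity)]; linarith [n.cast_nonneg (α := ℝ)]
    nlinarith [abs_nonneg (s m).1]
  · refine key n (fun a => (n : ℝ) ≤ nrm2 a.2.2.1 a.2.2.2)
      (fun a ha => by simpa [rc, nrm2] using ha) (fun m hm => ⟨c (s m), by simp, ?_⟩) F hF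
    have h2 := hinv n m hm
    have h3 : 0 < |(s m).1| := abs_pos.2 (hneg m).ne
    have h4 : (n : ℝ) + 1 < |(s m).1|⁻¹ := by
      rw [lt_inv_comm₀ (by positivity) h3]; simpa using h2
    linarith [L.le_p _ (hbox m) (hneg m).ne]
  · exact key 0 (fun a => nrm2 a.2.2.1 a.2.2.2 ≤ 2) (fun a ha => by simpa [rc, nrm2] using ha)
      (fun m _ => ⟨w m, by simp, hw m⟩) F hF

end PCRTBP

/-- There is `μ₀ ∈ (0,1/2]` such that for every `μ ∈ (0,μ₀)` the PCRTBP has a globally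
defined solution which is oscillatory in both time directions, accumulates on collision
with the first primary, and is also oscillatory in velocity. -/
theorem oscillatory_orbits_accumulating_on_collision :
    ∃ μ₀ : ℝ, μ₀ ∈ Set.Ioc (0 : ℝ) (1 / 2) ∧
      ∀ μ ∈ Set.Ioo (0 : ℝ) μ₀,
        ∃ q1 q2 p1 p2 : ℝ → ℝ,
          IsPCRTBPSol μ Set.univ q1 q2 p1 p2 ∧
          Filter.limsup (fun t => ((nrm2 (q1 t) (q2 t) : ℝ) : EReal)) atTop = ⊤ ∧
          Filter.liminf (fun t => ((nrm2 (q1 t + μ) (q2 t) : ℝ) : EReal)) atTop = 0 ∧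
          Filter.limsup (fun t => ((nrm2 (q1 t) (q2 t) : ℝ) : EReal)) atBot = ⊤ ∧
          Filter.liminf (fun t => ((nrm2 (q1 t + μ) (q2 t) : ℝ) : EReal)) atBot = 0 ∧
          Filter.limsup (fun t => ((nrm2 (p1 t) (p2 t) : ℝ) : EReal)) atTop = ⊤ ∧
          Filter.limsup (fun t => ((nrm2 (p1 t) (p2 t) : ℝ) : EReal)) atBot = ⊤ ∧
          Filter.liminf (fun t => ((nrm2 (p1 t) (p2 t) : ℝ) : EReal)) atTop < ⊤ ∧
          Filter.liminf (fun t => ((nrm2 (p1 t) (p2 t) : ℝ) : EReal)) atBot < ⊤ := by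
  obtain ⟨I, M, C, r, F⟩ := PCRTBP.exists_innerMap
  have hM := F.M_ge
  have hC := F.C_pos
  have hr := F.r_pos
  refine ⟨min (1 / 1000000) (min (r / 8 / (C + 1)) (1 / 128 / (C * (M + 1)))),
    ⟨by positivity, (min_le_left _ _).trans (by norm_num)⟩, fun μ hμ => ?_⟩
  obtain ⟨h0, h1⟩ := hμ
  obtain ⟨h1, h2, h3⟩ : μ < 1 / 1000000 ∧ μ < r / 8 / (C + 1) ∧ μ < 1 / 128 / (C * (M + 1)) := by
    simpa only [lt_min_iff] using h1
  rw [lt_div_iff₀ (by positivity)] at h2 h3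
  obtain ⟨h, f, c, e, V, L⟩ := F.exists_launch h0 h1.le h2.le (by linarith)
  obtain ⟨x, hx, H⟩ := L.exists_oscillatory h0.le h1.le
  obtain ⟨a1, a2, a3, a4⟩ := H atTop (by simp)
  obtain ⟨b1, b2, b3, b4⟩ := H atBot (by simp)
  exact ⟨fun t => (x t).1, fun t => (x t).2.1, fun t => (x t).2.2.1, fun t => (x t).2.2.2,
    fun t _ => ⟨(hx t).1, PCRTBP.hasDerivAt_FS.1 (hx t).2⟩,
    PCRTBP.limsup_eq_top a1, PCRTBP.liminf_eq_zero (fun _ => Real.sqrt_nonneg _) a2,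
    PCRTBP.limsup_eq_top b1, PCRTBP.liminf_eq_zero (fun _ => Real.sqrt_nonneg _) b2,
    PCRTBP.limsup_eq_top a3, PCRTBP.limsup_eq_top b3, PCRTBP.liminf_lt_top a4,
    PCRTBP.liminf_lt_top b4⟩
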